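/- Let ω ∈ ℝ² be non-resonant and assume ω does not satisfy the Bruno–Rüssmann condition. Then for all ε > 0 and all s > 0, there exists a real-analytic map V : 𝕋² → ℝ², admitting a bounded holomorphic ℤ²-periodic extension to the strip {z ∈ ℂ² : max_i |Im z_i| < s} with sup-norm |V|_s ≤ ε, such that the analytic vector field U(θ) = ω + V(θ) on 𝕋² is topologically conjugate, but not analytically conjugate, to the constant vector field ω. -/

import Mathlib

/-!
STATEMENT 7 (Yoccoz, continuous version: if ω ∈ ℝ² is non-resonant and does
not satisfy the Bruno–Rüssmann condition, then arbitrarily close to the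
constant vector field ω, in any sup norm `|·|_s` on a complex strip, there is
an analytic vector field on 𝕋² which is topologically but not analytically
conjugate to ω).

Objects on the torus `𝕋ⁿ = ℝⁿ/ℤⁿ` are represented on the universal cover
`ℝⁿ = Fin n → ℝ` by `ℤⁿ`-periodic/equivariant data.
-/

open MeasureTheory

/-- `v ∈ ℝⁿ` is an integer vector. -/
def IsIntVec {n : ℕ} (v : Fin n → ℝ) : Prop := ∀ i, ∃ m : ℤ, v i = (m : ℝ)

/-- `ω ∈ ℝⁿ` is non-resonant: `k·ω ≠ 0` for all nonzero `k ∈ ℤⁿ`. -/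
def NonResonant (n : ℕ) (ω : Fin n → ℝ) : Prop :=
  ∀ k : Fin n → ℤ, k ≠ 0 → (∑ i, (k i : ℝ) * ω i) ≠ 0

/-- `Ψ_ω (Q) = max { |k·ω|⁻¹ : k ∈ ℤⁿ, 0 < |k| ≤ Q }` (sup norm on `k`). -/
noncomputable def Psi (n : ℕ) (ω : Fin n → ℝ) (Q : ℝ) : ℝ :=
  sSup {x : ℝ | ∃ k : Fin n → ℤ, k ≠ 0 ∧ (∀ i, |(k i : ℝ)| ≤ Q) ∧
    x = |∑ i, (k i : ℝ) * ω i|⁻¹}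

/-- The Bruno–Rüssmann condition: `∫_1^∞ ln (Ψ_ω (Q)) / Q² dQ < ∞`. -/
def BRCondition (n : ℕ) (ω : Fin n → ℝ) : Prop :=
  ∫⁻ Q in Set.Ici (1:ℝ), ENNReal.ofReal (Real.log (Psi n ω Q) / Q ^ 2) < ⊤

/-- The `ℤⁿ`-periodic map `V : ℝⁿ → ℝⁿ` (a vector field on `𝕋ⁿ`) admits a
bounded holomorphic `ℤⁿ`-periodic extension to the strip
`{z ∈ ℂⁿ : max_i |Im z_i| < s}` with sup norm `|V|_s ≤ ε`. -/
def HasHolExtTorusVF (n : ℕ) (V : (Fin n → ℝ) → (Fin n → ℝ)) (s ε : ℝ) : Prop :=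
  ∃ W : (Fin n → ℂ) → (Fin n → ℂ),
    DifferentiableOn ℂ W {z : Fin n → ℂ | ∀ i, |(z i).im| < s} ∧
    (∀ z : Fin n → ℂ, (∀ i, |(z i).im| < s) →
      ∀ k : Fin n → ℤ, W (z + fun i => (k i : ℂ)) = W z) ∧
    (∀ x : Fin n → ℝ, W (fun i => (x i : ℂ)) = fun i => (V x i : ℂ)) ∧
    ∀ z : Fin n → ℂ, (∀ i, |(z i).im| < s) → ‖W z‖ ≤ ε

/-- `φ` is the flow of the (complete) vector field `u` on `ℝⁿ`. -/
def IsFlowOf {n : ℕ} (u : (Fin n → ℝ) → (Fin n → ℝ))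
    (φ : ℝ → (Fin n → ℝ) → (Fin n → ℝ)) : Prop :=
  (∀ x, φ 0 x = x) ∧ ∀ x t, HasDerivAt (fun τ => φ τ x) (u (φ t x)) t

/-- `(H, G)` are lifts to `ℝⁿ` of a homeomorphism of `𝕋ⁿ` and of its inverse:
both are continuous, descend to the torus (they map `ℤⁿ`-translates to
`ℤⁿ`-translates) and are inverse of each other modulo `ℤⁿ`. -/
def IsTorusHomeoLiftPair {n : ℕ} (H G : (Fin n → ℝ) → (Fin n → ℝ)) : Prop :=
  Continuous H ∧ Continuous G ∧
  (∀ x v, IsIntVec v → IsIntVec (H (x + v) - H x)) ∧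
  (∀ x v, IsIntVec v → IsIntVec (G (x + v) - G x)) ∧
  (∀ x, IsIntVec (G (H x) - x)) ∧ (∀ x, IsIntVec (H (G x) - x))

/-- The flow `φ` (on the cover) is topologically conjugate, on the torus, to
the linear flow of frequency `ω` : there is a homeomorphism `h` of `𝕋ⁿ` with
`h (θ + tω) = Φ_t (h (θ))`, expressed through lifts. -/
def FlowTopConjLinear {n : ℕ} (ω : Fin n → ℝ)
    (φ : ℝ → (Fin n → ℝ) → (Fin n → ℝ)) : Prop :=
  ∃ H G : (Fin n → ℝ) → (Fin n → ℝ), IsTorusHomeoLiftPair H G ∧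
    ∀ (t : ℝ) (x : Fin n → ℝ), H (x + t • ω) = φ t (H x)

/-- Same as `FlowTopConjLinear`, with the conjugating homeomorphism a
real-analytic diffeomorphism. -/
def FlowAnalyticConjLinear {n : ℕ} (ω : Fin n → ℝ)
    (φ : ℝ → (Fin n → ℝ) → (Fin n → ℝ)) : Prop :=
  ∃ H G : (Fin n → ℝ) → (Fin n → ℝ), IsTorusHomeoLiftPair H G ∧
    (∀ x, AnalyticAt ℝ H x) ∧ (∀ x, AnalyticAt ℝ G x) ∧
    ∀ (t : ℝ) (x : Fin n → ℝ), H (x + t • ω) = φ t (H x)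

open Filter Topology

/-- Differentiability under the integral sign for dominated families of holomorphic functions. -/
theorem differentiableOn_integral_of_dominated {X : Type*} [MeasurableSpace X] {μ : Measure X}
    {F : ℂ → X → ℂ} {U : Set ℂ} (hU : IsOpen U)
    (hmeas : ∀ z ∈ U, AEStronglyMeasurable (F z) μ)
    (hdom : ∀ z₀ ∈ U, ∃ r > 0, ∃ b : X → ℝ, Integrable b μ ∧
      ∀ᵐ x ∂μ, DifferentiableOn ℂ (F · x) (Metric.ball z₀ r) ∧
        ∀ z ∈ Metric.ball z₀ r, ‖F z x‖ ≤ b x) :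
    DifferentiableOn ℂ (fun z => ∫ x, F z x ∂μ) U := by
  intro z₀ hz₀
  obtain ⟨r, hr, b, hb, hF⟩ := hdom z₀ hz₀
  obtain ⟨r', hr', hrU⟩ := Metric.isOpen_iff.1 hU z₀ hz₀
  set ρ := min r r' / 2 with hρ
  have hρ0 : 0 < ρ := by positivity
  have hρr : 2 * ρ ≤ r := by rw [hρ]; linarith [min_le_left r r']
  have hρr' : 2 * ρ ≤ r' := by rw [hρ]; linarith [min_le_right r r']
  have hball : ∀ z ∈ Metric.ball z₀ ρ, Metric.ball z ρ ⊆ Metric.ball z₀ (2 * ρ) := by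
    intro z hz
    apply Metric.ball_subset_ball'
    rw [Metric.mem_ball] at hz; linarith
  have hmem : ∀ z ∈ Metric.ball z₀ (2*ρ), z ∈ U := fun z hz =>
    hrU (Metric.ball_subset_ball hρr' hz)
  have hsub : Metric.ball z₀ (2*ρ) ⊆ Metric.ball z₀ r := Metric.ball_subset_ball hρr
  have hz₀' : z₀ ∈ Metric.ball z₀ (2*ρ) := Metric.mem_ball_self (by positivity)
  have hderiv : ∀ᵐ x ∂μ, ∀ z ∈ Metric.ball z₀ ρ, ‖deriv (F · x) z‖ ≤ b x / (ρ/2) := by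
    filter_upwards [hF] with x ⟨hd, hbd⟩ z hz
    have hsub' : Metric.closedBall z (ρ/2) ⊆ Metric.ball z₀ r :=
      (Metric.closedBall_subset_ball (by linarith)).trans ((hball z hz).trans hsub)
    refine Complex.norm_deriv_le_of_forall_mem_sphere_norm_le (by positivity)
      (hd.diffContOnCl_ball hsub') fun w hw => hbd w (hsub' (Metric.sphere_subset_closedBall hw))
  have hmem' : ∀ z ∈ Metric.ball z₀ ρ, z ∈ Metric.ball z₀ (2*ρ) := fun z hz =>
    Metric.ball_subset_ball (by linarith) hz
  have hdiff : ∀ᵐ x ∂μ, ∀ z ∈ Metric.ball z₀ ρ, HasDerivAt (F · x) (deriv (F · x) z) z := by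
    filter_upwards [hF] with x ⟨hd, _⟩ z hz
    exact (hd.differentiableAt (Metric.isOpen_ball.mem_nhds (hsub (hmem' z hz)))).hasDerivAt
  refine (hasDerivAt_integral_of_dominated_loc_of_deriv_le (Metric.ball_mem_nhds z₀ hρ0)
    (F' := fun z x => deriv (F · x) z) (bound := fun x => b x / (ρ/2)) ?_ ?_ ?_ hderiv
    (hb.div_const _) hdiff).2.differentiableAt.differentiableWithinAt
  · filter_upwards [hU.mem_nhds hz₀] with z hz using hmeas z hz
  · refine hb.mono' (hmeas z₀ hz₀) ?_
    filter_upwards [hF] with x hx using hx.2 _ (hsub hz₀')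
  · have hu : Filter.Tendsto (fun n : ℕ => z₀ + ((ρ / (n + 2) : ℝ) : ℂ)) Filter.atTop
        (nhdsWithin z₀ {z₀}ᶜ) := by
      refine tendsto_nhdsWithin_iff.2 ⟨?_, ?_⟩
      · have h1 : Filter.Tendsto (fun n : ℕ => ρ / ((n:ℝ) + 2)) Filter.atTop (nhds 0) :=
          tendsto_const_nhds.div_atTop
            (Filter.tendsto_atTop_add_const_right _ _ tendsto_natCast_atTop_atTop)
        have h2 := (Complex.continuous_ofReal.tendsto 0).comp h1
        simpa using h2.const_add z₀
      · refine Filter.Eventually.of_forall fun n => ?_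
        have : ρ / ((n:ℝ) + 2) ≠ 0 := by positivity
        rw [Set.mem_compl_singleton_iff, Ne, add_eq_left, Complex.ofReal_eq_zero]
        exact this
    have hU' : ∀ n : ℕ, z₀ + ((ρ / (n + 2) : ℝ) : ℂ) ∈ U := by
      intro n
      apply hmem
      have h3 : |ρ / ((n:ℝ) + 2)| < 2 * ρ := by
        rw [abs_of_pos (by positivity), div_lt_iff₀ (by positivity)]
        nlinarith [(Nat.cast_nonneg n : (0:ℝ) ≤ n)]
      rwa [Metric.mem_ball, dist_eq_norm, add_sub_cancel_left, Complex.norm_real]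
    refine aestronglyMeasurable_of_tendsto_ae Filter.atTop
      (f := fun (n : ℕ) x => slope (F · x) z₀ (z₀ + ((ρ / (n + 2) : ℝ) : ℂ))) ?_ ?_
    · intro n
      simp only [slope, vsub_eq_sub, smul_eq_mul]
      exact ((hmeas _ (hU' n)).sub (hmeas _ hz₀)).const_mul _
    · filter_upwards [hdiff] with x hx
      exact (hasDerivAt_iff_tendsto_slope.1 (hx z₀ (Metric.mem_ball_self hρ0))).comp hu

open Complex in
theorem rect_integral_inv {a b c d : ℝ} (ha : a < 0) (hb : 0 < b) (hc : c < 0) (hd : 0 < d) :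
    (∫ x : ℝ in a..b, ((x : ℂ) + c * I)⁻¹) - (∫ x : ℝ in a..b, ((x : ℂ) + d * I)⁻¹) +
      I * (∫ y : ℝ in c..d, ((b : ℂ) + y * I)⁻¹) - I * (∫ y : ℝ in c..d, ((a : ℂ) + y * I)⁻¹)
      = 2 * Real.pi * I := by
  have hor : ∀ e : ℝ, e ≠ 0 → ∫ x : ℝ in a..b, ((x : ℂ) + e * I)⁻¹
      = log (b + e * I) - log (a + e * I) := by
    intro e he
    refine intervalIntegral.integral_eq_sub_of_hasDerivAt (f := fun x : ℝ => log (x + e * I))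
      (fun x _ => ?_) ?_
    · have h1 : (x : ℂ) + e * I ∈ slitPlane := by right; simpa using he
      simpa using ((hasDerivAt_id (x:ℂ)).add_const (e * I)).comp_ofReal.clog_real h1
    · refine ContinuousOn.intervalIntegrable (ContinuousOn.inv₀ (by fun_prop) fun x _ h => he ?_)
      simpa using congrArg im h
  have ver : ∫ y : ℝ in c..d, ((b : ℂ) + y * I)⁻¹ * I = log (b + d * I) - log (b + c * I) := by
    refine intervalIntegral.integral_eq_sub_of_hasDerivAt (f := fun y : ℝ => log (b + y * I))
      (fun y _ => ?_) ?_
    · have h1 : (b : ℂ) + y * I ∈ slitPlane := by left; simpa using hb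
      have := (((hasDerivAt_id (y:ℂ)).mul_const I).const_add (b:ℂ)).comp_ofReal.clog_real h1
      simpa [div_eq_mul_inv, mul_comm] using this
    · refine ContinuousOn.intervalIntegrable (ContinuousOn.mul (ContinuousOn.inv₀ (by fun_prop) fun x _ h => hb.ne' ?_) (by fun_prop))
      simpa using congrArg re h
  have vel : ∫ y : ℝ in c..d, ((a : ℂ) + y * I)⁻¹ * I
      = log (-(a + d * I)) - log (-(a + c * I)) := by
    refine intervalIntegral.integral_eq_sub_of_hasDerivAt (f := fun y : ℝ => log (-(a + y * I)))
      (fun y _ => ?_) ?_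
    · have h1 : -((a : ℂ) + y * I) ∈ slitPlane := by left; simpa using ha
      have := (((hasDerivAt_id (y:ℂ)).mul_const I).const_add (a:ℂ)).neg.comp_ofReal.clog_real h1
      refine this.congr_deriv ?_
      simp only [Pi.neg_apply, id, one_mul, neg_div_neg_eq]
      rw [div_eq_mul_inv, mul_comm]
    · refine ContinuousOn.intervalIntegrable (ContinuousOn.mul (ContinuousOn.inv₀ (by fun_prop) fun x _ h => ha.ne ?_) (by fun_prop))
      simpa using congrArg re h
  have l1 : log (-((a:ℂ) + d * I)) = log (a + d * I) - Real.pi * I := by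
    have := arg_neg_eq_arg_sub_pi_of_im_pos (x := (a:ℂ) + d * I) (by simpa using hd)
    simp only [log, norm_neg, this]; push_cast; ring
  have l2 : log (-((a:ℂ) + c * I)) = log (a + c * I) + Real.pi * I := by
    have := arg_neg_eq_arg_add_pi_of_im_neg (x := (a:ℂ) + c * I) (by simpa using hc)
    simp only [log, norm_neg, this]; push_cast; ring
  rw [intervalIntegral.integral_mul_const] at ver vel
  rw [hor c hc.ne, hor d hd.ne', mul_comm I, mul_comm I, ver, vel, l1, l2]
  ring

open Complex in
/-- Cauchy's integral formula for a rectangle. -/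
theorem rect_integral_cauchy {a b c d : ℝ} {p : ℂ} (ha : a < p.re) (hb : p.re < b)
    (hc : c < p.im) (hd : p.im < d) {F : ℂ → ℂ}
    (hF : DifferentiableOn ℂ F (Set.Icc a b ×ℂ Set.Icc c d)) :
    (∫ x : ℝ in a..b, F (x + c * I) / ((x : ℂ) + c * I - p))
      - (∫ x : ℝ in a..b, F (x + d * I) / ((x : ℂ) + d * I - p))
      + I * (∫ y : ℝ in c..d, F (b + y * I) / ((b : ℂ) + y * I - p))
      - I * (∫ y : ℝ in c..d, F (a + y * I) / ((a : ℂ) + y * I - p))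
      = 2 * Real.pi * I * F p := by
  set R : Set ℂ := Set.Icc a b ×ℂ Set.Icc c d with hR
  have hp : R ∈ nhds p := by
    rw [hR, mem_nhds_iff]
    refine ⟨Set.Ioo a b ×ℂ Set.Ioo c d, ?_, isOpen_Ioo.reProdIm isOpen_Ioo, ⟨⟨ha, hb⟩, hc, hd⟩⟩
    exact fun z hz => ⟨Set.Ioo_subset_Icc_self hz.1, Set.Ioo_subset_Icc_self hz.2⟩
  have hds : DifferentiableOn ℂ (dslope F p) R := (differentiableOn_dslope hp).2 hF
  have hab : a ≤ b := by linarith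
  have hcd : c ≤ d := by linarith
  have edge : ∀ (γ : ℝ → ℂ) (u v : ℝ), Continuous γ → u ≤ v → (∀ x ∈ Set.Icc u v, γ x ∈ R) →
      (∀ x, γ x ≠ p) → ∫ x in u..v, F (γ x) / (γ x - p)
        = (∫ x in u..v, dslope F p (γ x)) + F p * ∫ x in u..v, (γ x - p)⁻¹ := by
    intro γ u v hγ huv hm hne
    rw [← intervalIntegral.integral_const_mul, ← intervalIntegral.integral_add]
    · refine intervalIntegral.integral_congr fun x _ => ?_
      have : γ x - p ≠ 0 := sub_ne_zero.2 (hne x)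
      simp only [dslope_of_ne _ (hne x), slope, vsub_eq_sub, smul_eq_mul]
      field_simp
      ring
    · refine ContinuousOn.intervalIntegrable (hds.continuousOn.comp hγ.continuousOn ?_)
      rwa [Set.uIcc_of_le huv]
    · refine Continuous.intervalIntegrable ?_ _ _
      exact continuous_const.mul ((hγ.sub continuous_const).inv₀ fun x => sub_ne_zero.2 (hne x))
  have h0 := integral_boundary_rect_eq_zero_of_differentiableOn (dslope F p) ⟨a, c⟩ ⟨b, d⟩
    (by simpa only [Set.uIcc_of_le hab, Set.uIcc_of_le hcd] using hds)
  have h1 := rect_integral_inv (sub_neg.2 ha) (sub_pos.2 hb) (sub_neg.2 hc) (sub_pos.2 hd)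
  have hhor : ∀ e : ℝ, ∫ x : ℝ in (a - p.re)..(b - p.re), ((x:ℂ) + ((e - p.im : ℝ) : ℂ) * I)⁻¹
      = ∫ x : ℝ in a..b, ((x : ℂ) + e * I - p)⁻¹ := by
    intro e
    rw [← intervalIntegral.integral_comp_sub_right
      (fun x : ℝ => ((x:ℂ) + ((e - p.im : ℝ) : ℂ) * I)⁻¹) p.re]
    refine intervalIntegral.integral_congr fun x _ => ?_
    congr 1
    apply Complex.ext <;> simp
  have hver : ∀ e : ℝ, ∫ y : ℝ in (c - p.im)..(d - p.im), (((e - p.re : ℝ) : ℂ) + (y : ℂ) * I)⁻¹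
      = ∫ y : ℝ in c..d, ((e : ℂ) + y * I - p)⁻¹ := by
    intro e
    rw [← intervalIntegral.integral_comp_sub_right
      (fun y : ℝ => (((e - p.re : ℝ) : ℂ) + (y : ℂ) * I)⁻¹) p.im]
    refine intervalIntegral.integral_congr fun x _ => ?_
    congr 1
    apply Complex.ext <;> simp
  rw [hhor, hhor, hver, hver] at h1
  rw [edge (fun x => x + c * I) a b (by fun_prop) hab, edge (fun x => x + d * I) a b (by fun_prop) hab,
    edge (fun y => b + y * I) c d (by fun_prop) hcd, edge (fun y => a + y * I) c d (by fun_prop) hcd]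
  · simp only [smul_eq_mul] at h0
    linear_combination h0 + F p * h1
  · intro x hx
    refine ⟨?_, ?_⟩ <;> simp [hx.1, hx.2, hab, hcd]
  · intro x hx
    have := congrArg re hx
    simp at this; linarith
  · intro x hx
    refine ⟨?_, ?_⟩ <;> simp [hx.1, hx.2, hab, hcd]
  · intro x hx
    have := congrArg re hx
    simp at this; linarith
  · intro x hx
    refine ⟨?_, ?_⟩ <;> simp [hx.1, hx.2, hab, hcd]
  · intro x hx
    have := congrArg im hx
    simp at this; linarith
  · intro x hx
    refine ⟨?_, ?_⟩ <;> simp [hx.1, hx.2, hab, hcd]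
  · intro x hx
    have := congrArg im hx
    simp at this; linarith

/-- `cot (π z)`. -/
noncomputable def cotPi (z : ℂ) : ℂ := Complex.cos (Real.pi * z) / Complex.sin (Real.pi * z)

theorem cotPi_add_one (z : ℂ) : cotPi (z + 1) = cotPi z := by
  simp only [cotPi, mul_add, mul_one, Complex.cos_add_pi, Complex.sin_add_pi, neg_div_neg_eq]

theorem cotPi_sub_one (z : ℂ) : cotPi (z - 1) = cotPi z := by
  rw [← cotPi_add_one (z - 1), sub_add_cancel]

theorem normSq_sin (z : ℂ) :
    ‖Complex.sin z‖ ^ 2 = Real.sin z.re ^ 2 + Real.sinh z.im ^ 2 := by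
  rw [Complex.sq_norm, Complex.normSq_apply]
  conv_lhs => rw [Complex.sin_eq z]
  simp only [← Complex.ofReal_sin, ← Complex.ofReal_cos, ← Complex.ofReal_sinh,
    ← Complex.ofReal_cosh, Complex.add_re, Complex.mul_re, Complex.ofReal_re, Complex.ofReal_im,
    Complex.add_im, Complex.mul_im, Complex.I_re, Complex.I_im]
  have h1 := Real.sin_sq_add_cos_sq z.re
  have h2 := Real.cosh_sq z.im
  ring_nf
  nlinarith

theorem norm_cos_le_one_add_norm_sin (z : ℂ) : ‖Complex.cos z‖ ≤ 1 + ‖Complex.sin z‖ := by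
  have h : ‖Complex.cos z‖ ^ 2 ≤ 1 + ‖Complex.sin z‖ ^ 2 := by
    have h1 : Complex.cos z ^ 2 = 1 - Complex.sin z ^ 2 := by
      linear_combination Complex.sin_sq_add_cos_sq z
    rw [← norm_pow, h1, ← norm_pow]
    exact (norm_sub_le _ _).trans (by simp)
  nlinarith [norm_nonneg (Complex.cos z), norm_nonneg (Complex.sin z)]

theorem abs_sin_pi_ge {x : ℝ} (hx : |x| ≤ 1 / 2) : 2 * |x| ≤ |Real.sin (Real.pi * x)| := by
  have hpi := Real.pi_pos
  have h := Real.mul_abs_le_abs_sin (x := Real.pi * x) (by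
    rw [abs_mul, abs_of_pos hpi]; nlinarith)
  rw [abs_mul, abs_of_pos hpi] at h
  calc 2 * |x| = 2 / Real.pi * (Real.pi * |x|) := by field_simp
    _ ≤ _ := h

theorem abs_sinh_pi_ge (x : ℝ) : 3 * |x| ≤ |Real.sinh (Real.pi * x)| := by
  have h3 := Real.pi_gt_three
  rw [Real.abs_sinh, abs_mul, abs_of_pos Real.pi_pos]
  have := Real.self_le_sinh_iff.2 (mul_nonneg Real.pi_pos.le (abs_nonneg x))
  nlinarith [abs_nonneg x]

theorem norm_cotPi_le (z : ℂ) : ‖cotPi z‖ ≤ 1 + ‖Complex.sin (Real.pi * z)‖⁻¹ := by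
  rw [cotPi, norm_div]
  rcases eq_or_ne (Complex.sin (Real.pi * z)) 0 with h | h
  · simp [h]
  · have := norm_pos_iff.2 h
    rw [div_le_iff₀ this, add_mul, inv_mul_cancel₀ this.ne']
    linarith [norm_cos_le_one_add_norm_sin (Real.pi * z)]

theorem norm_sin_pi_ge_im (z : ℂ) : 3 * |z.im| ≤ ‖Complex.sin (Real.pi * z)‖ := by
  have h := normSq_sin (Real.pi * z)
  simp only [Complex.mul_re, Complex.mul_im, Complex.ofReal_re, Complex.ofReal_im, zero_mul,
    sub_zero, add_zero] at h
  refine (abs_sinh_pi_ge z.im).trans (abs_le_of_sq_le_sq ?_ (norm_nonneg _))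
  nlinarith [sq_nonneg (Real.sin (Real.pi * z.re))]

theorem norm_sin_pi_ge_re (z : ℂ) : |Real.sin (Real.pi * z.re)| ≤ ‖Complex.sin (Real.pi * z)‖ := by
  have h := normSq_sin (Real.pi * z)
  simp only [Complex.mul_re, Complex.mul_im, Complex.ofReal_re, Complex.ofReal_im, zero_mul,
    sub_zero, add_zero] at h
  refine abs_le_of_sq_le_sq ?_ (norm_nonneg _)
  nlinarith [sq_nonneg (Real.sinh (Real.pi * z.im))]

theorem sin_pi_ne_zero_of_re {z : ℂ} (h0 : 0 < |z.re|) (h1 : |z.re| < 1) :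
    Complex.sin (Real.pi * z) ≠ 0 := by
  intro h
  obtain ⟨k, hk⟩ := Complex.sin_eq_zero_iff.1 h
  have hz : z = k := mul_left_cancel₀ (Complex.ofReal_ne_zero.2 Real.pi_ne_zero)
    (hk.trans (mul_comm _ _))
  rw [hz, Complex.intCast_re] at h0 h1
  have : |k| < 1 := by exact_mod_cast h1
  have : k = 0 := Int.abs_lt_one_iff.1 this
  simp [this] at h0

theorem sin_pi_ne_zero_of_ne {z : ℂ} (h0 : z ≠ 0) (h1 : |z.re| < 1) :
    Complex.sin (Real.pi * z) ≠ 0 := by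
  intro h
  obtain ⟨k, hk⟩ := Complex.sin_eq_zero_iff.1 h
  have hz : z = k := mul_left_cancel₀ (Complex.ofReal_ne_zero.2 Real.pi_ne_zero)
    (hk.trans (mul_comm _ _))
  rw [hz, Complex.intCast_re] at h1
  have : |k| < 1 := by exact_mod_cast h1
  have : k = 0 := Int.abs_lt_one_iff.1 this
  simp [this] at hz; exact h0 hz

theorem sin_pi_ne_zero_of_im {z : ℂ} (h0 : z.im ≠ 0) : Complex.sin (Real.pi * z) ≠ 0 := by
  intro h
  have := norm_sin_pi_ge_im z
  rw [h, norm_zero] at this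
  have := abs_pos.2 h0
  linarith

theorem norm_cotPi_le_of_im {z : ℂ} {m : ℝ} (hm : 0 < m) (h : m ≤ |z.im|) :
    ‖cotPi z‖ ≤ 1 + m⁻¹ := by
  refine (norm_cotPi_le z).trans (add_le_add_right (inv_anti₀ hm ?_) _)
  linarith [norm_sin_pi_ge_im z]

theorem norm_cotPi_le_of_re {z : ℂ} {m : ℝ} (hm : 0 < m) (h : m ≤ z.re) (h' : z.re ≤ 1 - m) :
    ‖cotPi z‖ ≤ 1 + m⁻¹ := by
  refine (norm_cotPi_le z).trans (add_le_add_right (inv_anti₀ hm ?_) _)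
  refine le_trans ?_ (norm_sin_pi_ge_re z)
  rcases le_total z.re (1/2) with h2 | h2
  · have := abs_sin_pi_ge (x := z.re) (by rw [abs_of_pos] <;> linarith)
    rw [abs_of_pos (by linarith : 0 < z.re)] at this; linarith
  · have := abs_sin_pi_ge (x := z.re - 1) (by rw [abs_le]; constructor <;> linarith)
    rw [mul_sub, mul_one, Real.sin_sub_pi, abs_neg, abs_sub_comm, abs_of_pos (by linarith : 0 < 1 - z.re)] at this
    linarith

theorem norm_inv_sin_pi_le {z : ℂ} (h : -(1/2) < z.re) (h' : z.re < 3/2) (h0 : z.re ≠ 0)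
    (h1 : z.re ≠ 1) (hi : z.im ≠ 0) :
    ‖Complex.sin (Real.pi * z)‖⁻¹ ≤
      (|z.re| ^ (-(1/2) : ℝ) + |z.re - 1| ^ (-(1/2) : ℝ)) * |z.im| ^ (-(1/2) : ℝ) := by
  have key : ∀ x : ℝ, |x| ≤ 1/2 → x ≠ 0 → |Real.sin (Real.pi * z.re)| = |Real.sin (Real.pi * x)| →
      ‖Complex.sin (Real.pi * z)‖⁻¹ ≤ |x| ^ (-(1/2) : ℝ) * |z.im| ^ (-(1/2) : ℝ) := by
    intro x hx hx0 he
    have hs : 0 < |x| * |z.im| := mul_pos (abs_pos.2 hx0) (abs_pos.2 hi)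
    rw [← Real.mul_rpow (abs_nonneg _) (abs_nonneg _), Real.rpow_neg hs.le, ← Real.sqrt_eq_rpow]
    refine inv_anti₀ (Real.sqrt_pos.2 hs) (Real.sqrt_le_iff.2 ⟨norm_nonneg _, ?_⟩)
    have h2 := norm_sin_pi_ge_re z
    rw [he] at h2
    have h3 := abs_sin_pi_ge hx
    have h4 := norm_sin_pi_ge_im z
    nlinarith [abs_nonneg x, abs_nonneg z.im, norm_nonneg (Complex.sin (Real.pi * z))]
  have hp : ∀ x : ℝ, 0 ≤ |x| ^ (-(1/2) : ℝ) := fun x => Real.rpow_nonneg (abs_nonneg _) _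
  rcases le_total z.re (1/2) with h2 | h2
  · refine (key z.re (abs_le.2 ⟨by linarith, h2⟩) h0 rfl).trans ?_
    exact mul_le_mul_of_nonneg_right (le_add_of_nonneg_right (hp _)) (hp _)
  · refine (key (z.re - 1) (abs_le.2 ⟨by linarith, by linarith⟩) (sub_ne_zero.2 h1) ?_).trans ?_
    · rw [mul_sub, mul_one, Real.sin_sub_pi, abs_neg]
    · exact mul_le_mul_of_nonneg_right (le_add_of_nonneg_left (hp _)) (hp _)

theorem differentiableAt_cotPi {z : ℂ} (h : Complex.sin (Real.pi * z) ≠ 0) :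
    DifferentiableAt ℂ cotPi z := by
  unfold cotPi
  fun_prop (disch := assumption)

theorem measurable_cotPi : Measurable cotPi := by
  unfold cotPi
  fun_prop

open Complex in
/-- Residue computation for the kernel `cotPi` on a rectangle. -/
theorem rect_integral_cotPi' {a b c d : ℝ} {p : ℂ} (ha : a < p.re) (hb : p.re < b)
    (hc : c < p.im) (hd : p.im < d) (hab : b - p.re < 1) (hab' : p.re - a < 1) {F : ℂ → ℂ}
    (hF : DifferentiableOn ℂ F (Set.Icc a b ×ℂ Set.Icc c d)) :
    (∫ x : ℝ in a..b, F (x + c * I) * cotPi ((x : ℂ) + c * I - p))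
      - (∫ x : ℝ in a..b, F (x + d * I) * cotPi ((x : ℂ) + d * I - p))
      + I * (∫ y : ℝ in c..d, F (b + y * I) * cotPi ((b : ℂ) + y * I - p))
      - I * (∫ y : ℝ in c..d, F (a + y * I) * cotPi ((a : ℂ) + y * I - p))
      = 2 * I * F p := by
  set R : Set ℂ := Set.Icc a b ×ℂ Set.Icc c d with hR
  have hp : R ∈ nhds p := by
    rw [hR, mem_nhds_iff]
    refine ⟨Set.Ioo a b ×ℂ Set.Ioo c d, ?_, isOpen_Ioo.reProdIm isOpen_Ioo, ⟨⟨ha, hb⟩, hc, hd⟩⟩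
    exact fun z hz => ⟨Set.Ioo_subset_Icc_self hz.1, Set.Ioo_subset_Icc_self hz.2⟩
  set s : ℂ → ℂ := fun t => sin (Real.pi * (t - p)) with hs
  have hsd : Differentiable ℂ s := by fun_prop
  have hsp : s p = 0 := by simp [hs]
  have hsp' : HasDerivAt s Real.pi p := by
    have : HasDerivAt (fun t : ℂ => (Real.pi : ℂ) * (t - p)) Real.pi p := by
      simpa using ((hasDerivAt_id p).sub_const p).const_mul (Real.pi : ℂ)
    simpa using this.csin
  have hne : ∀ t, t ≠ p → dslope s p t = s t / (t - p) := fun t ht => by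
    rw [dslope_of_ne _ ht, slope_def_field, hsp, sub_zero]
  have hds0 : ∀ t ∈ R, dslope s p t ≠ 0 := by
    intro t ht
    rcases eq_or_ne t p with rfl | htp
    · rw [dslope_same, hsp'.deriv]; exact ofReal_ne_zero.2 Real.pi_ne_zero
    · rw [hne t htp]
      refine div_ne_zero (sin_pi_ne_zero_of_ne (sub_ne_zero.2 htp) ?_) (sub_ne_zero.2 htp)
      have h1 : a ≤ t.re := ht.1.1
      have h2 : t.re ≤ b := ht.1.2
      rw [sub_re, abs_lt]; constructor <;> linarith
  set G : ℂ → ℂ := fun t => F t * cos (Real.pi * (t - p)) / dslope s p t with hG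
  have hGd : DifferentiableOn ℂ G R := by
    refine (hF.mul (by fun_prop)).div ((differentiableOn_dslope hp).2 hsd.differentiableOn) hds0
  have hGe : ∀ t, t ≠ p → G t / (t - p) = F t * cotPi (t - p) := by
    intro t ht
    have := sub_ne_zero.2 ht
    simp only [hG]
    rw [hne t ht, div_div, div_mul_cancel₀ _ this, mul_div_assoc]
    rfl
  have hGp : G p = F p / Real.pi := by
    simp [hG, hsp'.deriv]
  have key := rect_integral_cauchy ha hb hc hd hGd
  rw [hGp] at key
  have e1 : ∀ e : ℝ, e ≠ p.im → (∫ x : ℝ in a..b, G (x + e * I) / ((x : ℂ) + e * I - p))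
      = ∫ x : ℝ in a..b, F (x + e * I) * cotPi ((x : ℂ) + e * I - p) := by
    intro e he
    refine intervalIntegral.integral_congr fun x _ => hGe _ fun h => he ?_
    simpa using congrArg im h
  have e2 : ∀ e : ℝ, e ≠ p.re → (∫ y : ℝ in c..d, G (e + y * I) / ((e : ℂ) + y * I - p))
      = ∫ y : ℝ in c..d, F (e + y * I) * cotPi ((e : ℂ) + y * I - p) := by
    intro e he
    refine intervalIntegral.integral_congr fun x _ => hGe _ fun h => he ?_
    simpa using congrArg re h
  rw [e1 _ hc.ne, e1 _ hd.ne', e2 _ hb.ne', e2 _ ha.ne] at key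
  rw [key]
  have := ofReal_ne_zero.2 Real.pi_ne_zero
  field_simp

open Complex in
theorem rect_integral_cotPi {a b c d : ℝ} {p : ℂ} (ha : a < p.re) (hb : p.re < b)
    (hc : c < p.im) (hd : p.im < d) (hab : b - a < 1) {F : ℂ → ℂ}
    (hF : DifferentiableOn ℂ F (Set.Icc a b ×ℂ Set.Icc c d)) :
    (∫ x : ℝ in a..b, F (x + c * I) * cotPi ((x : ℂ) + c * I - p))
      - (∫ x : ℝ in a..b, F (x + d * I) * cotPi ((x : ℂ) + d * I - p))
      + I * (∫ y : ℝ in c..d, F (b + y * I) * cotPi ((b : ℂ) + y * I - p))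
      - I * (∫ y : ℝ in c..d, F (a + y * I) * cotPi ((a : ℂ) + y * I - p)) = 2 * I * F p :=
  rect_integral_cotPi' ha hb hc hd (by linarith) (by linarith) hF

/-- The integrable singularity `|x| ^ (-1/2)` truncated to `[-1, 1]`. -/
noncomputable def sqrtSing (x : ℝ) : ℝ :=
  (Set.Icc (-1 : ℝ) 1).indicator (fun x => |x| ^ (-(1/2) : ℝ)) x

theorem sqrtSing_nonneg (x : ℝ) : 0 ≤ sqrtSing x :=
  Set.indicator_nonneg (fun _ _ => Real.rpow_nonneg (abs_nonneg _) _) _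

theorem rpow_le_one_add_sqrtSing (x : ℝ) : |x| ^ (-(1/2) : ℝ) ≤ 1 + sqrtSing x := by
  unfold sqrtSing
  by_cases h : x ∈ Set.Icc (-1 : ℝ) 1
  · rw [Set.indicator_of_mem h]; linarith
  · rw [Set.indicator_of_notMem h, add_zero]
    refine Real.rpow_le_one_of_one_le_of_nonpos ?_ (by norm_num)
    by_contra hc
    exact h (abs_le.1 (not_le.1 hc).le)

theorem integrable_sqrtSing : Integrable sqrtSing := by
  have h1 : IntervalIntegrable (fun x : ℝ => |x| ^ (-(1/2) : ℝ)) volume 0 1 := by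
    refine (intervalIntegral.intervalIntegrable_rpow' (r := -(1/2)) (by norm_num)).congr ?_
    intro x hx
    rw [Set.uIoc_of_le zero_le_one] at hx
    simp [abs_of_pos hx.1]
  have h2 : IntervalIntegrable (fun x : ℝ => |x| ^ (-(1/2) : ℝ)) volume (-1) 0 := by
    have := ((IntervalIntegrable.iff_comp_neg (by simp)).1 h1).symm
    simpa using this
  have h3 := h2.trans h1
  rw [intervalIntegrable_iff_integrableOn_Icc_of_le (by norm_num)] at h3
  exact (integrable_indicator_iff measurableSet_Icc).2 h3

/-- The exponential weight on `|η| < h`. -/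
noncomputable def expWeight (h η : ℝ) : ℝ := Real.exp (-2 * Real.pi * (h - |η|))

theorem expWeight_nonneg (h η : ℝ) : 0 ≤ expWeight h η := (Real.exp_pos _).le

theorem expWeight_le_one {h η : ℝ} (hη : |η| < h) : expWeight h η ≤ 1 :=
  Real.exp_le_one_iff.2 (by nlinarith [Real.pi_pos])

theorem continuous_expWeight (h : ℝ) : Continuous (expWeight h) := by
  unfold expWeight; fun_prop

theorem integral_expWeight_le {h : ℝ} (hh : 0 < h) :
    ∫ η in Set.Ioo (-h) h, expWeight h η ≤ 1 := by
  have e1 : ∀ c : ℝ, c ≠ 0 → ∀ d, ∫ η in (-h)..h, Real.exp (c * η + d)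
      = (Real.exp (c * h + d) - Real.exp (c * (-h) + d)) / c := by
    intro c hc d
    have : ∀ x ∈ Set.uIcc (-h) h, HasDerivAt (fun η => Real.exp (c * η + d) / c)
        (Real.exp (c * x + d)) x := by
      intro x _
      have := ((((hasDerivAt_id x).const_mul c).add_const d).exp).div_const c
      simpa [hc] using this
    rw [intervalIntegral.integral_eq_sub_of_hasDerivAt this
      (Continuous.intervalIntegrable (by fun_prop) _ _), sub_div]
  rw [← integral_Ioc_eq_integral_Ioo, ← intervalIntegral.integral_of_le (by linarith)]
  have hpi := Real.pi_gt_three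
  calc ∫ η in (-h)..h, expWeight h η
      ≤ ∫ η in (-h)..h, (Real.exp (2 * Real.pi * η + -(2 * Real.pi * h))
          + Real.exp (-(2 * Real.pi) * η + -(2 * Real.pi * h))) := by
        refine intervalIntegral.integral_mono (by linarith)
          ((continuous_expWeight h).intervalIntegrable _ _)
          (Continuous.intervalIntegrable (by fun_prop) _ _) fun η => ?_
        unfold expWeight
        have p1 := Real.exp_pos (2 * Real.pi * η + -(2 * Real.pi * h))
        have p2 := Real.exp_pos (-(2 * Real.pi) * η + -(2 * Real.pi * h))
        rcases abs_cases η with ⟨h1, _⟩ | ⟨h1, _⟩ <;> rw [h1]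
        · rw [show -2 * Real.pi * (h - η) = 2 * Real.pi * η + -(2 * Real.pi * h) by ring]
          linarith
        · rw [show -2 * Real.pi * (h - -η) = -(2 * Real.pi) * η + -(2 * Real.pi * h) by ring]
          linarith
    _ = (1 - Real.exp (2 * Real.pi * (-h) + -(2 * Real.pi * h))) / Real.pi := by
        rw [intervalIntegral.integral_add (Continuous.intervalIntegrable (by fun_prop) _ _)
          (Continuous.intervalIntegrable (by fun_prop) _ _), e1 _ (by positivity),
          e1 _ (by linarith)]
        rw [show 2 * Real.pi * h + -(2 * Real.pi * h) = 0 by ring,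
          show -(2 * Real.pi) * -h + -(2 * Real.pi * h) = 0 by ring,
          show -(2 * Real.pi) * h + -(2 * Real.pi * h) =
            2 * Real.pi * (-h) + -(2 * Real.pi * h) by ring, Real.exp_zero]
        field_simp
        ring
    _ ≤ 1 := by
        rw [div_le_one (by positivity)]
        linarith [Real.exp_pos (2 * Real.pi * (-h) + -(2 * Real.pi * h))]

/-- A point of `ℂ` from its coordinates. -/
noncomputable def pt (p : ℝ × ℝ) : ℂ := p.1 + p.2 * Complex.I

@[simp] theorem pt_re (p : ℝ × ℝ) : (pt p).re = p.1 := by simp [pt]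
@[simp] theorem pt_im (p : ℝ × ℝ) : (pt p).im = p.2 := by simp [pt]

theorem continuous_pt : Continuous pt := by unfold pt; fun_prop

/-- The open rectangle `|Re z| < w`, `|Im z| < h`. -/
def Rect (w h : ℝ) : Set ℂ := {z | |z.re| < w ∧ |z.im| < h}

/-- The open rectangle `-1 - w < Re z < w`, `|Im z| < h`. -/
def WideRect (w h : ℝ) : Set ℂ := {z | -1 - w < z.re ∧ z.re < w ∧ |z.im| < h}

theorem isOpen_Rect (w h : ℝ) : IsOpen (Rect w h) := by
  have h1 : IsOpen {z : ℂ | |z.re| < w} := isOpen_lt (by fun_prop) (by fun_prop)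
  have h2 : IsOpen {z : ℂ | |z.im| < h} := isOpen_lt (by fun_prop) (by fun_prop)
  exact h1.inter h2

theorem isOpen_WideRect (w h : ℝ) : IsOpen (WideRect w h) := by
  have h1 : IsOpen {z : ℂ | -1 - w < z.re} := isOpen_lt (by fun_prop) (by fun_prop)
  have h2 : IsOpen {z : ℂ | z.re < w} := isOpen_lt (by fun_prop) (by fun_prop)
  have h3 : IsOpen {z : ℂ | |z.im| < h} := isOpen_lt (by fun_prop) (by fun_prop)
  exact h1.inter (h2.inter h3)

/-- The dominating function of the gluing kernel. -/
noncomputable def glueDom (h : ℝ) (y : ℂ) (p : ℝ × ℝ) : ℝ :=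
  expWeight h p.2 + (2 + sqrtSing (p.1 - y.re) + sqrtSing (p.1 - y.re - 1)) *
    (expWeight h p.2 + sqrtSing (p.2 - y.im))

/-- The coordinate rectangle. -/
def coordRect (w h : ℝ) : Set (ℝ × ℝ) := Set.Ioo (-w) w ×ˢ Set.Ioo (-h) h

theorem measurableSet_coordRect (w h : ℝ) : MeasurableSet (coordRect w h) :=
  measurableSet_Ioo.prod measurableSet_Ioo

theorem pt_mem_Rect {w h : ℝ} {p : ℝ × ℝ} : pt p ∈ Rect w h ↔ p ∈ coordRect w h := by
  simp [Rect, coordRect, abs_lt]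

theorem norm_cotPi_le_glueDom {w h : ℝ} (hw : w < 1/4) {y : ℂ} (hy : y ∈ WideRect w h)
    {p : ℝ × ℝ} (hp : p ∈ coordRect w h) (h0 : p.1 ≠ y.re) (h1 : p.1 ≠ y.re + 1)
    (h2 : p.2 ≠ y.im) : expWeight h p.2 * ‖cotPi (pt p - y)‖ ≤ glueDom h y p := by
  obtain ⟨⟨hp1, hp2⟩, hp3, hp4⟩ := hp
  obtain ⟨hy1, hy2, hy3⟩ := hy
  have hre : (pt p - y).re = p.1 - y.re := by simp
  have him : (pt p - y).im = p.2 - y.im := by simp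
  have key := norm_inv_sin_pi_le (z := pt p - y) (by rw [hre]; linarith) (by rw [hre]; linarith)
    (by rw [hre]; exact sub_ne_zero.2 h0) (by rw [hre]; exact fun h => h1 (by linarith))
    (by rw [him]; exact sub_ne_zero.2 h2)
  rw [hre, him] at key
  have k1 := norm_cotPi_le (pt p - y)
  have r1 := rpow_le_one_add_sqrtSing (p.1 - y.re)
  have r2 := rpow_le_one_add_sqrtSing (p.1 - y.re - 1)
  have r3 := rpow_le_one_add_sqrtSing (p.2 - y.im)
  have s1 := sqrtSing_nonneg (p.1 - y.re)
  have s2 := sqrtSing_nonneg (p.1 - y.re - 1)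
  have s3 := sqrtSing_nonneg (p.2 - y.im)
  have w0 := expWeight_nonneg h p.2
  have w1 := expWeight_le_one (h := h) (η := p.2) (abs_lt.2 ⟨hp3, hp4⟩)
  have k2 : ‖cotPi (pt p - y)‖ ≤ 1 + (2 + sqrtSing (p.1 - y.re) + sqrtSing (p.1 - y.re - 1)) *
      (1 + sqrtSing (p.2 - y.im)) := by
    refine k1.trans (add_le_add_right (key.trans ?_) _)
    refine mul_le_mul (by linarith) r3 (Real.rpow_nonneg (abs_nonneg _) _) (by linarith)
  unfold glueDom
  refine (mul_le_mul_of_nonneg_left k2 w0).trans ?_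
  have : expWeight h p.2 * (1 + sqrtSing (p.2 - y.im)) ≤ expWeight h p.2 + sqrtSing (p.2 - y.im) := by
    nlinarith
  have h3 := mul_le_mul_of_nonneg_left this (by linarith : 0 ≤ 2 + sqrtSing (p.1 - y.re) + sqrtSing (p.1 - y.re - 1))
  linarith

/-- The constant of the gluing operator. -/
noncomputable def glueConst (w : ℝ) : ℝ :=
  (2 * w + (4 * w + 2 * ∫ x, sqrtSing x) * (1 + ∫ x, sqrtSing x)) / (4 * w) + 2

theorem integrableOn_glueDom {w h : ℝ} (hw : 0 < w) (hh : 0 < h) (y : ℂ) :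
    IntegrableOn (glueDom h y) (coordRect w h) ∧
    ∫ p in coordRect w h, glueDom h y p
      ≤ 2 * w + (4 * w + 2 * ∫ x, sqrtSing x) * (1 + ∫ x, sqrtSing x) := by
  have hWi : IntegrableOn (expWeight h) (Set.Ioo (-h) h) :=
    ((continuous_expWeight h).integrableOn_Icc).mono_set Set.Ioo_subset_Icc_self
  have hsi : ∀ (c : ℝ) (s : Set ℝ), IntegrableOn (fun x => sqrtSing (x - c)) s := fun c s =>
    (integrable_sqrtSing.comp_sub_right c).integrableOn
  have hsI : ∀ (c : ℝ) (s : Set ℝ), ∫ x in s, sqrtSing (x - c) ≤ ∫ x, sqrtSing x := by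
    intro c s
    rw [← integral_sub_right_eq_self (μ := volume) sqrtSing c]
    exact setIntegral_le_integral (integrable_sqrtSing.comp_sub_right c)
      (Filter.Eventually.of_forall fun x => sqrtSing_nonneg _)
  have hc : ∀ c : ℝ, IntegrableOn (fun _ : ℝ => c) (Set.Ioo (-w) w) := fun c => by
    simp [integrableOn_const_iff]
  have hA : IntegrableOn (fun x => 2 + sqrtSing (x - y.re) + sqrtSing (x - y.re - 1))
      (Set.Ioo (-w) w) := by
    have := hsi (y.re + 1) (Set.Ioo (-w) w)
    simp only [← sub_sub] at this
    exact ((hc 2).add (hsi _ _)).add this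
  have hB : IntegrableOn (fun x => expWeight h x + sqrtSing (x - y.im)) (Set.Ioo (-h) h) :=
    hWi.add (hsi _ _)
  have hAI : ∫ x in Set.Ioo (-w) w, (2 + sqrtSing (x - y.re) + sqrtSing (x - y.re - 1))
      ≤ 4 * w + 2 * ∫ x, sqrtSing x := by
    have h1 := hsi (y.re + 1) (Set.Ioo (-w) w)
    have h2 := hsI (y.re + 1) (Set.Ioo (-w) w)
    simp only [← sub_sub] at h1 h2
    have h5 : IntegrableOn (fun x => 2 + sqrtSing (x - y.re)) (Set.Ioo (-w) w) :=
      (hc 2).add (hsi _ _)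
    rw [integral_add h5 h1, integral_add (hc 2) (hsi _ _)]
    have h3 := hsI y.re (Set.Ioo (-w) w)
    have h4 : ∫ x in Set.Ioo (-w) w, (2:ℝ) = 4 * w := by
      rw [setIntegral_const, Real.volume_real_Ioo_of_le (by linarith), smul_eq_mul]; ring
    linarith
  have hBI : ∫ x in Set.Ioo (-h) h, (expWeight h x + sqrtSing (x - y.im))
      ≤ 1 + ∫ x, sqrtSing x := by
    rw [integral_add hWi (hsi _ _)]
    exact add_le_add (integral_expWeight_le hh) (hsI _ _)
  have hA0 : 0 ≤ ∫ x in Set.Ioo (-w) w, (2 + sqrtSing (x - y.re) + sqrtSing (x - y.re - 1)) :=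
    integral_nonneg fun x => by
      have := sqrtSing_nonneg (x - y.re); have := sqrtSing_nonneg (x - y.re - 1)
      simp only [Pi.zero_apply]; linarith
  have hB0 : 0 ≤ ∫ x in Set.Ioo (-h) h, (expWeight h x + sqrtSing (x - y.im)) :=
    integral_nonneg fun x => add_nonneg (expWeight_nonneg _ _) (sqrtSing_nonneg _)
  have i1 := (hc 1).mul_prod hWi
  have i2 := hA.mul_prod hB
  simp only [one_mul] at i1
  rw [coordRect, IntegrableOn, Measure.volume_eq_prod, ← Measure.prod_restrict]
  refine ⟨i1.add i2, ?_⟩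
  have e1 := integral_prod_mul (μ := volume.restrict (Set.Ioo (-w) w))
    (ν := volume.restrict (Set.Ioo (-h) h)) (fun _ => (1:ℝ)) (expWeight h)
  have e2 := integral_prod_mul (μ := volume.restrict (Set.Ioo (-w) w))
    (ν := volume.restrict (Set.Ioo (-h) h))
    (fun x => 2 + sqrtSing (x - y.re) + sqrtSing (x - y.re - 1))
    (fun x => expWeight h x + sqrtSing (x - y.im))
  simp only [one_mul] at e1
  have : ∫ p, glueDom h y p ∂((volume.restrict (Set.Ioo (-w) w)).prod
      (volume.restrict (Set.Ioo (-h) h))) = _ := integral_add i1 i2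
  rw [this, e1, e2]
  have h5 : ∫ x in Set.Ioo (-w) w, (1:ℝ) = 2 * w := by
    rw [setIntegral_const, Real.volume_real_Ioo_of_le (by linarith), smul_eq_mul]; ring
  rw [h5]
  have h6 := integral_expWeight_le hh
  have h7 := mul_le_mul hAI hBI hB0 (hA0.trans hAI)
  nlinarith

/-- Linear cut-off. -/
noncomputable def glueCut (w a : ℝ) : ℝ := max 0 (min 1 ((a + w) / (2 * w)))

theorem glueCut_nonneg (w a : ℝ) : 0 ≤ glueCut w a := le_max_left _ _

theorem glueCut_le_one (w a : ℝ) : glueCut w a ≤ 1 :=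
  max_le zero_le_one (min_le_left _ _)

theorem glueCut_eq_zero {w a : ℝ} (hw : 0 < w) (h : a ≤ -w) : glueCut w a = 0 := by
  have : (a + w) / (2 * w) ≤ 0 := div_nonpos_of_nonpos_of_nonneg (by linarith) (by linarith)
  unfold glueCut
  rw [max_eq_left ((min_le_right _ _).trans this)]

theorem glueCut_of_abs_le {w a : ℝ} (hw : 0 < w) (h : |a| ≤ w) :
    glueCut w a = (a + w) / (2 * w) := by
  obtain ⟨h1, h2⟩ := abs_le.1 h
  unfold glueCut
  rw [min_eq_right (by rw [div_le_one (by linarith)]; linarith),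
    max_eq_right (div_nonneg (by linarith) (by linarith))]

/-- The gluing operator: a solution `n` of `n (y - 1) - n y = - μ y`. -/
noncomputable def glueT (w h : ℝ) (μ : ℂ → ℂ) (y : ℂ) : ℂ :=
  (1 / (4 * w) : ℝ) * (∫ p in coordRect w h, μ (pt p) * cotPi (pt p - y))
    + glueCut w y.re * μ y - glueCut w (-(y.re + 1)) * μ (y + 1)

theorem glueT_sub {w h : ℝ} (hw : 0 < w) (hw' : w < 1 / 4) (μ : ℂ → ℂ) {y : ℂ}
    (hy : |y.re| < w) : glueT w h μ (y - 1) - glueT w h μ y = - μ y := by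
  obtain ⟨h1, h2⟩ := abs_lt.1 hy
  have e : ∀ p, cotPi (pt p - (y - 1)) = cotPi (pt p - y) := fun p => by
    rw [show pt p - (y - 1) = pt p - y + 1 by ring, cotPi_add_one]
  have c1 : glueCut w (y - 1).re = 0 := glueCut_eq_zero hw (by simp; linarith)
  have c2 : glueCut w (-(y.re + 1)) = 0 := glueCut_eq_zero hw (by linarith)
  have c3 : glueCut w (-((y - 1).re + 1)) = (-y.re + w) / (2 * w) := by
    rw [Complex.sub_re, Complex.one_re, sub_add_cancel]
    exact glueCut_of_abs_le hw (by rw [abs_neg]; exact hy.le)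
  have c4 := glueCut_of_abs_le hw hy.le
  simp only [glueT, e, c1, c2, c3, c4, sub_add_cancel]
  have : (w : ℂ) ≠ 0 := Complex.ofReal_ne_zero.2 hw.ne'
  push_cast
  field_simp
  ring

theorem glue_ae_ne (y : ℂ) (s : Set (ℝ × ℝ)) : ∀ᵐ p : ℝ × ℝ ∂(volume.restrict s),
    p.1 ≠ y.re ∧ p.1 ≠ y.re + 1 ∧ p.2 ≠ y.im := by
  refine ae_restrict_of_ae ?_
  have h1 : ∀ c : ℝ, ∀ᵐ p : ℝ × ℝ, p.1 ≠ c := fun c => by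
    rw [Measure.volume_eq_prod]
    exact (Measure.quasiMeasurePreserving_fst (μ := volume) (ν := volume)).ae
      (Measure.ae_ne volume c)
  have h2 : ∀ c : ℝ, ∀ᵐ p : ℝ × ℝ, p.2 ≠ c := fun c => by
    rw [Measure.volume_eq_prod]
    exact (Measure.quasiMeasurePreserving_snd (μ := volume) (ν := volume)).ae
      (Measure.ae_ne volume c)
  filter_upwards [h1 y.re, h1 (y.re + 1), h2 y.im] with p a b c using ⟨a, b, c⟩

theorem glue_kernel_bound {w h B : ℝ} (hw' : w < 1 / 4) (hB : 0 ≤ B) {μ : ℂ → ℂ}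
    (hμ : ∀ t ∈ Rect w h, ‖μ t‖ ≤ B * expWeight h t.im) {y : ℂ} (hy : y ∈ WideRect w h) :
    ∀ᵐ p ∂(volume.restrict (coordRect w h)),
      ‖μ (pt p) * cotPi (pt p - y)‖ ≤ B * glueDom h y p := by
  filter_upwards [glue_ae_ne y (coordRect w h), ae_restrict_mem (measurableSet_coordRect w h)]
    with p ⟨h0, h1, h2⟩ hp
  have k := norm_cotPi_le_glueDom hw' hy hp h0 h1 h2
  have m := hμ _ (pt_mem_Rect.2 hp)
  rw [pt_im] at m
  rw [norm_mul]
  calc _ ≤ B * expWeight h p.2 * ‖cotPi (pt p - y)‖ :=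
        mul_le_mul_of_nonneg_right m (norm_nonneg _)
    _ = B * (expWeight h p.2 * ‖cotPi (pt p - y)‖) := by ring
    _ ≤ _ := mul_le_mul_of_nonneg_left k hB

theorem norm_glueT_le {w h B : ℝ} (hw : 0 < w) (hw' : w < 1 / 4) (hh : 0 < h) (hB : 0 ≤ B)
    {μ : ℂ → ℂ} (hμ : ∀ t ∈ Rect w h, ‖μ t‖ ≤ B * expWeight h t.im) {y : ℂ}
    (hy : y ∈ WideRect w h) : ‖glueT w h μ y‖ ≤ glueConst w * B := by
  obtain ⟨hi, hI⟩ := integrableOn_glueDom hw hh y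
  have h1 : ‖∫ p in coordRect w h, μ (pt p) * cotPi (pt p - y)‖
      ≤ ∫ p in coordRect w h, B * glueDom h y p :=
    norm_integral_le_of_norm_le (hi.const_mul B) (glue_kernel_bound hw' hB hμ hy)
  rw [integral_const_mul] at h1
  have hcut : ∀ (a : ℝ) (z : ℂ), z.im = y.im → (z.re < w) → (glueCut w a ≠ 0 → -w < z.re) →
      ‖(glueCut w a : ℂ) * μ z‖ ≤ B := by
    intro a z hz hz1 hz2
    rcases eq_or_ne (glueCut w a) 0 with h0 | h0
    · simpa [h0] using hB
    · have hzR : z ∈ Rect w h := ⟨abs_lt.2 ⟨hz2 h0, hz1⟩, hz ▸ hy.2.2⟩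
      rw [norm_mul, Complex.norm_real, Real.norm_of_nonneg (glueCut_nonneg _ _)]
      have m := hμ z hzR
      have := expWeight_le_one hzR.2
      have := mul_le_of_le_one_right hB this
      calc _ ≤ 1 * ‖μ z‖ := mul_le_mul_of_nonneg_right (glueCut_le_one _ _) (norm_nonneg _)
        _ ≤ B := by linarith
  have h2 := hcut y.re y rfl hy.2.1 fun h0 => by
    by_contra hc; exact h0 (glueCut_eq_zero hw (not_lt.1 hc))
  have h3 : ‖(glueCut w (-(y.re + 1)) : ℂ) * μ (y + 1)‖ ≤ B := by
    rcases eq_or_ne (glueCut w (-(y.re + 1))) 0 with h0 | h0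
    · rw [h0]; simpa using hB
    · have : y.re + 1 < w := by
        by_contra hc; exact h0 (glueCut_eq_zero hw (by linarith [not_lt.1 hc]))
      refine hcut _ _ (by simp) (by simpa using this) fun _ => ?_
      have := hy.1
      simp; linarith
  have h4 : ‖((1 / (4 * w) : ℝ) : ℂ) * ∫ p in coordRect w h, μ (pt p) * cotPi (pt p - y)‖
      ≤ 1 / (4 * w) * (B * (2 * w + (4 * w + 2 * ∫ x, sqrtSing x) * (1 + ∫ x, sqrtSing x))) := by
    rw [norm_mul, Complex.norm_real, Real.norm_of_nonneg (by positivity)]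
    exact mul_le_mul_of_nonneg_left (h1.trans (mul_le_mul_of_nonneg_left hI hB)) (by positivity)
  have h5 : glueConst w * B = 1 / (4 * w) *
      (B * (2 * w + (4 * w + 2 * ∫ x, sqrtSing x) * (1 + ∫ x, sqrtSing x))) + B + B := by
    unfold glueConst; ring
  rw [h5]
  exact (norm_sub_le _ _).trans (add_le_add ((norm_add_le _ _).trans (add_le_add h4 h2)) h3)

theorem aestronglyMeasurable_glue {w h : ℝ} {μ : ℂ → ℂ} (hμ : ContinuousOn μ (Rect w h)) (y : ℂ) :
    AEStronglyMeasurable (fun p => μ (pt p) * cotPi (pt p - y))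
      (volume.restrict (coordRect w h)) := by
  refine AEStronglyMeasurable.mul ?_ ?_
  · refine ContinuousOn.aestronglyMeasurable (hμ.comp continuous_pt.continuousOn
      fun p hp => pt_mem_Rect.2 hp) (measurableSet_coordRect w h)
  · exact (measurable_cotPi.comp (continuous_pt.measurable.sub_const y)).aestronglyMeasurable

theorem integrableOn_glue {w h B : ℝ} (hw : 0 < w) (hw' : w < 1 / 4) (hh : 0 < h) (hB : 0 ≤ B)
    {μ : ℂ → ℂ} (hμ : ∀ t ∈ Rect w h, ‖μ t‖ ≤ B * expWeight h t.im)
    (hμc : ContinuousOn μ (Rect w h)) {y : ℂ} (hy : y ∈ WideRect w h) :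
    IntegrableOn (fun p => μ (pt p) * cotPi (pt p - y)) (coordRect w h) :=
  ((integrableOn_glueDom hw hh y).1.const_mul B).mono' (aestronglyMeasurable_glue hμc y)
    (glue_kernel_bound hw' hB hμ hy)

theorem cotPi_conj (z : ℂ) : cotPi (starRingEnd ℂ z) = starRingEnd ℂ (cotPi z) := by
  simp only [cotPi, map_div₀, ← Complex.cos_conj, ← Complex.sin_conj, map_mul, Complex.conj_ofReal]

open ComplexConjugate in
theorem glueT_conj {w h : ℝ} {μ : ℂ → ℂ} (hμ : ∀ t, μ (conj t) = conj (μ t)) (y : ℂ) :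
    glueT w h μ (conj y) = conj (glueT w h μ y) := by
  have hmp : MeasurePreserving (fun p : ℝ × ℝ => (p.1, -p.2)) volume volume := by
    rw [Measure.volume_eq_prod]
    exact (MeasurePreserving.id volume).prod (Measure.measurePreserving_neg volume)
  have key : ∫ p in coordRect w h, μ (pt p) * cotPi (pt p - conj y)
      = conj (∫ p in coordRect w h, μ (pt p) * cotPi (pt p - y)) := by
    rw [← integral_conj]
    have he : MeasurableEmbedding (fun p : ℝ × ℝ => (p.1, -p.2)) :=
      ((MeasurableEquiv.refl ℝ).prodCongr (MeasurableEquiv.neg ℝ)).measurableEmbedding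
    have := hmp.setIntegral_preimage_emb he
      (fun p => μ (pt p) * cotPi (pt p - conj y)) (coordRect w h)
    rw [← this]
    have hpre : (fun p : ℝ × ℝ => (p.1, -p.2)) ⁻¹' coordRect w h = coordRect w h := by
      ext p
      simp only [coordRect, Set.mem_preimage, Set.mem_prod, Set.mem_Ioo]
      constructor <;> rintro ⟨a, b, c⟩ <;> exact ⟨a, by linarith, by linarith⟩
    rw [hpre]
    refine integral_congr_ae (Filter.Eventually.of_forall fun p => ?_)
    have : pt (p.1, -p.2) = conj (pt p) := by simp [pt]
    simp only [this]
    rw [hμ, ← map_sub, cotPi_conj, map_mul]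
  have h1 : μ (conj y + 1) = conj (μ (y + 1)) := by rw [← hμ]; simp
  unfold glueT
  rw [key, h1, hμ, map_sub, map_add, map_mul, map_mul, map_mul]
  simp only [Complex.conj_ofReal, Complex.conj_re]

open Complex in
theorem rect_integral_cotPi_eq_zero {a b c d : ℝ} {p : ℂ} (hab : a ≤ b) (hcd : c ≤ d)
    (ha : 0 < a - p.re) (hb : b - p.re < 1) {F : ℂ → ℂ}
    (hF : DifferentiableOn ℂ F (Set.Icc a b ×ℂ Set.Icc c d)) :
    (∫ x : ℝ in a..b, F (x + c * I) * cotPi ((x : ℂ) + c * I - p))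
      - (∫ x : ℝ in a..b, F (x + d * I) * cotPi ((x : ℂ) + d * I - p))
      + I * (∫ y : ℝ in c..d, F (b + y * I) * cotPi ((b : ℂ) + y * I - p))
      - I * (∫ y : ℝ in c..d, F (a + y * I) * cotPi ((a : ℂ) + y * I - p)) = 0 := by
  have := integral_boundary_rect_eq_zero_of_differentiableOn (fun t => F t * cotPi (t - p))
    ⟨a, c⟩ ⟨b, d⟩ ?_
  · simpa only [smul_eq_mul] using this
  · simp only [Set.uIcc_of_le hab, Set.uIcc_of_le hcd]
    refine hF.mul fun t ht => DifferentiableAt.differentiableWithinAt ?_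
    have h1 : a ≤ t.re := ht.1.1
    have h2 : t.re ≤ b := ht.1.2
    have : DifferentiableAt ℂ cotPi (t - p) := differentiableAt_cotPi
      (sin_pi_ne_zero_of_re (by rw [sub_re, abs_pos]; linarith)
        (by rw [sub_re, abs_lt]; constructor <;> linarith))
    exact this.comp (f := fun t => t - p) t (by fun_prop)

/-- The vertical slice integral. -/
noncomputable def sliceInt (μ : ℂ → ℂ) (h' : ℝ) (y : ℂ) (σ : ℝ) : ℂ :=
  ∫ η : ℝ in (-h')..h', μ (σ + η * Complex.I) * cotPi ((σ : ℂ) + η * Complex.I - y)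

/-- The horizontal edge integral. -/
noncomputable def edgeInt (μ : ℂ → ℂ) (e : ℝ) (y : ℂ) (σ σ₁ : ℝ) : ℂ :=
  ∫ x : ℝ in σ..σ₁, μ (x + e * Complex.I) * cotPi ((x : ℂ) + e * Complex.I - y)

theorem sliceInt_jump {w h h' σ₁ σ : ℝ} (hw' : w < 1 / 4) (hh : h' < h)
    {μ : ℂ → ℂ} (hμ : DifferentiableOn ℂ μ (Rect w h)) {y : ℂ} (hb : |y.im| < h')
    (h1 : |σ₁| < w) (h2 : y.re < σ₁) (h3 : σ₁ < y.re + 1) (h4 : |σ| < w) (h5 : σ ≠ y.re)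
    (h6 : σ ≠ y.re + 1) :
    sliceInt μ h' y σ + 2 * (if σ < y.re then μ y else 0)
      - 2 * (if y.re + 1 < σ then μ (y + 1) else 0)
      = sliceInt μ h' y σ₁
        - Complex.I * (edgeInt μ (-h') y σ σ₁ - edgeInt μ h' y σ σ₁) := by
  obtain ⟨b1, b2⟩ := abs_lt.1 hb
  obtain ⟨s1, s2⟩ := abs_lt.1 h1
  obtain ⟨s3, s4⟩ := abs_lt.1 h4
  have hI := Complex.I_mul_I
  have hsub : ∀ a b, -w < a → b < w → DifferentiableOn ℂ μ (Set.Icc a b ×ℂ Set.Icc (-h') h') := by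
    intro a b ha hb
    refine hμ.mono fun t ht => ?_
    have := ht.1; have := ht.2
    simp only [Set.mem_preimage, Set.mem_Icc] at *
    exact ⟨abs_lt.2 ⟨by linarith, by linarith⟩, abs_lt.2 ⟨by linarith, by linarith⟩⟩
  rcases le_or_gt σ σ₁ with hσ | hσ
  · rw [if_neg (by linarith : ¬ y.re + 1 < σ)]
    rcases lt_or_gt_of_ne h5 with h7 | h7
    · rw [if_pos h7]
      have key := rect_integral_cotPi h7 h2 b1 b2 (by linarith) (hsub _ _ s3 s2)
      have key' : edgeInt μ (-h') y σ σ₁ - edgeInt μ h' y σ σ₁ + Complex.I * sliceInt μ h' y σ₁ - Complex.I * sliceInt μ h' y σ = 2 * Complex.I * μ y := key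
      linear_combination Complex.I * key' + (sliceInt μ h' y σ + 2 * μ y - sliceInt μ h' y σ₁) * hI
    · rw [if_neg (by linarith : ¬ σ < y.re)]
      have key := rect_integral_cotPi_eq_zero (p := y) hσ (by linarith : -h' ≤ h') (by linarith)
        (by linarith) (hsub _ _ s3 s2)
      have key' : edgeInt μ (-h') y σ σ₁ - edgeInt μ h' y σ σ₁ + Complex.I * sliceInt μ h' y σ₁ - Complex.I * sliceInt μ h' y σ = 0 := key
      linear_combination Complex.I * key' + (sliceInt μ h' y σ - sliceInt μ h' y σ₁) * hI
  · rw [if_neg (by linarith : ¬ σ < y.re)]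
    have hsymm : ∀ e, edgeInt μ e y σ σ₁ = - edgeInt μ e y σ₁ σ := fun e =>
      intervalIntegral.integral_symm _ _
    rw [hsymm, hsymm]
    rcases lt_or_gt_of_ne h6 with h7 | h7
    · rw [if_neg (by linarith : ¬ y.re + 1 < σ)]
      have key := rect_integral_cotPi_eq_zero (p := y) hσ.le (by linarith : -h' ≤ h') (by linarith)
        (by linarith) (hsub _ _ s1 s4)
      have key' : edgeInt μ (-h') y σ₁ σ - edgeInt μ h' y σ₁ σ + Complex.I * sliceInt μ h' y σ - Complex.I * sliceInt μ h' y σ₁ = 0 := key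
      linear_combination (-Complex.I) * key' + (sliceInt μ h' y σ - sliceInt μ h' y σ₁) * hI
    · rw [if_pos h7]
      have key := rect_integral_cotPi (p := y + 1) (by simpa using h3) (by simpa using h7)
        (by simpa using b1) (by simpa using b2) (by linarith) (hsub _ _ s1 s4)
      simp only [← sub_sub, cotPi_sub_one] at key
      have key' : edgeInt μ (-h') y σ₁ σ - edgeInt μ h' y σ₁ σ + Complex.I * sliceInt μ h' y σ - Complex.I * sliceInt μ h' y σ₁ = 2 * Complex.I * μ (y + 1) := key
      linear_combination (-Complex.I) * key' + (sliceInt μ h' y σ - sliceInt μ h' y σ₁ - 2 * μ (y + 1)) * hI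

/-- Holomorphic dependence on a parameter of the integral of `g * cotPi (γ - y)`. -/
theorem differentiableOn_integral_cotPi {g γ : ℝ → ℂ} {c d M K : ℝ} {N : Set ℂ} (hN : IsOpen N)
    (hg : ContinuousOn g (Set.uIcc c d)) (hγ : Continuous γ) (hM : ∀ x ∈ Set.uIcc c d, ‖g x‖ ≤ M)
    (hK : ∀ x ∈ Set.uIcc c d, ∀ y ∈ N,
      Complex.sin (Real.pi * (γ x - y)) ≠ 0 ∧ ‖cotPi (γ x - y)‖ ≤ K) :
    DifferentiableOn ℂ (fun y => ∫ x in c..d, g x * cotPi (γ x - y)) N := by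
  simp only [intervalIntegral.intervalIntegral_eq_integral_uIoc]
  refine DifferentiableOn.const_smul (c := (if c ≤ d then (1:ℝ) else -1)) ?_
  refine differentiableOn_integral_of_dominated hN ?_ ?_
  · intro z hz
    refine ((hg.mono Set.uIoc_subset_uIcc).aestronglyMeasurable measurableSet_uIoc).mul ?_
    exact (measurable_cotPi.comp (hγ.measurable.sub_const z)).aestronglyMeasurable
  · intro z₀ hz₀
    obtain ⟨r, hr, hrN⟩ := Metric.isOpen_iff.1 hN z₀ hz₀
    refine ⟨r, hr, fun _ => M * K, ?_, ?_⟩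
    · exact (intervalIntegrable_const (μ := volume) (a := c) (b := d)).def'
    · filter_upwards [ae_restrict_mem measurableSet_uIoc] with x hx
      have hx := Set.uIoc_subset_uIcc hx
      refine ⟨fun z hz => DifferentiableAt.differentiableWithinAt ?_, fun z hz => ?_⟩
      · have : DifferentiableAt ℂ cotPi (γ x - z) := differentiableAt_cotPi (hK x hx z (hrN hz)).1
        exact (this.comp (f := fun z => γ x - z) z (by fun_prop)).const_mul (g x)
      · rw [norm_mul]
        exact mul_le_mul (hM x hx) (hK x hx z (hrN hz)).2 (norm_nonneg _)
          ((norm_nonneg _).trans (hM x hx))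

theorem integral_ite_lt_cut {w a : ℝ} (hw : 0 < w) (c : ℂ) :
    ∫ σ in Set.Ioo (-w) w, (if σ < a then c else 0) = (2 * w * glueCut w a : ℝ) * c := by
  have h1 : (fun σ => if σ < a then c else 0) = (Set.Iio a).indicator fun _ => c := by
    ext σ; simp [Set.indicator]
  rw [h1, setIntegral_indicator measurableSet_Iio, setIntegral_const, Complex.real_smul]
  congr 2
  rw [← Set.Ioi_inter_Iio, Set.inter_assoc, Set.Iio_inter_Iio, Set.Ioi_inter_Iio, measureReal_def,
    Real.volume_Ioo, glueCut]
  rcases le_total a (-w) with h | h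
  · rw [ENNReal.ofReal_of_nonpos (by have := min_le_right w a; linarith)]
    have : (a + w) / (2 * w) ≤ 0 := div_nonpos_of_nonpos_of_nonneg (by linarith) (by linarith)
    rw [max_eq_left ((min_le_right _ _).trans this)]; simp
  · rw [ENNReal.toReal_ofReal (by have := le_min (by linarith : -w ≤ w) h; linarith),
      max_eq_right (le_min zero_le_one (div_nonneg (by linarith) (by linarith)))]
    rcases le_total a w with h' | h'
    · rw [min_eq_right h', min_eq_right (by rw [div_le_one (by linarith)]; linarith)]
      field_simp; ring
    · rw [min_eq_left h', min_eq_left (by rw [le_div_iff₀ (by linarith)]; linarith)]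
      ring

theorem integral_ite_gt_cut {w a : ℝ} (hw : 0 < w) (c : ℂ) :
    ∫ σ in Set.Ioo (-w) w, (if a < σ then c else 0) = (2 * w * glueCut w (-a) : ℝ) * c := by
  rw [← integral_ite_lt_cut hw, ← integral_Ioc_eq_integral_Ioo, ← integral_Ioc_eq_integral_Ioo,
    ← intervalIntegral.integral_of_le (by linarith),
    ← intervalIntegral.integral_of_le (by linarith)]
  have := intervalIntegral.integral_comp_neg (a := -w) (b := w) fun x => if x < -a then c else 0
  rw [neg_neg] at this
  rw [← this]
  simp only [neg_lt_neg_iff]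

theorem sliceInt_integrable {w h h' B : ℝ} (hw : 0 < w) (hw' : w < 1 / 4) (hh : 0 < h) (hB : 0 ≤ B)
    (h0 : 0 < h') (hh' : h' < h)
    {μ : ℂ → ℂ} (hμ : ∀ t ∈ Rect w h, ‖μ t‖ ≤ B * expWeight h t.im)
    (hμc : ContinuousOn μ (Rect w h)) {y : ℂ} (hy : y ∈ WideRect w h) :
    IntegrableOn (sliceInt μ h' y) (Set.Ioo (-w) w) ∧
    ∫ p in coordRect w h, μ (pt p) * cotPi (pt p - y) =
      (∫ p in coordRect w h ∩ {p | h' < |p.2|}, μ (pt p) * cotPi (pt p - y)) +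
      ∫ σ in Set.Ioo (-w) w, sliceInt μ h' y σ := by
  have hi := integrableOn_glue hw hw' hh hB hμ hμc hy
  have hmeas : MeasurableSet {p : ℝ × ℝ | h' < |p.2|} :=
    measurableSet_lt measurable_const (measurable_snd.abs)
  have hset : coordRect w h \ {p | h' < |p.2|} = Set.Ioo (-w) w ×ˢ Set.Icc (-h') h' := by
    ext p
    simp only [coordRect, Set.mem_diff, Set.mem_prod, Set.mem_Ioo, Set.mem_setOf_eq, not_lt,
      abs_le, Set.mem_Icc]
    constructor
    · rintro ⟨⟨a, b⟩, c⟩; exact ⟨a, c⟩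
    · rintro ⟨a, c⟩; exact ⟨⟨a, by linarith [c.1], by linarith [c.2]⟩, c⟩
  have hi2 := hi.mono_set (Set.diff_subset (s := coordRect w h) (t := {p | h' < |p.2|}))
  rw [hset] at hi2
  have e : ∀ σ, ∫ η in Set.Icc (-h') h', μ (pt (σ, η)) * cotPi (pt (σ, η) - y)
      = sliceInt μ h' y σ := fun σ => by
    rw [sliceInt, intervalIntegral.integral_of_le (by linarith), integral_Icc_eq_integral_Ioc]
    rfl
  constructor
  · rw [IntegrableOn, Measure.volume_eq_prod, ← Measure.prod_restrict] at hi2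
    have := hi2.integral_prod_left
    simp only [e] at this
    exact this
  · rw [← integral_inter_add_diff hmeas hi, hset, Measure.volume_eq_prod,
      setIntegral_prod _ (by rw [← Measure.volume_eq_prod]; exact hi2)]
    simp only [e]

theorem glueT_eq_local {w h h' B σ₁ : ℝ} (hw : 0 < w) (hw' : w < 1 / 4) (hh : 0 < h) (hB : 0 ≤ B)
    (hh' : h' < h) {μ : ℂ → ℂ} (hμ : ∀ t ∈ Rect w h, ‖μ t‖ ≤ B * expWeight h t.im)
    (hμd : DifferentiableOn ℂ μ (Rect w h)) {y : ℂ} (hy : y ∈ WideRect w h) (hb : |y.im| < h')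
    (h1 : |σ₁| < w) (h2 : y.re < σ₁) (h3 : σ₁ < y.re + 1) :
    AEStronglyMeasurable (fun σ => sliceInt μ h' y σ₁
        - Complex.I * (edgeInt μ (-h') y σ σ₁ - edgeInt μ h' y σ σ₁))
        (volume.restrict (Set.Ioo (-w) w)) ∧
    glueT w h μ y = (1 / (4 * w) : ℝ) *
      ((∫ p in coordRect w h ∩ {p | h' < |p.2|}, μ (pt p) * cotPi (pt p - y)) +
      ∫ σ in Set.Ioo (-w) w, (sliceInt μ h' y σ₁
        - Complex.I * (edgeInt μ (-h') y σ σ₁ - edgeInt μ h' y σ σ₁))) := by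
  obtain ⟨hs1, hs2⟩ := sliceInt_integrable hw hw' hh hB ((abs_nonneg _).trans_lt hb) hh' hμ
    hμd.continuousOn hy
  have hae : (fun σ => sliceInt μ h' y σ + 2 * (if σ < y.re then μ y else 0)
      - 2 * (if y.re + 1 < σ then μ (y + 1) else 0)) =ᵐ[volume.restrict (Set.Ioo (-w) w)]
      fun σ => sliceInt μ h' y σ₁
        - Complex.I * (edgeInt μ (-h') y σ σ₁ - edgeInt μ h' y σ σ₁) := by
    filter_upwards [ae_restrict_mem measurableSet_Ioo, ae_restrict_of_ae (Measure.ae_ne volume y.re),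
      ae_restrict_of_ae (Measure.ae_ne volume (y.re + 1))] with σ a b c
    exact sliceInt_jump hw' hh' hμd hb h1 h2 h3 (abs_lt.2 a) b c
  have i1 : IntegrableOn (fun σ => 2 * (if σ < y.re then μ y else 0)) (Set.Ioo (-w) w) := by
    refine Integrable.const_mul (Integrable.mono' (g := fun _ => ‖μ y‖) (by simp)
      (Measurable.ite measurableSet_Iio measurable_const measurable_const).aestronglyMeasurable
      (Filter.Eventually.of_forall fun σ => ?_)) _
    split_ifs <;> simp
  have i2 : IntegrableOn (fun σ => 2 * (if y.re + 1 < σ then μ (y + 1) else 0))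
      (Set.Ioo (-w) w) := by
    refine Integrable.const_mul (Integrable.mono' (g := fun _ => ‖μ (y + 1)‖) (by simp)
      (Measurable.ite measurableSet_Ioi measurable_const measurable_const).aestronglyMeasurable
      (Filter.Eventually.of_forall fun σ => ?_)) _
    split_ifs <;> simp
  refine ⟨((hs1.add i1).sub i2).aestronglyMeasurable.congr hae, ?_⟩
  rw [← integral_congr_ae hae, integral_sub (f := fun σ => sliceInt μ h' y σ + 2 * (if σ < y.re then μ y else 0))
      (hs1.add i1) i2, integral_add hs1 i1,
    integral_const_mul, integral_const_mul, integral_ite_lt_cut hw, integral_ite_gt_cut hw, glueT,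
    hs2]
  have : (w : ℂ) ≠ 0 := Complex.ofReal_ne_zero.2 hw.ne'
  push_cast
  field_simp
  ring

theorem differentiableOn_glueT {w h B : ℝ} (hw : 0 < w) (hw' : w < 1 / 4) (hh : 0 < h) (hB : 0 ≤ B)
    {μ : ℂ → ℂ} (hμ : ∀ t ∈ Rect w h, ‖μ t‖ ≤ B * expWeight h t.im)
    (hμd : DifferentiableOn ℂ μ (Rect w h)) : DifferentiableOn ℂ (glueT w h μ) (WideRect w h) := by
  intro y₀ hy₀
  obtain ⟨a1, a2, a3⟩ := id hy₀
  have hM : ∀ t ∈ Rect w h, ‖μ t‖ ≤ B := fun t ht =>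
    (hμ t ht).trans (mul_le_of_le_one_right hB (expWeight_le_one ht.2))
  obtain ⟨h', hb', hh'⟩ := exists_between a3
  have h0 : 0 < h' := (abs_nonneg _).trans_lt hb'
  obtain ⟨σ₁, s1, s2⟩ := exists_between
    (max_lt (lt_min (by linarith) (by linarith)) (lt_min a2 (by linarith)) :
      max (-w) y₀.re < min w (y₀.re + 1))
  obtain ⟨s1, s1'⟩ := max_lt_iff.1 s1
  obtain ⟨s2, s2'⟩ := lt_min_iff.1 s2
  have hσ₁ : |σ₁| < w := abs_lt.2 ⟨s1, s2⟩
  obtain ⟨m, hm0, hm1, hm2, hm3⟩ : ∃ m > 0, 2 * m < σ₁ - y₀.re ∧ 2 * m < y₀.re + 1 - σ₁ ∧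
      2 * m < h' - |y₀.im| := by
    obtain ⟨m, hm, hm'⟩ := exists_between (lt_min (sub_pos.2 s1')
      (lt_min (sub_pos.2 s2') (sub_pos.2 hb')))
    simp only [lt_min_iff] at hm'
    exact ⟨m / 2, by linarith, by linarith, by linarith, by linarith⟩
  set N := Metric.ball y₀ m ∩ WideRect w h with hN
  have hNo : IsOpen N := Metric.isOpen_ball.inter (isOpen_WideRect w h)
  have hNre : ∀ y ∈ N, m ≤ σ₁ - y.re ∧ σ₁ - y.re ≤ 1 - m := fun y hy => by
    have := (Complex.abs_re_le_norm (y - y₀)).trans_lt (mem_ball_iff_norm.1 hy.1)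
    rw [Complex.sub_re, abs_lt] at this
    constructor <;> linarith
  have hNim : ∀ y ∈ N, |y.im| ≤ h' - m := fun y hy => by
    have := (Complex.abs_im_le_norm (y - y₀)).trans_lt (mem_ball_iff_norm.1 hy.1)
    rw [Complex.sub_im] at this
    have := abs_sub_abs_le_abs_sub y.im y₀.im
    linarith
  have hloc : ∀ y ∈ N, _ := fun y hy => glueT_eq_local hw hw' hh hB hh' hμ hμd hy.2
    (by linarith [hNim y hy]) hσ₁ (by linarith [hNre y hy]) (by linarith [hNre y hy])
  have hJ : DifferentiableOn ℂ (fun y => sliceInt μ h' y σ₁) N := by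
    refine differentiableOn_integral_cotPi (γ := fun η => (σ₁ : ℂ) + η * Complex.I) (M := B)
      (K := 1 + m⁻¹) hNo ?_ (by fun_prop) ?_ ?_
    · refine hμd.continuousOn.comp (by fun_prop) fun η hη => ?_
      rw [Set.uIcc_of_le (by linarith)] at hη
      exact ⟨by simpa using hσ₁, by simpa using (abs_le.2 hη).trans_lt hh'⟩
    · intro η hη
      rw [Set.uIcc_of_le (by linarith)] at hη
      exact hM _ ⟨by simpa using hσ₁, by simpa using (abs_le.2 hη).trans_lt hh'⟩
    · intro η _ y hy
      obtain ⟨k1, k2⟩ := hNre y hy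
      have hre : ((σ₁ : ℂ) + η * Complex.I - y).re = σ₁ - y.re := by simp
      refine ⟨sin_pi_ne_zero_of_re ?_ ?_, norm_cotPi_le_of_re hm0 ?_ ?_⟩ <;> rw [hre]
      · rw [abs_pos]; linarith
      · rw [abs_lt]; constructor <;> linarith
      · exact k1
      · exact k2
  have hedgeK : ∀ e, |e| = h' → ∀ x : ℝ, ∀ y ∈ N,
      Complex.sin (Real.pi * ((x : ℂ) + e * Complex.I - y)) ≠ 0 ∧
        ‖cotPi ((x : ℂ) + e * Complex.I - y)‖ ≤ 1 + m⁻¹ := by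
    intro e he x y hy
    have him : ((x : ℂ) + e * Complex.I - y).im = e - y.im := by simp
    have h1 : m ≤ |e - y.im| := by
      have := abs_sub_abs_le_abs_sub e y.im
      have := hNim y hy
      linarith
    refine ⟨sin_pi_ne_zero_of_im ?_, norm_cotPi_le_of_im hm0 ?_⟩ <;> rw [him]
    · exact abs_pos.1 (hm0.trans_le h1)
    · exact h1
  have hedgeR : ∀ e, |e| = h' → ∀ σ ∈ Set.Ioo (-w) w, ∀ x ∈ Set.uIcc σ σ₁,
      (x : ℂ) + e * Complex.I ∈ Rect w h := by
    intro e he σ hσ x hx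
    have := Set.uIcc_subset_Icc (Set.Ioo_subset_Icc_self hσ) (abs_le.1 hσ₁.le) hx
    have hx' : |x| < w := by
      have h3 : x ∈ Set.Ioo (-w) w := (Set.ordConnected_Ioo.uIcc_subset hσ (abs_lt.1 hσ₁)) hx
      exact abs_lt.2 h3
    exact ⟨by simpa using hx', by simpa [he] using hh'⟩
  have hE : ∀ e, |e| = h' → ∀ σ ∈ Set.Ioo (-w) w, DifferentiableOn ℂ
      (fun y => edgeInt μ e y σ σ₁) N := fun e he σ hσ => by
    refine differentiableOn_integral_cotPi (γ := fun x => (x : ℂ) + e * Complex.I) (M := B)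
      (K := 1 + m⁻¹) hNo ?_ (by fun_prop) ?_ (fun x _ y hy => hedgeK e he x y hy)
    · exact hμd.continuousOn.comp (by fun_prop) fun x hx => hedgeR e he σ hσ x hx
    · exact fun x hx => hM _ (hedgeR e he σ hσ x hx)
  have hEb : ∀ e, |e| = h' → ∀ σ ∈ Set.Ioo (-w) w, ∀ y ∈ N,
      ‖edgeInt μ e y σ σ₁‖ ≤ B * (1 + m⁻¹) * (2 * w) := fun e he σ hσ y hy => by
    refine (intervalIntegral.norm_integral_le_of_norm_le_const (C := B * (1 + m⁻¹))
      fun x hx => ?_).trans (mul_le_mul_of_nonneg_left ?_ (by positivity))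
    · rw [norm_mul]
      exact mul_le_mul (hM _ (hedgeR e he σ hσ x (Set.uIoc_subset_uIcc hx)))
        (hedgeK e he x y hy).2 (norm_nonneg _) hB
    · rw [abs_le]; constructor <;> linarith [hσ.1, hσ.2]
  have hJb : ∀ y ∈ N, ‖sliceInt μ h' y σ₁‖ ≤ B * (1 + m⁻¹) * (2 * h') := fun y hy => by
    refine (intervalIntegral.norm_integral_le_of_norm_le_const (C := B * (1 + m⁻¹))
      fun η hη => ?_).trans (mul_le_mul_of_nonneg_left ?_ (by positivity))
    · rw [Set.uIoc_of_le (by linarith)] at hη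
      rw [norm_mul]
      refine mul_le_mul (hM _ ⟨by simpa using hσ₁,
        by simpa using (abs_le.2 ⟨hη.1.le, hη.2⟩).trans_lt hh'⟩)
        (norm_cotPi_le_of_re hm0 ?_ ?_) (norm_nonneg _) hB
      · simpa using (hNre y hy).1
      · simpa using (hNre y hy).2
    · rw [abs_of_pos (by linarith)]; linarith
  have key : DifferentiableOn ℂ (glueT w h μ) N := by
    refine DifferentiableOn.congr (DifferentiableOn.const_mul (DifferentiableOn.add ?_ ?_) _)
      fun y hy => (hloc y hy).2
    · have hms : MeasurableSet (coordRect w h ∩ {p | h' < |p.2|}) :=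
        (measurableSet_coordRect w h).inter
          (measurableSet_lt measurable_const (measurable_snd.abs))
      refine differentiableOn_integral_of_dominated hNo ?_ ?_
      · intro y _
        exact (aestronglyMeasurable_glue hμd.continuousOn y).mono_measure
          (Measure.restrict_mono Set.inter_subset_left le_rfl)
      · intro z hz
        obtain ⟨r, hr, hrN⟩ := Metric.isOpen_iff.1 hNo z hz
        have hk : ∀ p ∈ coordRect w h ∩ {p | h' < |p.2|}, ∀ y ∈ N, m ≤ |(pt p - y).im| := by
          intro p hp y hy
          rw [Complex.sub_im, pt_im]
          have h1 : h' < |p.2| := hp.2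
          have := abs_sub_abs_le_abs_sub p.2 y.im
          have := hNim y hy
          linarith
        refine ⟨r, hr, fun _ => B * (1 + m⁻¹), ?_, ?_⟩
        · have hfin : volume (coordRect w h ∩ {p | h' < |p.2|}) ≠ ⊤ := by
            refine measure_ne_top_of_subset Set.inter_subset_left ?_
            rw [coordRect, Measure.volume_eq_prod, Measure.prod_prod, Real.volume_Ioo,
              Real.volume_Ioo]
            exact ENNReal.mul_ne_top ENNReal.ofReal_ne_top ENNReal.ofReal_ne_top
          exact integrableOn_const hfin
        · filter_upwards [ae_restrict_mem hms] with p hp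
          refine ⟨fun y hy => DifferentiableAt.differentiableWithinAt ?_, fun y hy => ?_⟩
          · have : DifferentiableAt ℂ cotPi (pt p - y) := differentiableAt_cotPi
              (sin_pi_ne_zero_of_im (abs_pos.1 (hm0.trans_le (hk p hp y (hrN hy)))))
            exact (this.comp (f := fun y => pt p - y) y (by fun_prop)).const_mul _
          · rw [norm_mul]
            exact mul_le_mul (hM _ (pt_mem_Rect.2 hp.1))
              (norm_cotPi_le_of_im hm0 (hk p hp y (hrN hy))) (norm_nonneg _) hB
    · refine differentiableOn_integral_of_dominated hNo (fun y hy => (hloc y hy).1) ?_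
      intro z hz
      obtain ⟨r, hr, hrN⟩ := Metric.isOpen_iff.1 hNo z hz
      refine ⟨r, hr, fun _ => B * (1 + m⁻¹) * (2 * h') +
        (B * (1 + m⁻¹) * (2 * w) + B * (1 + m⁻¹) * (2 * w)), by simp, ?_⟩
      have e1 : |(-h')| = h' := by rw [abs_neg, abs_of_pos h0]
      have e2 : |h'| = h' := abs_of_pos h0
      filter_upwards [ae_restrict_mem measurableSet_Ioo] with σ hσ
      refine ⟨(hJ.sub (((hE _ e1 σ hσ).sub (hE _ e2 σ hσ)).const_mul _)).mono hrN,
        fun y hy => ?_⟩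
      refine (norm_sub_le _ _).trans (add_le_add (hJb y (hrN hy)) ?_)
      rw [norm_mul, Complex.norm_I, one_mul]
      exact (norm_sub_le _ _).trans (add_le_add (hEb _ e1 σ hσ y (hrN hy))
        (hEb _ e2 σ hσ y (hrN hy)))
  exact ((key y₀ ⟨Metric.mem_ball_self hm0, hy₀⟩).differentiableAt
    (hNo.mem_nhds ⟨Metric.mem_ball_self hm0, hy₀⟩)).differentiableWithinAt

theorem Rect_subset_WideRect {w h : ℝ} : Rect w h ⊆ WideRect w h := fun z hz => by
  obtain ⟨h1, h2⟩ := abs_lt.1 hz.1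
  exact ⟨by linarith, h2, hz.2⟩

theorem sub_one_mem_WideRect {w h : ℝ} (hw : w < 1 / 4) {y : ℂ} (hy : y ∈ Rect w h) :
    y - 1 ∈ WideRect w h := by
  obtain ⟨h1, h2⟩ := abs_lt.1 hy.1
  exact ⟨by simp; linarith, by simp; linarith, by simpa using hy.2⟩

theorem glueConst_nonneg {w : ℝ} (hw : 0 < w) : 0 ≤ glueConst w := by
  have : 0 ≤ ∫ x, sqrtSing x := integral_nonneg sqrtSing_nonneg
  unfold glueConst; positivity

/-- A nonlinear right-hand side for the gluing equation `n (y - 1) - n y = E y (n y)`. -/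
structure GlueAdm (w h δ L η : ℝ) (E : ℂ → ℂ → ℂ) : Prop where
  w_pos : 0 < w
  w_lt : w < 1 / 4
  h_pos : 0 < h
  δ_nonneg : 0 ≤ δ
  L_nonneg : 0 ≤ L
  contr : glueConst w * L ≤ 1 / 2
  small : glueConst w * δ ≤ η
  bound : ∀ y ∈ Rect w h, ∀ v, ‖v‖ ≤ η → ‖E y v‖ ≤ δ * expWeight h y.im
  lip : ∀ y ∈ Rect w h, ∀ v v', ‖v‖ ≤ η → ‖v'‖ ≤ η →
    ‖E y v - E y v'‖ ≤ L * ‖v - v'‖ * expWeight h y.im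
  diff : ∀ n : ℂ → ℂ, DifferentiableOn ℂ n (Rect w h) → (∀ y ∈ Rect w h, ‖n y‖ ≤ η) →
    DifferentiableOn ℂ (fun y => E y (n y)) (Rect w h)

/-- Picard iterates of the gluing equation. -/
noncomputable def glueIter (w h : ℝ) (E : ℂ → ℂ → ℂ) : ℕ → ℂ → ℂ
  | 0 => fun _ => 0
  | k + 1 => fun y => - glueT w h (fun t => E t (glueIter w h E k t)) y

/-- The solution of the gluing equation. -/
noncomputable def glueSol (w h : ℝ) (E : ℂ → ℂ → ℂ) (y : ℂ) : ℂ :=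
  limUnder atTop fun k => glueIter w h E k y

theorem glueT_sub_fun {w h B : ℝ} (hw : 0 < w) (hw' : w < 1 / 4) (hh : 0 < h) (hB : 0 ≤ B)
    {μ ν : ℂ → ℂ} (hμ : ∀ t ∈ Rect w h, ‖μ t‖ ≤ B * expWeight h t.im)
    (hν : ∀ t ∈ Rect w h, ‖ν t‖ ≤ B * expWeight h t.im)
    (hμc : ContinuousOn μ (Rect w h)) (hνc : ContinuousOn ν (Rect w h)) {y : ℂ}
    (hy : y ∈ WideRect w h) :
    glueT w h (fun t => μ t - ν t) y = glueT w h μ y - glueT w h ν y := by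
  simp only [glueT, sub_mul]
  rw [integral_sub (integrableOn_glue hw hw' hh hB hμ hμc hy)
    (integrableOn_glue hw hw' hh hB hν hνc hy)]
  ring

namespace GlueAdm
variable {w h δ L η : ℝ} {E : ℂ → ℂ → ℂ}

theorem iter (H : GlueAdm w h δ L η E) (k : ℕ) :
    DifferentiableOn ℂ (glueIter w h E k) (WideRect w h) ∧
    ∀ y ∈ WideRect w h, ‖glueIter w h E k y‖ ≤ glueConst w * δ := by
  induction k with
  | zero =>
    refine ⟨differentiableOn_const 0, fun y _ => ?_⟩
    simpa [glueIter] using mul_nonneg (glueConst_nonneg H.w_pos) H.δ_nonneg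
  | succ k ih =>
    have hb : ∀ y ∈ Rect w h, ‖E y (glueIter w h E k y)‖ ≤ δ * expWeight h y.im := fun y hy =>
      H.bound y hy _ ((ih.2 y (Rect_subset_WideRect hy)).trans H.small)
    have hd := H.diff _ (ih.1.mono Rect_subset_WideRect)
      fun y hy => (ih.2 y (Rect_subset_WideRect hy)).trans H.small
    refine ⟨(differentiableOn_glueT H.w_pos H.w_lt H.h_pos H.δ_nonneg hb hd).neg, fun y hy => ?_⟩
    simp only [glueIter, norm_neg]
    exact norm_glueT_le H.w_pos H.w_lt H.h_pos H.δ_nonneg hb hy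

theorem iter_small (H : GlueAdm w h δ L η E) (k : ℕ) {y : ℂ} (hy : y ∈ Rect w h) :
    ‖glueIter w h E k y‖ ≤ η :=
  ((H.iter k).2 y (Rect_subset_WideRect hy)).trans H.small

theorem rhs_diff (H : GlueAdm w h δ L η E) (k : ℕ) :
    DifferentiableOn ℂ (fun y => E y (glueIter w h E k y)) (Rect w h) :=
  H.diff _ ((H.iter k).1.mono Rect_subset_WideRect) fun _ hy => H.iter_small k hy

theorem iter_sub (H : GlueAdm w h δ L η E) (k : ℕ) : ∀ y ∈ WideRect w h,
    ‖glueIter w h E (k + 1) y - glueIter w h E k y‖ ≤ glueConst w * δ * (1 / 2) ^ k := by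
  have hC := mul_nonneg (glueConst_nonneg H.w_pos) H.δ_nonneg
  induction k with
  | zero =>
    intro y hy
    simpa [glueIter] using (H.iter 1).2 y hy
  | succ k ih =>
    intro y hy
    have hb : ∀ j, ∀ y ∈ Rect w h, ‖E y (glueIter w h E j y)‖ ≤ δ * expWeight h y.im :=
      fun j y hy => H.bound y hy _ (H.iter_small j hy)
    have e : glueIter w h E (k + 1 + 1) y - glueIter w h E (k + 1) y
        = - glueT w h (fun t => E t (glueIter w h E (k + 1) t) - E t (glueIter w h E k t)) y := by
      rw [glueT_sub_fun H.w_pos H.w_lt H.h_pos H.δ_nonneg (hb _) (hb _)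
        (H.rhs_diff _).continuousOn (H.rhs_diff _).continuousOn hy]
      rw [glueIter, glueIter]; ring
    rw [e, norm_neg]
    have h1 := norm_glueT_le (B := L * (glueConst w * δ * (1 / 2) ^ k)) H.w_pos H.w_lt H.h_pos
      (mul_nonneg H.L_nonneg (by positivity))
      (μ := fun t => E t (glueIter w h E (k + 1) t) - E t (glueIter w h E k t))
      (fun t ht => (H.lip t ht _ _ (H.iter_small _ ht) (H.iter_small _ ht)).trans
        (mul_le_mul_of_nonneg_right (mul_le_mul_of_nonneg_left
          (ih t (Rect_subset_WideRect ht)) H.L_nonneg) (expWeight_nonneg _ _))) hy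
    refine h1.trans ?_
    rw [← mul_assoc, pow_succ]
    have := mul_le_mul_of_nonneg_right H.contr
      (mul_nonneg hC (by positivity : (0:ℝ) ≤ (1 / 2) ^ k))
    linarith

theorem tendsto (H : GlueAdm w h δ L η E) {y : ℂ} (hy : y ∈ WideRect w h) :
    Tendsto (fun k => glueIter w h E k y) atTop (𝓝 (glueSol w h E y)) :=
  (cauchySeq_of_le_geometric (1 / 2) (glueConst w * δ) (by norm_num) fun k => by
    rw [dist_comm, dist_eq_norm]; exact H.iter_sub k y hy).tendsto_limUnder

theorem norm_iter_sub_sol (H : GlueAdm w h δ L η E) {y : ℂ} (hy : y ∈ WideRect w h) (k : ℕ) :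
    ‖glueIter w h E k y - glueSol w h E y‖ ≤ glueConst w * δ * (1 / 2) ^ k * 2 := by
  have := dist_le_of_le_geometric_of_tendsto (1 / 2) (glueConst w * δ) (by norm_num)
    (fun k => by rw [dist_comm, dist_eq_norm]; exact H.iter_sub k y hy) (H.tendsto hy) k
  rw [dist_eq_norm] at this
  refine this.trans (le_of_eq ?_)
  ring

theorem norm_sol (H : GlueAdm w h δ L η E) {y : ℂ} (hy : y ∈ WideRect w h) :
    ‖glueSol w h E y‖ ≤ glueConst w * δ :=
  le_of_tendsto (H.tendsto hy).norm (Eventually.of_forall fun k => (H.iter k).2 y hy)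

theorem tendstoUniformlyOn (H : GlueAdm w h δ L η E) :
    TendstoUniformlyOn (glueIter w h E) (glueSol w h E) atTop (WideRect w h) := by
  rw [Metric.tendstoUniformlyOn_iff]
  intro ε hε
  have : Tendsto (fun k : ℕ => glueConst w * δ * (1 / 2 : ℝ) ^ k * 2) atTop (𝓝 0) := by
    have := ((tendsto_pow_atTop_nhds_zero_of_lt_one (by norm_num : (0:ℝ) ≤ 1 / 2)
      (by norm_num)).const_mul (glueConst w * δ)).mul_const 2
    simpa using this
  filter_upwards [this.eventually (gt_mem_nhds hε)] with k hk y hy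
  rw [dist_comm, dist_eq_norm]
  exact (H.norm_iter_sub_sol hy k).trans_lt hk

theorem sol_diff (H : GlueAdm w h δ L η E) :
    DifferentiableOn ℂ (glueSol w h E) (WideRect w h) :=
  H.tendstoUniformlyOn.tendstoLocallyUniformlyOn.differentiableOn
    (Eventually.of_forall fun k => (H.iter k).1) (isOpen_WideRect w h)

theorem sol_eq (H : GlueAdm w h δ L η E) {y : ℂ} (hy : y ∈ Rect w h) :
    glueSol w h E (y - 1) - glueSol w h E y = E y (glueSol w h E y) := by
  have hy1 := sub_one_mem_WideRect H.w_lt hy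
  have hyW := Rect_subset_WideRect hy
  have t1 : Tendsto (fun k => glueIter w h E (k + 1) (y - 1) - glueIter w h E (k + 1) y) atTop
      (𝓝 (glueSol w h E (y - 1) - glueSol w h E y)) :=
    ((tendsto_add_atTop_iff_nat 1).2 (H.tendsto hy1)).sub
      ((tendsto_add_atTop_iff_nat 1).2 (H.tendsto hyW))
  have t2 : Tendsto (fun k => E y (glueIter w h E k y)) atTop (𝓝 (E y (glueSol w h E y))) := by
    rw [tendsto_iff_norm_sub_tendsto_zero]
    have h0 := (tendsto_iff_norm_sub_tendsto_zero.1 (H.tendsto hyW)).const_mul L |>.mul_const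
      (expWeight h y.im)
    rw [mul_zero, zero_mul] at h0
    exact squeeze_zero (fun _ => norm_nonneg _) (fun k => H.lip y hy _ _ (H.iter_small k hy)
      ((H.norm_sol hyW).trans H.small)) h0
  refine tendsto_nhds_unique t1 (t2.congr fun k => ?_)
  have := glueT_sub (h := h) H.w_pos H.w_lt (fun t => E t (glueIter w h E k t)) hy.1
  simp only [glueIter]
  linear_combination this

open ComplexConjugate in
theorem sol_conj (H : GlueAdm w h δ L η E) (hE : ∀ y v, E (conj y) (conj v) = conj (E y v))
    {y : ℂ} (hy : y ∈ WideRect w h) : glueSol w h E (conj y) = conj (glueSol w h E y) := by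
  have hy' : conj y ∈ WideRect w h := by
    simpa [WideRect] using hy
  have key : ∀ k y, glueIter w h E k (conj y) = conj (glueIter w h E k y) := by
    intro k
    induction k with
    | zero => simp [glueIter]
    | succ k ih =>
      intro y
      simp only [glueIter, map_neg]
      rw [glueT_conj]
      intro t
      rw [ih, hE]
  refine tendsto_nhds_unique (H.tendsto hy') ?_
  simp only [key]
  exact (Complex.continuous_conj.tendsto _).comp (H.tendsto hy)

end GlueAdm

/-- The horizontal strip `|Im z| < S`. -/
def Strip (S : ℝ) : Set ℂ := {z | |z.im| < S}

theorem isOpen_Strip (S : ℝ) : IsOpen (Strip S) :=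
  isOpen_lt (by fun_prop) (by fun_prop)

theorem two_div_bound {m : ℝ} (hm : 1 / 2 ≤ m) :
    Real.exp (-(Real.pi * m)) / Real.sinh (Real.pi * m) ≤ 3 * Real.exp (-2 * Real.pi * m) := by
  have hpi := Real.pi_gt_three
  have hp : 0 < Real.pi * m := by positivity
  rw [div_le_iff₀ (Real.sinh_pos_iff.2 hp), Real.sinh_eq]
  have e1 : Real.exp (-2 * Real.pi * m) = Real.exp (-(Real.pi * m)) ^ 2 := by
    rw [← Real.exp_nat_mul]; congr 1; push_cast; ring
  have e2 : Real.exp (Real.pi * m) * Real.exp (-(Real.pi * m)) = 1 := by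
    rw [← Real.exp_add]; simp
  have h3 : Real.exp (-(Real.pi * m)) ≤ 2 / 5 := by
    have h4 : (5 / 2 : ℝ) ≤ Real.exp (Real.pi * m) := by
      have := Real.add_one_le_exp (Real.pi * m); nlinarith
    have h5 := Real.exp_pos (-(Real.pi * m))
    nlinarith
  rw [e1]
  have h5 := Real.exp_pos (-(Real.pi * m))
  set q := Real.exp (-(Real.pi * m))
  have : 3 * q ^ 2 * ((Real.exp (Real.pi * m) - q) / 2)
      = 3 / 2 * q * (Real.exp (Real.pi * m) * q) - 3 / 2 * q ^ 3 := by ring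
  rw [this, e2]
  nlinarith [sq_nonneg q, pow_pos h5 3, pow_pos h5 2]

theorem norm_cotPi_sub_I_le {z : ℂ} {m : ℝ} (hm : 1 / 2 ≤ m) (h : z.im ≤ -m) :
    ‖cotPi z - Complex.I‖ ≤ 3 * Real.exp (-2 * Real.pi * m) := by
  have hpi := Real.pi_gt_three
  have hm' : m ≤ -z.im := by linarith
  have hs : Complex.sin (Real.pi * z) ≠ 0 := sin_pi_ne_zero_of_im (by linarith)
  have e : cotPi z - Complex.I = Complex.exp (-(Real.pi * z) * Complex.I) /
      Complex.sin (Real.pi * z) := by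
    rw [eq_div_iff hs, Complex.exp_mul_I, Complex.cos_neg, Complex.sin_neg]
    unfold cotPi; field_simp; ring
  have h1 : ‖Complex.exp (-(Real.pi * z) * Complex.I)‖ = Real.exp (-(Real.pi * -z.im)) := by
    rw [Complex.norm_exp]; congr 1; simp
  have h2 : Real.sinh (Real.pi * -z.im) ≤ ‖Complex.sin (Real.pi * z)‖ := by
    have h4 := normSq_sin (Real.pi * z)
    have hs0 : 0 < Real.sinh (Real.pi * -z.im) := Real.sinh_pos_iff.2 (by nlinarith)
    have h5 : Real.sinh (Real.pi * z : ℂ).im ^ 2 = Real.sinh (Real.pi * -z.im) ^ 2 := by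
      rw [show (Real.pi * z : ℂ).im = -(Real.pi * -z.im) by simp, Real.sinh_neg]; ring
    refine abs_le_of_sq_le_sq' ?_ (norm_nonneg _) |>.2
    rw [h4, h5]; nlinarith [sq_nonneg (Real.sin (Real.pi * z : ℂ).re)]
  rw [e, norm_div, h1]
  have hs0 : 0 < Real.sinh (Real.pi * -z.im) := Real.sinh_pos_iff.2 (by nlinarith)
  calc _ ≤ Real.exp (-(Real.pi * -z.im)) / Real.sinh (Real.pi * -z.im) := by gcongr
    _ ≤ 3 * Real.exp (-2 * Real.pi * -z.im) := two_div_bound (hm.trans hm')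
    _ ≤ _ := by
      gcongr 3 * Real.exp ?_
      nlinarith

theorem norm_cotPi_add_I_le {z : ℂ} {m : ℝ} (hm : 1 / 2 ≤ m) (h : m ≤ z.im) :
    ‖cotPi z + Complex.I‖ ≤ 3 * Real.exp (-2 * Real.pi * m) := by
  have := norm_cotPi_sub_I_le (z := starRingEnd ℂ z) hm (by simpa using neg_le_neg h)
  rw [cotPi_conj, ← Complex.norm_conj] at this
  simpa using this

theorem exists_const_decay {H H' B : ℝ} {ψ : ℂ → ℂ} (hH : H < H')
    (hd : DifferentiableOn ℂ ψ (Strip H')) (hper : ∀ z, ψ (z + 1) = ψ z)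
    (hB : ∀ z ∈ Strip H', ‖ψ z‖ ≤ B) :
    ∃ c : ℂ, ∀ z : ℂ, |z.im| ≤ H - 1 / 2 →
      ‖ψ z - c‖ ≤ 3 * B * Real.exp (-2 * Real.pi * (H - |z.im|)) := by
  have hcont : ∀ e : ℝ, |e| < H' → Continuous fun x : ℝ => ψ (x + e * Complex.I) := fun e he =>
    hd.continuousOn.comp_continuous (by fun_prop) fun x => by simpa [Strip] using he
  have hI : ∀ e : ℝ, Function.Periodic (fun x : ℝ => ψ (x + e * Complex.I)) 1 := fun e x => by
    simp only
    rw [← hper (x + e * Complex.I)]; congr 1; push_cast; ring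
  refine ⟨((∫ x : ℝ in 0..1, ψ (x + (-H : ℝ) * Complex.I)) +
    ∫ x : ℝ in 0..1, ψ (x + (H : ℝ) * Complex.I)) / 2, fun z hz => ?_⟩
  set m := H - |z.im| with hm
  have hm2 : 1 / 2 ≤ m := by linarith
  have hH0 : 0 < H := by linarith [abs_nonneg z.im]
  obtain ⟨hz1, hz2⟩ := abs_le.1 hz
  have hB0 : 0 ≤ B := (norm_nonneg _).trans (hB 0 (by simp [Strip]; linarith))
  have hsub : Set.Icc (z.re - 1 / 2) (z.re + 1 / 2) ×ℂ Set.Icc (-H) H ⊆ Strip H' := fun t ht => by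
    obtain ⟨h1, h2⟩ : -H ≤ t.im ∧ t.im ≤ H := ht.2
    show |t.im| < H'
    exact abs_lt.2 ⟨by linarith, by linarith⟩
  have key := rect_integral_cotPi' (a := z.re - 1 / 2) (b := z.re + 1 / 2) (c := -H) (d := H)
    (p := z) (by linarith) (by linarith) (by linarith) (by linarith) (by linarith) (by linarith)
    (hd.mono hsub)
  have hside : ∀ y : ℝ, ψ ((z.re + 1 / 2 : ℝ) + y * Complex.I) *
      cotPi (((z.re + 1 / 2 : ℝ) : ℂ) + y * Complex.I - z) =
      ψ ((z.re - 1 / 2 : ℝ) + y * Complex.I) *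
      cotPi (((z.re - 1 / 2 : ℝ) : ℂ) + y * Complex.I - z) := fun y => by
    rw [← hper ((z.re - 1 / 2 : ℝ) + y * Complex.I),
      ← cotPi_add_one (((z.re - 1 / 2 : ℝ) : ℂ) + y * Complex.I - z)]
    congr 2 <;> push_cast <;> ring
  simp only [hside] at key
  rw [add_sub_cancel_right] at key
  have hne : ∀ e : ℝ, |e| = H → ∀ x : ℝ,
      Complex.sin (Real.pi * ((x : ℂ) + e * Complex.I - z)) ≠ 0 := fun e he x => by
    apply sin_pi_ne_zero_of_im
    intro h
    have h' : e = z.im := by simpa [sub_eq_zero] using h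
    rw [← h', he] at hz; linarith
  have hcot : ∀ e : ℝ, |e| = H → Continuous fun x : ℝ => cotPi ((x : ℂ) + e * Complex.I - z) :=
    fun e he => continuous_iff_continuousAt.2 fun x =>
      (differentiableAt_cotPi (hne e he x)).continuousAt.comp (f := fun x : ℝ => (x : ℂ) + e * Complex.I - z) (by fun_prop)
  have hwin : ∀ e : ℝ, ∫ x : ℝ in (z.re - 1 / 2)..(z.re + 1 / 2), ψ (x + e * Complex.I) =
      ∫ x : ℝ in 0..1, ψ (x + e * Complex.I) := fun e => by
    have := (hI e).intervalIntegral_add_eq (z.re - 1 / 2) 0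
    rw [show z.re - 1 / 2 + 1 = z.re + 1 / 2 by ring, zero_add] at this
    exact this
  have hsplit : ∀ (e : ℝ) (k : ℂ), |e| = H →
      ∫ x : ℝ in (z.re - 1 / 2)..(z.re + 1 / 2),
        ψ (x + e * Complex.I) * cotPi ((x : ℂ) + e * Complex.I - z) =
      (∫ x : ℝ in 0..1, ψ (x + e * Complex.I)) * k +
      ∫ x : ℝ in (z.re - 1 / 2)..(z.re + 1 / 2),
        ψ (x + e * Complex.I) * (cotPi ((x : ℂ) + e * Complex.I - z) - k) := fun e k he => by
    rw [← hwin e, ← intervalIntegral.integral_mul_const, ← intervalIntegral.integral_add]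
    · congr 1; ext x; ring
    · exact ((hcont e (by rw [he]; exact hH)).mul continuous_const).intervalIntegrable _ _
    · exact ((hcont e (by rw [he]; exact hH)).mul ((hcot e he).sub continuous_const)).intervalIntegrable _ _
  have hbd : ∀ (e : ℝ) (k : ℂ), |e| = H → (∀ x : ℝ, ‖cotPi ((x : ℂ) + e * Complex.I - z) - k‖ ≤
      3 * Real.exp (-2 * Real.pi * m)) →
      ‖∫ x : ℝ in (z.re - 1 / 2)..(z.re + 1 / 2),
        ψ (x + e * Complex.I) * (cotPi ((x : ℂ) + e * Complex.I - z) - k)‖ ≤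
        3 * B * Real.exp (-2 * Real.pi * m) := fun e k he hk => by
    refine (intervalIntegral.norm_integral_le_of_norm_le_const
      (C := 3 * B * Real.exp (-2 * Real.pi * m)) fun x _ => ?_).trans (by norm_num)
    rw [norm_mul]
    calc _ ≤ B * (3 * Real.exp (-2 * Real.pi * m)) :=
          mul_le_mul (hB _ (by simpa [Strip, he] using hH)) (hk x) (norm_nonneg _) hB0
      _ = _ := by ring
  have habs : |-H| = H := by rw [abs_neg, abs_of_pos hH0]
  have b1 := hbd (-H) Complex.I habs fun x => norm_cotPi_sub_I_le hm2 (by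
    simp; rw [hm]; linarith [neg_abs_le z.im])
  have b2 := hbd H (-Complex.I) (abs_of_pos hH0) fun x => by
    rw [sub_neg_eq_add]
    exact norm_cotPi_add_I_le hm2 (by simp; rw [hm]; linarith [le_abs_self z.im])
  rw [hsplit (-H) Complex.I habs, hsplit H (-Complex.I) (abs_of_pos hH0)] at key
  set R1 := ∫ x : ℝ in (z.re - 1 / 2)..(z.re + 1 / 2),
        ψ (x + (-H : ℝ) * Complex.I) * (cotPi ((x : ℂ) + (-H : ℝ) * Complex.I - z) - Complex.I)
  set R2 := ∫ x : ℝ in (z.re - 1 / 2)..(z.re + 1 / 2),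
        ψ (x + (H : ℝ) * Complex.I) * (cotPi ((x : ℂ) + (H : ℝ) * Complex.I - z) - -Complex.I)
  set c1 := ∫ x : ℝ in 0..1, ψ (x + (-H : ℝ) * Complex.I)
  set c2 := ∫ x : ℝ in 0..1, ψ (x + (H : ℝ) * Complex.I)
  have e : ψ z - (c1 + c2) / 2 = (R1 - R2) / (2 * Complex.I) := by
    rw [eq_div_iff (by simp)]
    linear_combination -key
  rw [e, norm_div]
  simp only [norm_mul, Complex.norm_I, Complex.norm_ofNat, mul_one]
  have := norm_sub_le R1 R2
  linarith

theorem norm_le_decay {H B : ℝ} {ψ : ℂ → ℂ} (hd : DifferentiableOn ℂ ψ (Strip H))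
    (hper : ∀ z, ψ (z + 1) = ψ z) (hB : ∀ z ∈ Strip H, ‖ψ z‖ ≤ B) {x₀ : ℂ} (hx₀ : x₀.im = 0)
    (h0 : ψ x₀ = 0) {z : ℂ} (hz : z ∈ Strip H) :
    ‖ψ z‖ ≤ 60 * B * Real.exp (-2 * Real.pi * (H - |z.im|)) := by
  have hz' : |z.im| < H := hz
  have hB0 : 0 ≤ B := (norm_nonneg _).trans (hB z hz)
  rcases lt_or_ge |z.im| (H - 1 / 2) with h | h
  · have hev : ∀ᶠ t in 𝓝[<] H, ‖ψ z‖ ≤ 6 * B * Real.exp (-2 * Real.pi * (t - |z.im|)) := by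
      filter_upwards [self_mem_nhdsWithin, mem_nhdsWithin_of_mem_nhds
        (eventually_gt_nhds (show |z.im| + 1 / 2 < H by linarith))] with t ht ht'
      obtain ⟨c, hc⟩ := exists_const_decay ht hd hper hB
      have h1 := hc z (by linarith)
      have h2 := hc x₀ (by rw [hx₀, abs_zero]; linarith [abs_nonneg z.im])
      rw [h0, hx₀, abs_zero, zero_sub, norm_neg] at h2
      have h3 : Real.exp (-2 * Real.pi * (t - 0)) ≤ Real.exp (-2 * Real.pi * (t - |z.im|)) := by
        apply Real.exp_le_exp.2; nlinarith [Real.pi_pos, abs_nonneg z.im]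
      have h4 : ‖ψ z‖ ≤ ‖ψ z - c‖ + ‖c‖ := by simpa using norm_add_le (ψ z - c) c
      nlinarith
    have hlim : Tendsto (fun t => 6 * B * Real.exp (-2 * Real.pi * (t - |z.im|))) (𝓝[<] H)
        (𝓝 (6 * B * Real.exp (-2 * Real.pi * (H - |z.im|)))) :=
      tendsto_nhdsWithin_of_tendsto_nhds (Continuous.tendsto (by fun_prop) H)
    refine (ge_of_tendsto hlim hev).trans ?_
    gcongr; norm_num
  · have h1 : Real.exp (-4) ≤ Real.exp (-2 * Real.pi * (H - |z.im|)) := by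
      apply Real.exp_le_exp.2; nlinarith [Real.pi_gt_three, Real.pi_lt_four]
    have h2 : Real.exp 4 ≤ 60 := by
      rw [show (4 : ℝ) = (4 : ℕ) * 1 by norm_num, Real.exp_nat_mul]
      calc _ ≤ (2.7182818286 : ℝ) ^ 4 := by gcongr; exact Real.exp_one_lt_d9.le
        _ ≤ 60 := by norm_num
    have h3 : Real.exp 4 * Real.exp (-4) = 1 := by rw [← Real.exp_add]; simp
    have h4 : 1 ≤ 60 * Real.exp (-2 * Real.pi * (H - |z.im|)) := by
      nlinarith [Real.exp_pos (-4)]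
    calc ‖ψ z‖ ≤ B := hB z hz
      _ ≤ B * (60 * Real.exp (-2 * Real.pi * (H - |z.im|))) := le_mul_of_one_le_right hB0 h4
      _ = _ := by ring

theorem norm_deriv_le_of_closedBall {U : Set ℂ} {n : ℂ → ℂ} {η ρ : ℝ} (hd : DifferentiableOn ℂ n U)
    (hn : ∀ v ∈ U, ‖n v‖ ≤ η) (hρ : 0 < ρ) {y : ℂ} (hy : Metric.closedBall y ρ ⊆ U) :
    ‖deriv n y‖ ≤ η / ρ := by
  refine Complex.norm_deriv_le_of_forall_mem_sphere_norm_le hρ ?_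
    fun z hz => hn z (hy (Metric.sphere_subset_closedBall hz))
  refine DifferentiableOn.diffContOnCl ?_
  rw [closure_ball _ hρ.ne']
  exact hd.mono hy

theorem norm_sub_le_of_closedBall {U : Set ℂ} {n : ℂ → ℂ} {η ρ : ℝ} (hU : IsOpen U)
    (hd : DifferentiableOn ℂ n U)
    (hn : ∀ v ∈ U, ‖n v‖ ≤ η) (hρ : 0 < ρ) {y : ℂ} (hy : Metric.closedBall y ρ ⊆ U) {v v' : ℂ}
    (hv : v ∈ Metric.closedBall y (ρ / 2)) (hv' : v' ∈ Metric.closedBall y (ρ / 2)) :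
    ‖n v - n v'‖ ≤ 2 * η / ρ * ‖v - v'‖ := by
  have hsub : ∀ x ∈ Metric.closedBall y (ρ / 2), Metric.closedBall x (ρ / 2) ⊆ U := fun x hx =>
    (Metric.closedBall_subset_closedBall' (by have := Metric.mem_closedBall.1 hx; linarith)).trans hy
  refine Convex.norm_image_sub_le_of_norm_deriv_le (s := Metric.closedBall y (ρ / 2))
    (fun x hx => ?_) (fun x hx => ?_) (convex_closedBall _ _) hv' hv
  · exact hd.differentiableAt (hU.mem_nhds (hsub x hx (Metric.mem_closedBall_self (by linarith))))
  · refine (norm_deriv_le_of_closedBall hd hn (by linarith) (hsub x hx)).trans_eq ?_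
    field_simp

/-- Inverse of a small holomorphic perturbation of the identity. -/
theorem exists_inverse {U V : Set ℂ} {n : ℂ → ℂ} {η ρ : ℝ} (hU : IsOpen U) (hV : IsOpen V)
    (hd : DifferentiableOn ℂ n U) (hn : ∀ v ∈ U, ‖n v‖ ≤ η) (hρ : 0 < ρ) (hηρ : 4 * η ≤ ρ)
    (hUV : ∀ y ∈ V, Metric.closedBall y ρ ⊆ U) :
    ∃ P : ℂ → ℂ, DifferentiableOn ℂ P V ∧ ∀ y ∈ V, P y ∈ U ∧ ‖P y - y‖ ≤ η ∧ P y + n (P y) = y ∧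
      (∀ v ∈ U, v + n v = y → v = P y) ∧ ‖deriv P y‖ ≤ (1 - 2 * η / ρ)⁻¹ := by
  have hex : ∀ y ∈ V, ∃ v, v ∈ Metric.closedBall y η ∧ v + n v = y := fun y hy => by
    have hyU := hUV y hy (Metric.mem_closedBall_self hρ.le)
    have hη : 0 ≤ η := (norm_nonneg _).trans (hn y hyU)
    have hsub : Metric.closedBall y η ⊆ Metric.closedBall y (ρ / 2) :=
      Metric.closedBall_subset_closedBall (by linarith)
    have hmaps : Set.MapsTo (fun v => y - n v) (Metric.closedBall y η) (Metric.closedBall y η) :=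
      fun v hv => by
        rw [Metric.mem_closedBall, dist_eq_norm]
        simpa using hn v (hUV y hy (Metric.closedBall_subset_closedBall (by linarith) hv))
    have hc : ContractingWith (1 / 2) (hmaps.restrict _ _ _) := by
      refine ⟨by rw [← NNReal.coe_lt_coe]; norm_num, LipschitzWith.of_dist_le_mul fun a b => ?_⟩
      rw [Subtype.dist_eq, Subtype.dist_eq, dist_eq_norm, dist_eq_norm]
      simp only [Set.MapsTo.val_restrict_apply]
      rw [sub_sub_sub_cancel_left, norm_sub_rev]
      refine (norm_sub_le_of_closedBall hU hd hn hρ (hUV y hy) (hsub a.2) (hsub b.2)).trans ?_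
      gcongr
      rw [div_le_iff₀ hρ]; push_cast; linarith
    obtain ⟨v, hv, hv', -⟩ := hc.exists_fixedPoint' Metric.isClosed_closedBall.isComplete hmaps
      (Metric.mem_closedBall_self hη) (edist_ne_top _ _)
    refine ⟨v, hv, ?_⟩
    have : y - n v = v := hv'
    linear_combination -this
  choose! P hP1 hP2 using hex
  have hη : ∀ y ∈ V, 0 ≤ η := fun y hy =>
    (norm_nonneg _).trans (hn y (hUV y hy (Metric.mem_closedBall_self hρ.le)))
  have hPU : ∀ y ∈ V, P y ∈ U := fun y hy =>
    hUV y hy (Metric.closedBall_subset_closedBall (by linarith [hη y hy]) (hP1 y hy))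
  have hL : 2 * η / ρ ≤ 1 / 2 := by rw [div_le_iff₀ hρ]; linarith
  have hclose : ∀ y ∈ V, ∀ y' ∈ V, ‖y - y'‖ ≤ ρ / 4 → ‖P y - P y'‖ ≤ 2 * ‖y - y'‖ :=
    fun y hy y' hy' h => by
      have h1 : P y ∈ Metric.closedBall y (ρ / 2) :=
        Metric.closedBall_subset_closedBall (by linarith [hη y hy]) (hP1 y hy)
      have h2 : P y' ∈ Metric.closedBall y (ρ / 2) := by
        have := Metric.mem_closedBall.1 (hP1 y' hy')
        rw [← dist_eq_norm, dist_comm] at h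
        exact Metric.mem_closedBall.2 ((dist_triangle _ y' _).trans (by linarith [hη y hy]))
      have h3 := norm_sub_le_of_closedBall hU hd hn hρ (hUV y hy) h1 h2
      have h4 : P y - P y' = (y - y') - (n (P y) - n (P y')) := by
        linear_combination hP2 y hy - hP2 y' hy'
      have h5 := norm_sub_le (y - y') (n (P y) - n (P y'))
      rw [← h4] at h5
      nlinarith [norm_nonneg (P y - P y')]
  have hder : ∀ y ∈ V, HasDerivAt P (1 + deriv n (P y))⁻¹ y ∧ ‖(1 + deriv n (P y))⁻¹‖ ≤ (1 - 2 * η / ρ)⁻¹ :=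
    fun y hy => by
      have hnd : HasDerivAt n (deriv n (P y)) (P y) :=
        (hd.differentiableAt (hU.mem_nhds (hPU y hy))).hasDerivAt
      have hb : ‖deriv n (P y)‖ ≤ 2 * η / ρ := by
        refine (norm_deriv_le_of_closedBall hd hn (show 0 < ρ / 2 by linarith) ?_).trans_eq (by field_simp)
        refine (Metric.closedBall_subset_closedBall' ?_).trans (hUV y hy)
        have := Metric.mem_closedBall.1 (hP1 y hy)
        linarith [hη y hy]
      have h1 : 1 - 2 * η / ρ ≤ ‖1 + deriv n (P y)‖ := by
        have := norm_sub_le (1 + deriv n (P y)) (deriv n (P y))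
        simp only [add_sub_cancel_right, norm_one] at this
        linarith
      constructor
      · refine HasDerivAt.of_local_left_inverse (f := fun v => v + n v) ?_
          ((hasDerivAt_id _).add hnd) ?_ ?_
        · rw [Metric.continuousAt_iff]
          intro e he
          obtain ⟨r, hr, hrV⟩ := Metric.isOpen_iff.1 hV y hy
          refine ⟨min r (min (ρ / 4) (e / 2)), by positivity, fun x hx => ?_⟩
          have h2 := hx.trans_le (min_le_left _ _)
          have h3 := hx.trans_le ((min_le_right _ _).trans (min_le_left _ _))
          have h4 := hx.trans_le ((min_le_right _ _).trans (min_le_right _ _))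
          rw [dist_eq_norm] at h3 h4 ⊢
          exact (hclose x (hrV h2) y hy h3.le).trans_lt (by linarith)
        · intro h; rw [h, norm_zero] at h1; linarith
        · filter_upwards [hV.mem_nhds hy] with x hx using hP2 x hx
      · rw [norm_inv]
        exact inv_anti₀ (by linarith) h1
  refine ⟨P, fun y hy => (hder y hy).1.differentiableAt.differentiableWithinAt, fun y hy =>
    ⟨hPU y hy, by simpa [dist_eq_norm] using hP1 y hy, hP2 y hy, fun v hv hvy => ?_, ?_⟩⟩
  · have hvb : v ∈ Metric.closedBall y (ρ / 2) := by
      rw [Metric.mem_closedBall, dist_eq_norm, show v - y = - n v by linear_combination hvy, norm_neg]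
      exact (hn v hv).trans (by linarith [hη y hy])
    have hpb : P y ∈ Metric.closedBall y (ρ / 2) :=
        Metric.closedBall_subset_closedBall (by linarith [hη y hy]) (hP1 y hy)
    have h3 := norm_sub_le_of_closedBall hU hd hn hρ (hUV y hy) hvb hpb
    rw [show n v - n (P y) = -(v - P y) by linear_combination hvy - hP2 y hy, norm_neg] at h3
    have : ‖v - P y‖ ≤ 0 := by nlinarith [norm_nonneg (v - P y)]
    exact sub_eq_zero.1 (norm_le_zero_iff.1 this)
  · rw [(hder y hy).1.deriv]; exact (hder y hy).2

/-- A rectangle slightly wider than a fundamental domain of `z ↦ z + 1`. -/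
def FundRect (H : ℝ) : Set ℂ := {z | -11 / 10 < z.re ∧ z.re < 1 / 10 ∧ |z.im| < H}

theorem isOpen_FundRect (H : ℝ) : IsOpen (FundRect H) :=
  (isOpen_lt continuous_const Complex.continuous_re).inter
    ((isOpen_lt Complex.continuous_re continuous_const).inter (isOpen_Strip H))

/-- Extension of a map commuting with the unit translation from a fundamental domain. -/
noncomputable def perExt (F : ℂ → ℂ) (y : ℂ) : ℂ := F (y - ⌈y.re⌉) + ⌈y.re⌉

theorem perExt_add_one (F : ℂ → ℂ) (y : ℂ) : perExt F (y + 1) = perExt F y + 1 := by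
  simp only [perExt, Complex.add_re, Complex.one_re, Int.ceil_add_one, Int.cast_add, Int.cast_one]
  rw [add_sub_add_right_eq_sub, add_assoc]

theorem perExt_add_int (F : ℂ → ℂ) (y : ℂ) (m : ℤ) : perExt F (y + m) = perExt F y + m := by
  simp only [perExt, Complex.add_re, Complex.intCast_re, Int.ceil_add_intCast, Int.cast_add]
  rw [add_sub_add_right_eq_sub, add_assoc]

theorem sub_ceil_mem {H : ℝ} {y : ℂ} (hy : y ∈ Strip H) : y - ⌈y.re⌉ ∈ FundRect H := by
  have h1 := Int.ceil_lt_add_one y.re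
  have h2 := Int.le_ceil y.re
  refine ⟨by simp; linarith, by simp; linarith, by simpa [Strip] using hy⟩

section
variable {F : ℂ → ℂ} {H : ℝ}
  (hF : ∀ y : ℂ, |y.re| < 1 / 10 → |y.im| < H → F (y - 1) = F y - 1)
include hF

theorem perExt_eq {y : ℂ} (hy : y ∈ FundRect H) : perExt F y = F y := by
  obtain ⟨h1, h2, h3⟩ := hy
  rcases lt_or_ge 0 y.re with h | h
  · have : ⌈y.re⌉ = 1 := by rw [Int.ceil_eq_iff]; constructor <;> push_cast <;> linarith
    simp only [perExt, this, Int.cast_one]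
    rw [hF y (abs_lt.2 ⟨by linarith, by linarith⟩) h3]; ring
  rcases lt_or_ge (-1) y.re with h' | h'
  · have : ⌈y.re⌉ = 0 := by rw [Int.ceil_eq_iff]; constructor <;> push_cast <;> linarith
    simp [perExt, this]
  · have : ⌈y.re⌉ = -1 := by rw [Int.ceil_eq_iff]; constructor <;> push_cast <;> linarith
    simp only [perExt, this, Int.cast_neg, Int.cast_one, sub_neg_eq_add]
    have := hF (y + 1) (abs_lt.2 ⟨by simp; linarith, by simp; linarith⟩) (by simpa using h3)
    rw [add_sub_cancel_right] at this
    rw [this]; ring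

theorem perExt_differentiableOn (hd : DifferentiableOn ℂ F (FundRect H)) :
    DifferentiableOn ℂ (perExt F) (Strip H) := by
  intro y hy
  refine DifferentiableAt.differentiableWithinAt ?_
  have h0 := (isOpen_FundRect H).mem_nhds (sub_ceil_mem hy)
  have h1 : DifferentiableAt ℂ (fun x => F (x - ⌈y.re⌉) + ⌈y.re⌉) y := by
    refine DifferentiableAt.add_const _ ?_
    exact DifferentiableAt.comp (g := F) y (hd.differentiableAt h0) (by fun_prop)
  refine h1.congr_of_eventuallyEq ?_
  have hc : ContinuousAt (fun x : ℂ => x - ⌈y.re⌉) y := by fun_prop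
  filter_upwards [hc h0] with x hx
  rw [← perExt_eq hF hx, ← perExt_add_int, sub_add_cancel]

theorem perExt_conj (hc : ∀ y ∈ FundRect H, F (starRingEnd ℂ y) = starRingEnd ℂ (F y)) {y : ℂ}
    (hy : y ∈ Strip H) : perExt F (starRingEnd ℂ y) = starRingEnd ℂ (perExt F y) := by
  have := hc _ (sub_ceil_mem hy)
  simp only [perExt, Complex.conj_re, map_add, map_intCast]
  rw [← this, map_sub, map_intCast]

omit hF in
theorem norm_perExt_sub_le {b : ℝ} (hb : ∀ y ∈ FundRect H, ‖F y - y‖ ≤ b) {y : ℂ}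
    (hy : y ∈ Strip H) : ‖perExt F y - y‖ ≤ b := by
  have := hb _ (sub_ceil_mem hy)
  rwa [show perExt F y - y = F (y - ⌈y.re⌉) - (y - ⌈y.re⌉) by simp only [perExt]; ring]
end

/-- The covering map `ℂ → ℂˣ` of the cylinder. -/
noncomputable def ex (y : ℂ) : ℂ := Complex.exp (2 * Real.pi * Complex.I * y)

theorem ex_ne_zero (y : ℂ) : ex y ≠ 0 := Complex.exp_ne_zero _

theorem ex_add (a b : ℂ) : ex (a + b) = ex a * ex b := by
  rw [ex, mul_add, Complex.exp_add]; rfl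

theorem ex_neg (a : ℂ) : ex (-a) = (ex a)⁻¹ := by
  rw [ex, mul_neg, Complex.exp_neg]; rfl

theorem ex_sub (a b : ℂ) : ex (a - b) = ex a / ex b := by
  rw [sub_eq_add_neg, ex_add, ex_neg, div_eq_mul_inv]

theorem ex_intCast (n : ℤ) : ex n = 1 := by
  rw [ex, mul_comm]; exact Complex.exp_int_mul_two_pi_mul_I n

theorem norm_ex (y : ℂ) : ‖ex y‖ = Real.exp (-2 * Real.pi * y.im) := by
  rw [ex, Complex.norm_exp]; congr 1; simp;

theorem ex_conj (y : ℂ) : ex (starRingEnd ℂ y) = (starRingEnd ℂ (ex y))⁻¹ := by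
  rw [ex, ex, ← Complex.exp_conj, ← Complex.exp_neg]; congr 1
  simp [show (starRingEnd ℂ) 2 = 2 from Complex.conj_ofNat 2]

theorem differentiable_ex : Differentiable ℂ ex := by unfold ex; fun_prop

theorem ex_inj {a b : ℂ} (h : ex a = ex b) (hab : ‖a - b‖ < 1) : a = b := by
  rw [ex, ex, Complex.exp_eq_exp_iff_exists_int] at h
  obtain ⟨n, hn⟩ := h
  have h1 : a - b = n := by
    have h2 : (2 * Real.pi * Complex.I : ℂ) ≠ 0 := Complex.two_pi_I_ne_zero
    apply mul_left_cancel₀ h2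
    linear_combination hn
  rw [h1, Complex.norm_intCast] at hab
  have : n = 0 := by
    have h3 : |n| < 1 := by exact_mod_cast hab
    exact Int.abs_lt_one_iff.1 h3
  rw [this] at h1
  exact sub_eq_zero.1 (by simpa using h1)

/-- The logarithm in the coordinate of `ex`, near `1`. -/
noncomputable def lg (u : ℂ) : ℂ := Complex.log u / (2 * Real.pi * Complex.I)

theorem ex_lg {u : ℂ} (hu : u ≠ 0) : ex (lg u) = u := by
  rw [ex, lg, mul_div_cancel₀ _ Complex.two_pi_I_ne_zero, Complex.exp_log hu]

theorem norm_lg_one_add_le {z : ℂ} (hz : ‖z‖ ≤ 1 / 2) : ‖lg (1 + z)‖ ≤ ‖z‖ / 4 := by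
  have h := Complex.norm_log_one_add_half_le_self hz
  have hpi := Real.pi_gt_three
  rw [lg, norm_div]
  simp only [norm_mul, Complex.norm_I, Complex.norm_ofNat, mul_one, Complex.norm_real,
    Real.norm_of_nonneg Real.pi_pos.le]
  rw [div_le_iff₀ (by positivity)]
  nlinarith [norm_nonneg z]

theorem one_add_mem_slitPlane {z : ℂ} (hz : ‖z‖ < 1) : 1 + z ∈ Complex.slitPlane := by
  left
  have := (abs_lt.1 ((Complex.abs_re_le_norm z).trans_lt hz)).1
  simp; linarith

theorem one_add_ne_zero {z : ℂ} (hz : ‖z‖ < 1) : 1 + z ≠ 0 :=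
  Complex.slitPlane_ne_zero (one_add_mem_slitPlane hz)

theorem lg_conj {u : ℂ} (hu : u ∈ Complex.slitPlane) :
    lg (starRingEnd ℂ u) = - starRingEnd ℂ (lg u) := by
  rw [lg, lg, Complex.log_conj _ (Complex.slitPlane_arg_ne_pi hu)]
  simp [show (starRingEnd ℂ) 2 = 2 from Complex.conj_ofNat 2]
  ring

theorem differentiableAt_lg {u : ℂ} (hu : u ∈ Complex.slitPlane) : DifferentiableAt ℂ lg u := by
  unfold lg
  exact (Complex.differentiableAt_log hu).div_const _

/-- Numerator factor of the model flow, minus `1`. -/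
noncomputable def mP (r : ℝ) (u w : ℂ) : ℂ := (u - 1) * (1 + r / w) / (1 - r ^ 2)

/-- Denominator factor of the model flow, minus `1`. -/
noncomputable def mQ (r : ℝ) (u w : ℂ) : ℂ := -(u - 1) * r * (w + r) / (1 - r ^ 2)

/-- Size of the displacement of the model flow. -/
noncomputable def mB (r : ℝ) (u w : ℂ) : ℝ := ‖u - 1‖ * (1 + r / ‖w‖ + r * ‖w‖)

/-- Displacement of the model flow: the lift of `v ↦ u v`, `v = (w + r) / (1 + r w)`, `w = ex y`. -/
noncomputable def mE (r : ℝ) (u y : ℂ) : ℂ := lg (1 + mP r u (ex y)) - lg (1 + mQ r u (ex y))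

/-- The linearizing coordinate of the model flow. -/
noncomputable def mV (r : ℝ) (w : ℂ) : ℂ := (w + r) / (1 + r * w)

/-- The Moebius transformation `v ↦ u v` read in `w`. -/
noncomputable def mM (r : ℝ) (u w : ℂ) : ℂ :=
  (u * (w + r) - r * (1 + r * w)) / (1 + r * w - u * r * (w + r))

section
variable {r : ℝ} (hr : 0 ≤ r) (hr' : r ≤ 1 / 100)
include hr hr'

theorem one_sub_sq_ne_zero : (1 - r ^ 2 : ℂ) ≠ 0 := by
  have : (1 - r ^ 2 : ℝ) ≠ 0 := by nlinarith
  exact_mod_cast this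

theorem norm_mP_add_norm_mQ_le (u w : ℂ) :
    ‖mP r u w‖ + ‖mQ r u w‖ ≤ 101 / 100 * mB r u w := by
  have h0 : ‖(1 - r ^ 2 : ℂ)‖ = 1 - r ^ 2 := by
    rw [← Complex.ofReal_one, ← Complex.ofReal_pow, ← Complex.ofReal_sub, Complex.norm_real,
      Real.norm_of_nonneg (by nlinarith)]
  have hpos : 0 < 1 - r ^ 2 := by nlinarith
  have h1 : ‖mP r u w‖ ≤ ‖u - 1‖ * (1 + r / ‖w‖) / (1 - r ^ 2) := by
    rw [mP, norm_div, norm_mul, h0]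
    gcongr
    refine (norm_add_le _ _).trans_eq ?_
    rw [norm_div, norm_one, Complex.norm_real, Real.norm_of_nonneg hr]
  have h2 : ‖mQ r u w‖ ≤ ‖u - 1‖ * (r * ‖w‖ + r ^ 2) / (1 - r ^ 2) := by
    rw [mQ, norm_div, norm_mul, norm_mul, norm_neg, h0, Complex.norm_real, Real.norm_of_nonneg hr,
      mul_assoc]
    gcongr
    have := norm_add_le w r
    rw [Complex.norm_real, Real.norm_of_nonneg hr] at this
    nlinarith
  have h3 : 0 ≤ r / ‖w‖ := by positivity
  have h4 : 0 ≤ r * ‖w‖ := by positivity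
  calc _ ≤ ‖u - 1‖ * (1 + r / ‖w‖) / (1 - r ^ 2) + ‖u - 1‖ * (r * ‖w‖ + r ^ 2) / (1 - r ^ 2) :=
        add_le_add h1 h2
    _ = ‖u - 1‖ * (1 + r / ‖w‖ + r * ‖w‖ + r ^ 2) / (1 - r ^ 2) := by ring
    _ ≤ _ := by
      rw [div_le_iff₀ hpos, mB]
      have : 1 + r / ‖w‖ + r * ‖w‖ + r ^ 2 ≤ 101 / 100 * (1 + r / ‖w‖ + r * ‖w‖) * (1 - r ^ 2) := by
        have hr2 : r ^ 2 ≤ 1 / 10000 := by nlinarith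
        nlinarith [mul_nonneg h3 (sub_nonneg.2 hr2), mul_nonneg h4 (sub_nonneg.2 hr2)]
      nlinarith [norm_nonneg (u - 1)]

variable {u : ℂ}

theorem norm_mP_mQ_lt {w : ℂ} (hb : mB r u w ≤ 1 / 10) : ‖mP r u w‖ < 1 / 2 ∧ ‖mQ r u w‖ < 1 / 2 := by
  have := norm_mP_add_norm_mQ_le hr hr' u w
  constructor <;> linarith [norm_nonneg (mP r u w), norm_nonneg (mQ r u w)]

theorem norm_mE_le {y : ℂ} (hb : mB r u (ex y) ≤ 1 / 10) : ‖mE r u y‖ ≤ mB r u (ex y) / 3 := by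
  obtain ⟨h1, h2⟩ := norm_mP_mQ_lt hr hr' hb
  have h3 := norm_lg_one_add_le h1.le
  have h4 := norm_lg_one_add_le h2.le
  have h5 := norm_mP_add_norm_mQ_le hr hr' u (ex y)
  have h6 := norm_nonneg (mP r u (ex y))
  have h7 := norm_nonneg (mQ r u (ex y))
  have := norm_sub_le (lg (1 + mP r u (ex y))) (lg (1 + mQ r u (ex y)))
  rw [mE]; linarith

theorem ex_add_mE {y : ℂ} (hb : mB r u (ex y) ≤ 1 / 10) :
    1 + r * ex y - u * r * (ex y + r) ≠ 0 ∧ ex (y + mE r u y) = mM r u (ex y) := by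
  obtain ⟨h1, h2⟩ := norm_mP_mQ_lt hr hr' hb
  have hP := one_add_ne_zero (h1.trans (by norm_num))
  have hQ := one_add_ne_zero (h2.trans (by norm_num))
  have hw := ex_ne_zero y
  have hs := one_sub_sq_ne_zero hr hr'
  have eQ : (1 - r ^ 2) * (1 + mQ r u (ex y)) = 1 + r * ex y - u * r * (ex y + r) := by
    rw [mQ]; field_simp; ring
  have eP : ex y * ((1 - r ^ 2) * (1 + mP r u (ex y))) = u * (ex y + r) - r * (1 + r * ex y) := by
    rw [mP]; field_simp; ring
  have hD : 1 + r * ex y - u * r * (ex y + r) ≠ 0 := by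
    rw [← eQ]; exact mul_ne_zero hs hQ
  refine ⟨hD, ?_⟩
  rw [mE, ex_add, ex_sub, ex_lg hP, ex_lg hQ, mM, ← eP, ← eQ]
  field_simp

omit hr hr' in
theorem mM_add {w : ℂ} (h : 1 + r * w - u * r * (w + r) ≠ 0) :
    mM r u w + r = u * (w + r) * (1 - r ^ 2) / (1 + r * w - u * r * (w + r)) := by
  rw [mM, eq_div_iff h, add_mul, div_mul_cancel₀ _ h]; ring

omit hr hr' in
theorem one_add_mM {w : ℂ} (h : 1 + r * w - u * r * (w + r) ≠ 0) :
    1 + r * mM r u w = (1 + r * w) * (1 - r ^ 2) / (1 + r * w - u * r * (w + r)) := by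
  rw [mM, eq_div_iff h, add_mul, mul_assoc (r : ℂ) (_ / _), div_mul_cancel₀ _ h]; ring

theorem mV_mM {w : ℂ} (h1 : 1 + r * w ≠ 0) (h2 : 1 + r * w - u * r * (w + r) ≠ 0) :
    mV r (mM r u w) = u * mV r w := by
  have hs := one_sub_sq_ne_zero hr hr'
  rw [mV, mM_add h2, one_add_mM h2, mV, div_div_div_cancel_right₀ h2, mul_div_mul_right _ _ hs,
    mul_div_assoc]

theorem mM_mM {u' w : ℂ} (h1 : 1 + r * w - u * r * (w + r) ≠ 0) :
    mM r u' (mM r u w) = mM r (u' * u) w := by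
  have hs := one_sub_sq_ne_zero hr hr'
  rw [mM, mM_add h1, one_add_mM h1, mM]
  have e1 : u' * (u * (w + r) * (1 - r ^ 2) / (1 + r * w - u * r * (w + r))) -
      r * ((1 + r * w) * (1 - r ^ 2) / (1 + r * w - u * r * (w + r))) =
      (u' * u * (w + r) - r * (1 + r * w)) * ((1 - r ^ 2) / (1 + r * w - u * r * (w + r))) := by
    ring
  have e2 : (1 + r * w) * (1 - r ^ 2) / (1 + r * w - u * r * (w + r)) -
      u' * r * (u * (w + r) * (1 - r ^ 2) / (1 + r * w - u * r * (w + r))) =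
      (1 + r * w - u' * u * r * (w + r)) * ((1 - r ^ 2) / (1 + r * w - u * r * (w + r))) := by
    ring
  rw [e1, e2, mul_div_mul_right _ _ (div_ne_zero hs h1)]

theorem mE_mul {u' y : ℂ} (h1 : mB r u (ex y) ≤ 1 / 10)
    (h2 : mB r u' (ex (y + mE r u y)) ≤ 1 / 10) (h12 : mB r (u' * u) (ex y) ≤ 1 / 10) :
    mE r (u' * u) y = mE r u y + mE r u' (y + mE r u y) := by
  obtain ⟨d1, e1⟩ := ex_add_mE hr hr' h1
  obtain ⟨d2, e2⟩ := ex_add_mE hr hr' h2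
  obtain ⟨d12, e12⟩ := ex_add_mE hr hr' h12
  have n1 := norm_mE_le hr hr' h1
  have n2 := norm_mE_le hr hr' h2
  have n12 := norm_mE_le hr hr' h12
  have key : y + mE r (u' * u) y = y + mE r u y + mE r u' (y + mE r u y) := by
    apply ex_inj
    · rw [e12, e2, e1, mM_mM hr hr' d1]
    · have := norm_add₃_le (a := mE r (u' * u) y) (b := - mE r u y) (c := - mE r u' (y + mE r u y))
      rw [norm_neg, norm_neg] at this
      rw [show y + mE r (u' * u) y - (y + mE r u y + mE r u' (y + mE r u y)) =
        mE r (u' * u) y + - mE r u y + - mE r u' (y + mE r u y) by ring]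
      linarith
  linear_combination key

theorem differentiableAt_mE {u : ℂ → ℂ} {y : ℂ} (hu : DifferentiableAt ℂ u y)
    (hb : mB r (u y) (ex y) ≤ 1 / 10) : DifferentiableAt ℂ (fun y => mE r (u y) y) y := by
  obtain ⟨h1, h2⟩ := norm_mP_mQ_lt hr hr' hb
  have hex := differentiable_ex y
  have hw := ex_ne_zero y
  unfold mE
  refine DifferentiableAt.sub ?_ ?_
  · refine DifferentiableAt.comp (g := lg) (f := fun y => 1 + mP r (u y) (ex y)) y
      (differentiableAt_lg (one_add_mem_slitPlane (h1.trans (by norm_num)))) ?_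
    unfold mP
    fun_prop (disch := assumption)
  · refine DifferentiableAt.comp (g := lg) (f := fun y => 1 + mQ r (u y) (ex y)) y
      (differentiableAt_lg (one_add_mem_slitPlane (h2.trans (by norm_num)))) ?_
    unfold mQ
    fun_prop (disch := assumption)

open ComplexConjugate in
theorem mE_conj {u' y : ℂ} (huu : u' * conj u = 1) (h1 : mB r u (ex y) ≤ 1 / 10)
    (h2 : mB r u' (ex (conj y)) ≤ 1 / 10) : mE r u' (conj y) = conj (mE r u y) := by
  obtain ⟨d1, e1⟩ := ex_add_mE hr hr' h1
  obtain ⟨d2, e2⟩ := ex_add_mE hr hr' h2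
  have n1 := norm_mE_le hr hr' h1
  have n2 := norm_mE_le hr hr' h2
  have hne := ex_ne_zero (y + mE r u y)
  have key : conj y + mE r u' (conj y) = conj (y + mE r u y) := by
    apply ex_inj
    · rw [e2, ex_conj (y + mE r u y)]
      rw [e1] at hne ⊢
      rw [ex_conj] at d2 ⊢
      have hw : conj (ex y) ≠ 0 := by simpa using ex_ne_zero y
      have hu : conj u ≠ 0 := right_ne_zero_of_mul_eq_one huu
      have d1' : 1 + r * conj (ex y) - conj u * r * (conj (ex y) + r) ≠ 0 := by
        have := (map_ne_zero (starRingEnd ℂ)).2 d1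
        simpa using this
      have hn : conj u * (conj (ex y) + r) - r * (1 + r * conj (ex y)) ≠ 0 := by
        have := (map_ne_zero (starRingEnd ℂ)).2 hne
        simp only [mM, map_div₀] at this
        simpa using (div_ne_zero_iff.1 this).1
      simp only [mM, map_div₀, inv_div]
      simp only [map_sub, map_mul, map_add, map_one, Complex.conj_ofReal]
      have hu' : u' = (conj u)⁻¹ := eq_inv_of_mul_eq_one_left huu
      rw [hu'] at d2 ⊢
      rw [div_eq_div_iff d2 hn]
      field_simp
    · rw [map_add, add_sub_add_left_eq_sub]
      have := norm_sub_le (mE r u' (conj y)) (conj (mE r u y))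
      rw [Complex.norm_conj] at this
      linarith
  rw [map_add] at key
  exact add_left_cancel key

end

theorem im_lg (u : ℂ) : (lg u).im = - Real.log ‖u‖ / (2 * Real.pi) := by
  have : (2 * Real.pi * Complex.I : ℂ) = ((2 * Real.pi : ℝ) : ℂ) * Complex.I := by push_cast; ring
  have hpi := Real.pi_ne_zero
  rw [lg, this, ← div_div, Complex.div_I]
  simp [Complex.log_re, Complex.div_im, Complex.normSq_apply, Complex.div_re, -Complex.ofReal_mul]
  field_simp

theorem re_lg (u : ℂ) : (lg u).re = Complex.arg u / (2 * Real.pi) := by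
  have : (2 * Real.pi * Complex.I : ℂ) = ((2 * Real.pi : ℝ) : ℂ) * Complex.I := by push_cast; ring
  have hpi := Real.pi_ne_zero
  rw [lg, this, ← div_div, Complex.div_I]
  simp [Complex.log_im, Complex.div_im, Complex.normSq_apply, Complex.div_re, -Complex.ofReal_mul]
  field_simp

open ComplexConjugate in
theorem lg_inv_conj {u : ℂ} (hu : u ∈ Complex.slitPlane) : lg (conj u)⁻¹ = conj (lg u) := by
  have h := Complex.slitPlane_arg_ne_pi hu
  have h2 : (conj u).arg ≠ Real.pi := by
    rw [Complex.arg_conj, if_neg h]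
    intro h'
    linarith [Complex.neg_pi_lt_arg u]
  rw [lg, lg, Complex.log_inv _ h2, Complex.log_conj _ h]
  simp [show (starRingEnd ℂ) 2 = 2 from Complex.conj_ofNat 2]
  ring

theorem ex_re_pos {y : ℂ} (hy : |y.re| < 1 / 4) : 0 < (ex y).re := by
  obtain ⟨h1, h2⟩ := abs_lt.1 hy
  have hpi := Real.pi_pos
  rw [ex, Complex.exp_re]
  refine mul_pos (Real.exp_pos _) (Real.cos_pos_of_mem_Ioo ⟨?_, ?_⟩) <;> simp <;> nlinarith

theorem lg_ex {y : ℂ} (hy : |y.re| < 1 / 2) : lg (ex y) = y := by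
  obtain ⟨h1, h2⟩ := abs_lt.1 hy
  have hpi := Real.pi_pos
  rw [lg, ex, Complex.log_exp, mul_div_cancel_left₀ _ Complex.two_pi_I_ne_zero]
  · simp; nlinarith
  · simp; nlinarith

/-- The modulus of the position of the ghost fixed point of the model flow. -/
noncomputable def rr (h : ℝ) : ℝ := Real.exp (-2 * Real.pi * h)

theorem rr_nonneg (h : ℝ) : 0 ≤ rr h := (Real.exp_pos _).le

theorem rr_pos (h : ℝ) : 0 < rr h := Real.exp_pos _

theorem exp_le_hundredth {x : ℝ} (hx : x ≤ -5) : Real.exp x ≤ 1 / 100 := by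
  have h1 : Real.exp x ≤ Real.exp (-5) := Real.exp_le_exp.2 hx
  have h3 : Real.exp 5 * Real.exp (-5) = 1 := by rw [← Real.exp_add]; simp
  have h2 : 100 ≤ Real.exp 5 := by
    rw [show (5 : ℝ) = (5 : ℕ) * 1 by norm_num, Real.exp_nat_mul]
    calc (100 : ℝ) ≤ (2.7182818283 : ℝ) ^ 5 := by norm_num
      _ ≤ _ := by gcongr; exact Real.exp_one_gt_d9.le
  nlinarith [Real.exp_pos (-5)]

theorem rr_le {h : ℝ} (hh : 2 ≤ h) : rr h ≤ 1 / 100 :=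
  exp_le_hundredth (by nlinarith [Real.pi_gt_three])

/-- Time coordinate of the model flow near the section. -/
noncomputable def tau (α r : ℝ) (y : ℂ) : ℂ := lg (mV r (ex y)) / α

/-- Position of the real solution of the model flow at complex time `t`. -/
noncomputable def zc (α r : ℝ) (t : ℂ) : ℂ :=
  α * t + lg (1 + -(r / ex (α * t))) - lg (1 + -(r * ex (α * t)))

theorem mV_re_pos {r : ℝ} (hr : 0 ≤ r) {w : ℂ} (hw : 0 < w.re) : 0 < (mV r w).re := by
  have h0 : 0 < (1 + r * w).re := by simp; positivity
  have h1 : 1 + r * w ≠ 0 := fun h => by rw [h] at h0; simp at h0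
  have h2 : 0 < Complex.normSq (1 + r * w) := Complex.normSq_pos.2 h1
  rw [mV, Complex.div_re, ← add_div]
  refine div_pos ?_ h2
  simp
  nlinarith [mul_nonneg hr hw.le, mul_nonneg hr (sq_nonneg w.re), mul_nonneg hr (sq_nonneg w.im),
    mul_nonneg (sq_nonneg r) hw.le]

theorem norm_mV_le {r : ℝ} (hr : 0 ≤ r) (hr' : r ≤ 1) {w : ℂ} (hw : 0 < w.re) {E : ℝ}
    (hE : ‖w‖ ≤ E) (hE' : 1 ≤ E) :
    ‖mV r w‖ ≤ 2 * E ∧ r * ‖mV r w‖ ≤ 2 := by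
  have h0 : 1 ≤ (1 + r * w).re := by simp; positivity
  have h1 : 1 ≤ ‖1 + r * w‖ := h0.trans (Complex.re_le_norm _)
  have h2 : r * ‖w‖ ≤ ‖1 + r * w‖ := by
    refine abs_le_of_sq_le_sq' ?_ (norm_nonneg _) |>.2
    rw [mul_pow, Complex.sq_norm, Complex.sq_norm, Complex.normSq_apply, Complex.normSq_apply]
    simp
    nlinarith [mul_nonneg hr hw.le]
  have h3 := norm_add_le w r
  rw [Complex.norm_real, Real.norm_of_nonneg hr] at h3
  constructor
  · rw [mV, norm_div, div_le_iff₀ (by linarith)]; nlinarith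
  · rw [mV, norm_div, ← mul_div_assoc, div_le_iff₀ (by linarith)]; nlinarith

theorem mV_inv {r : ℝ} {w : ℂ} (hw : w ≠ 0) : mV r w⁻¹ = (mV r w)⁻¹ := by
  rw [mV, mV, inv_div]
  have e1 : w⁻¹ + r = (1 + r * w) * w⁻¹ := by rw [add_mul, mul_assoc, mul_inv_cancel₀ hw]; ring
  have e2 : 1 + r * w⁻¹ = (w + r) * w⁻¹ := by rw [add_mul, mul_inv_cancel₀ hw]
  rw [e1, e2, mul_div_mul_right _ _ (inv_ne_zero hw)]

theorem log_two_div_le : Real.log 2 / (2 * Real.pi) ≤ 3 / 25 := by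
  rw [div_le_iff₀ (by positivity)]
  nlinarith [Real.log_two_lt_d9, Real.pi_gt_three]

section
variable {α h : ℝ} (hα : 0 < α) (hh : 2 ≤ h)
include hα hh

omit hα in
theorem abs_log_mV_le {y : ℂ} (hy : |y.re| < 1 / 4) :
    |Real.log ‖mV (rr h) (ex y)‖| ≤ 2 * Real.pi * (|y.im| + 3 / 25) ∧
    |Real.log ‖mV (rr h) (ex y)‖| ≤ 2 * Real.pi * (h + 3 / 25) := by
  have key : ∀ y : ℂ, |y.re| < 1 / 4 →
      Real.log ‖mV (rr h) (ex y)‖ ≤ 2 * Real.pi * (|y.im| + 3 / 25) ∧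
      Real.log ‖mV (rr h) (ex y)‖ ≤ 2 * Real.pi * (h + 3 / 25) := fun y hy => by
    have hv := mV_re_pos (rr_nonneg h) (ex_re_pos hy)
    have hv0 : 0 < ‖mV (rr h) (ex y)‖ := norm_pos_iff.2 fun h => by rw [h] at hv; simp at hv
    have hl := log_two_div_le
    rw [div_le_iff₀ (by positivity)] at hl
    obtain ⟨h1, h2⟩ := norm_mV_le (E := Real.exp (2 * Real.pi * |y.im|)) (rr_nonneg h)
      ((rr_le hh).trans (by norm_num)) (ex_re_pos hy)
      (by rw [norm_ex]; apply Real.exp_le_exp.2; nlinarith [neg_abs_le y.im, Real.pi_pos])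
      (Real.one_le_exp (by positivity))
    constructor
    · have := Real.log_le_log hv0 h1
      rw [Real.log_mul (by norm_num) (Real.exp_ne_zero _), Real.log_exp] at this
      linarith
    · have := Real.log_le_log (mul_pos (rr_pos h) hv0) h2
      have e0 : Real.log (rr h) = -2 * Real.pi * h := Real.log_exp _
      rw [Real.log_mul (rr_pos h).ne' hv0.ne', e0] at this
      linarith
  have h1 := key y hy
  have h2 := key (-y) (by simpa using hy)
  rw [ex_neg, mV_inv (ex_ne_zero y), norm_inv, Real.log_inv, Complex.neg_im, abs_neg] at h2
  exact ⟨abs_le.2 ⟨by linarith [h2.1], h1.1⟩, abs_le.2 ⟨by linarith [h2.2], h1.2⟩⟩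

theorem abs_im_tau_le {y : ℂ} (hy : |y.re| < 1 / 4) :
    α * |(tau α (rr h) y).im| ≤ |y.im| + 3 / 25 ∧ α * |(tau α (rr h) y).im| ≤ h + 3 / 25 := by
  obtain ⟨h1, h2⟩ := abs_log_mV_le hh hy
  have hpi := Real.pi_pos
  have : α * |(tau α (rr h) y).im| = |Real.log ‖mV (rr h) (ex y)‖| / (2 * Real.pi) := by
    rw [tau, Complex.div_ofReal_im, im_lg, abs_div, abs_div, abs_neg, abs_of_pos hα,
      abs_of_pos (show 0 < 2 * Real.pi by positivity)]
    field_simp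
  rw [this, div_le_iff₀ (by positivity), div_le_iff₀ (by positivity)]
  exact ⟨by linarith, by linarith⟩

omit hα hh in
theorem differentiableAt_tau {y : ℂ} (hy : |y.re| < 1 / 4) :
    DifferentiableAt ℂ (tau α (rr h)) y := by
  have hw := ex_re_pos hy
  have hv := mV_re_pos (rr_nonneg h) hw
  have h0 : 0 < (1 + rr h * ex y).re := by
    have := rr_nonneg h
    simp; positivity
  have h1 : 1 + rr h * ex y ≠ 0 := fun h => by rw [h] at h0; simp at h0
  unfold tau
  refine DifferentiableAt.div_const ?_ _
  refine DifferentiableAt.comp (g := lg) (f := fun y => mV (rr h) (ex y)) y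
    (differentiableAt_lg (Or.inl hv)) ?_
  have hex := differentiable_ex y
  unfold mV
  fun_prop (disch := assumption)

open ComplexConjugate in
omit hα hh in
theorem tau_conj {y : ℂ} (hy : |y.re| < 1 / 4) : tau α (rr h) (conj y) = conj (tau α (rr h) y) := by
  have hv := mV_re_pos (rr_nonneg h) (ex_re_pos hy)
  have : mV (rr h) (conj (ex y)) = conj (mV (rr h) (ex y)) := by simp [mV]
  rw [tau, tau, ex_conj, mV_inv (by simpa using ex_ne_zero y), this, lg_inv_conj (Or.inl hv),
    map_div₀, Complex.conj_ofReal]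

omit hα hh in
theorem abs_re_lg_le {u : ℂ} (hu : 0 < u.re) : |(lg u).re| ≤ 1 / 4 := by
  have h1 := (Complex.abs_arg_lt_pi_div_two_iff.2 (Or.inl hu)).le
  have hpi := Real.pi_pos
  rw [re_lg, abs_div, abs_of_pos (show 0 < 2 * Real.pi by positivity), div_le_iff₀ (by positivity)]
  linarith

theorem tau_add_mE {y : ℂ} {t : ℝ} (ht : |α * t| ≤ 1 / 4) (hy : |y.re| < 1 / 4)
    (hb : mB (rr h) (ex (α * t)) (ex y) ≤ 1 / 10)
    (hy' : |(y + mE (rr h) (ex (α * t)) y).re| < 1 / 4) :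
    tau α (rr h) (y + mE (rr h) (ex (α * t)) y) = tau α (rr h) y + t := by
  have hr := rr_nonneg h
  have hw := ex_re_pos hy
  have hv := mV_re_pos hr hw
  have hv' := mV_re_pos hr (ex_re_pos hy')
  have h0 : 0 < (1 + rr h * ex y).re := by simp; positivity
  have h1 : 1 + rr h * ex y ≠ 0 := fun h => by rw [h] at h0; simp at h0
  obtain ⟨d, e⟩ := ex_add_mE hr (rr_le hh) hb
  have e2 := mV_mM hr (rr_le hh) h1 d
  rw [← e] at e2
  have hα' : (α : ℂ) ≠ 0 := by exact_mod_cast hα.ne'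
  have key : lg (mV (rr h) (ex (y + mE (rr h) (ex (α * t)) y))) =
      lg (mV (rr h) (ex y)) + α * t := by
    have hne : mV (rr h) (ex y) ≠ 0 := fun h => by rw [h] at hv; simp at hv
    have hne' : mV (rr h) (ex (y + mE (rr h) (ex (α * t)) y)) ≠ 0 := fun h => by
      rw [h] at hv'; simp at hv'
    have hee : ex (lg (mV (rr h) (ex (y + mE (rr h) (ex (α * t)) y)))) =
      ex (lg (mV (rr h) (ex y)) + α * t) := by rw [ex_lg hne', ex_add (lg _), ex_lg hne, e2, mul_comm]
    apply ex_inj hee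
    have him : (lg (mV (rr h) (ex (y + mE (rr h) (ex (α * t)) y)))-
      (lg (mV (rr h) (ex y)) + α * t)).im = 0 := by
      have h3 := congrArg norm hee
      rw [norm_ex, norm_ex, Real.exp_eq_exp] at h3
      have := mul_left_cancel₀ (by simp : -2 * Real.pi ≠ 0) h3
      rw [Complex.sub_im, this, sub_self]
    rw [← Complex.re_add_im (_ - _), him]
    simp only [Complex.ofReal_zero, zero_mul, add_zero, Complex.norm_real, Real.norm_eq_abs]
    have a1 := abs_le.1 (abs_re_lg_le hv)
    have a2 := abs_le.1 (abs_re_lg_le hv')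
    have a3 := abs_le.1 ht
    have : ((α : ℂ) * t).re = α * t := by simp
    rw [Complex.sub_re, Complex.add_re, this, abs_lt]
    constructor <;> linarith [a1.1, a1.2, a2.1, a2.2, a3.1, a3.2]
  rw [tau, key, tau]; field_simp

theorem zc_small {t : ℂ} (ht : α * |t.im| ≤ h / 2) :
    ‖rr h / ex (α * t)‖ ≤ 1 / 100 ∧ ‖rr h * ex (α * t)‖ ≤ 1 / 100 := by
  have h3 := Real.pi_gt_three
  have e : ((α : ℂ) * t).im = α * t.im := by simp
  rw [norm_div, norm_mul, Complex.norm_real, Real.norm_of_nonneg (rr_nonneg h), norm_ex, rr,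
    ← Real.exp_sub, ← Real.exp_add, e]
  have hb : |α * t.im| ≤ h / 2 := by rwa [abs_mul, abs_of_pos hα]
  obtain ⟨b1, b2⟩ := abs_le.1 hb
  constructor <;> refine exp_le_hundredth ?_ <;> nlinarith

theorem norm_zc_sub_le {t : ℂ} (ht : α * |t.im| ≤ h / 2) : ‖zc α (rr h) t - α * t‖ ≤ 1 / 150 := by
  obtain ⟨h1, h2⟩ := zc_small hα hh ht
  rw [← norm_neg] at h1 h2
  have n1 := norm_lg_one_add_le (h1.trans (by norm_num))
  have n2 := norm_lg_one_add_le (h2.trans (by norm_num))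
  have := norm_sub_le (lg (1 + -(rr h / ex (α * t)))) (lg (1 + -(rr h * ex (α * t))))
  rw [zc, show ∀ a b c : ℂ, a + b - c - a = b - c by intros; ring]
  linarith

theorem ex_zc {t : ℂ} (ht : α * |t.im| ≤ h / 2) : 1 - rr h * ex (α * t) ≠ 0 ∧
    ex (zc α (rr h) t) = (ex (α * t) - rr h) / (1 - rr h * ex (α * t)) := by
  obtain ⟨h1, h2⟩ := zc_small hα hh ht
  rw [← norm_neg] at h1 h2
  have m1 := one_add_ne_zero (h1.trans_lt (by norm_num))
  have m2 := one_add_ne_zero (h2.trans_lt (by norm_num))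
  have hv := ex_ne_zero (α * t)
  rw [← sub_eq_add_neg] at m2
  refine ⟨m2, ?_⟩
  rw [zc, ex_sub, ex_add, ex_lg m1, ← sub_eq_add_neg 1 (rr h * ex (α * t) : ℂ), ex_lg m2,
    ← sub_eq_add_neg, mul_sub, mul_one, mul_div_cancel₀ _ hv]

theorem zc_moebius {t : ℂ} (ht : α * |t.im| ≤ h / 2) :
    ex (zc α (rr h) t) + rr h =
      ex (α * t) * ((1 - rr h ^ 2) / (1 - rr h * ex (α * t))) ∧
    1 + rr h * ex (zc α (rr h) t) = (1 - rr h ^ 2) / (1 - rr h * ex (α * t)) := by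
  obtain ⟨m, e⟩ := ex_zc hα hh ht
  rw [e]
  constructor
  · rw [← mul_div_assoc, eq_div_iff m, add_mul, div_mul_cancel₀ _ m]; ring
  · rw [eq_div_iff m, add_mul, mul_assoc (rr h : ℂ) (_ / _), div_mul_cancel₀ _ m]; ring

theorem tau_zc {t : ℂ} (ht : α * |t.im| ≤ h / 2) (hz : |(zc α (rr h) t).re| < 1 / 4) :
    tau α (rr h) (zc α (rr h) t) = t := by
  obtain ⟨m, e⟩ := ex_zc hα hh ht
  obtain ⟨e1, e2⟩ := zc_moebius hα hh ht
  have hn := norm_zc_sub_le hα hh ht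
  have hα' : (α : ℂ) ≠ 0 := by exact_mod_cast hα.ne'
  have hs := one_sub_sq_ne_zero (rr_nonneg h) (rr_le hh)
  have : mV (rr h) (ex (zc α (rr h) t)) = ex (α * t) := by
    rw [mV, e1, e2, mul_div_assoc, div_self (div_ne_zero hs m), mul_one]
  rw [tau, this, lg_ex, mul_div_cancel_left₀ _ hα']
  have h1 := (Complex.abs_re_le_norm _).trans hn
  rw [Complex.sub_re] at h1
  have h2 := abs_lt.1 hz
  have h3 := abs_le.1 h1
  exact abs_lt.2 ⟨by linarith [h2.1, h3.2], by linarith [h2.2, h3.1]⟩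

theorem zc_eq_add_mE {t t' : ℂ} (ht : α * |t.im| ≤ h / 2) (ht' : α * |t'.im| ≤ h / 2)
    (hd : ‖α * (t' - t)‖ ≤ 1 / 2)
    (hb : mB (rr h) (ex (α * (t' - t))) (ex (zc α (rr h) t)) ≤ 1 / 10) :
    zc α (rr h) t' = zc α (rr h) t + mE (rr h) (ex (α * (t' - t))) (zc α (rr h) t) := by
  have hs := one_sub_sq_ne_zero (rr_nonneg h) (rr_le hh)
  obtain ⟨m, e⟩ := ex_zc hα hh ht
  obtain ⟨m', e'⟩ := ex_zc hα hh ht'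
  obtain ⟨e1, e2⟩ := zc_moebius hα hh ht
  obtain ⟨-, e3⟩ := ex_add_mE (rr_nonneg h) (rr_le hh) hb
  have hu : ex (α * t') = ex (α * (t' - t)) * ex (α * t) := by rw [← ex_add]; congr 1; ring
  have hk : (1 - rr h ^ 2 : ℂ) / (1 - rr h * ex (α * t)) ≠ 0 := div_ne_zero hs m
  apply ex_inj
  · rw [e', e3, mM, e1, e2, hu]
    generalize (1 - rr h ^ 2 : ℂ) / (1 - rr h * ex (α * t)) = k at hk
    rw [show ex (α * (t' - t)) * (ex (α * t) * k) - rr h * k =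
      (ex (α * (t' - t)) * ex (α * t) - rr h) * k by ring,
      show k - ex (α * (t' - t)) * rr h * (ex (α * t) * k) =
      (1 - rr h * (ex (α * (t' - t)) * ex (α * t))) * k by ring, mul_div_mul_right _ _ hk]
  · have n1 := norm_zc_sub_le hα hh ht
    have n2 := norm_zc_sub_le hα hh ht'
    have n3 := norm_mE_le (rr_nonneg h) (rr_le hh) hb
    have := norm_add₄_le (a := zc α (rr h) t' - α * t') (b := -(zc α (rr h) t - α * t))
      (c := α * (t' - t)) (d := - mE (rr h) (ex (α * (t' - t))) (zc α (rr h) t))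
    rw [norm_neg, norm_neg] at this
    refine lt_of_eq_of_lt (congrArg norm ?_) (this.trans_lt (by linarith))
    ring

omit hh in
theorem zc_add_inv {r : ℝ} {t : ℂ} (n : ℤ) : zc α r (t + n / α) = zc α r t + n := by
  have hα' : (α : ℂ) ≠ 0 := by exact_mod_cast hα.ne'
  have : ex (α * (t + n / α)) = ex (α * t) := by
    rw [mul_add, mul_div_cancel₀ _ hα', ex_add, ex_intCast, mul_one]
  rw [zc, zc, this, mul_add, mul_div_cancel₀ _ hα']; ring

open ComplexConjugate in
theorem zc_conj {t : ℂ} (ht : α * |t.im| ≤ h / 2) : zc α (rr h) (conj t) = conj (zc α (rr h) t) := by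
  obtain ⟨h1, h2⟩ := zc_small hα hh ht
  rw [← norm_neg] at h1 h2
  have m1 := one_add_mem_slitPlane (h1.trans_lt (by norm_num))
  have m2 := one_add_mem_slitPlane (h2.trans_lt (by norm_num))
  have e : ex (α * conj t) = (conj (ex (α * t)))⁻¹ := by
    rw [← ex_conj, map_mul, Complex.conj_ofReal]
  have c1 := lg_conj m1
  have c2 := lg_conj m2
  rw [zc, zc, e, map_sub, map_add, map_mul, Complex.conj_ofReal, div_inv_eq_mul, ← div_eq_mul_inv]
  simp only [map_add, map_neg, map_mul, map_div₀, map_one, Complex.conj_ofReal] at c1 c2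
  rw [c1, c2]; ring

theorem hasDerivAt_zc_sub {t : ℂ} (ht : α * |t.im| ≤ h / 2) :
    ∃ d : ℂ, HasDerivAt (fun t : ℂ => zc α (rr h) t - α * t) d t ∧ ‖d‖ ≤ 3 / 100 * α := by
  obtain ⟨h1, h2⟩ := zc_small hα hh ht
  rw [← norm_neg] at h1 h2
  have m1 := one_add_mem_slitPlane (h1.trans_lt (by norm_num))
  have m2 := one_add_mem_slitPlane (h2.trans_lt (by norm_num))
  have hv := ex_ne_zero (α * t)
  have dv : HasDerivAt (fun t : ℂ => ex (α * t)) (2 * Real.pi * Complex.I * α * ex (α * t)) t := by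
    have : HasDerivAt (fun t : ℂ => 2 * Real.pi * Complex.I * (α * t))
        (2 * Real.pi * Complex.I * (α * 1)) t :=
      ((hasDerivAt_id t).const_mul (α : ℂ)).const_mul _
    refine this.cexp.congr_deriv ?_
    rw [ex]; ring
  have d1 : HasDerivAt (fun t : ℂ => lg (1 + -(rr h / ex (α * t))))
      (α * (rr h / ex (α * t)) / (1 + -(rr h / ex (α * t)))) t := by
    have := (((dv.inv hv).const_mul (-(rr h : ℂ))).const_add 1)
    have := (this.clog (by simpa [div_eq_mul_inv] using m1)).div_const (2 * Real.pi * Complex.I)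
    refine (this.congr_deriv ?_).congr_of_eventuallyEq (Eventually.of_forall fun x => ?_)
    · rw [div_div, mul_comm _ (2 * Real.pi * Complex.I : ℂ), ← div_div]
      congr 1
      · rw [div_eq_iff Complex.two_pi_I_ne_zero]
        field_simp
      · simp [div_eq_mul_inv]
    · simp [lg, div_eq_mul_inv]
  have d2 : HasDerivAt (fun t : ℂ => lg (1 + -(rr h * ex (α * t))))
      (- α * (rr h * ex (α * t)) / (1 + -(rr h * ex (α * t)))) t := by
    have := ((dv.const_mul (-(rr h : ℂ))).const_add 1)
    have := (this.clog (by simpa using m2)).div_const (2 * Real.pi * Complex.I)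
    refine (this.congr_deriv ?_).congr_of_eventuallyEq (Eventually.of_forall fun x => ?_)
    · rw [div_div, mul_comm _ (2 * Real.pi * Complex.I : ℂ), ← div_div]
      congr 1
      · rw [div_eq_iff Complex.two_pi_I_ne_zero]
        ring
      · simp
    · simp [lg]
  refine ⟨_, (d1.sub d2).congr_of_eventuallyEq (Eventually.of_forall fun x => ?_), ?_⟩
  · simp [zc]; ring
  · have bd : ∀ x : ℂ, ‖x‖ ≤ 1 / 100 → ‖x / (1 + -x)‖ ≤ 3 / 200 := fun x hx => by
      have : 99 / 100 ≤ ‖1 + -x‖ := by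
        have := norm_sub_le (1 + -x) (-x)
        simp only [add_sub_cancel_right, norm_one, norm_neg] at this
        linarith
      rw [norm_div, div_le_iff₀ (by linarith)]; linarith
    rw [norm_neg] at h1 h2
    have b1 := bd _ h1
    have b2 := bd _ h2
    rw [mul_div_assoc, mul_div_assoc, neg_mul, sub_neg_eq_add, ← mul_add, norm_mul,
      Complex.norm_real, Real.norm_of_nonneg hα.le, mul_comm]
    have := norm_add_le _ _ |>.trans (add_le_add b1 b2)
    gcongr
    linarith

theorem norm_zc_sub_zc_le {t t' : ℂ} (ht : α * |t.im| ≤ h / 2) (ht' : α * |t'.im| ≤ h / 2) :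
    ‖zc α (rr h) t - zc α (rr h) t' - α * (t - t')‖ ≤ 3 / 100 * α * ‖t - t'‖ := by
  have hconv : Convex ℝ {t : ℂ | α * |t.im| ≤ h / 2} := by
    have : {t : ℂ | α * |t.im| ≤ h / 2} = Complex.imLm ⁻¹' (Set.Icc (-(h / 2 / α)) (h / 2 / α)) := by
      ext t
      simp only [Set.mem_setOf_eq, Set.mem_preimage, Complex.imLm_coe, Set.mem_Icc]
      rw [← abs_le, le_div_iff₀ hα, mul_comm]
    rw [this]
    exact (convex_Icc _ _).linear_preimage _
  choose! d hd hd' using fun t (ht : t ∈ {t : ℂ | α * |t.im| ≤ h / 2}) => hasDerivAt_zc_sub hα hh ht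
  have := hconv.norm_image_sub_le_of_norm_hasDerivWithin_le
    (fun x hx => (hd x hx).hasDerivWithinAt) hd' ht' ht
  refine (congrArg norm ?_).trans_le this
  ring
end

/-- Small perturbations of the rotation by `α` on a complex strip, commuting with the unit
translation and with complex conjugation. -/
structure Adm (α S : ℝ) (f : ℂ → ℂ) : Prop where
  diff : DifferentiableOn ℂ f (Strip S)
  add_one : ∀ z, f (z + 1) = f z + 1
  conj : ∀ z ∈ Strip S, f (starRingEnd ℂ z) = starRingEnd ℂ (f z)
  bound : ∀ z ∈ Strip S, ‖f z - z - α‖ ≤ 1 / 200 * Real.exp (-2 * Real.pi * (S - |z.im|))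

theorem norm_ex_sub_one_le {z : ℂ} (hz : ‖z‖ ≤ 1 / 75) : ‖ex z - 1‖ ≤ 7 * ‖z‖ := by
  have hpi := Real.pi_pos
  have hpi' := Real.pi_lt_d2
  have e : ‖2 * Real.pi * Complex.I * z‖ = 2 * Real.pi * ‖z‖ := by
    simp [abs_of_pos hpi]
  have h0 := norm_nonneg z
  have h1 : ‖2 * Real.pi * Complex.I * z‖ ≤ 1 := by rw [e]; nlinarith
  have h2 := Complex.norm_exp_sub_one_sub_id_le h1
  have h3 : ‖ex z - 1‖ ≤ ‖2 * Real.pi * Complex.I * z‖ + ‖2 * Real.pi * Complex.I * z‖ ^ 2 := by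
    calc ‖ex z - 1‖ = ‖2 * Real.pi * Complex.I * z + (ex z - 1 - 2 * Real.pi * Complex.I * z)‖ := by
          congr 1; ring
      _ ≤ _ := (norm_add_le _ _).trans (by gcongr; exact h2)
  rw [e] at h3
  have h4 : 2 * Real.pi * ‖z‖ ≤ 6.3 * ‖z‖ := by gcongr; linarith
  nlinarith [mul_nonneg hpi.le h0]

/-- A translated holomorphic perturbation is admissible for the gluing equation. -/
theorem glueAdm_translate {h δ : ℝ} (hh : 1 ≤ h) (hδ : 0 ≤ δ)
    (hG : glueConst (3 / 16) * δ ≤ 1 / 10 ^ 4) {e : ℂ → ℂ}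
    (hd : DifferentiableOn ℂ e (Rect (1 / 4) (h + 1 / 40)))
    (hb : ∀ y ∈ Rect (1 / 4) (h + 1 / 40), ‖e y‖ ≤ δ * expWeight h y.im) :
    GlueAdm (3 / 16) h (2 * δ) (200 * δ) (1 / 1000) (fun y v => e (y + v)) := by
  have hexp : ∀ {y z : ℂ}, ‖z - y‖ ≤ 1 / 45 → expWeight h z.im ≤ 2 * expWeight h y.im := by
    intro y z hz
    have h1 : |z.im| ≤ |y.im| + 1 / 45 := by
      have := Complex.abs_im_le_norm (z - y)
      have h2 := abs_sub_abs_le_abs_sub z.im y.im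
      rw [Complex.sub_im] at this
      linarith
    have hpi := Real.pi_pos
    have hpi' := Real.pi_lt_d2
    have h2 : Real.exp (Real.log 2) = 2 := Real.exp_log (by norm_num)
    rw [← h2, expWeight, expWeight, ← Real.exp_add, Real.exp_le_exp]
    have := Real.log_two_gt_d9
    nlinarith
  have hmem : ∀ {y z : ℂ}, y ∈ Rect (3 / 16) h → ‖z - y‖ ≤ 1 / 45 → z ∈ Rect (1 / 4) (h + 1 / 40) := by
    intro y z hy hz
    have h1 := Complex.abs_im_le_norm (z - y)
    have h2 := abs_sub_abs_le_abs_sub z.im y.im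
    have h3 := Complex.abs_re_le_norm (z - y)
    have h4 := abs_sub_abs_le_abs_sub z.re y.re
    rw [Complex.sub_im] at h1
    rw [Complex.sub_re] at h3
    exact ⟨by linarith [hy.1], by linarith [hy.2]⟩
  have hgc := glueConst_nonneg (show (0 : ℝ) < 3 / 16 by norm_num)
  refine ⟨by norm_num, by norm_num, by linarith, by linarith, by linarith, by linarith, by linarith,
    ?_, ?_, ?_⟩
  · intro y hy v hv
    have h1 : ‖y + v - y‖ ≤ 1 / 45 := by rw [add_sub_cancel_left]; linarith
    refine (hb _ (hmem hy h1)).trans ?_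
    have := hexp h1
    nlinarith [expWeight_nonneg h y.im]
  · intro y hy v v' hv hv'
    have := norm_sub_le_of_closedBall (U := Metric.ball y (1 / 45)) (ρ := 1 / 50) (y := y)
      (η := 2 * δ * expWeight h y.im) Metric.isOpen_ball
      (hd.mono fun z hz => hmem hy (mem_ball_iff_norm.1 hz).le) (fun z hz => ?_) (by norm_num)
      (Metric.closedBall_subset_ball (by norm_num)) (v := y + v) (v' := y + v')
      (by rw [mem_closedBall_iff_norm, add_sub_cancel_left]; linarith)
      (by rw [mem_closedBall_iff_norm, add_sub_cancel_left]; linarith)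
    · rw [add_sub_add_left_eq_sub] at this
      refine this.trans (le_of_eq ?_)
      ring
    · have hz' := (mem_ball_iff_norm.1 hz).le
      refine (hb z (hmem hy hz')).trans ?_
      nlinarith [hexp hz']
  · intro n hn hn'
    refine hd.comp (differentiableOn_id.add hn) fun y hy => hmem hy ?_
    have := hn' y hy
    simp only [add_sub_cancel_left]
    linarith

/-- Data for one (inverse) renormalisation step. -/
structure StepData (α h₁ h κ α₁ S₁ : ℝ) (a : ℤ) (g : ℂ → ℂ) : Prop where
  α_pos : 0 < α
  α_le : α ≤ 1
  h₁_le : 2 ≤ h₁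
  h_le : 2 ≤ h
  h_ge : 3 / 5 * h₁ + 1 ≤ h
  κ_pos : 0 < κ
  κ_le : κ ≤ 1 / 10 ^ 6
  κ_glue : glueConst (3 / 16) * κ ≤ 1 / 10 ^ 4
  rel : α * Real.exp (-2 * Real.pi * h₁) = κ * Real.exp (-2 * Real.pi * h)
  S₁_le : h₁ + 1 ≤ α * S₁
  adm : Adm α₁ S₁ g
  frac : 1 / α = a + α₁

namespace StepData
variable {α h₁ h κ α₁ S₁ : ℝ} {a : ℤ} {g : ℂ → ℂ}

theorem weight (D : StepData α h₁ h κ α₁ S₁ a g) (η : ℝ) :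
    α * Real.exp (2 * Real.pi * (|η| - h₁)) = κ * expWeight h η := by
  have e1 : Real.exp (2 * Real.pi * (|η| - h₁)) =
      Real.exp (-2 * Real.pi * h₁) * Real.exp (2 * Real.pi * |η|) := by
    rw [← Real.exp_add]; congr 1; ring
  have e2 : expWeight h η = Real.exp (-2 * Real.pi * h) * Real.exp (2 * Real.pi * |η|) := by
    rw [expWeight, ← Real.exp_add]; congr 1; ring
  rw [e1, e2, ← mul_assoc, D.rel]; ring

theorem weight_le (D : StepData α h₁ h κ α₁ S₁ a g) {η : ℝ} (hη : |η| ≤ h + 1 / 20) :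
    κ * expWeight h η ≤ 2 / 10 ^ 6 := by
  have h1 : expWeight h η ≤ 2 := by
    have h2 : Real.exp (Real.log 2) = 2 := Real.exp_log (by norm_num)
    rw [← h2, expWeight, Real.exp_le_exp]
    have := Real.log_two_gt_d9
    nlinarith [Real.pi_pos, Real.pi_lt_d2]
  have := D.κ_le
  have := D.κ_pos
  nlinarith

theorem mB_le (D : StepData α h₁ h κ α₁ S₁ a g) {c : ℂ} (hc : ‖c‖ ≤ 1 / 75) (y : ℂ) :
    mB (rr h₁) (ex (α * c)) (ex y) ≤ 7 * ‖c‖ * (α + 2 * (κ * expWeight h y.im)) := by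
  have hα := D.α_pos
  have hα1 := D.α_le
  have e : ‖(α : ℂ) * c‖ = α * ‖c‖ := by rw [norm_mul, Complex.norm_real, Real.norm_of_nonneg hα.le]
  have h1 : ‖ex (α * c) - 1‖ ≤ 7 * (α * ‖c‖) := by
    rw [← e]; exact norm_ex_sub_one_le (by rw [e]; nlinarith [norm_nonneg c])
  have h2 : rr h₁ / ‖ex y‖ ≤ Real.exp (2 * Real.pi * (|y.im| - h₁)) := by
    rw [norm_ex, rr, ← Real.exp_sub, Real.exp_le_exp]
    nlinarith [Real.pi_pos, le_abs_self y.im]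
  have h3 : rr h₁ * ‖ex y‖ ≤ Real.exp (2 * Real.pi * (|y.im| - h₁)) := by
    rw [norm_ex, rr, ← Real.exp_add, Real.exp_le_exp]
    nlinarith [Real.pi_pos, neg_abs_le y.im]
  have hr := rr_pos h₁
  rw [← D.weight]
  calc mB (rr h₁) (ex (α * c)) (ex y)
      ≤ (7 * (α * ‖c‖)) * (1 + Real.exp (2 * Real.pi * (|y.im| - h₁))
        + Real.exp (2 * Real.pi * (|y.im| - h₁))) := by
          unfold mB; gcongr
    _ = _ := by ring

theorem mB_le_tenth (D : StepData α h₁ h κ α₁ S₁ a g) {c : ℂ} (hc : ‖c‖ ≤ 1 / 75) {y : ℂ}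
    (hy : |y.im| ≤ h + 1 / 20) : mB (rr h₁) (ex (α * c)) (ex y) ≤ 1 / 10 := by
  have h1 := D.mB_le hc y
  have h2 := D.weight_le hy
  have h3 := D.α_le
  have h4 := norm_nonneg c
  nlinarith

theorem norm_mE_le (D : StepData α h₁ h κ α₁ S₁ a g) {c : ℂ} (hc : ‖c‖ ≤ 1 / 75) {y : ℂ}
    (hy : |y.im| ≤ h + 1 / 20) :
    ‖mE (rr h₁) (ex (α * c)) y‖ ≤ 7 / 3 * ‖c‖ * (α + 2 * (κ * expWeight h y.im)) := by
  have h1 := _root_.norm_mE_le (rr_nonneg h₁) (rr_le D.h₁_le) (D.mB_le_tenth hc hy)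
  have h2 := D.mB_le hc y
  linarith

theorem sub_tau_mem (D : StepData α h₁ h κ α₁ S₁ a g) (x : ℝ) {y : ℂ} (hy : |y.re| < 1 / 4) :
    (x - tau α (rr h₁) y) ∈ Strip S₁ ∧
    ‖g (x - tau α (rr h₁) y) - (x - tau α (rr h₁) y) - α₁‖ ≤ 1 / 200 ∧
    ‖g (x - tau α (rr h₁) y) - (x - tau α (rr h₁) y) - α₁‖ ≤
      1 / 200 * Real.exp (2 * Real.pi * (|y.im| - h₁)) := by
  obtain ⟨h1, h2⟩ := abs_im_tau_le D.α_pos D.h₁_le hy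
  have hα := D.α_pos
  have hα1 := D.α_le
  have hS := D.S₁_le
  have e : |(x - tau α (rr h₁) y).im| = |(tau α (rr h₁) y).im| := by simp
  have hm : 22 / 25 ≤ α * (S₁ - |(tau α (rr h₁) y).im|) := by nlinarith
  have hp : 0 < S₁ - |(tau α (rr h₁) y).im| := by
    by_contra hc
    push Not at hc
    nlinarith
  have hmem : (x - tau α (rr h₁) y) ∈ Strip S₁ := by
    rw [Strip, Set.mem_setOf_eq, e]; linarith
  have hb := D.adm.bound _ hmem
  rw [e] at hb
  refine ⟨hmem, hb.trans ?_, hb.trans ?_⟩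
  · have : Real.exp (-2 * Real.pi * (S₁ - |(tau α (rr h₁) y).im|)) ≤ 1 :=
      Real.exp_le_one_iff.2 (by nlinarith [Real.pi_pos])
    linarith
  · gcongr ?_ * Real.exp ?_
    have : h₁ - |y.im| ≤ S₁ - |(tau α (rr h₁) y).im| := by
      by_cases hc : |y.im| ≤ h₁ + 22 / 25
      · nlinarith
      · linarith
    nlinarith [Real.pi_pos]

end StepData

/-- Deviation of `g` from the rotation, at the point with time coordinate `x - τ y`. -/
noncomputable def stepPhase (α h₁ α₁ : ℝ) (g : ℂ → ℂ) (x : ℝ) (y : ℂ) : ℂ :=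
  g (x - tau α (rr h₁) y) - (x - tau α (rr h₁) y) - α₁

/-- Displacement of the transition map of the section, at phase `x`. -/
noncomputable def stepE (α h₁ h α₁ : ℝ) (g : ℂ → ℂ) (x : ℝ) (y : ℂ) : ℂ :=
  open Classical in
  if y ∈ Rect (1 / 4) (h + 1 / 40) then mE (rr h₁) (ex (α * -stepPhase α h₁ α₁ g x y)) y else 0

/-- Time `1/128` of the model flow. -/
noncomputable def stepFlow (α h₁ : ℝ) (y : ℂ) : ℂ :=
  y + mE (rr h₁) (ex (α * (1 / 128 : ℝ))) y

theorem stepFlow_add_int (α h₁ : ℝ) (y : ℂ) (m : ℤ) :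
    stepFlow α h₁ (y + m) = stepFlow α h₁ y + m := by
  simp only [stepFlow, mE, ex_add, ex_intCast, mul_one]; ring

namespace StepData
open ComplexConjugate
variable {α h₁ h κ α₁ S₁ : ℝ} {a : ℤ} {g : ℂ → ℂ} (D : StepData α h₁ h κ α₁ S₁ a g)
include D

theorem norm_phase_le (x : ℝ) {y : ℂ} (hy : |y.re| < 1 / 4) :
    ‖stepPhase α h₁ α₁ g x y‖ ≤ 1 / 200 ∧
    α * ‖stepPhase α h₁ α₁ g x y‖ ≤ 1 / 200 * (κ * expWeight h y.im) := by
  obtain ⟨-, h1, h2⟩ := D.sub_tau_mem x hy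
  refine ⟨h1, ?_⟩
  rw [← D.weight]
  calc _ ≤ α * (1 / 200 * Real.exp (2 * Real.pi * (|y.im| - h₁))) := by
        have := D.α_pos
        gcongr; exact h2
    _ = _ := by ring

theorem norm_stepE_le (x : ℝ) (y : ℂ) :
    ‖stepE α h₁ h α₁ g x y‖ ≤ κ * expWeight h y.im := by
  have hw : 0 ≤ κ * expWeight h y.im := mul_nonneg D.κ_pos.le (expWeight_nonneg _ _)
  rw [stepE]
  split_ifs with hy
  · obtain ⟨h1, h2⟩ := D.norm_phase_le x hy.1
    have := D.norm_mE_le (c := -stepPhase α h₁ α₁ g x y) (by rw [norm_neg]; linarith)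
      (y := y) (by linarith [hy.2])
    rw [norm_neg] at this
    nlinarith [norm_nonneg (stepPhase α h₁ α₁ g x y)]
  · simpa using hw

theorem norm_stepE_le' (x : ℝ) (y : ℂ) : ‖stepE α h₁ h α₁ g x y‖ ≤ 2 / 10 ^ 6 := by
  by_cases hy : y ∈ Rect (1 / 4) (h + 1 / 40)
  · exact (D.norm_stepE_le x y).trans (D.weight_le (by linarith [hy.2]))
  · rw [stepE, if_neg hy, norm_zero]; norm_num

theorem differentiableOn_stepE (x : ℝ) :
    DifferentiableOn ℂ (stepE α h₁ h α₁ g x) (Rect (1 / 4) (h + 1 / 40)) := by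
  have : ∀ y ∈ Rect (1 / 4) (h + 1 / 40),
      stepE α h₁ h α₁ g x y = mE (rr h₁) (ex (α * -stepPhase α h₁ α₁ g x y)) y :=
    fun y hy => by rw [stepE, if_pos hy]
  refine DifferentiableOn.congr ?_ this
  intro y hy
  refine DifferentiableAt.differentiableWithinAt ?_
  obtain ⟨h1, h2⟩ := D.norm_phase_le x hy.1
  obtain ⟨hm, -⟩ := D.sub_tau_mem x hy.1
  refine differentiableAt_mE (u := fun y => ex (α * -stepPhase α h₁ α₁ g x y)) (rr_nonneg h₁)
    (rr_le D.h₁_le) ?_ (D.mB_le_tenth (by rw [norm_neg]; linarith) (by linarith [hy.2]))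
  have hs : DifferentiableAt ℂ (fun y => (x - tau α (rr h₁) y)) y :=
    (differentiableAt_const _).sub (differentiableAt_tau hy.1)
  have hg : DifferentiableAt ℂ g (x - tau α (rr h₁) y) :=
    D.adm.diff.differentiableAt ((isOpen_Strip _).mem_nhds hm)
  have hp : DifferentiableAt ℂ (stepPhase α h₁ α₁ g x) y := by
    unfold stepPhase
    exact ((DifferentiableAt.comp y hg hs).sub hs).sub (differentiableAt_const _)
  exact (differentiable_ex _).comp y ((differentiableAt_const _).mul hp.neg)

theorem stepE_conj (x : ℝ) (y : ℂ) :
    stepE α h₁ h α₁ g x (conj y) = conj (stepE α h₁ h α₁ g x y) := by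
  by_cases hy : y ∈ Rect (1 / 4) (h + 1 / 40)
  · have hy' : conj y ∈ Rect (1 / 4) (h + 1 / 40) := by simpa [Rect] using hy
    obtain ⟨hm, -⟩ := D.sub_tau_mem x hy.1
    have hp : stepPhase α h₁ α₁ g x (conj y) = conj (stepPhase α h₁ α₁ g x y) := by
      rw [stepPhase, tau_conj hy.1, stepPhase, map_sub, map_sub,
        ← D.adm.conj _ hm, map_sub, Complex.conj_ofReal, Complex.conj_ofReal]
    obtain ⟨h1, h2⟩ := D.norm_phase_le x hy.1
    obtain ⟨h1', h2'⟩ := D.norm_phase_le x hy'.1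
    rw [stepE, stepE, if_pos hy, if_pos hy']
    refine mE_conj (rr_nonneg h₁) (rr_le D.h₁_le) ?_
      (D.mB_le_tenth (by rw [norm_neg]; linarith) (by linarith [hy.2]))
      (D.mB_le_tenth (by rw [norm_neg]; linarith) (by linarith [hy'.2]))
    have : (α : ℂ) * -conj (stepPhase α h₁ α₁ g x y) = conj ((α : ℂ) * -stepPhase α h₁ α₁ g x y) := by
      simp
    rw [hp, this, ex_conj, inv_mul_cancel₀]
    simpa using ex_ne_zero _
  · have hy' : ¬ conj y ∈ Rect (1 / 4) (h + 1 / 40) := by simpa [Rect] using hy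
    rw [stepE, stepE, if_neg hy, if_neg hy', map_zero]

theorem stepE_add_one (x : ℝ) (y : ℂ) :
    stepE α h₁ h α₁ g (x + 1) y = stepE α h₁ h α₁ g x y := by
  have : stepPhase α h₁ α₁ g (x + 1) y = stepPhase α h₁ α₁ g x y := by
    simp only [stepPhase]
    rw [show ((x + 1 : ℝ) : ℂ) - tau α (rr h₁) y = x - tau α (rr h₁) y + 1 by push_cast; ring,
      D.adm.add_one]
    ring
  simp only [stepE, this]

theorem glueAdm (x : ℝ) : GlueAdm (3 / 16) h (2 * κ) (200 * κ) (1 / 1000)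
    (fun y v => stepE α h₁ h α₁ g x (y + v)) :=
  glueAdm_translate (by linarith [D.h_le]) D.κ_pos.le D.κ_glue (D.differentiableOn_stepE x)
    fun y _ => D.norm_stepE_le x y

theorem norm_stepFlow_sub_le {y : ℂ} (hy : |y.im| ≤ h + 1 / 20) :
    ‖stepFlow α h₁ y - y‖ ≤ 19 / 1000 := by
  have hc : ‖((1 / 128 : ℝ) : ℂ)‖ = 1 / 128 := by rw [Complex.norm_real]; norm_num
  have := D.norm_mE_le (c := (1 / 128 : ℝ)) (by rw [hc]; norm_num) hy
  rw [hc] at this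
  rw [stepFlow, add_sub_cancel_left]
  nlinarith [D.weight_le hy, D.α_le]

theorem mB_stepFlow_le {y : ℂ} (hy : |y.im| ≤ h + 1 / 20) :
    mB (rr h₁) (ex (α * (1 / 128 : ℝ))) (ex y) ≤ 1 / 10 :=
  D.mB_le_tenth (by rw [Complex.norm_real]; norm_num) hy

theorem differentiableAt_stepFlow {y : ℂ} (hy : |y.im| ≤ h + 1 / 20) :
    DifferentiableAt ℂ (stepFlow α h₁) y := by
  refine differentiableAt_id.add ?_
  exact differentiableAt_mE (u := fun _ => ex (α * (1 / 128 : ℝ))) (rr_nonneg h₁) (rr_le D.h₁_le)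
    (differentiableAt_const _) (D.mB_stepFlow_le hy)

theorem stepFlow_conj {y : ℂ} (hy : |y.im| ≤ h + 1 / 20) :
    stepFlow α h₁ (conj y) = conj (stepFlow α h₁ y) := by
  rw [stepFlow, stepFlow, map_add, mE_conj (rr_nonneg h₁) (rr_le D.h₁_le) ?_ (D.mB_stepFlow_le hy)
    (D.mB_stepFlow_le (by simpa using hy))]
  have : (α : ℂ) * (1 / 128 : ℝ) = conj ((α : ℂ) * (1 / 128 : ℝ)) := by
    rw [map_mul, Complex.conj_ofReal, Complex.conj_ofReal]
  nth_rw 1 [this]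
  rw [ex_conj, inv_mul_cancel₀]
  simpa using ex_ne_zero _

/-- The model flow conjugates the transition maps at different phases. -/
theorem stepFlow_add_stepE (x : ℝ) {y : ℂ} (hy : y ∈ Rect (1 / 4) (h + 1 / 40))
    (hy' : stepFlow α h₁ y ∈ Rect (1 / 4) (h + 1 / 40)) :
    stepFlow α h₁ (y + stepE α h₁ h α₁ g x y) =
      stepFlow α h₁ y + stepE α h₁ h α₁ g (x + 1 / 128) (stepFlow α h₁ y) := by
  have hα := D.α_pos
  have hα1 := D.α_le
  obtain ⟨h1, h2⟩ := D.norm_phase_le x hy.1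
  have hyi := hy.2
  have hyi' := hy'.2
  have hE := D.norm_stepE_le' x y
  have hτ : tau α (rr h₁) (stepFlow α h₁ y) = tau α (rr h₁) y + (1 / 128 : ℝ) := by
    refine tau_add_mE hα D.h₁_le ?_ hy.1 (D.mB_stepFlow_le (by linarith)) hy'.1
    rw [abs_of_nonneg (by positivity)]; linarith
  have hp : stepPhase α h₁ α₁ g (x + 1 / 128) (stepFlow α h₁ y) = stepPhase α h₁ α₁ g x y := by
    have : ((x + 1 / 128 : ℝ) : ℂ) - tau α (rr h₁) (stepFlow α h₁ y) = x - tau α (rr h₁) y := by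
      rw [hτ]; push_cast; ring
    rw [stepPhase, this]; rfl
  rw [stepE, stepE, if_pos hy, if_pos hy', hp]
  rw [stepE, if_pos hy] at hE
  set c := -stepPhase α h₁ α₁ g x y with hc
  have hcn : ‖c‖ ≤ 1 / 200 := by rw [hc, norm_neg]; exact h1
  have him : |(y + mE (rr h₁) (ex (α * c)) y).im| ≤ h + 1 / 20 := by
    have := Complex.abs_im_le_norm (mE (rr h₁) (ex (α * c)) y)
    rw [Complex.add_im]
    refine (abs_add_le _ _).trans ?_
    linarith
  have hsum : ex (α * c) * ex (α * (1 / 128 : ℝ)) = ex (α * (c + (1 / 128 : ℝ))) := by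
    rw [← ex_add]; congr 1; ring
  have hsn : ‖c + ((1 / 128 : ℝ) : ℂ)‖ ≤ 1 / 75 := by
    refine (norm_add_le _ _).trans ?_
    rw [Complex.norm_real]; norm_num; linarith
  have hb := D.mB_le_tenth hsn (y := y) (by linarith)
  have e1 := mE_mul (rr_nonneg h₁) (rr_le D.h₁_le) (u := ex (α * c)) (u' := ex (α * (1 / 128 : ℝ)))
    (y := y) (D.mB_le_tenth (by linarith) (by linarith)) (D.mB_stepFlow_le him)
    (by rw [mul_comm, hsum]; exact hb)
  have e2 := mE_mul (rr_nonneg h₁) (rr_le D.h₁_le) (u' := ex (α * c)) (u := ex (α * (1 / 128 : ℝ)))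
    (y := y) (D.mB_stepFlow_le (by linarith))
    (D.mB_le_tenth (by linarith) (by rw [stepFlow] at hyi'; linarith)) (by rw [hsum]; exact hb)
  rw [mul_comm] at e1
  rw [e1] at e2
  simp only [stepFlow]
  rw [add_assoc, e2, ← add_assoc]

end StepData

/-- Uniformizing coordinate of the glued surface at phase `x`. -/
noncomputable def stepN (α h₁ h α₁ : ℝ) (g : ℂ → ℂ) (x : ℝ) (y : ℂ) : ℂ :=
  y + glueSol (3 / 16) h (fun y v => stepE α h₁ h α₁ g x (y + v)) y

/-- Inverse of the uniformizing coordinate. -/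
noncomputable def stepP (α h₁ h α₁ : ℝ) (g : ℂ → ℂ) (x : ℝ) : ℂ → ℂ :=
  Function.invFunOn (stepN α h₁ h α₁ g x) (WideRect (3 / 16) h)

/-- Domain of the inverse of the uniformizing coordinate. -/
def InvRect (h : ℝ) : Set ℂ := {z | -9 / 8 < z.re ∧ z.re < 1 / 8 ∧ |z.im| < h - 1 / 16}

theorem isOpen_InvRect (h : ℝ) : IsOpen (InvRect h) :=
  (isOpen_lt continuous_const Complex.continuous_re).inter
    ((isOpen_lt Complex.continuous_re continuous_const).inter (isOpen_Strip _))

theorem convex_InvRect (h : ℝ) : Convex ℝ (InvRect h) := by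
  have : InvRect h = Complex.re ⁻¹' Set.Ioo (-9 / 8) (1 / 8) ∩
      Complex.im ⁻¹' Set.Ioo (-(h - 1 / 16)) (h - 1 / 16) := by
    ext z; simp [InvRect, abs_lt, and_assoc]
  rw [this]
  exact ((convex_Ioo _ _).linear_preimage Complex.reLm).inter
    ((convex_Ioo _ _).linear_preimage Complex.imLm)

/-- The short-time map of the glued surface on a fundamental domain. -/
noncomputable def stepFund (α h₁ h α₁ : ℝ) (g : ℂ → ℂ) (x : ℝ) (y : ℂ) : ℂ :=
  stepP α h₁ h α₁ g (x + 1 / 128) (stepFlow α h₁ (stepN α h₁ h α₁ g x y))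

/-- The composition of the first `k` short-time maps. -/
noncomputable def stepIter (α h₁ h α₁ : ℝ) (g : ℂ → ℂ) : ℕ → ℂ → ℂ
  | 0 => id
  | k + 1 => fun z => perExt (stepFund α h₁ h α₁ g (k / 128)) (stepIter α h₁ h α₁ g k z)

/-- The map with rotation number `α` obtained from `g`. -/
noncomputable def stepMap (α h₁ h α₁ : ℝ) (g : ℂ → ℂ) : ℂ → ℂ := stepIter α h₁ h α₁ g 128

namespace StepData
open ComplexConjugate
variable {α h₁ h κ α₁ S₁ : ℝ} {a : ℤ} {g : ℂ → ℂ} (D : StepData α h₁ h κ α₁ S₁ a g)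
include D

theorem norm_glueSol_le (x : ℝ) {y : ℂ} (hy : y ∈ WideRect (3 / 16) h) :
    ‖glueSol (3 / 16) h (fun y v => stepE α h₁ h α₁ g x (y + v)) y‖ ≤ 1 / 1000 :=
  ((D.glueAdm x).norm_sol hy).trans (by linarith [D.κ_glue])

theorem stepN_sub (x : ℝ) {y : ℂ} (hy : y ∈ WideRect (3 / 16) h) :
    ‖stepN α h₁ h α₁ g x y - y‖ ≤ 1 / 1000 := by
  rw [stepN, add_sub_cancel_left]; exact D.norm_glueSol_le x hy

theorem stepN_diff (x : ℝ) : DifferentiableOn ℂ (stepN α h₁ h α₁ g x) (WideRect (3 / 16) h) :=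
  differentiableOn_id.add (D.glueAdm x).sol_diff

theorem stepN_conj (x : ℝ) {y : ℂ} (hy : y ∈ WideRect (3 / 16) h) :
    stepN α h₁ h α₁ g x (conj y) = conj (stepN α h₁ h α₁ g x y) := by
  rw [stepN, stepN, map_add, (D.glueAdm x).sol_conj (fun y v => ?_) hy]
  rw [← map_add, D.stepE_conj]

theorem stepN_sub_one (x : ℝ) {y : ℂ} (hy : y ∈ Rect (3 / 16) h) :
    stepN α h₁ h α₁ g x (y - 1) =
      stepN α h₁ h α₁ g x y + stepE α h₁ h α₁ g x (stepN α h₁ h α₁ g x y) - 1 := by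
  have := (D.glueAdm x).sol_eq hy
  rw [sub_eq_iff_eq_add] at this
  rw [stepN, this, stepN]; ring

theorem stepN_add_one (x : ℝ) : stepN α h₁ h α₁ g (x + 1) = stepN α h₁ h α₁ g x := by
  ext y
  simp only [stepN, D.stepE_add_one]

theorem stepP_add_one (x : ℝ) : stepP α h₁ h α₁ g (x + 1) = stepP α h₁ h α₁ g x := by
  simp only [stepP, D.stepN_add_one]

theorem stepP_spec (x : ℝ) : DifferentiableOn ℂ (stepP α h₁ h α₁ g x) (InvRect h) ∧
    ∀ y ∈ InvRect h, stepP α h₁ h α₁ g x y ∈ WideRect (3 / 16) h ∧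
      ‖stepP α h₁ h α₁ g x y - y‖ ≤ 1 / 1000 ∧ stepN α h₁ h α₁ g x (stepP α h₁ h α₁ g x y) = y ∧
      (∀ v ∈ WideRect (3 / 16) h, stepN α h₁ h α₁ g x v = y → v = stepP α h₁ h α₁ g x y) ∧
      ‖deriv (stepP α h₁ h α₁ g x) y‖ ≤ 25 / 24 := by
  obtain ⟨P, hP, hP'⟩ := exists_inverse (isOpen_WideRect (3 / 16) h) (isOpen_InvRect h)
    (D.glueAdm x).sol_diff (fun v hv => D.norm_glueSol_le x hv) (ρ := 1 / 20) (by norm_num)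
    (by norm_num) (fun y hy z hz => by
      have hz' := mem_closedBall_iff_norm.1 hz
      have h1 := (Complex.abs_im_le_norm _).trans hz'
      have h2 := abs_sub_abs_le_abs_sub z.im y.im
      have h3 := (Complex.abs_re_le_norm _).trans hz'
      rw [Complex.sub_im] at h1
      rw [Complex.sub_re] at h3
      obtain ⟨h4, h5⟩ := abs_le.1 h3
      obtain ⟨h6, h7, h8⟩ := hy
      exact ⟨by linarith, by linarith, by linarith⟩)
  have heq : Set.EqOn (stepP α h₁ h α₁ g x) P (InvRect h) := fun y hy => by
    obtain ⟨p1, p2, p3, p4, p5⟩ := hP' y hy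
    have hex : ∃ v ∈ WideRect (3 / 16) h, stepN α h₁ h α₁ g x v = y := ⟨P y, p1, p3⟩
    exact p4 _ (Function.invFunOn_mem hex) (Function.invFunOn_eq hex)
  refine ⟨hP.congr heq, fun y hy => ?_⟩
  obtain ⟨p1, p2, p3, p4, p5⟩ := hP' y hy
  have hd : deriv (stepP α h₁ h α₁ g x) y = deriv P y :=
    (heq.eventuallyEq_of_mem ((isOpen_InvRect h).mem_nhds hy)).deriv_eq
  rw [hd, heq hy]
  exact ⟨p1, p2, p3, p4, p5.trans (by norm_num)⟩

theorem stepP_lipschitz (x : ℝ) {y y' : ℂ} (hy : y ∈ InvRect h) (hy' : y' ∈ InvRect h) :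
    ‖stepP α h₁ h α₁ g x y - stepP α h₁ h α₁ g x y'‖ ≤ 25 / 24 * ‖y - y'‖ := by
  obtain ⟨hd, hs⟩ := D.stepP_spec x
  exact (convex_InvRect h).norm_image_sub_le_of_norm_deriv_le
    (fun z hz => hd.differentiableAt ((isOpen_InvRect h).mem_nhds hz))
    (fun z hz => (hs z hz).2.2.2.2) hy' hy

theorem stepP_conj (x : ℝ) {y : ℂ} (hy : y ∈ InvRect h) :
    stepP α h₁ h α₁ g x (conj y) = conj (stepP α h₁ h α₁ g x y) := by
  have hy' : conj y ∈ InvRect h := by simpa [InvRect] using hy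
  obtain ⟨p1, p2, p3, p4, p5⟩ := (D.stepP_spec x).2 y hy
  refine ((D.stepP_spec x).2 _ hy').2.2.2.1 _ (by simpa [WideRect] using p1) ?_ |>.symm
  rw [D.stepN_conj x p1, p3]

theorem stepP_sub_one (x : ℝ) {y : ℂ} (hy : y ∈ InvRect h) (hyr : -1 / 8 < y.re)
    (hy' : y + stepE α h₁ h α₁ g x y - 1 ∈ InvRect h) :
    stepP α h₁ h α₁ g x (y + stepE α h₁ h α₁ g x y - 1) = stepP α h₁ h α₁ g x y - 1 := by
  obtain ⟨p1, p2, p3, p4, p5⟩ := (D.stepP_spec x).2 y hy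
  have hre := abs_le.1 ((Complex.abs_re_le_norm _).trans p2)
  rw [Complex.sub_re] at hre
  have hR : stepP α h₁ h α₁ g x y ∈ Rect (3 / 16) h :=
    ⟨abs_lt.2 ⟨by linarith [hre.1], by linarith [hre.2, hy.2.1]⟩, p1.2.2⟩
  refine (((D.stepP_spec x).2 _ hy').2.2.2.1 _ (sub_one_mem_WideRect (by norm_num) hR) ?_).symm
  rw [D.stepN_sub_one x hR, p3]

/-- Basic location estimates for the short-time map. -/
theorem stepFund_aux (x : ℝ) {y : ℂ} (hy : y ∈ FundRect (h - 1 / 10)) :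
    y ∈ WideRect (3 / 16) h ∧ ‖stepN α h₁ h α₁ g x y - y‖ ≤ 1 / 1000 ∧
    |(stepN α h₁ h α₁ g x y).im| < h - 1 / 16 ∧
    ‖stepFlow α h₁ (stepN α h₁ h α₁ g x y) - y‖ ≤ 1 / 50 ∧
    stepFlow α h₁ (stepN α h₁ h α₁ g x y) ∈ InvRect h := by
  obtain ⟨h1, h2, h3⟩ := hy
  have hW : y ∈ WideRect (3 / 16) h := ⟨by linarith, by linarith, by linarith⟩
  have hN := D.stepN_sub x hW
  have i1 := (Complex.abs_im_le_norm _).trans hN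
  have i2 := abs_sub_abs_le_abs_sub (stepN α h₁ h α₁ g x y).im y.im
  rw [Complex.sub_im] at i1
  have hF := D.norm_stepFlow_sub_le (y := stepN α h₁ h α₁ g x y) (by linarith)
  have hF' : ‖stepFlow α h₁ (stepN α h₁ h α₁ g x y) - y‖ ≤ 1 / 50 := by
    have := norm_sub_le_norm_sub_add_norm_sub (stepFlow α h₁ (stepN α h₁ h α₁ g x y))
      (stepN α h₁ h α₁ g x y) y
    linarith
  refine ⟨hW, hN, by linarith, hF', ?_⟩
  have j1 := (Complex.abs_im_le_norm _).trans hF'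
  have j2 := abs_sub_abs_le_abs_sub (stepFlow α h₁ (stepN α h₁ h α₁ g x y)).im y.im
  have j3 := abs_le.1 ((Complex.abs_re_le_norm _).trans hF')
  rw [Complex.sub_im] at j1
  rw [Complex.sub_re] at j3
  exact ⟨by linarith [j3.1], by linarith [j3.2], by linarith⟩

theorem stepFund_sub (x : ℝ) {y : ℂ} (hy : y ∈ FundRect (h - 1 / 10)) :
    ‖stepFund α h₁ h α₁ g x y - y‖ ≤ 21 / 1000 := by
  obtain ⟨h1, h2, h3, h4, h5⟩ := D.stepFund_aux x hy
  obtain ⟨p1, p2, p3, p4, p5⟩ := (D.stepP_spec (x + 1 / 128)).2 _ h5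
  have := norm_sub_le_norm_sub_add_norm_sub (stepFund α h₁ h α₁ g x y)
    (stepFlow α h₁ (stepN α h₁ h α₁ g x y)) y
  rw [stepFund] at this ⊢
  linarith

theorem stepFund_diff (x : ℝ) :
    DifferentiableOn ℂ (stepFund α h₁ h α₁ g x) (FundRect (h - 1 / 10)) := by
  intro y hy
  obtain ⟨h1, h2, h3, h4, h5⟩ := D.stepFund_aux x hy
  have d1 := (D.stepN_diff x).differentiableAt ((isOpen_WideRect _ _).mem_nhds h1)
  have d2 := D.differentiableAt_stepFlow (y := stepN α h₁ h α₁ g x y) (by linarith)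
  have d3 := (D.stepP_spec (x + 1 / 128)).1.differentiableAt ((isOpen_InvRect _).mem_nhds h5)
  exact (DifferentiableAt.comp (g := stepP α h₁ h α₁ g (x + 1 / 128)) y d3
    (DifferentiableAt.comp y d2 d1)).differentiableWithinAt

theorem stepFund_conj (x : ℝ) {y : ℂ} (hy : y ∈ FundRect (h - 1 / 10)) :
    stepFund α h₁ h α₁ g x (conj y) = conj (stepFund α h₁ h α₁ g x y) := by
  obtain ⟨h1, h2, h3, h4, h5⟩ := D.stepFund_aux x hy
  rw [stepFund, D.stepN_conj x h1, D.stepFlow_conj (by linarith), D.stepP_conj _ h5]; rfl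

theorem stepFund_sub_one (x : ℝ) {y : ℂ} (hyr : |y.re| < 1 / 10) (hyi : |y.im| < h - 1 / 10) :
    stepFund α h₁ h α₁ g x (y - 1) = stepFund α h₁ h α₁ g x y - 1 := by
  obtain ⟨b1, b2⟩ := abs_lt.1 hyr
  obtain ⟨h1, h2, h3, h4, h5⟩ := D.stepFund_aux x (y := y) ⟨by linarith, by linarith, hyi⟩
  obtain ⟨h1', h2', h3', h4', h5'⟩ := D.stepFund_aux x (y := y - 1)
    ⟨by simp; linarith, by simp; linarith, by simpa using hyi⟩
  have hR : y ∈ Rect (3 / 16) h := ⟨by linarith, by linarith⟩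
  have hN := D.stepN_sub_one x hR
  have hre := (Complex.abs_re_le_norm _).trans h2
  have hre2 := abs_sub_abs_le_abs_sub (stepN α h₁ h α₁ g x y).re y.re
  rw [Complex.sub_re] at hre
  have hre' := abs_le.1 ((Complex.abs_re_le_norm _).trans h4)
  rw [Complex.sub_re] at hre'
  have key : stepFlow α h₁ (stepN α h₁ h α₁ g x (y - 1)) = stepFlow α h₁ (stepN α h₁ h α₁ g x y)
      + stepE α h₁ h α₁ g (x + 1 / 128) (stepFlow α h₁ (stepN α h₁ h α₁ g x y)) - 1 := by
    rw [hN, ← D.stepFlow_add_stepE x ⟨by linarith, by linarith⟩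
      ⟨abs_lt.2 ⟨by linarith [hre'.1], by linarith [hre'.2]⟩, by linarith [h5.2.2]⟩]
    have := stepFlow_add_int α h₁ (stepN α h₁ h α₁ g x y
      + stepE α h₁ h α₁ g x (stepN α h₁ h α₁ g x y)) (-1)
    push_cast at this
    rwa [← sub_eq_add_neg, ← sub_eq_add_neg] at this
  rw [key] at h5'
  rw [stepFund, key, D.stepP_sub_one _ h5 (by linarith [hre'.1]) h5', stepFund]

theorem stepIter_spec (k : ℕ) :
    (∀ z, stepIter α h₁ h α₁ g k (z + 1) = stepIter α h₁ h α₁ g k z + 1) ∧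
    DifferentiableOn ℂ (stepIter α h₁ h α₁ g k) (Strip (h - 1 / 10 - 21 / 1000 * k)) ∧
    ∀ z ∈ Strip (h - 1 / 10 - 21 / 1000 * k),
      ‖stepIter α h₁ h α₁ g k z - z‖ ≤ 21 / 1000 * k ∧
      stepIter α h₁ h α₁ g k (conj z) = conj (stepIter α h₁ h α₁ g k z) := by
  induction k with
  | zero => exact ⟨fun z => rfl, differentiableOn_id, fun z hz => by simp [stepIter]⟩
  | succ k ih =>
    obtain ⟨i1, i2, i3⟩ := ih
    have hsub : Strip (h - 1 / 10 - 21 / 1000 * (k + 1 : ℕ)) ⊆ Strip (h - 1 / 10 - 21 / 1000 * k) :=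
      fun z hz => by
        have : |z.im| < h - 1 / 10 - 21 / 1000 * (k + 1 : ℕ) := hz
        push_cast at this
        exact show |z.im| < _ by linarith
    have hmem : ∀ z ∈ Strip (h - 1 / 10 - 21 / 1000 * (k + 1 : ℕ)),
        stepIter α h₁ h α₁ g k z ∈ Strip (h - 1 / 10) := fun z hz => by
      have h1 := (Complex.abs_im_le_norm _).trans (i3 z (hsub hz)).1
      have h2 := abs_sub_abs_le_abs_sub (stepIter α h₁ h α₁ g k z).im z.im
      have : |z.im| < h - 1 / 10 - 21 / 1000 * (k + 1 : ℕ) := hz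
      rw [Complex.sub_im] at h1
      push_cast at this
      show |(stepIter α h₁ h α₁ g k z).im| < _
      linarith
    have hper : ∀ y : ℂ, |y.re| < 1 / 10 → |y.im| < h - 1 / 10 →
      stepFund α h₁ h α₁ g (k / 128) (y - 1) = stepFund α h₁ h α₁ g (k / 128) y - 1 :=
        fun y => D.stepFund_sub_one _
    refine ⟨fun z => ?_, ?_, fun z hz => ⟨?_, ?_⟩⟩
    · simp only [stepIter, i1, perExt_add_one]
    · exact (perExt_differentiableOn hper (D.stepFund_diff _)).comp (i2.mono hsub) hmem
    · have h1 := norm_perExt_sub_le (fun y hy => D.stepFund_sub (k / 128) hy) (hmem z hz)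
      have h2 := (i3 z (hsub hz)).1
      have := norm_sub_le_norm_sub_add_norm_sub (stepIter α h₁ h α₁ g (k + 1) z)
        (stepIter α h₁ h α₁ g k z) z
      simp only [stepIter] at this ⊢
      push_cast
      linarith
    · simp only [stepIter]
      rw [(i3 z (hsub hz)).2, perExt_conj hper (fun y hy => D.stepFund_conj _ hy) (hmem z hz)]

theorem stepMap_adm {S : ℝ} (hS : S ≤ h - 5) {x₀ : ℝ}
    (hx : stepMap α h₁ h α₁ g x₀ = x₀ + α) (hS' : 0 < S) : Adm α S (stepMap α h₁ h α₁ g) := by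
  obtain ⟨i1, i2, i3⟩ := D.stepIter_spec 128
  have hsub : Strip (h - 3) ⊆ Strip (h - 1 / 10 - 21 / 1000 * (128 : ℕ)) := fun z hz => by
    have : |z.im| < h - 3 := hz
    push_cast
    exact show |z.im| < _ by linarith
  have hsub' : Strip S ⊆ Strip (h - 3) := fun z hz => by
    have : |z.im| < S := hz
    exact show |z.im| < _ by linarith
  refine ⟨i2.mono (hsub'.trans hsub), i1, fun z hz => (i3 z (hsub (hsub' hz))).2, fun z hz => ?_⟩
  have hα := D.α_pos
  have hα1 := D.α_le
  have := norm_le_decay (ψ := fun z => stepMap α h₁ h α₁ g z - z - α) (H := h - 3) (B := 4)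
    (x₀ := x₀) (z := z) ?_ ?_ ?_ (by simp) (by simp [hx]) (hsub' hz)
  · refine this.trans ?_
    have e : Real.exp (-2 * Real.pi * (h - 3 - |z.im|)) =
        Real.exp (-2 * Real.pi * (h - 3 - S)) * Real.exp (-2 * Real.pi * (S - |z.im|)) := by
      rw [← Real.exp_add]; congr 1; ring
    have h1 : Real.exp (-2 * Real.pi * (h - 3 - S)) ≤ 1 / 48000 := by
      have h2 : Real.exp (-2 * Real.pi * (h - 3 - S)) ≤ Real.exp (-12) :=
        Real.exp_le_exp.2 (by nlinarith [Real.pi_gt_three])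
      have h3 : Real.exp 12 * Real.exp (-12) = 1 := by rw [← Real.exp_add]; simp
      have h4 : (48000 : ℝ) ≤ Real.exp 12 := by
        rw [show (12 : ℝ) = (12 : ℕ) * 1 by norm_num, Real.exp_nat_mul]
        calc (48000 : ℝ) ≤ (2.7182818283 : ℝ) ^ 12 := by norm_num
          _ ≤ _ := by gcongr; exact Real.exp_one_gt_d9.le
      nlinarith [Real.exp_pos (-12)]
    rw [e]
    nlinarith [Real.exp_pos (-2 * Real.pi * (S - |z.im|))]
  · exact ((i2.mono hsub).sub differentiableOn_id).sub (differentiableOn_const _)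
  · intro z
    show stepMap α h₁ h α₁ g (z + 1) - (z + 1) - α = _
    rw [stepMap, i1]; ring
  · intro z hz
    have h1 := (i3 z (hsub hz)).1
    have h2 := norm_sub_le (stepMap α h₁ h α₁ g z - z) α
    rw [Complex.norm_real, Real.norm_of_nonneg hα.le] at h2
    rw [← stepMap] at h1
    push_cast at h1
    show ‖stepMap α h₁ h α₁ g z - z - α‖ ≤ 4
    linarith

end StepData

/-- A family of orbits of `g` indexed by a lattice, of imaginary part at most `u`. -/
structure LatOrbit (u : ℝ) (g : ℂ → ℂ) (o : ℤ → ℤ → ℂ) : Prop where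
  step : ∀ j k, g (o j k) = o (j + 1) k
  shift : ∀ j k, o j (k + 1) = o j k + 1
  im_le : ∀ j k, |(o j k).im| ≤ u

theorem LatOrbit.shift_int {u : ℝ} {g : ℂ → ℂ} {o : ℤ → ℤ → ℂ} (O : LatOrbit u g o) (j k m : ℤ) :
    o j (k + m) = o j k + m := by
  induction m using Int.induction_on with
  | zero => simp
  | succ i ih => rw [← add_assoc, O.shift, ih]; push_cast; ring
  | pred i ih =>
    have := O.shift j (k + (-(i : ℤ) - 1))
    rw [show k + (-(i : ℤ) - 1) + 1 = k + -(i : ℤ) by ring, ih] at this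
    rw [eq_sub_of_add_eq this.symm]; push_cast; ring

/-- Time coordinates of the orbit family seen by the renormalised dynamics. -/
noncomputable def stepTime (a : ℤ) (o : ℤ → ℤ → ℂ) (x : ℝ) (j k : ℤ) : ℂ :=
  x - o (-k) (-j - a * k)

/-- Positions of the orbit family along the model flow. -/
noncomputable def stepPos (α h₁ : ℝ) (a : ℤ) (o : ℤ → ℤ → ℂ) (x : ℝ) (j k : ℤ) : ℂ :=
  zc α (rr h₁) (stepTime a o x j k)

/-- The transported orbit family. -/
noncomputable def stepOrb (α h₁ h α₁ : ℝ) (a : ℤ) (g : ℂ → ℂ) (o : ℤ → ℤ → ℂ) (x : ℝ) (j k : ℤ) : ℂ :=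
  open Classical in
  if H : ∃ m : ℤ, -11 / 10 < (stepPos α h₁ a o x j (k - m)).re ∧
      (stepPos α h₁ a o x j (k - m)).re < 1 / 10
  then stepP α h₁ h α₁ g x (stepPos α h₁ a o x j (k - H.choose)) + H.choose else 0

namespace StepData
open ComplexConjugate
variable {α h₁ h κ α₁ S₁ : ℝ} {a : ℤ} {g : ℂ → ℂ} (D : StepData α h₁ h κ α₁ S₁ a g)
include D

variable {u : ℝ} {o : ℤ → ℤ → ℂ} (O : LatOrbit u g o) (hu : α * u ≤ h₁ / 2)
include O hu

omit hu in
theorem im_stepTime_le (x : ℝ) (j k : ℤ) : α * |(stepTime a o x j k).im| ≤ α * u := by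
  have := O.im_le (-k) (-j - a * k)
  have hα := D.α_pos
  gcongr
  simpa [stepTime] using this

theorem stepTime_sub_one (x : ℝ) (j k : ℤ) :
    ∃ c : ℂ, ‖c‖ ≤ 1 / 200 ∧ c = g (x - stepTime a o x j k) - (x - stepTime a o x j k) - α₁ ∧
    stepTime a o x j (k - 1) = (stepTime a o x j k + -c) + ((-1 : ℤ) : ℂ) / α := by
  have e : x - stepTime a o x j k = o (-k) (-j - a * k) := by rw [stepTime]; ring
  refine ⟨_, ?_, rfl, ?_⟩
  · rw [e]
    have hu' := O.im_le (-k) (-j - a * k)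
    have hS : u < S₁ := by
      have := D.S₁_le
      have := D.h₁_le
      have := D.α_pos
      by_contra hc
      push Not at hc
      nlinarith
    refine (D.adm.bound _ (show o (-k) (-j - a * k) ∈ Strip S₁ from hu'.trans_lt hS)).trans ?_
    have : Real.exp (-2 * Real.pi * (S₁ - |(o (-k) (-j - a * k)).im|)) ≤ 1 :=
      Real.exp_le_one_iff.2 (by nlinarith [Real.pi_pos])
    linarith
  · rw [e, O.step]
    have hf : (1 : ℂ) / α = a + α₁ := by
      have := D.frac
      rw [← Complex.ofReal_one, ← Complex.ofReal_div, this]; push_cast; ring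
    have := O.shift_int (-k + 1) (-j - a * k) a
    rw [stepTime, stepTime, show -(k - 1) = -k + 1 by ring,
      show -j - a * (k - 1) = -j - a * k + a by ring, this, Int.cast_neg, Int.cast_one, neg_div, hf]
    ring

theorem stepTime_half (x : ℝ) (j k : ℤ) : α * |(stepTime a o x j k).im| ≤ h₁ / 2 :=
  (D.im_stepTime_le O x j k).trans hu

/-- Lipschitz estimate for the real solution of the model flow. -/
theorem norm_stepPos_sub (x x' : ℝ) (j k j' k' : ℤ) :
    ‖stepPos α h₁ a o x j k - stepPos α h₁ a o x' j' k'‖ ≤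
      103 / 100 * α * ‖stepTime a o x j k - stepTime a o x' j' k'‖ := by
  have h1 := norm_zc_sub_zc_le D.α_pos D.h₁_le (D.stepTime_half O hu x j k)
    (D.stepTime_half O hu x' j' k')
  have h2 : ‖(α : ℂ) * (stepTime a o x j k - stepTime a o x' j' k')‖ =
      α * ‖stepTime a o x j k - stepTime a o x' j' k'‖ := by
    rw [norm_mul, Complex.norm_real, Real.norm_of_nonneg D.α_pos.le]
  have h3 := norm_sub_norm_le (stepPos α h₁ a o x j k - stepPos α h₁ a o x' j' k')
    ((α : ℂ) * (stepTime a o x j k - stepTime a o x' j' k'))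
  simp only [stepPos] at h3 ⊢
  linarith

theorem im_stepPos_le (x : ℝ) (j k : ℤ) :
    |(stepPos α h₁ a o x j k).im| ≤ 103 / 100 * (α * u) := by
  have ht := D.stepTime_half O hu x j k
  have ht' : α * |(conj (stepTime a o x j k)).im| ≤ h₁ / 2 := by simpa using ht
  have h1 := norm_zc_sub_zc_le D.α_pos D.h₁_le ht ht'
  rw [zc_conj D.α_pos D.h₁_le ht, Complex.sub_conj, Complex.sub_conj] at h1
  have h3 := norm_sub_norm_le (((2 * (zc α (rr h₁) (stepTime a o x j k)).im : ℝ) : ℂ) * Complex.I)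
    (α * (((2 * (stepTime a o x j k).im : ℝ) : ℂ) * Complex.I))
  simp only [norm_mul, Complex.norm_real, Complex.norm_I, mul_one, Real.norm_eq_abs, abs_mul,
    abs_two, abs_of_pos D.α_pos] at h1 h3
  have := D.im_stepTime_le O x j k
  rw [stepPos]
  linarith

theorem stepPos_sub_one (x : ℝ) (j k : ℤ) :
    ‖stepPos α h₁ a o x j (k - 1) - (stepPos α h₁ a o x j k - 1)‖ ≤ 3 / 500 := by
  obtain ⟨c, hc, -, e⟩ := D.stepTime_sub_one O hu x j k
  have hα := D.α_pos
  have hα1 := D.α_le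
  have ht := D.stepTime_half O hu x j k
  have ht' := D.stepTime_half O hu x j (k - 1)
  have e2 : (stepTime a o x j (k - 1)).im = (stepTime a o x j k + -c).im := by
    rw [e, Complex.add_im (_ + _), Complex.div_ofReal_im]; simp
  rw [e2] at ht'
  have h1 := norm_zc_sub_zc_le hα D.h₁_le ht' ht
  rw [stepPos, stepPos, e, zc_add_inv hα]
  have h2 : ‖stepTime a o x j k + -c - stepTime a o x j k‖ ≤ 1 / 200 := by
    rw [add_sub_cancel_left, norm_neg]; exact hc
  have h3 : ‖(α : ℂ) * (stepTime a o x j k + -c - stepTime a o x j k)‖ =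
      α * ‖(stepTime a o x j k + -c - stepTime a o x j k)‖ := by
    rw [norm_mul, Complex.norm_real, Real.norm_of_nonneg hα.le]
  have h4 := norm_sub_norm_le (zc α (rr h₁) (stepTime a o x j k + -c) - zc α (rr h₁) (stepTime a o x j k))
    ((α : ℂ) * (stepTime a o x j k + -c - stepTime a o x j k))
  have e3 : zc α (rr h₁) (stepTime a o x j k + -c) + ((-1 : ℤ) : ℂ) - (zc α (rr h₁) (stepTime a o x j k) - 1)
      = zc α (rr h₁) (stepTime a o x j k + -c) - zc α (rr h₁) (stepTime a o x j k) := by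
    push_cast; ring
  rw [e3]
  nlinarith

theorem im_stepPos_lt (x : ℝ) (j k : ℤ) : |(stepPos α h₁ a o x j k).im| < h - 1 / 10 := by
  have := D.im_stepPos_le O hu x j k
  have := D.h_ge
  have := D.h₁_le
  linarith

theorem stepPos_sub_one_eq (x : ℝ) (j k : ℤ) (hz : |(stepPos α h₁ a o x j k).re| < 1 / 4) :
    stepPos α h₁ a o x j (k - 1) = stepPos α h₁ a o x j k +
      stepE α h₁ h α₁ g x (stepPos α h₁ a o x j k) - 1 := by
  obtain ⟨c, hc, hc', e⟩ := D.stepTime_sub_one O hu x j k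
  have hα := D.α_pos
  have hα1 := D.α_le
  have ht := D.stepTime_half O hu x j k
  have ht' := D.stepTime_half O hu x j (k - 1)
  have e2 : (stepTime a o x j (k - 1)).im = (stepTime a o x j k + -c).im := by
    rw [e, Complex.add_im (_ + _), Complex.div_ofReal_im]; simp
  rw [e2] at ht'
  have him := D.im_stepPos_lt O hu x j k
  have hτ : tau α (rr h₁) (stepPos α h₁ a o x j k) = stepTime a o x j k :=
    tau_zc hα D.h₁_le ht hz
  have hp : stepPhase α h₁ α₁ g x (stepPos α h₁ a o x j k) = c := by
    rw [stepPhase, hτ, hc']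
  have e3 : stepTime a o x j k + -c - stepTime a o x j k = -c := by ring
  have hz' := zc_eq_add_mE hα D.h₁_le ht ht' (by
      rw [e3, norm_mul, Complex.norm_real, Real.norm_of_nonneg hα.le, norm_neg]
      nlinarith [norm_nonneg c])
    (by rw [e3]; exact D.mB_le_tenth (by rw [norm_neg]; linarith) (by rw [stepPos] at him; linarith))
  rw [e3] at hz'
  rw [stepE, if_pos ⟨hz, by linarith⟩, hp]
  nth_rw 1 [stepPos]
  rw [e, zc_add_inv hα, hz']
  simp only [stepPos]
  push_cast; ring

theorem stepPos_flow (x : ℝ) (j k : ℤ) :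
    stepPos α h₁ a o (x + 1 / 128) j k = stepFlow α h₁ (stepPos α h₁ a o x j k) := by
  have hα := D.α_pos
  have hα1 := D.α_le
  have ht := D.stepTime_half O hu x j k
  have ht' := D.stepTime_half O hu (x + 1 / 128) j k
  have him := D.im_stepPos_lt O hu x j k
  have e : stepTime a o (x + 1 / 128) j k - stepTime a o x j k = ((1 / 128 : ℝ) : ℂ) := by
    rw [stepTime, stepTime]; push_cast; ring
  have := zc_eq_add_mE hα D.h₁_le ht ht' (by
      rw [e, norm_mul, Complex.norm_real, Real.norm_of_nonneg hα.le, Complex.norm_real]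
      norm_num; linarith)
    (by rw [e]; exact D.mB_stepFlow_le (by rw [stepPos] at him; linarith))
  rw [e] at this
  exact this

end StepData

theorem sub_le_of_steps {F : ℤ → ℝ} {c : ℝ} (hF : ∀ m, F (m + 1) ≤ F m - c) (m : ℤ) (n : ℕ) :
    F (m + n) ≤ F m - c * n := by
  induction n with
  | zero => simp
  | succ n ih =>
    have := hF (m + n)
    push_cast
    rw [← add_assoc]
    linarith

theorem exists_mem_window {F : ℤ → ℝ} (hF : ∀ m, |F (m + 1) - (F m - 1)| ≤ 3 / 500) :
    ∃ m, -101 / 100 < F m ∧ F m ≤ 0 := by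
  have hF' : ∀ m, F (m + 1) ≤ F m - 1 / 2 := fun m => by linarith [(abs_le.1 (hF m)).2]
  obtain ⟨n, hn⟩ := exists_nat_gt (2 * |F 0|)
  obtain ⟨m, hm, hm'⟩ := Int.exists_least_of_bdd (P := fun m => F m ≤ 0)
    ⟨-n, fun z hz => by
      by_contra hc
      push Not at hc
      obtain ⟨l, hl⟩ := Int.eq_ofNat_of_zero_le (show 0 ≤ -z by omega)
      have h1 := sub_le_of_steps hF' z l
      rw [show z + (l : ℤ) = 0 by omega] at h1
      have h2 : (n : ℝ) < l := by exact_mod_cast (show (n : ℤ) < l by omega)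
      have := neg_abs_le (F 0)
      linarith⟩
    ⟨n, by
      have h1 := sub_le_of_steps hF' 0 n
      rw [zero_add] at h1
      have := le_abs_self (F 0)
      linarith⟩
  refine ⟨m, ?_, hm⟩
  have h1 : 0 < F (m - 1) := by
    by_contra hc
    have := hm' (m - 1) (not_lt.1 hc)
    omega
  have h2 := (abs_le.1 (hF (m - 1))).1
  rw [sub_add_cancel] at h2
  linarith

namespace StepData
open ComplexConjugate
variable {α h₁ h κ α₁ S₁ : ℝ} {a : ℤ} {g : ℂ → ℂ} (D : StepData α h₁ h κ α₁ S₁ a g)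
include D

variable {u : ℝ} {o : ℤ → ℤ → ℂ} (O : LatOrbit u g o) (hu : α * u ≤ h₁ / 2)
include O hu

theorem re_stepPos_steps (x : ℝ) (j k m : ℤ) :
    |(stepPos α h₁ a o x j (k - (m + 1))).re - ((stepPos α h₁ a o x j (k - m)).re - 1)| ≤ 3 / 500 := by
  have h1 := (Complex.abs_re_le_norm _).trans (D.stepPos_sub_one O hu x j (k - m))
  rw [show k - (m + 1) = k - m - 1 by ring]
  simpa using h1

theorem exists_stepPos_mem (x : ℝ) (j k : ℤ) : ∃ m : ℤ,
    -101 / 100 < (stepPos α h₁ a o x j (k - m)).re ∧ (stepPos α h₁ a o x j (k - m)).re ≤ 0 :=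
  exists_mem_window (F := fun m => (stepPos α h₁ a o x j (k - m)).re) (D.re_stepPos_steps O hu x j k)

theorem stepPos_mem_InvRect {x : ℝ} {j k : ℤ} (h1 : -11 / 10 < (stepPos α h₁ a o x j k).re)
    (h2 : (stepPos α h₁ a o x j k).re < 1 / 10) : stepPos α h₁ a o x j k ∈ InvRect h :=
  ⟨by linarith, by linarith, by linarith [D.im_stepPos_lt O hu x j k]⟩

theorem stepOrb_eq {x : ℝ} {j k m : ℤ} (h1 : -11 / 10 < (stepPos α h₁ a o x j (k - m)).re)
    (h2 : (stepPos α h₁ a o x j (k - m)).re < 1 / 10) : stepOrb α h₁ h α₁ a g o x j k =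
      stepP α h₁ h α₁ g x (stepPos α h₁ a o x j (k - m)) + m := by
  have key : ∀ m m' : ℤ, m ≤ m' → -11 / 10 < (stepPos α h₁ a o x j (k - m)).re →
      (stepPos α h₁ a o x j (k - m)).re < 1 / 10 → -11 / 10 < (stepPos α h₁ a o x j (k - m')).re →
      (stepPos α h₁ a o x j (k - m')).re < 1 / 10 →
      stepP α h₁ h α₁ g x (stepPos α h₁ a o x j (k - m)) + m =
        stepP α h₁ h α₁ g x (stepPos α h₁ a o x j (k - m')) + m' := by
    intro m m' hm a1 a2 b1 b2
    have hst := D.re_stepPos_steps O hu x j k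
    have hst' := sub_le_of_steps (F := fun m => (stepPos α h₁ a o x j (k - m)).re) (c := 99 / 100)
      (fun m => by linarith [(abs_le.1 (hst m)).2]) m
    obtain ⟨l, hl⟩ := Int.eq_ofNat_of_zero_le (sub_nonneg.2 hm)
    have hm' : m' = m + l := by omega
    have h3 := hst' l
    rw [← hm'] at h3
    have hl2 : l < 2 := by
      by_contra hc
      have : (2 : ℝ) ≤ l := by exact_mod_cast not_lt.1 hc
      linarith
    interval_cases l
    · simp at hm'; rw [hm']
    · simp only [Nat.cast_one] at hm' h3
      subst hm'
      have e := D.stepPos_sub_one_eq O hu x j (k - m) (abs_lt.2 ⟨by linarith, by linarith⟩)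
      have hb1 := D.stepPos_mem_InvRect O hu a1 a2
      have hb2 := D.stepPos_mem_InvRect O hu b1 b2
      rw [show k - (m + 1) = k - m - 1 by ring] at hb2 ⊢
      rw [e] at hb2 ⊢
      rw [D.stepP_sub_one x hb1 (by linarith) hb2]
      push_cast; ring
  have H : ∃ m : ℤ, -11 / 10 < (stepPos α h₁ a o x j (k - m)).re ∧
      (stepPos α h₁ a o x j (k - m)).re < 1 / 10 := ⟨m, h1, h2⟩
  rw [stepOrb, dif_pos H]
  obtain ⟨c1, c2⟩ := H.choose_spec
  rcases le_total m H.choose with hl | hl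
  · exact (key _ _ hl h1 h2 c1 c2).symm
  · exact key _ _ hl c1 c2 h1 h2

theorem stepOrb_shift (x : ℝ) (j k : ℤ) :
    stepOrb α h₁ h α₁ a g o x j (k + 1) = stepOrb α h₁ h α₁ a g o x j k + 1 := by
  obtain ⟨m, h1, h2⟩ := D.exists_stepPos_mem O hu x j k
  have e : k + 1 - (m + 1) = k - m := by ring
  rw [D.stepOrb_eq O hu (k := k) (m := m) (by linarith) (by linarith),
    D.stepOrb_eq O hu (k := k + 1) (m := m + 1) (by rw [e]; linarith) (by rw [e]; linarith), e]
  push_cast; ring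

theorem stepOrb_flow (x : ℝ) (j k : ℤ) :
    perExt (stepFund α h₁ h α₁ g x) (stepOrb α h₁ h α₁ a g o x j k) =
      stepOrb α h₁ h α₁ a g o (x + 1 / 128) j k := by
  obtain ⟨m, h1, h2⟩ := D.exists_stepPos_mem O hu x j k
  have him := D.im_stepPos_lt O hu x j (k - m)
  have hf := D.stepPos_flow O hu x j (k - m)
  have hfn := D.norm_stepFlow_sub_le (y := stepPos α h₁ a o x j (k - m)) (by linarith)
  rw [← hf] at hfn
  have hre := abs_le.1 ((Complex.abs_re_le_norm _).trans hfn)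
  rw [Complex.sub_re] at hre
  have hmem := D.stepPos_mem_InvRect O hu (show -11 / 10 < (stepPos α h₁ a o x j (k - m)).re by linarith)
    (by linarith)
  obtain ⟨p1, p2, p3, -⟩ := (D.stepP_spec x).2 _ hmem
  have pre := abs_le.1 ((Complex.abs_re_le_norm _).trans p2)
  rw [Complex.sub_re] at pre
  have him' := D.im_stepPos_le O hu x j (k - m)
  have pim := (Complex.abs_im_le_norm _).trans p2
  rw [Complex.sub_im] at pim
  have pim2 := abs_sub_abs_le_abs_sub (stepP α h₁ h α₁ g x (stepPos α h₁ a o x j (k - m))).im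
    (stepPos α h₁ a o x j (k - m)).im
  have hge := D.h_ge
  have hh1 := D.h₁_le
  have hF : stepP α h₁ h α₁ g x (stepPos α h₁ a o x j (k - m)) ∈ FundRect (h - 1 / 10) :=
    ⟨by linarith, by linarith, by linarith⟩
  rw [D.stepOrb_eq O hu (m := m) (by linarith) (by linarith),
    D.stepOrb_eq O hu (x := x + 1 / 128) (m := m) (by linarith) (by linarith), perExt_add_int,
    perExt_eq (fun y => D.stepFund_sub_one x) hF, stepFund, p3, hf]

theorem stepIter_stepOrb (j k : ℤ) (n : ℕ) :
    stepIter α h₁ h α₁ g n (stepOrb α h₁ h α₁ a g o 0 j k) =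
      stepOrb α h₁ h α₁ a g o (n / 128) j k := by
  induction n with
  | zero => simp [stepIter]
  | succ n ih =>
    simp only [stepIter]
    rw [ih, D.stepOrb_flow O hu]
    congr 1
    push_cast; ring

theorem stepMap_stepOrb (j k : ℤ) : stepMap α h₁ h α₁ g (stepOrb α h₁ h α₁ a g o 0 j k) =
      stepOrb α h₁ h α₁ a g o 0 (j + 1) k := by
  rw [stepMap, D.stepIter_stepOrb O hu]
  have hT : ∀ k, stepPos α h₁ a o 1 j k = stepPos α h₁ a o 0 (j + 1) k := fun k => by
    rw [stepPos, stepPos, stepTime, stepTime, show -j - a * k = -(j + 1) - a * k + 1 by ring, O.shift]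
    congr 1; push_cast; ring
  obtain ⟨m, h1, h2⟩ := D.exists_stepPos_mem O hu 1 j k
  have hP := D.stepP_add_one 0
  rw [zero_add] at hP
  rw [show ((128 : ℕ) : ℝ) / 128 = 1 by norm_num,
    D.stepOrb_eq O hu (m := m) (by linarith) (by linarith),
    D.stepOrb_eq O hu (x := 0) (j := j + 1) (m := m) (by rw [← hT]; linarith) (by rw [← hT]; linarith),
    hT, hP]

theorem im_stepOrb_le (x : ℝ) (j k : ℤ) :
    |(stepOrb α h₁ h α₁ a g o x j k).im| ≤ 11 / 10 * (α * u) := by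
  obtain ⟨m, h1, h2⟩ := D.exists_stepPos_mem O hu x j k
  have hu0 : 0 ≤ α * u := mul_nonneg D.α_pos.le ((abs_nonneg _).trans (O.im_le 0 0))
  have hmem := D.stepPos_mem_InvRect O hu (show -11 / 10 < (stepPos α h₁ a o x j (k - m)).re by linarith)
    (by linarith)
  have hmem' : conj (stepPos α h₁ a o x j (k - m)) ∈ InvRect h := by simpa [InvRect] using hmem
  have hl := D.stepP_lipschitz x hmem hmem'
  have him := D.im_stepPos_le O hu x j (k - m)
  rw [D.stepP_conj x hmem, Complex.sub_conj, Complex.sub_conj] at hl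
  simp only [norm_mul, Complex.norm_real, Complex.norm_I, mul_one, Real.norm_eq_abs, abs_mul,
    abs_two] at hl
  rw [D.stepOrb_eq O hu (m := m) (by linarith) (by linarith)]
  simp only [Complex.add_im, Complex.intCast_im, add_zero]
  linarith

theorem latOrbit_stepOrb :
    LatOrbit (11 / 10 * (α * u)) (stepMap α h₁ h α₁ g) (stepOrb α h₁ h α₁ a g o 0) :=
  ⟨D.stepMap_stepOrb O hu, D.stepOrb_shift O hu 0, D.im_stepOrb_le O hu 0⟩

theorem stepOrb_period {q p : ℤ} (hp : ∀ j k, o (j + q) (k + p) = o j k) (j k : ℤ) :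
    stepOrb α h₁ h α₁ a g o 0 (j + (a * q - p)) (k - q) = stepOrb α h₁ h α₁ a g o 0 j k := by
  have hT : ∀ k, stepPos α h₁ a o 0 (j + (a * q - p)) (k - q) = stepPos α h₁ a o 0 j k := fun k => by
    rw [stepPos, stepPos, stepTime, stepTime,
      show -(j + (a * q - p)) - a * (k - q) = -j - a * k + p by ring,
      show -(k - q) = -k + q by ring, hp]
  obtain ⟨m, h1, h2⟩ := D.exists_stepPos_mem O hu 0 j k
  have e : stepPos α h₁ a o 0 (j + (a * q - p)) (k - q - m) = stepPos α h₁ a o 0 j (k - m) := by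
    rw [← hT]; congr 1; ring
  rw [D.stepOrb_eq O hu (j := j) (k := k) (m := m) (by linarith) (by linarith),
    D.stepOrb_eq O hu (j := j + (a * q - p)) (m := m) (by rw [e]; linarith) (by rw [e]; linarith), e]

theorem stepTime_rot (j k : ℤ) :
    α * (((-k : ℤ) : ℝ) * α₁ + ((-j - a * k : ℤ) : ℝ)) = - (j * α + k) := by
  have hf := D.frac
  have hα := D.α_pos.ne'
  have : 1 = α * (a + α₁) := by rw [← hf, mul_one_div_cancel hα]
  push_cast
  linear_combination (k : ℝ) * this

theorem stepOrb_sub_rot {E : ℝ} (hE : ∀ j k, ‖o j k - ((j * α₁ + k : ℝ) : ℂ)‖ ≤ E) (j k : ℤ) :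
    ‖stepOrb α h₁ h α₁ a g o 0 j k - ((j * α + k : ℝ) : ℂ)‖ ≤ α * E + 1 / 50 := by
  obtain ⟨m, h1, h2⟩ := D.exists_stepPos_mem O hu 0 j k
  have hmem := D.stepPos_mem_InvRect O hu (show -11 / 10 < (stepPos α h₁ a o 0 j (k - m)).re by linarith)
    (by linarith)
  obtain ⟨-, p2, -⟩ := (D.stepP_spec 0).2 _ hmem
  have hz := norm_zc_sub_le D.α_pos D.h₁_le (D.stepTime_half O hu 0 j (k - m))
  have hE' := hE (-(k - m)) (-j - a * (k - m))
  have hrot := D.stepTime_rot O hu j (k - m)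
  set P := stepP α h₁ h α₁ g 0 (stepPos α h₁ a o 0 j (k - m)) with hP
  have e1 : α * stepTime a o 0 j (k - m) - (((j * α + k : ℝ) : ℂ) - m) =
      - (α * (o (-(k - m)) (-j - a * (k - m)) -
        ((((-(k - m) : ℤ) : ℝ) * α₁ + ((-j - a * (k - m) : ℤ) : ℝ) : ℝ) : ℂ))) := by
    rw [mul_sub, ← Complex.ofReal_mul, hrot, stepTime]
    push_cast; ring
  have e2 : ‖α * stepTime a o 0 j (k - m) - (((j * α + k : ℝ) : ℂ) - m)‖ ≤ α * E := by
    rw [e1, norm_neg, norm_mul, Complex.norm_real, Real.norm_of_nonneg D.α_pos.le]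
    have := D.α_pos
    gcongr
  rw [D.stepOrb_eq O hu (m := m) (by linarith) (by linarith), ← hP]
  calc ‖P + m - ((j * α + k : ℝ) : ℂ)‖ = ‖(P - stepPos α h₁ a o 0 j (k - m)) +
        (stepPos α h₁ a o 0 j (k - m) - α * stepTime a o 0 j (k - m)) +
        (α * stepTime a o 0 j (k - m) - (((j * α + k : ℝ) : ℂ) - m))‖ := by congr 1; ring
    _ ≤ _ := norm_add₃_le
    _ ≤ 1 / 1000 + 1 / 150 + α * E := by rw [stepPos] at p2 ⊢; gcongr
    _ ≤ _ := by linarith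

theorem stepOrb_modulus {d B : ℝ} (hB : α * B ≤ 1 / 20)
    (hd : ∀ j k j' k' : ℤ, |(j * α₁ + k : ℝ) - (j' * α₁ + k')| ≤ d → ‖o j k - o j' k'‖ ≤ B)
    (j k j' k' : ℤ) (hjk : |(j * α + k : ℝ) - (j' * α + k')| ≤ α * d) :
    ‖stepOrb α h₁ h α₁ a g o 0 j k - stepOrb α h₁ h α₁ a g o 0 j' k'‖ ≤ 11 / 10 * (α * B) := by
  have hα := D.α_pos
  have hα1 := D.α_le
  obtain ⟨m, h1, h2⟩ := D.exists_stepPos_mem O hu 0 j k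
  have hrot := D.stepTime_rot O hu j (k - m)
  have hrot' := D.stepTime_rot O hu j' (k' - m)
  have hB' := hd (-(k - m)) (-j - a * (k - m)) (-(k' - m)) (-j' - a * (k' - m)) (by
    refine le_of_mul_le_mul_left (le_trans (le_of_eq ?_) hjk) hα
    nth_rewrite 1 [← abs_of_pos hα]
    rw [← abs_mul, mul_sub, hrot, hrot', ← abs_neg]
    congr 1
    push_cast; ring)
  have ht : stepTime a o 0 j (k - m) - stepTime a o 0 j' (k' - m) =
      -(o (-(k - m)) (-j - a * (k - m)) - o (-(k' - m)) (-j' - a * (k' - m))) := by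
    rw [stepTime, stepTime]; ring
  have hz := D.norm_stepPos_sub O hu 0 0 j (k - m) j' (k' - m)
  rw [ht, norm_neg] at hz
  have hz' : ‖stepPos α h₁ a o 0 j (k - m) - stepPos α h₁ a o 0 j' (k' - m)‖ ≤
      103 / 100 * (α * B) := by
    refine hz.trans ?_
    rw [mul_assoc]; gcongr
  have hre := abs_le.1 ((Complex.abs_re_le_norm _).trans hz')
  rw [Complex.sub_re] at hre
  have hBn : 0 ≤ B := (norm_nonneg _).trans hB'
  have hm1 := D.stepPos_mem_InvRect O hu (show -11 / 10 < (stepPos α h₁ a o 0 j (k - m)).re by linarith)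
    (by linarith)
  have hm2 := D.stepPos_mem_InvRect O hu
    (show -11 / 10 < (stepPos α h₁ a o 0 j' (k' - m)).re by linarith) (by linarith)
  have hl := D.stepP_lipschitz 0 hm1 hm2
  rw [D.stepOrb_eq O hu (m := m) (by linarith) (by linarith),
    D.stepOrb_eq O hu (j := j') (k := k') (m := m) (by linarith) (by linarith), add_sub_add_right_eq_sub]
  have := mul_nonneg hα.le hBn
  linarith

omit O hu in
/-- The ghost fixed point of the model flow yields a fixed point. -/
theorem exists_fixed (hh : h₁ + 1 < h) :
    ∃ ζ : ℂ, |ζ.im| ≤ h₁ + 1 ∧ stepMap α h₁ h α₁ g ζ = ζ := by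
  set y : ℂ := ⟨-1 / 2, h₁⟩ with hy
  have hh1 := D.h₁_le
  have hex : ex y = -rr h₁ := by
    have e : (2 * Real.pi * Complex.I * y : ℂ) = ((-2 * Real.pi * h₁ : ℝ) : ℂ) + (-(Real.pi * Complex.I)) := by
      rw [hy]
      apply Complex.ext <;> simp
      ring
    rw [ex, e, Complex.exp_add, Complex.exp_neg, Complex.exp_pi_mul_I, rr, Complex.ofReal_exp]
    norm_num
  have hr : (rr h₁ : ℂ) ≠ 0 := by exact_mod_cast (rr_pos h₁).ne'
  have hflow : stepFlow α h₁ y = y := by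
    rw [stepFlow, mE, hex, mP, mQ, neg_add_cancel, div_neg, div_self hr, add_neg_cancel]
    simp
  have him : y.im = h₁ := rfl
  have hre : y.re = -1 / 2 := rfl
  have habs : |y.im| = h₁ := by rw [him, abs_of_nonneg (by linarith)]
  have hV : y ∈ InvRect h := ⟨by rw [hre]; norm_num, by rw [hre]; norm_num, by rw [habs]; linarith⟩
  have hspec := fun x => (D.stepP_spec x).2 y hV
  have hstep : ∀ x, perExt (stepFund α h₁ h α₁ g x) (stepP α h₁ h α₁ g x y) =
      stepP α h₁ h α₁ g (x + 1 / 128) y := by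
    intro x
    obtain ⟨p1, p2, p3, -⟩ := hspec x
    have pre := abs_le.1 ((Complex.abs_re_le_norm _).trans p2)
    rw [Complex.sub_re] at pre
    have pim := (Complex.abs_im_le_norm _).trans p2
    rw [Complex.sub_im] at pim
    have pim2 := abs_sub_abs_le_abs_sub (stepP α h₁ h α₁ g x y).im y.im
    rw [perExt_eq (fun y => D.stepFund_sub_one x)
      ⟨by linarith, by linarith, by linarith⟩, stepFund, p3, hflow]
  have hiter : ∀ n : ℕ, stepIter α h₁ h α₁ g n (stepP α h₁ h α₁ g 0 y) =
      stepP α h₁ h α₁ g (n / 128) y := by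
    intro n
    induction n with
    | zero => simp [stepIter]
    | succ n ih =>
      simp only [stepIter]
      rw [ih, hstep]
      congr 1
      push_cast; ring
  refine ⟨stepP α h₁ h α₁ g 0 y, ?_, ?_⟩
  · have pim := (Complex.abs_im_le_norm _).trans (hspec 0).2.1
    rw [Complex.sub_im] at pim
    have pim2 := abs_sub_abs_le_abs_sub (stepP α h₁ h α₁ g 0 y).im y.im
    linarith
  · have hP := D.stepP_add_one 0
    rw [zero_add] at hP
    rw [stepMap, hiter, show ((128 : ℕ) : ℝ) / 128 = 1 by norm_num, hP]

end StepData

/-- A sequence of successive fractional parts of inverses. -/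
structure GaussSeq (A : ℕ → ℝ) : Prop where
  pos : ∀ n, 0 < A n
  lt_one : ∀ n, A n < 1
  frac : ∀ n, ∃ a : ℤ, 1 / A n = a + A (n + 1)

namespace GaussSeq
variable {A : ℕ → ℝ} (G : GaussSeq A)
include G

theorem tail (m : ℕ) : GaussSeq fun n => A (n + m) :=
  ⟨fun n => G.pos _, fun n => G.lt_one _, fun n => by
    obtain ⟨a, ha⟩ := G.frac (n + m)
    exact ⟨a, by rw [ha, add_right_comm]⟩⟩

theorem mul_le (n : ℕ) : A n * A (n + 1) ≤ 1 / 2 := by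
  obtain ⟨a, ha⟩ := G.frac n
  have h0 := G.pos n
  have h1 := G.lt_one n
  have h2 := G.pos (n + 1)
  have h3 := G.lt_one (n + 1)
  have e : A n * (a + A (n + 1)) = 1 := by rw [← ha, mul_one_div_cancel h0.ne']
  have ha1 : (1 : ℝ) ≤ a := by
    have : 0 < a := by
      by_contra hc
      have : (a : ℝ) ≤ 0 := by exact_mod_cast not_lt.1 hc
      nlinarith
    exact_mod_cast this
  nlinarith [mul_nonneg h0.le (sub_nonneg.2 ha1)]

theorem prod_pos (n : ℕ) : 0 < ∏ i ∈ Finset.range n, A i := Finset.prod_pos fun i _ => G.pos i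

theorem prod_sq_le (n : ℕ) : (∏ i ∈ Finset.range n, A i) ^ 2 ≤ 2 * (1 / 2) ^ n := by
  induction n using Nat.strong_induction_on with
  | _ n ih =>
    match n with
    | 0 => norm_num
    | 1 =>
      have h0 := G.pos 0
      have h1 := G.lt_one 0
      rw [Finset.prod_range_one]; nlinarith
    | n + 2 =>
      have h := ih n (by omega)
      have h2 := G.mul_le n
      have h3 := mul_pos (G.pos n) (G.pos (n + 1))
      rw [Finset.prod_range_succ, Finset.prod_range_succ, mul_assoc, mul_pow, pow_add,
        ← mul_assoc]
      exact mul_le_mul h (by nlinarith) (sq_nonneg _) (by positivity)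

theorem prod_le_one (n : ℕ) : (∏ i ∈ Finset.range n, A i) ≤ 1 :=
  Finset.prod_le_one (fun i _ => (G.pos i).le) fun i _ => (G.lt_one i).le

theorem tendsto_prod : Tendsto (fun n => ∏ i ∈ Finset.range n, A i) atTop (𝓝 0) := by
  have h1 : Tendsto (fun n : ℕ => (2 : ℝ) * (1 / 2) ^ n) atTop (𝓝 0) := by
    simpa using (tendsto_pow_atTop_nhds_zero_of_lt_one (r := (1 / 2 : ℝ)) (by norm_num)
      (by norm_num)).const_mul 2
  have h2 := squeeze_zero (fun n => sq_nonneg _) G.prod_sq_le h1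
  have h3 := h2.sqrt
  simp only [Real.sqrt_zero] at h3
  refine h3.congr fun n => Real.sqrt_sq (G.prod_pos n).le

theorem summable_prod : Summable fun n => ∏ i ∈ Finset.range n, A i := by
  have hs : (√(1 / 2) : ℝ) < 1 := by rw [Real.sqrt_lt' one_pos]; norm_num
  refine Summable.of_nonneg_of_le (fun n => (G.prod_pos n).le) (fun n => ?_)
    ((summable_geometric_of_lt_one (Real.sqrt_nonneg _) hs).mul_left 2)
  refine abs_le_of_sq_le_sq' ((G.prod_sq_le n).trans ?_) (by positivity) |>.2
  rw [mul_pow, ← pow_mul, mul_comm n 2, pow_mul, Real.sq_sqrt (by norm_num)]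
  have : (0 : ℝ) < (1 / 2) ^ n := by positivity
  linarith

theorem abs_mul_prod_ge (n : ℕ) {k p : ℤ} (hkp : (k, p) ≠ (0, 0))
    (h : |k * A 0 + p| < (∏ i ∈ Finset.range n, A i) / 8) :
    1 / 2 + (1 / 2) ^ (n + 1) ≤ |(k : ℝ)| * ∏ i ∈ Finset.range n, A i := by
  induction n generalizing A k p with
  | zero =>
    have hk : k ≠ 0 := by
      rintro rfl
      have hp : p ≠ 0 := by rintro rfl; exact hkp rfl
      have : (1 : ℝ) ≤ |(p : ℝ)| := by exact_mod_cast Int.one_le_abs hp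
      simp at h
      linarith
    have : (1 : ℝ) ≤ |(k : ℝ)| := by exact_mod_cast Int.one_le_abs hk
    simpa using (by linarith : (2 : ℝ)⁻¹ + 2⁻¹ ≤ |(k : ℝ)|)
  | succ n ih =>
    obtain ⟨a, ha⟩ := G.frac 0
    have h0 := G.pos 0
    have e : 1 = A 0 * (a + A 1) := by rw [← ha, mul_one_div_cancel h0.ne']
    have T := G.tail 1
    rw [Finset.prod_range_succ'] at h ⊢
    set b := ∏ i ∈ Finset.range n, A (i + 1) with hb
    have e2 : (k * A 0 + p : ℝ) = A 0 * (p * A 1 + (k + p * a : ℤ)) := by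
      push_cast; linear_combination (p : ℝ) * e
    have h' : |p * A 1 + (k + p * a : ℤ)| < b / 8 := by
      rw [e2, abs_mul, abs_of_pos h0] at h
      exact lt_of_mul_lt_mul_left (by linarith) h0.le
    have := ih T (k := p) (p := k + p * a) (by
      intro hc
      rw [Prod.mk.injEq] at hc
      obtain ⟨rfl, hc⟩ := hc
      simp at hc
      exact hkp (by rw [hc])) h'
    have hb2 := T.prod_sq_le n
    have hb0 := T.prod_pos n
    rw [← hb] at hb2 hb0
    have hk : |(p : ℝ)| ≤ |(k : ℝ)| * A 0 + b * A 0 / 8 := by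
      have : (p : ℝ) = (k * A 0 + p) - k * A 0 := by ring
      calc |(p : ℝ)| = |(k * A 0 + p) - k * A 0| := by rw [← this]
        _ ≤ |k * A 0 + p| + |k * A 0| := abs_sub _ _
        _ ≤ _ := by rw [abs_mul, abs_of_pos h0]; linarith
    have h1 := G.lt_one 0
    have h3 : |(p : ℝ)| * b ≤ |(k : ℝ)| * (b * A 0) + b ^ 2 / 8 := by
      have := mul_le_mul_of_nonneg_right hk hb0.le
      nlinarith [mul_nonneg (sq_nonneg b) (sub_nonneg.2 h1.le)]
    rw [pow_succ (1 / 2 : ℝ) (n + 1)]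
    rw [pow_succ] at this ⊢
    linarith

theorem prod_div_le_abs (n : ℕ) {k p : ℤ} (hkp : (k, p) ≠ (0, 0))
    (h : |(k : ℝ)| < 1 / (2 * ∏ i ∈ Finset.range n, A i)) :
    (∏ i ∈ Finset.range n, A i) / 8 ≤ |k * A 0 + p| := by
  by_contra hc
  have h1 := G.abs_mul_prod_ge n hkp (not_le.1 hc)
  have h0 := G.prod_pos n
  rw [lt_div_iff₀ (by positivity)] at h
  have : (0 : ℝ) < (1 / 2) ^ (n + 1) := by positivity
  linarith

end GaussSeq

theorem exists_gaussSeq {α : ℝ} (hα : Irrational α) (h0 : 0 < α) (h1 : α < 1) :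
    ∃ A, GaussSeq A ∧ A 0 = α := by
  set A : ℕ → ℝ := fun n => (fun x => Int.fract (1 / x))^[n] α with hA
  have hs : ∀ n, A (n + 1) = Int.fract (1 / A n) := fun n => Function.iterate_succ_apply' _ _ _
  have key : ∀ n, Irrational (A n) ∧ 0 < A n ∧ A n < 1 := by
    intro n
    induction n with
    | zero => exact ⟨hα, h0, h1⟩
    | succ n ih =>
      have hi : Irrational (A (n + 1)) := by
        rw [hs, Int.fract, one_div]
        exact (irrational_inv_iff.2 ih.1).sub_intCast _
      refine ⟨hi, lt_of_le_of_ne ?_ hi.ne_zero.symm, ?_⟩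
      · rw [hs]; exact Int.fract_nonneg _
      · rw [hs]; exact Int.fract_lt_one _
  exact ⟨A, ⟨fun n => (key n).2.1, fun n => (key n).2.2, fun n => ⟨⌊1 / A n⌋, by
    rw [hs, Int.floor_add_fract]⟩⟩, rfl⟩

theorem NonResonant.ne_zero {ω : Fin 2 → ℝ} (h : NonResonant 2 ω) : ω 0 ≠ 0 := by
  have := h ![1, 0] (by intro h; simpa using congrFun h 0)
  simpa using this

theorem NonResonant.irrational {ω : Fin 2 → ℝ} (h : NonResonant 2 ω) : Irrational (ω 1 / ω 0) := by
  rintro ⟨q, hq⟩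
  have h0 := h.ne_zero
  have hd : (q.den : ℝ) ≠ 0 := by exact_mod_cast q.den_ne_zero
  refine h ![q.num, -q.den] (by intro h; simpa using congrFun h 1) ?_
  rw [Rat.cast_def, div_eq_div_iff hd h0] at hq
  simp only [Fin.sum_univ_two, Matrix.cons_val_zero, Matrix.cons_val_one]
  push_cast
  linarith

theorem log_Psi_le {ω : Fin 2 → ℝ} (hω : NonResonant 2 ω) {Q B : ℝ} (hQ : 1 ≤ Q) (hB : 1 ≤ B)
    (h : ∀ k : Fin 2 → ℤ, k ≠ 0 → (∀ i, |(k i : ℝ)| ≤ Q) → |∑ i, (k i : ℝ) * ω i|⁻¹ ≤ B) :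
    Real.log (Psi 2 ω Q) ≤ Real.log B := by
  have hne : {x : ℝ | ∃ k : Fin 2 → ℤ, k ≠ 0 ∧ (∀ i, |(k i : ℝ)| ≤ Q) ∧
    x = |∑ i, (k i : ℝ) * ω i|⁻¹}.Nonempty := by
    refine ⟨_, ![1, 0], by intro h; simpa using congrFun h 0, fun i => ?_, rfl⟩
    fin_cases i <;> simp <;> linarith
  have h1 : Psi 2 ω Q ≤ B := csSup_le hne (by rintro x ⟨k, h1, h2, rfl⟩; exact h k h1 h2)
  have h0 : 0 ≤ Psi 2 ω Q := Real.sSup_nonneg (by rintro x ⟨k, h1, h2, rfl⟩; positivity)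
  rcases h0.eq_or_lt with h0 | h0
  · rw [← h0, Real.log_zero]; exact Real.log_nonneg hB
  · exact Real.log_le_log h0 h1

theorem GaussSeq.exists_log_Psi_le {ω : Fin 2 → ℝ} (hω : NonResonant 2 ω) {A : ℕ → ℝ} (G : GaussSeq A)
    (hA : A 0 = Int.fract (ω 1 / ω 0)) : ∃ C, 0 ≤ C ∧ ∀ Q ≥ 1, ∃ N : ℕ,
      Real.log (Psi 2 ω Q) ≤ C + ∑ i ∈ Finset.range (N + 1), Real.log (1 / A i) ∧
      ∀ i ≤ N, 1 / (2 * ∏ j ∈ Finset.range i, A j) ≤ Q := by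
  have h0 := hω.ne_zero
  set c := |ω 0|⁻¹ * 8 with hc
  have hc0 : 0 < c := by positivity
  refine ⟨Real.log (max 1 c), Real.log_nonneg (le_max_left _ _), fun Q hQ => ?_⟩
  have hex : ∃ N, Q < 1 / (2 * ∏ j ∈ Finset.range (N + 1), A j) := by
    obtain ⟨N, hN⟩ := ((tendsto_add_atTop_iff_nat 1).2 G.tendsto_prod).eventually
      (gt_mem_nhds (show 0 < 1 / (2 * Q) by positivity)) |>.exists
    refine ⟨N, ?_⟩
    have hp := G.prod_pos (N + 1)
    rw [lt_div_iff₀ (by positivity)] at hN ⊢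
    linarith
  classical
  refine ⟨Nat.find hex, ?_, ?_⟩
  · have hN := Nat.find_spec hex
    set N := Nat.find hex
    set b := ∏ j ∈ Finset.range (N + 1), A j with hb
    have hb0 : 0 < b := G.prod_pos _
    have hb1 : b ≤ 1 := G.prod_le_one _
    have hlog : ∑ i ∈ Finset.range (N + 1), Real.log (1 / A i) = Real.log (1 / b) := by
      rw [one_div, Real.log_inv, hb, Real.log_prod fun i _ => (G.pos i).ne', ← Finset.sum_neg_distrib]
      simp
    have hm1 : 1 ≤ max 1 c := le_max_left _ _
    rw [hlog, ← Real.log_mul (by positivity) (by positivity)]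
    refine log_Psi_le hω hQ ?_ fun k hk hkQ => ?_
    · have : 1 ≤ 1 / b := by rw [le_div_iff₀ hb0]; linarith
      nlinarith
    have hk' : (k 1, k 0 + k 1 * ⌊ω 1 / ω 0⌋) ≠ (0, 0) := by
      intro h
      rw [Prod.mk.injEq] at h
      obtain ⟨h1, h2⟩ := h
      rw [h1, zero_mul, add_zero] at h2
      exact hk (by ext i; fin_cases i <;> assumption)
    have hlow := G.prod_div_le_abs (N + 1) hk' ((hkQ 1).trans_lt hN)
    rw [← hb, hA] at hlow
    have e : ∑ i, (k i : ℝ) * ω i = ω 0 * (k 1 * Int.fract (ω 1 / ω 0) +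
        ((k 0 + k 1 * ⌊ω 1 / ω 0⌋ : ℤ) : ℝ)) := by
      have h1 : ω 1 = ω 0 * (ω 1 / ω 0) := by field_simp
      rw [Fin.sum_univ_two, Int.fract]
      push_cast
      linear_combination (k 1 : ℝ) * h1
    rw [e, abs_mul, mul_inv]
    have h2 := inv_anti₀ (by positivity) hlow
    have h3 : |ω 0|⁻¹ * (b / 8)⁻¹ = c * (1 / b) := by rw [hc]; field_simp
    calc _ ≤ |ω 0|⁻¹ * (b / 8)⁻¹ := by gcongr
      _ ≤ _ := by rw [h3]; gcongr; exact le_max_right _ _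
  · intro i hi
    rcases i with _ | i
    · simp; linarith
    · exact not_lt.1 (Nat.find_min hex (show i < Nat.find hex by omega))

theorem lintegral_inv_sq {a : ℝ} (ha : 0 < a) :
    ∫⁻ Q in Set.Ioi a, ENNReal.ofReal (1 / Q ^ 2) = ENNReal.ofReal (1 / a) := by
  have hi := integrableOn_Ioi_rpow_of_lt (show (-2 : ℝ) < -1 by norm_num) ha
  have he := integral_Ioi_rpow_of_lt (show (-2 : ℝ) < -1 by norm_num) ha
  have hn : ∀ᵐ x ∂volume.restrict (Set.Ioi a), 0 ≤ x ^ (-2 : ℝ) := by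
    filter_upwards [ae_restrict_mem measurableSet_Ioi] with x hx
    exact Real.rpow_nonneg (ha.trans hx).le _
  rw [show (1 / a : ℝ) = -a ^ (-2 + 1 : ℝ) / (-2 + 1) by norm_num [Real.rpow_neg_one], ← he,
    ofReal_integral_eq_lintegral_ofReal hi hn]
  refine setLIntegral_congr_fun measurableSet_Ioi fun x hx => ?_
  have hx0 : 0 < x := ha.trans hx
  rw [Real.rpow_neg hx0.le, one_div]
  norm_cast

/-- Failure of the Bruno–Rüssmann condition in terms of the Gauss expansion. -/
theorem GaussSeq.not_summable_log {ω : Fin 2 → ℝ} (hω : NonResonant 2 ω) (hBR : ¬ BRCondition 2 ω)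
    {A : ℕ → ℝ} (G : GaussSeq A) (hA : A 0 = Int.fract (ω 1 / ω 0)) :
    ¬ Summable fun n => (∏ i ∈ Finset.range n, A i) * Real.log (1 / A n) := by
  intro hs
  obtain ⟨C, hC, hP⟩ := G.exists_log_Psi_le hω hA
  have hl : ∀ n, 0 ≤ Real.log (1 / A n) := fun n =>
    Real.log_nonneg (by rw [le_div_iff₀ (G.pos n)]; linarith [G.lt_one n])
  refine hBR ?_
  unfold BRCondition
  set b := fun n => ∏ i ∈ Finset.range n, A i with hb
  have hb0 : ∀ n, 0 < b n := G.prod_pos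
  set F : ℕ → ℝ → ENNReal := fun i => (Set.Ici (1 / (2 * b i))).indicator fun Q =>
    ENNReal.ofReal (Real.log (1 / A i)) * ENNReal.ofReal (1 / Q ^ 2) with hF
  have hmeas : Measurable fun Q : ℝ => ENNReal.ofReal (1 / Q ^ 2) := by fun_prop
  have hFm : ∀ i, Measurable (F i) := fun i => (hmeas.const_mul _).indicator measurableSet_Ici
  have hintg : ∀ a : ℝ, 0 < a → ∫⁻ Q in Set.Ici a, ENNReal.ofReal (1 / Q ^ 2) = ENNReal.ofReal (1 / a) :=
    fun a ha => by rw [setLIntegral_congr Ioi_ae_eq_Ici.symm, lintegral_inv_sq ha]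
  have hFi : ∀ i, ∫⁻ Q in Set.Ici 1, F i Q ≤ ENNReal.ofReal (2 * (b i * Real.log (1 / A i))) := by
    intro i
    refine (setLIntegral_le_lintegral _ _).trans ?_
    rw [hF, lintegral_indicator measurableSet_Ici, lintegral_const_mul _ hmeas,
      hintg _ (by have := hb0 i; positivity), ← ENNReal.ofReal_mul (hl i), one_div_one_div]
    refine le_of_eq (congrArg _ ?_)
    ring
  have hbound : ∀ Q ∈ Set.Ici (1 : ℝ), ENNReal.ofReal (Real.log (Psi 2 ω Q) / Q ^ 2) ≤
      ENNReal.ofReal C * ENNReal.ofReal (1 / Q ^ 2) + ∑' i, F i Q := by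
    intro Q hQ
    obtain ⟨N, h1, h2⟩ := hP Q hQ
    have hQ0 : 0 ≤ 1 / Q ^ 2 := by positivity
    calc ENNReal.ofReal (Real.log (Psi 2 ω Q) / Q ^ 2)
        ≤ ENNReal.ofReal ((C + ∑ i ∈ Finset.range (N + 1), Real.log (1 / A i)) * (1 / Q ^ 2)) := by
          apply ENNReal.ofReal_le_ofReal
          rw [div_eq_mul_one_div]
          gcongr
      _ = ENNReal.ofReal C * ENNReal.ofReal (1 / Q ^ 2) + ∑ i ∈ Finset.range (N + 1), F i Q := by
          rw [add_mul, Finset.sum_mul, ENNReal.ofReal_add (mul_nonneg hC hQ0)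
            (Finset.sum_nonneg fun i _ => mul_nonneg (hl i) hQ0), ENNReal.ofReal_mul hC,
            ENNReal.ofReal_sum_of_nonneg fun i _ => mul_nonneg (hl i) hQ0]
          congr 1
          refine Finset.sum_congr rfl fun i hi => ?_
          rw [hF, ENNReal.ofReal_mul (hl i)]
          simp only
          rw [Set.indicator_of_mem]
          exact h2 i (by simpa [Nat.lt_succ_iff] using hi)
      _ ≤ _ := by gcongr; exact ENNReal.sum_le_tsum _
  calc _ ≤ ∫⁻ Q in Set.Ici (1 : ℝ), (ENNReal.ofReal C * ENNReal.ofReal (1 / Q ^ 2) + ∑' i, F i Q) :=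
        setLIntegral_mono' measurableSet_Ici hbound
    _ = ENNReal.ofReal C * ENNReal.ofReal (1 / 1) + ∑' i, ∫⁻ Q in Set.Ici (1 : ℝ), F i Q := by
        rw [lintegral_add_left (hmeas.const_mul _), lintegral_const_mul _ hmeas, hintg 1 one_pos,
          lintegral_tsum fun i => (hFm i).aemeasurable]
    _ ≤ ENNReal.ofReal C * ENNReal.ofReal (1 / 1) +
          ∑' i, ENNReal.ofReal (2 * (b i * Real.log (1 / A i))) := by
        gcongr with i; exact hFi i
    _ < ⊤ := by
        refine ENNReal.add_lt_top.2 ⟨ENNReal.mul_lt_top ENNReal.ofReal_lt_top ENNReal.ofReal_lt_top, ?_⟩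
        exact (hs.mul_left 2).tsum_ofReal_lt_top

/-- The lattice orbit `o` stays within distance `E` of the rotation orbit. -/
def OrbDev (α E : ℝ) (o : ℤ → ℤ → ℂ) : Prop := ∀ j k, ‖o j k - ((j * α + k : ℝ) : ℂ)‖ ≤ E

/-- Points of the orbit whose rotation counterparts are `d`-close are `B`-close. -/
def OrbModulus (α d B : ℝ) (o : ℤ → ℤ → ℂ) : Prop :=
  ∀ j k j' k' : ℤ, |(j * α + k : ℝ) - (j' * α + k')| ≤ d → ‖o j k - o j' k'‖ ≤ B

theorem exists_pos_le_of_periodic {φ : ℝ → ℝ} (hc : Continuous φ) (hp : ∀ x, φ (x + 1) = φ x)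
    (h : ∀ x, φ x ≠ 0) : ∃ c > 0, (∀ x, c ≤ φ x) ∨ ∀ x, c ≤ -φ x := by
  have hp' : Function.Periodic (fun x => |φ x|) 1 := fun x => by simp only [hp]
  obtain ⟨x₀, hx₀, hm⟩ := isCompact_Icc.exists_isMinOn (Set.nonempty_Icc.2 (zero_le_one (α := ℝ)))
    hc.abs.continuousOn
  have hb : ∀ x, |φ x₀| ≤ |φ x| := fun x => by
    obtain ⟨y, hy, e⟩ := hp'.exists_mem_Ico₀ one_pos x
    rw [e]; exact hm ⟨hy.1, hy.2.le⟩
  refine ⟨|φ x₀|, abs_pos.2 (h _), ?_⟩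
  rcases lt_or_gt_of_ne (h 0) with h0 | h0
  · right; intro x
    have : φ x < 0 := by
      by_contra hx
      obtain ⟨y, hy⟩ := mem_range_of_exists_le_of_exists_ge hc ⟨0, h0.le⟩ ⟨x, not_lt.1 hx⟩
      exact h y hy
    rw [← abs_of_neg this]; exact hb x
  · left; intro x
    have : 0 < φ x := by
      by_contra hx
      obtain ⟨y, hy⟩ := mem_range_of_exists_le_of_exists_ge hc ⟨x, not_lt.1 hx⟩ ⟨0, h0.le⟩
      exact h y hy
    rw [← abs_of_pos this]; exact hb x

theorem LatOrbit.eq_re {f : ℂ → ℂ} {o : ℤ → ℤ → ℂ} (O : LatOrbit 0 f o) (j k : ℤ) :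
    o j k = ((o j k).re : ℂ) :=
  Complex.ext rfl (by simpa using O.im_le j k)

theorem LatOrbit.exists_eq_add {f : ℂ → ℂ} {o : ℤ → ℤ → ℂ} {α E : ℝ} (O : LatOrbit 0 f o)
    (hE : OrbDev α E o) (hf : ∀ z, f (z + 1) = f z + 1) (hc : Continuous fun x : ℝ => (f x).re) :
    ∃ x : ℝ, (f x).re = x + α := by
  by_contra hne
  push Not at hne
  obtain ⟨c, hc0, hcs⟩ := exists_pos_le_of_periodic (φ := fun x : ℝ => (f x).re - x - α)
    (by fun_prop) (fun x => by
      rw [Complex.ofReal_add, Complex.ofReal_one, hf, Complex.add_re, Complex.one_re]; ring)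
    (fun x hx => hne x (by linarith))
  have hst : ∀ j, (o (j + 1) 0).re = (f ((o j 0).re : ℂ)).re := fun j => by
    rw [← O.eq_re, O.step]
  have hd : ∀ j : ℤ, |(o j 0).re - j * α| ≤ E := fun j => by
    have := (Complex.abs_re_le_norm _).trans (hE j 0)
    simpa using this
  obtain ⟨n, hn⟩ := exists_nat_gt (2 * E / c)
  rw [div_lt_iff₀ hc0] at hn
  have h0 := abs_le.1 (hd 0)
  have h1 := abs_le.1 (hd n)
  push_cast at h0 h1
  rcases hcs with hs | hs
  · have : ∀ n : ℕ, (o 0 0).re + n * (α + c) ≤ (o n 0).re := fun n => by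
      induction n with
      | zero => simp
      | succ n ih =>
        have := hst n
        have := hs (o n 0).re
        push_cast
        linarith
    have := this n
    linarith
  · have : ∀ n : ℕ, (o n 0).re ≤ (o 0 0).re + n * (α - c) := fun n => by
      induction n with
      | zero => simp
      | succ n ih =>
        have := hst n
        have := hs (o n 0).re
        push_cast
        linarith
    have := this n
    linarith

/-- `f` has rotation number `α`, and orbits of `g` give rise to orbits of `f`,
with control of heights, periods and moduli. -/
def Transports (α α₁ h₁ : ℝ) (a : ℤ) (g f : ℂ → ℂ) : Prop :=
  ∀ u o, LatOrbit u g o → α * u ≤ h₁ / 2 → ∃ o', LatOrbit (11 / 10 * (α * u)) f o' ∧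
    (∀ q p, (∀ j k, o (j + q) (k + p) = o j k) → ∀ j k, o' (j + (a * q - p)) (k - q) = o' j k) ∧
    (∀ E, OrbDev α₁ E o → OrbDev α (α * E + 1 / 50) o') ∧
    ∀ d B, α * B ≤ 1 / 20 → OrbModulus α₁ d B o → OrbModulus α (α * d) (11 / 10 * (α * B)) o'

theorem exists_step : ∃ C : ℝ, 1 ≤ C ∧ ∀ (α α₁ h₁ S S₁ : ℝ) (a : ℤ) (g : ℂ → ℂ) (E : ℝ)
    (o : ℤ → ℤ → ℂ), 0 < α → α ≤ 1 → C ≤ h₁ → S ≤ h₁ + Real.log (1 / α) / (2 * Real.pi) - C → 0 < S →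
    h₁ + 1 ≤ α * S₁ → 1 / α = a + α₁ → Adm α₁ S₁ g → LatOrbit 0 g o → OrbDev α₁ E o →
    ∃ f, Adm α S f ∧ Transports α α₁ h₁ a g f ∧
      (h₁ + 1 < S → ∃ ζ : ℂ, |ζ.im| ≤ h₁ + 1 ∧ f ζ = ζ) := by
  have hpi := Real.pi_pos
  have hg0 := glueConst_nonneg (show (0 : ℝ) < 3 / 16 by norm_num)
  set κ : ℝ := 1 / (10 ^ 6 * (1 + glueConst (3 / 16))) with hκ
  have hκ0 : 0 < κ := by positivity
  have hκ1 : κ ≤ 1 / 10 ^ 6 := by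
    rw [hκ]; apply one_div_le_one_div_of_le (by norm_num); nlinarith
  have hκg : glueConst (3 / 16) * κ ≤ 1 / 10 ^ 4 := by
    rw [hκ, mul_one_div, div_le_div_iff₀ (by positivity) (by norm_num)]; nlinarith
  set c := - Real.log κ / (2 * Real.pi) with hc
  have hc0 : 0 ≤ c := by
    have : Real.log κ ≤ 0 := Real.log_nonpos hκ0.le (hκ1.trans (by norm_num))
    rw [hc]; exact div_nonneg (by linarith) (by positivity)
  refine ⟨5 * (c + 5), by linarith, fun α α₁ h₁ S S₁ a g E o hα hα1 hh hS hS0 hS1 ha hg O hE => ?_⟩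
  set l := Real.log (1 / α) / (2 * Real.pi) with hl
  have hl0 : 0 ≤ l := div_nonneg (Real.log_nonneg (by rw [le_div_iff₀ hα]; linarith)) (by positivity)
  have D : StepData α h₁ (h₁ + l - c) κ α₁ S₁ a g := by
    refine ⟨hα, hα1, by linarith, by linarith, by linarith, hκ0, hκ1, hκg, ?_, hS1, hg, ha⟩
    rw [show -2 * Real.pi * (h₁ + l - c) = -2 * Real.pi * h₁ + (- (l * (2 * Real.pi)) + c * (2 * Real.pi)) by ring,
      hl, hc, div_mul_cancel₀ _ (by positivity), div_mul_cancel₀ _ (by positivity), Real.exp_add,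
      Real.exp_add, one_div, Real.log_inv, neg_neg, Real.exp_log hα, Real.exp_neg, Real.exp_log hκ0]
    field_simp
  set f := stepMap α h₁ (h₁ + l - c) α₁ g with hf
  have htr : Transports α α₁ h₁ a g f := fun u o O hu => ⟨_, D.latOrbit_stepOrb O hu,
    fun q p hp => D.stepOrb_period O hu hp, fun E hE => D.stepOrb_sub_rot O hu hE,
    fun d B hB hm => D.stepOrb_modulus O hu hB hm⟩
  obtain ⟨o', O', -, hd, -⟩ := htr 0 o O (by linarith)
  rw [mul_zero, mul_zero] at O'
  obtain ⟨i1, i2, i3⟩ := D.stepIter_spec 128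
  have hR : ∀ x : ℝ, (x : ℂ) ∈ Strip (h₁ + l - c - 1 / 10 - 21 / 1000 * (128 : ℕ)) := fun x => by
    show |(x : ℂ).im| < _
    simp only [Complex.ofReal_im, abs_zero]
    push_cast
    linarith
  obtain ⟨x, hx⟩ := O'.exists_eq_add (hd E hE) i1 (Complex.continuous_re.comp
    (i2.continuousOn.comp_continuous Complex.continuous_ofReal hR))
  have hx' : f x = x + α := by
    have h1 := (i3 x (hR x)).2
    rw [Complex.conj_ofReal] at h1
    have h2 := Complex.conj_eq_iff_re.1 h1.symm
    rw [hf, stepMap, ← h2, ← stepMap, ← hf, hx]; push_cast; ring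
  exact ⟨f, D.stepMap_adm (by linarith) hx' hS0, htr, fun h => D.exists_fixed (by linarith)⟩

theorem Adm.mono {α S S' : ℝ} {f : ℂ → ℂ} (h : Adm α S f) (hS : S' ≤ S) : Adm α S' f := by
  have hsub : Strip S' ⊆ Strip S := fun z hz => lt_of_lt_of_le hz hS
  refine ⟨h.diff.mono hsub, h.add_one, fun z hz => h.conj z (hsub hz), fun z hz =>
    (h.bound z (hsub hz)).trans ?_⟩
  have := Real.pi_pos
  gcongr ?_ * Real.exp ?_
  nlinarith

theorem adm_add (α S : ℝ) : Adm α S fun z => z + α :=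
  ⟨by fun_prop, fun z => by ring, fun z _ => by simp, fun z _ => by simp; positivity⟩

/-- Widths of the strips of analyticity in the construction. -/
noncomputable def towerS (A : ℕ → ℝ) (K C S₀ : ℝ) : ℕ → ℝ
  | 0 => max K S₀
  | n + 1 => max K (towerS A K C S₀ n + C - Real.log (1 / A n) / (2 * Real.pi) + 1) / A n

/-- Levels at which the width can be reset. -/
def Deep (A : ℕ → ℝ) (K C S₀ : ℝ) (n : ℕ) : Prop :=
  towerS A K C S₀ n ≤ K / 8 + Real.log (1 / A n) / (2 * Real.pi) - C

/-- Period vectors of transported fixed points. -/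
def perVec (a : ℕ → ℤ) : ℕ → ℕ → ℤ × ℤ
  | _, 0 => (1, 0)
  | m, i + 1 => (a m * (perVec a (m + 1) i).1 - (perVec a (m + 1) i).2, - (perVec a (m + 1) i).1)

theorem perVec_ne_zero (a : ℕ → ℤ) (m i : ℕ) : perVec a m i ≠ 0 := by
  induction i generalizing m with
  | zero => simp [perVec]
  | succ i ih =>
    intro h
    simp only [perVec, Prod.mk_eq_zero, neg_eq_zero] at h
    obtain ⟨h1, h2⟩ := h
    rw [h2, mul_zero, zero_sub, neg_eq_zero] at h1
    exact ih (m + 1) (Prod.ext h2 h1)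

theorem OrbDev.modulus {α E : ℝ} {o : ℤ → ℤ → ℂ} (h : OrbDev α E o) (d : ℝ) :
    OrbModulus α d (2 * E + d) o := by
  intro j k j' k' hd
  have h1 := h j k
  have h2 := h j' k'
  rw [norm_sub_rev] at h2
  calc ‖o j k - o j' k'‖ = ‖(o j k - ((j * α + k : ℝ) : ℂ)) +
        (((j * α + k : ℝ) : ℂ) - ((j' * α + k' : ℝ) : ℂ)) + (((j' * α + k' : ℝ) : ℂ) - o j' k')‖ := by
          congr 1; ring
    _ ≤ _ := norm_add₃_le
    _ ≤ E + d + E := by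
        gcongr
        rwa [← Complex.ofReal_sub, Complex.norm_real]
    _ = _ := by ring

theorem OrbModulus.mono {α d B B' : ℝ} {o : ℤ → ℤ → ℂ} (h : OrbModulus α d B o) (hB : B ≤ B') :
    OrbModulus α d B' o := fun j k j' k' hd => (h j k j' k' hd).trans hB

namespace GaussSeq
variable {A : ℕ → ℝ} (G : GaussSeq A)
include G

theorem log_nonneg (n : ℕ) : 0 ≤ Real.log (1 / A n) / (2 * Real.pi) :=
  div_nonneg (Real.log_nonneg (by rw [le_div_iff₀ (G.pos n)]; linarith [G.lt_one n]))
    (by have := Real.pi_pos; positivity)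

theorem prod_mul_le (m n : ℕ) : ∏ i ∈ Finset.range n, (11 / 10 * A (m + i)) ≤ 11 / 10 := by
  induction n using Nat.strong_induction_on with
  | _ n ih =>
    match n with
    | 0 => norm_num
    | 1 =>
      have h1 := G.lt_one m
      rw [Finset.prod_range_one, add_zero]; linarith
    | n + 2 =>
      have h := ih n (by omega)
      have h2 := G.mul_le (m + n)
      have h4 := G.pos (m + n)
      have h3 := mul_pos h4 (G.pos (m + n + 1))
      rw [Finset.prod_range_succ, Finset.prod_range_succ, mul_assoc, ← add_assoc]
      calc _ ≤ (11 / 10 : ℝ) * 1 :=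
            mul_le_mul h (by nlinarith) (by have := G.pos (m + n + 1); positivity) (by norm_num)
        _ = _ := mul_one _

theorem prod_mul_nonneg (m n : ℕ) : 0 ≤ ∏ i ∈ Finset.range n, (11 / 10 * A (m + i)) :=
  Finset.prod_nonneg fun i _ => by have := G.pos (m + i); positivity

theorem tendsto_prod_mul : Tendsto (fun n => ∏ i ∈ Finset.range n, (11 / 10 * A (0 + i))) atTop (𝓝 0) := by
  have hsq : ∀ n, (∏ i ∈ Finset.range n, (11 / 10 * A (0 + i))) ^ 2 ≤ 2 * (605 / 1000) ^ n := by
    intro n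
    simp only [zero_add]
    have := G.prod_sq_le n
    rw [Finset.prod_mul_distrib, Finset.prod_const, Finset.card_range, mul_pow, ← pow_mul, mul_comm n,
      pow_mul]
    calc ((11 / 10 : ℝ) ^ 2) ^ n * (∏ i ∈ Finset.range n, A i) ^ 2 ≤
          ((11 / 10 : ℝ) ^ 2) ^ n * (2 * (1 / 2) ^ n) := by gcongr
      _ = 2 * (((11 / 10 : ℝ) ^ 2) * (1 / 2)) ^ n := by rw [mul_pow]; ring
      _ = _ := by norm_num
  have h1 : Tendsto (fun n : ℕ => (2 : ℝ) * (605 / 1000) ^ n) atTop (𝓝 0) := by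
    simpa using (tendsto_pow_atTop_nhds_zero_of_lt_one (r := (605 / 1000 : ℝ)) (by norm_num)
      (by norm_num)).const_mul 2
  have h3 := (squeeze_zero (fun n => sq_nonneg _) hsq h1).sqrt
  simp only [Real.sqrt_zero] at h3
  exact h3.congr fun n => Real.sqrt_sq (G.prod_mul_nonneg 0 n)

theorem summable_prod_mul {l T : ℕ → ℝ} {M : ℝ} {N : ℕ} (hM : 0 ≤ M) (hl0 : ∀ n, 0 ≤ l n)
    (hT : ∀ n, 0 ≤ T n) (h : ∀ n ≥ N, A n * T (n + 1) ≤ T n + M - l n) :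
    Summable fun n => (∏ i ∈ Finset.range n, A i) * l n := by
  obtain ⟨b, hb⟩ : ∃ b : ℕ → ℝ, b = fun n => ∏ i ∈ Finset.range n, A i := ⟨_, rfl⟩
  have hb0 : ∀ n, 0 < b n := by rw [hb]; exact G.prod_pos
  have hbs : Summable b := by rw [hb]; exact G.summable_prod
  have hst : ∀ n ≥ N, b n * l n ≤ b n * T n - b (n + 1) * T (n + 1) + M * b n := by
    intro n hn
    have h3 : b (n + 1) = b n * A n := by rw [hb]; exact Finset.prod_range_succ _ _
    have := mul_le_mul_of_nonneg_left (h n hn) (hb0 n).le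
    rw [h3, mul_assoc]
    linarith
  have hsum : ∀ n, ∑ i ∈ Finset.range n, b (i + N) * l (i + N) ≤
      b N * T N - b (n + N) * T (n + N) + M * ∑ i ∈ Finset.range n, b (i + N) := by
    intro n
    induction n with
    | zero => simp
    | succ n ih =>
      rw [Finset.sum_range_succ, Finset.sum_range_succ]
      have := hst (n + N) (by omega)
      rw [show n + 1 + N = n + N + 1 by ring]
      linarith
  have key : Summable fun n => b (n + N) * l (n + N) := by
    refine summable_of_sum_range_le (c := b N * T N + M * ∑' n, b n)
      (fun n => mul_nonneg (hb0 _).le (hl0 _)) fun n => ?_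
    have h1 : ∑ i ∈ Finset.range n, b (i + N) ≤ ∑' n, b n :=
      (((summable_nat_add_iff N).2 hbs).sum_le_tsum _ fun i _ => (hb0 _).le).trans
        (by rw [← hbs.sum_add_tsum_nat_add N]
            exact le_add_of_nonneg_left (Finset.sum_nonneg fun i _ => (hb0 i).le))
    have h2 := mul_nonneg (hb0 (n + N)).le (hT (n + N))
    have := mul_le_mul_of_nonneg_left h1 hM
    linarith [hsum n]
  have := (summable_nat_add_iff (f := fun n => b n * l n) N).1 key
  rw [hb] at this
  exact this

variable {K C S₀ : ℝ} (hK : 100 * C ≤ K) (hC : 1 ≤ C)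
include hK hC

theorem le_towerS (n : ℕ) : K ≤ towerS A K C S₀ n := by
  cases n with
  | zero => exact le_max_left _ _
  | succ n =>
    rw [towerS, le_div_iff₀ (G.pos n)]
    have := G.lt_one n
    exact le_trans (by nlinarith) (le_max_left _ _)

theorem small_of_deep {n : ℕ} (hn : Deep A K C S₀ n) : A n ≤ 1 / 100 := by
  have h1 := G.le_towerS hK hC (S₀ := S₀) n
  have hpi := Real.pi_gt_three
  have h2 : 80 ≤ Real.log (1 / A n) / (2 * Real.pi) := by rw [Deep] at hn; linarith
  rw [le_div_iff₀ (by positivity)] at h2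
  have h3 : Real.log 100 ≤ Real.log (1 / A n) := by
    have := Real.log_le_sub_one_of_pos (show (0 : ℝ) < 100 by norm_num)
    nlinarith
  have h0 := G.pos n
  have := (Real.log_le_log_iff (by norm_num) (by positivity)).1 h3
  rw [le_div_iff₀ h0] at this
  linarith

theorem exists_height (n : ℕ) : ∃ h₁, C ≤ h₁ ∧
    towerS A K C S₀ n ≤ h₁ + Real.log (1 / A n) / (2 * Real.pi) - C ∧
    h₁ + 1 ≤ A n * towerS A K C S₀ (n + 1) ∧ A n * (K / 4) ≤ h₁ / 2 ∧
    (Deep A K C S₀ n → h₁ = K / 8) := by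
  have h0 := G.pos n
  have h1 := G.lt_one n
  have e : A n * towerS A K C S₀ (n + 1) =
      max K (towerS A K C S₀ n + C - Real.log (1 / A n) / (2 * Real.pi) + 1) := by
    rw [towerS, mul_div_cancel₀ _ h0.ne']
  have hm1 := le_max_left K (towerS A K C S₀ n + C - Real.log (1 / A n) / (2 * Real.pi) + 1)
  have hm2 := le_max_right K (towerS A K C S₀ n + C - Real.log (1 / A n) / (2 * Real.pi) + 1)
  by_cases hd : Deep A K C S₀ n
  · have hs := G.small_of_deep hK hC hd
    exact ⟨K / 8, by linarith, hd, by linarith, by nlinarith, fun _ => rfl⟩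
  · exact ⟨A n * towerS A K C S₀ (n + 1) - 1, by linarith, by linarith, by linarith, by nlinarith,
      fun h => absurd h hd⟩

theorem mul_towerS_le {n : ℕ} (hd : ¬ Deep A K C S₀ n) :
    A n * towerS A K C S₀ (n + 1) ≤
      K + (towerS A K C S₀ n + C - Real.log (1 / A n) / (2 * Real.pi) + 1) := by
  rw [towerS, mul_div_cancel₀ _ (G.pos n).ne']
  rw [Deep, not_le] at hd
  have hT := G.le_towerS hK hC (S₀ := S₀) n
  apply max_le <;> linarith

theorem infinite_deep (hs : ¬ Summable fun n => (∏ i ∈ Finset.range n, A i) * Real.log (1 / A n))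
    (N : ℕ) : ∃ n ≥ N, Deep A K C S₀ n := by
  by_contra hne
  have hne : ∀ n ≥ N, ¬ Deep A K C S₀ n := fun n hn hd => hne ⟨n, hn, hd⟩
  apply hs
  have hpi := Real.pi_pos
  have hst := fun n hn => G.mul_towerS_le hK hC (hne n hn)
  have hT := G.le_towerS hK hC (S₀ := S₀)
  generalize towerS A K C S₀ = T at hst hT
  have key := G.summable_prod_mul (l := fun n => Real.log (1 / A n) / (2 * Real.pi))
    (M := K + C + 1) (N := N) (T := T) (by linarith) G.log_nonneg (fun n => by linarith [hT n])
    fun n hn => by linarith [hst n hn]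
  refine (key.mul_left (2 * Real.pi)).congr fun n => ?_
  field_simp

end GaussSeq

theorem LatOrbit.mono {u u' : ℝ} {g : ℂ → ℂ} {o : ℤ → ℤ → ℂ} (O : LatOrbit u g o) (h : u ≤ u') :
    LatOrbit u' g o := ⟨O.step, O.shift, fun j k => (O.im_le j k).trans h⟩

theorem map_add_int {f : ℂ → ℂ} (hf : ∀ z, f (z + 1) = f z + 1) (z : ℂ) (k : ℤ) :
    f (z + k) = f z + k := by
  induction k using Int.induction_on with
  | zero => simp
  | succ i ih => push_cast at *; rw [← add_assoc, hf, ih]; ring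
  | pred i ih =>
    have := hf (z + ((-(i : ℤ) - 1 : ℤ) : ℂ))
    push_cast at *
    rw [show z + (-(i : ℂ) - 1) + 1 = z + -(i : ℂ) by ring, ih] at this
    linear_combination -this

theorem latOrbit_fixed {f : ℂ → ℂ} (hf : ∀ z, f (z + 1) = f z + 1) {ζ : ℂ} (hζ : f ζ = ζ) {u : ℝ}
    (hu : |ζ.im| ≤ u) : LatOrbit u f fun _ k => ζ + k :=
  ⟨fun j k => by rw [map_add_int hf, hζ], fun j k => by push_cast; ring, fun j k => by simpa using hu⟩

theorem prod_range_succ_shift (f : ℕ → ℝ) (m i : ℕ) :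
    ∏ t ∈ Finset.range (i + 1), f (m + t) = f m * ∏ t ∈ Finset.range i, f (m + 1 + t) := by
  rw [Finset.prod_range_succ', mul_comm, add_zero]
  exact congrArg _ (Finset.prod_congr rfl fun t _ => by rw [add_right_comm, add_assoc])

namespace GaussSeq
variable {A : ℕ → ℝ} (G : GaussSeq A)
include G

variable {K C S₀ : ℝ} (hK : 100 * C ≤ K) (hC : 1 ≤ C)
include hK hC

theorem exists_tower (hstep : ∀ (α α₁ h₁ S S₁ : ℝ) (a : ℤ) (g : ℂ → ℂ) (E : ℝ)
    (o : ℤ → ℤ → ℂ), 0 < α → α ≤ 1 → C ≤ h₁ → S ≤ h₁ + Real.log (1 / α) / (2 * Real.pi) - C → 0 < S →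
    h₁ + 1 ≤ α * S₁ → 1 / α = a + α₁ → Adm α₁ S₁ g → LatOrbit 0 g o → OrbDev α₁ E o →
    ∃ f, Adm α S f ∧ Transports α α₁ h₁ a g f ∧
      (h₁ + 1 < S → ∃ ζ : ℂ, |ζ.im| ≤ h₁ + 1 ∧ f ζ = ζ)) {a : ℕ → ℤ}
    (ha : ∀ n, 1 / A n = a n + A (n + 1)) (k m : ℕ) :
    ∃ f, Adm (A m) (towerS A K C S₀ m) f ∧
      (∃ o, LatOrbit 0 f o ∧ OrbDev (A m) ((1 + A m) / 25) o ∧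
        ∀ i < k, Deep A K C S₀ (m + i) → OrbModulus (A m) (∏ t ∈ Finset.range (i + 1), A (m + t))
          ((∏ t ∈ Finset.range (i + 1), (11 / 10 * A (m + t))) * 2) o) ∧
      ∀ i < k, Deep A K C S₀ (m + i) → ∃ o,
        LatOrbit ((∏ t ∈ Finset.range i, (11 / 10 * A (m + t))) * (K / 8 + 1)) f o ∧
        ∀ j l, o (j + (perVec a m i).1) (l + (perVec a m i).2) = o j l := by
  induction k generalizing m with
  | zero =>
    have h0 := G.pos m
    refine ⟨_, adm_add _ _, ⟨fun j k => ((j * A m + k : ℝ) : ℂ), ⟨fun j k => ?_, fun j k => ?_,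
      fun j k => ?_⟩, fun j k => ?_, fun i hi => absurd hi (by omega)⟩, fun i hi => absurd hi (by omega)⟩
    · push_cast; ring
    · push_cast; ring
    · simp
    · rw [sub_self, norm_zero]; positivity
  | succ k ih =>
    obtain ⟨g, hg, ⟨o, O, hE, hM⟩, hP⟩ := ih (m + 1)
    have h0 := G.pos m
    have h1 := G.lt_one m
    have h0' := G.pos (m + 1)
    have h1' := G.lt_one (m + 1)
    obtain ⟨h₁, hh1, hh2, hh3, hh4, hh5⟩ := G.exists_height hK hC (S₀ := S₀) m
    have hS := G.le_towerS hK hC (S₀ := S₀) m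
    obtain ⟨f, hf, htr, hfix⟩ := hstep (A m) (A (m + 1)) h₁ (towerS A K C S₀ m) _ (a m) g _ o h0 h1.le
      hh1 hh2 (by linarith) hh3 (ha m) hg O hE
    have eA : ∀ t, m + (t + 1) = m + 1 + t := fun t => by ring
    refine ⟨f, hf, ?_, ?_⟩
    · obtain ⟨o', O', -, hD, hM'⟩ := htr 0 o O (by linarith)
      rw [mul_zero, mul_zero] at O'
      refine ⟨o', O', fun j k => (hD _ hE j k).trans ?_, fun i hi hd => ?_⟩
      · have := G.mul_le m
        nlinarith
      · have hsm := G.small_of_deep hK hC hd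
        rcases i with _ | i
        · rw [add_zero] at hsm
          have := hM' 1 2 (by linarith) ((hE.modulus 1).mono (by linarith))
          convert this using 1
          · simp
          · simp; ring
        · rw [eA] at hd hsm
          have hpl := G.prod_mul_le (m + 1) i
          have hpn := G.prod_mul_nonneg (m + 1) i
          have := hM' _ _ ?_ (hM i (by omega) hd)
          · rw [prod_range_succ_shift A m (i + 1), prod_range_succ_shift (fun n => 11 / 10 * A n) m (i + 1)]
            convert this using 1
            ring
          · rw [Finset.prod_range_succ]
            have h2 := G.pos (m + 1 + i)
            have h3 := G.prod_mul_nonneg (m + 1) i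
            have h4 : (∏ t ∈ Finset.range i, (11 / 10 * A (m + 1 + t))) * (11 / 10 * A (m + 1 + i)) ≤
              11 / 10 * (11 / 10 * (1 / 100)) := by gcongr
            have h5 : 0 ≤ (∏ t ∈ Finset.range i, (11 / 10 * A (m + 1 + t))) * (11 / 10 * A (m + 1 + i)) := by
              positivity
            nlinarith
    · intro i hi hd
      rcases i with _ | i
      · rw [add_zero] at hd
        have e := hh5 hd
        obtain ⟨ζ, hz1, hz2⟩ := hfix (by linarith)
        refine ⟨_, latOrbit_fixed hf.add_one hz2 (u := _) (by simpa [← e] using hz1), fun j l => ?_⟩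
        simp [perVec]
      · rw [eA] at hd
        obtain ⟨o, O, hp⟩ := hP i (by omega) hd
        have hpl := G.prod_mul_le (m + 1) i
        obtain ⟨o', O', hp', -⟩ := htr _ o O (by
          refine le_trans ?_ hh4
          gcongr
          nlinarith)
        refine ⟨o', ?_, fun j l => ?_⟩
        · convert O' using 1
          rw [prod_range_succ_shift (fun n => 11 / 10 * A n) m i]
          ring
        · have := hp' _ _ hp j l
          rw [perVec, ← sub_eq_add_neg]
          exact this

end GaussSeq

/-- Approximate circle maps with control that is uniform in `N`. -/
theorem GaussSeq.exists_approx {A : ℕ → ℝ} (G : GaussSeq A)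
    (hs : ¬ Summable fun n => (∏ i ∈ Finset.range n, A i) * Real.log (1 / A n)) (S : ℝ) :
    ∃ (F : ℕ → ℂ → ℂ) (O : ℕ → ℤ → ℤ → ℂ), (∀ N, Adm (A 0) S (F N)) ∧
      (∀ N, LatOrbit 0 (F N) (O N)) ∧ (∀ N, OrbDev (A 0) 1 (O N)) ∧
      ∀ η > 0, ∃ d > 0, ∃ q p : ℤ, (q, p) ≠ (0, 0) ∧ ∃ N₀, ∀ N ≥ N₀,
        OrbModulus (A 0) d η (O N) ∧
        ∃ o, LatOrbit η (F N) o ∧ ∀ j l, o (j + q) (l + p) = o j l := by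
  obtain ⟨C, hC, hstep⟩ := exists_step
  choose a ha using G.frac
  have hT := fun N => G.exists_tower (K := 100 * C) (S₀ := S) le_rfl hC hstep ha N 0
  choose F hF hO hP using hT
  choose O hO1 hO2 hO3 using hO
  have h1 := G.lt_one 0
  refine ⟨F, O, fun N => (hF N).mono (le_max_right _ _), hO1, fun N j k => (hO2 N j k).trans (by linarith),
    fun η hη => ?_⟩
  have ht := G.tendsto_prod_mul
  have t1 := (((tendsto_add_atTop_iff_nat 1).2 ht).mul_const 2).eventually_lt_const
    (show (0 : ℝ) * 2 < η by simpa using hη)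
  have t2 := (ht.mul_const (100 * C / 8 + 1)).eventually_lt_const
    (show (0 : ℝ) * (100 * C / 8 + 1) < η by simpa using hη)
  obtain ⟨M, hM⟩ := eventually_atTop.1 (t1.and t2)
  obtain ⟨i, hi, hd⟩ := G.infinite_deep (S₀ := S) le_rfl hC hs M
  have hd' : Deep A (100 * C) C S (0 + i) := by rwa [zero_add]
  refine ⟨∏ t ∈ Finset.range (i + 1), A (0 + t), Finset.prod_pos fun t _ => G.pos _,
    (perVec a 0 i).1, (perVec a 0 i).2, perVec_ne_zero a 0 i, i + 1, fun N hN =>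
    ⟨(hO3 N i (by omega) hd').mono (hM i hi).1.le, ?_⟩⟩
  obtain ⟨o, ho, hp⟩ := hP N i (by omega) hd'
  exact ⟨o, ho.mono (hM i hi).2.le, hp⟩

theorem tendstoLocallyUniformlyOn_of_norm_le {ι : Type*} {l : Filter ι} [l.NeBot] {U : Set ℂ}
    (hU : IsOpen U) {F : ι → ℂ → ℂ} {f : ℂ → ℂ} {C : ℝ} (hd : ∀ n, DifferentiableOn ℂ (F n) U)
    (hC : ∀ n, ∀ z ∈ U, ‖F n z‖ ≤ C) (h : ∀ z ∈ U, Tendsto (fun n => F n z) l (𝓝 (f z))) :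
    TendstoLocallyUniformlyOn F f l U := by
  rw [Metric.tendstoLocallyUniformlyOn_iff]
  intro ε hε x hx
  obtain ⟨ρ, hρ, hρU⟩ := Metric.nhds_basis_closedBall.mem_iff.1 (hU.mem_nhds hx)
  have hlip : ∀ n, ∀ v ∈ Metric.closedBall x (ρ / 2), ‖F n v - F n x‖ ≤ 2 * C / ρ * ‖v - x‖ :=
    fun n v hv => norm_sub_le_of_closedBall hU (hd n) (hC n) hρ hρU hv
      (Metric.mem_closedBall_self (by positivity))
  obtain ⟨i⟩ : Nonempty ι := l.nonempty_of_neBot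
  have hC0 : 0 ≤ C := (norm_nonneg _).trans (hC i x hx)
  obtain ⟨δ, hδ⟩ : ∃ δ, δ = min (ρ / 2) (ε / (8 * C / ρ + 1)) := ⟨_, rfl⟩
  have hδ0 : 0 < δ := by rw [hδ]; positivity
  have hδ1 : δ ≤ ρ / 2 := by rw [hδ]; exact min_le_left _ _
  have hδ2 : 2 * C / ρ * δ ≤ ε / 4 := by
    have h1 : δ ≤ ε / (8 * C / ρ + 1) := by rw [hδ]; exact min_le_right _ _
    rw [le_div_iff₀ (by positivity)] at h1
    have : 8 * C / ρ = 4 * (2 * C / ρ) := by ring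
    nlinarith
  have hlip' : ∀ n, ∀ v ∈ Metric.closedBall x δ, ‖F n v - F n x‖ ≤ ε / 4 := fun n v hv => by
    refine (hlip n v (Metric.closedBall_subset_closedBall hδ1 hv)).trans (le_trans ?_ hδ2)
    rw [mem_closedBall_iff_norm] at hv
    gcongr
  have hsub : Metric.closedBall x δ ⊆ U :=
    (Metric.closedBall_subset_closedBall (by linarith)).trans hρU
  have hlim : ∀ v ∈ Metric.closedBall x δ, ‖f v - f x‖ ≤ ε / 4 := fun v hv =>
    le_of_tendsto ((h v (hsub hv)).sub (h x hx)).norm (Eventually.of_forall fun n => hlip' n v hv)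
  refine ⟨Metric.closedBall x δ, mem_nhdsWithin_of_mem_nhds (Metric.closedBall_mem_nhds x hδ0), ?_⟩
  filter_upwards [Metric.tendsto_nhds.1 (h x hx) (ε / 4) (by positivity)] with n hn v hv
  rw [dist_eq_norm] at hn ⊢
  calc ‖f v - F n v‖ = ‖(f v - f x) + (f x - F n x) + (F n x - F n v)‖ := by congr 1; ring
    _ ≤ ‖f v - f x‖ + ‖f x - F n x‖ + ‖F n x - F n v‖ := norm_add₃_le
    _ < ε := by
      rw [norm_sub_rev (f x), norm_sub_rev (F n x) (F n v)]
      linarith [hlim v hv, hlip' n v hv]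

theorem Ultrafilter.exists_tendsto_of_norm_le {ι : Type*} (l : Ultrafilter ι) {x : ι → ℂ} {C : ℝ}
    (h : ∀ᶠ n in (l : Filter ι), ‖x n‖ ≤ C) : ∃ y, Tendsto x l (𝓝 y) := by
  obtain ⟨y, -, hy⟩ := (isCompact_closedBall (0 : ℂ) C).ultrafilter_le_nhds (l.map x) (by
    rw [le_principal_iff, Ultrafilter.coe_map]
    exact h.mono fun n hn => by simpa using hn)
  exact ⟨y, hy⟩

section UltraLimit

variable {ι : Type*} {l : Ultrafilter ι} {α S : ℝ} {F : ι → ℂ → ℂ}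

theorem exists_adm_limit (hF : ∀ N, Adm α S (F N)) :
    ∃ f, Adm α S f ∧ TendstoLocallyUniformlyOn F f l (Strip S) := by
  have hle : ∀ N, ∀ z ∈ Strip S, ‖F N z - z - α‖ ≤ 1 := fun N z hz => by
    refine ((hF N).bound z hz).trans ?_
    have : Real.exp (-2 * Real.pi * (S - |z.im|)) ≤ 1 := Real.exp_le_one_iff.2 (by
      have : |z.im| < S := hz
      nlinarith [Real.pi_pos])
    linarith
  have hex : ∀ z, ∃ y, z ∈ Strip S → Tendsto (fun N => F N z) l (𝓝 y) := fun z => by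
    by_cases hz : z ∈ Strip S
    · obtain ⟨y, hy⟩ := l.exists_tendsto_of_norm_le (x := fun N => F N z - z - α)
        (Eventually.of_forall fun N => hle N z hz)
      refine ⟨y + z + α, fun _ => ?_⟩
      have := (hy.add_const z).add_const (α : ℂ)
      refine this.congr fun N => by ring
    · exact ⟨0, fun h => absurd h hz⟩
  classical
  choose g hg using hex
  obtain ⟨f, hf⟩ : ∃ f : ℂ → ℂ, f = fun z => if z ∈ Strip S then g z else z := ⟨_, rfl⟩
  have hfl : ∀ z ∈ Strip S, Tendsto (fun N => F N z) l (𝓝 (f z)) := fun z hz => by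
    rw [hf]; simpa [hz] using hg z hz
  have hloc : TendstoLocallyUniformlyOn (fun N z => F N z - z - α) (fun z => f z - z - α) l (Strip S) :=
    tendstoLocallyUniformlyOn_of_norm_le (isOpen_Strip S)
      (fun N => ((hF N).diff.sub differentiableOn_id).sub_const _) hle
      fun z hz => ((hfl z hz).sub_const z).sub_const _
  have hloc' : TendstoLocallyUniformlyOn F f l (Strip S) := by
    rw [Metric.tendstoLocallyUniformlyOn_iff] at hloc ⊢
    intro ε hε x hx
    obtain ⟨t, ht, h⟩ := hloc ε hε x hx
    refine ⟨t, ht, h.mono fun n hn y hy => ?_⟩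
    have := hn y hy
    rw [dist_eq_norm] at this ⊢
    convert this using 2
    ring
  refine ⟨f, ⟨hloc'.differentiableOn (Eventually.of_forall fun N => (hF N).diff) (isOpen_Strip S),
    fun z => ?_, fun z hz => ?_, fun z hz => ?_⟩, hloc'⟩
  · by_cases hz : z ∈ Strip S
    · have hz1 : z + 1 ∈ Strip S := by simpa [Strip] using hz
      refine tendsto_nhds_unique (hfl _ hz1) (((hfl z hz).add_const 1).congr fun N => ?_)
      rw [(hF N).add_one]
    · have hz1 : z + 1 ∉ Strip S := by simpa [Strip] using hz
      rw [hf]; simp [hz, hz1]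
  · have hz1 : starRingEnd ℂ z ∈ Strip S := by simpa [Strip] using hz
    refine tendsto_nhds_unique (hfl _ hz1)
      (((Complex.continuous_conj.tendsto _).comp (hfl z hz)).congr fun N => ?_)
    rw [(hF N).conj z hz]; rfl
  · exact le_of_tendsto (((hfl z hz).sub_const z).sub_const _).norm
      (Eventually.of_forall fun N => (hF N).bound z hz)

theorem exists_latOrbit_limit {f : ℂ → ℂ} {η : ℝ} (hη : η < S) (hf : DifferentiableOn ℂ f (Strip S))
    (hl : TendstoLocallyUniformlyOn F f l (Strip S)) {o : ι → ℤ → ℤ → ℂ}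
    (ho : ∀ᶠ N in (l : Filter ι), LatOrbit η (F N) (o N))
    (hb : ∀ j k, ∃ C, ∀ᶠ N in (l : Filter ι), ‖o N j k‖ ≤ C) :
    ∃ o', LatOrbit η f o' ∧ ∀ j k, Tendsto (fun N => o N j k) l (𝓝 (o' j k)) := by
  have hex : ∀ j k, ∃ y, Tendsto (fun N => o N j k) l (𝓝 y) := fun j k => by
    obtain ⟨C, hC⟩ := hb j k
    exact l.exists_tendsto_of_norm_le hC
  choose o' ho' using hex
  have him : ∀ j k, |(o' j k).im| ≤ η := fun j k =>
    le_of_tendsto ((Complex.continuous_im.tendsto _).comp (ho' j k)).abs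
      (ho.mono fun N hN => hN.im_le j k)
  have hmem : ∀ j k, o' j k ∈ Strip S := fun j k => (him j k).trans_lt hη
  refine ⟨o', ⟨fun j k => ?_, fun j k => ?_, him⟩, ho'⟩
  · have h1 := hl.tendsto_comp (hf.continuousOn _ (hmem j k)) (hmem j k)
      (tendsto_nhdsWithin_iff.2 ⟨ho' j k, ho.mono fun N hN => (hN.im_le j k).trans_lt hη⟩)
    exact tendsto_nhds_unique h1 ((ho' (j + 1) k).congr' (ho.mono fun N hN => (hN.step j k).symm))
  · exact tendsto_nhds_unique (ho' j (k + 1))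
      (((ho' j k).add_const 1).congr' (ho.mono fun N hN => (hN.shift j k).symm))

end UltraLimit

theorem LatOrbit.add_intCast {f : ℂ → ℂ} {η : ℝ} {o : ℤ → ℤ → ℂ} (O : LatOrbit η f o)
    (hf : ∀ z, f (z + 1) = f z + 1) (m : ℤ) : LatOrbit η f fun j k => o j k + m :=
  ⟨fun j k => by rw [map_add_int hf, O.step], fun j k => by rw [O.shift]; ring,
    fun j k => by simpa using O.im_le j k⟩

theorem LatOrbit.exists_norm_le {α S η : ℝ} (hη : η < S) (j k : ℤ) : ∃ C, ∀ f o, Adm α S f →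
    LatOrbit η f o → ‖o 0 0‖ ≤ 1 + η → ‖o j k‖ ≤ C := by
  have hst : ∀ f o, Adm α S f → LatOrbit η f o → ∀ j k, ‖o (j + 1) k - o j k‖ ≤ 1 + |α| := by
    intro f o hf O j k
    have hm : o j k ∈ Strip S := (O.im_le j k).trans_lt hη
    have h1 := hf.bound _ hm
    rw [O.step] at h1
    have h2 : Real.exp (-2 * Real.pi * (S - |(o j k).im|)) ≤ 1 := Real.exp_le_one_iff.2 (by
      have : |(o j k).im| < S := hm
      nlinarith [Real.pi_pos])
    have h3 := norm_add_le (o (j + 1) k - o j k - α) (α : ℂ)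
    rw [sub_add_cancel, Complex.norm_real, Real.norm_eq_abs] at h3
    linarith
  induction j using Int.induction_on with
  | zero =>
    refine ⟨1 + η + |(k : ℝ)|, fun f o hf O h => ?_⟩
    have h1 := O.shift_int 0 0 k
    rw [zero_add] at h1
    rw [h1]
    refine (norm_add_le _ _).trans ?_
    rw [Complex.norm_intCast]
    linarith
  | succ i ih =>
    obtain ⟨C, hC⟩ := ih
    refine ⟨C + (1 + |α|), fun f o hf O h => ?_⟩
    have h1 := hC f o hf O h
    have h2 := hst f o hf O i k
    have h3 := norm_sub_norm_le (o (i + 1) k) (o i k)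
    linarith
  | pred i ih =>
    obtain ⟨C, hC⟩ := ih
    refine ⟨C + (1 + |α|), fun f o hf O h => ?_⟩
    have h1 := hC f o hf O h
    have h2 := hst f o hf O (-i - 1) k
    rw [sub_add_cancel, norm_sub_rev] at h2
    have h3 := norm_sub_norm_le (o (-i - 1) k) (o (-i) k)
    linarith

theorem GaussSeq.exists_lattice {A : ℕ → ℝ} (G : GaussSeq A)
    (hs : ¬ Summable fun n => (∏ i ∈ Finset.range n, A i) * Real.log (1 / A n)) {S : ℝ} (hS : 0 < S) :
    ∃ f o, Adm (A 0) S f ∧ LatOrbit 0 f o ∧ OrbDev (A 0) 1 o ∧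
      (∀ η > 0, ∃ d > 0, OrbModulus (A 0) d η o) ∧
      ∀ η > 0, ∃ q p : ℤ, (q, p) ≠ (0, 0) ∧ ∃ o', LatOrbit η f o' ∧
        ∀ j l, o' (j + q) (l + p) = o' j l := by
  obtain ⟨F, O, hF, hO, hE, h⟩ := G.exists_approx hs S
  obtain ⟨l, hl⟩ : ∃ l : Ultrafilter ℕ, (l : Filter ℕ) ≤ atTop :=
    ⟨hyperfilter ℕ, Nat.hyperfilter_le_atTop⟩
  obtain ⟨f, hf, hFf⟩ := exists_adm_limit (l := l) hF
  obtain ⟨o, ho, hol⟩ := exists_latOrbit_limit hS hf.diff hFf (o := O) (Eventually.of_forall hO)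
    fun j k => ⟨1 + ‖((j * A 0 + k : ℝ) : ℂ)‖, Eventually.of_forall fun N => by
      have h1 := hE N j k
      have h2 := norm_sub_norm_le (O N j k) ((j * A 0 + k : ℝ) : ℂ)
      linarith⟩
  refine ⟨f, o, hf, ho, fun j k => ?_, fun η hη => ?_, fun η hη => ?_⟩
  · exact le_of_tendsto ((hol j k).sub_const _).norm (Eventually.of_forall fun N => hE N j k)
  · obtain ⟨d, hd, q, p, -, N₀, hN⟩ := h η hη
    refine ⟨d, hd, fun j k j' k' hjk => ?_⟩
    exact le_of_tendsto ((hol j k).sub (hol j' k')).norm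
      (hl ((eventually_ge_atTop N₀).mono fun N h0 => (hN N h0).1 j k j' k' hjk))
  · obtain ⟨η', hη'⟩ : ∃ η', η' = min η (S / 2) := ⟨_, rfl⟩
    have hη0 : 0 < η' := by rw [hη']; positivity
    have hηS : η' < S := by rw [hη']; exact (min_le_right _ _).trans_lt (by linarith)
    obtain ⟨d, hd, q, p, hqp, N₀, hN⟩ := h η' hη0
    have hex : ∀ N, ∃ o', N₀ ≤ N → LatOrbit η' (F N) o' ∧ ‖o' 0 0‖ ≤ 1 + η' ∧
        ∀ j l, o' (j + q) (l + p) = o' j l := fun N => by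
      by_cases hN0 : N₀ ≤ N
      · obtain ⟨-, o', ho', hper⟩ := hN N hN0
        refine ⟨fun j k => o' j k + (-⌊(o' 0 0).re⌋ : ℤ), fun _ =>
          ⟨ho'.add_intCast (hF N).add_one _, ?_, fun j l => congrArg (· + _) (hper j l)⟩⟩
        refine (Complex.norm_le_abs_re_add_abs_im _).trans ?_
        have h1 := ho'.im_le 0 0
        have h2 := Int.floor_le (o' 0 0).re
        have h3 := Int.lt_floor_add_one (o' 0 0).re
        have h4 : |(o' 0 0 + ((-⌊(o' 0 0).re⌋ : ℤ) : ℂ)).re| ≤ 1 := by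
          rw [Complex.add_re, Complex.intCast_re, Int.cast_neg]
          rw [abs_le]; constructor <;> linarith
        have h5 : (o' 0 0 + ((-⌊(o' 0 0).re⌋ : ℤ) : ℂ)).im = (o' 0 0).im := by simp
        rw [h5]
        linarith
      · exact ⟨0, fun h => absurd h hN0⟩
    choose o' ho' using hex
    have hev : ∀ᶠ N in (l : Filter ℕ), N₀ ≤ N := hl (eventually_ge_atTop N₀)
    obtain ⟨o₁, ho₁, hl₁⟩ := exists_latOrbit_limit hηS hf.diff hFf (o := o')
      (hev.mono fun N h0 => (ho' N h0).1) fun j k => by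
        obtain ⟨C, hC⟩ := LatOrbit.exists_norm_le (α := A 0) hηS j k
        exact ⟨C, hev.mono fun N h0 => hC _ _ (hF N) (ho' N h0).1 (ho' N h0).2.1⟩
    refine ⟨q, p, hqp, o₁, ho₁.mono (by rw [hη']; exact min_le_left _ _), fun j l => ?_⟩
    exact tendsto_nhds_unique (hl₁ (j + q) (l + p))
      ((hl₁ j l).congr' (hev.mono fun N h0 => ((ho' N h0).2.2 j l).symm))

theorem dense_lattice {α : ℝ} (hα : Irrational α) : Dense {x : ℝ | ∃ j k : ℤ, x = j * α + k} := by
  have h := dense_addSubgroupClosure_pair_iff (a := α) (b := 1) |>.2 (by simpa using hα)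
  refine h.mono fun x hx => ?_
  obtain ⟨j, k, e⟩ := AddSubgroup.mem_closure_pair.1 hx
  exact ⟨j, k, by simpa using e.symm⟩

/-- The orbit map extends to a continuous function on the line. -/
theorem exists_continuous_extension {α : ℝ} (hα : Irrational α) {o : ℤ → ℤ → ℂ}
    (hm : ∀ η > 0, ∃ d > 0, OrbModulus α d η o) :
    ∃ H : ℝ → ℝ, Continuous H ∧ ∀ j k : ℤ, H (j * α + k) = (o j k).re := by
  have hD := dense_lattice hα
  choose J K hJK using fun x : {x : ℝ | ∃ j k : ℤ, x = j * α + k} => x.2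
  obtain ⟨g, hg⟩ : ∃ g : {x : ℝ | ∃ j k : ℤ, x = j * α + k} → ℝ, g = fun x => (o (J x) (K x)).re :=
    ⟨_, rfl⟩
  have hgu : UniformContinuous g := by
    rw [Metric.uniformContinuous_iff]
    intro ε hε
    obtain ⟨d, hd, h⟩ := hm (ε / 2) (by positivity)
    refine ⟨d, hd, fun x y hxy => ?_⟩
    rw [Subtype.dist_eq, Real.dist_eq] at hxy
    have h1 := h (J x) (K x) (J y) (K y) (by rw [← hJK, ← hJK]; exact hxy.le)
    have h2 := Complex.abs_re_le_norm (o (J x) (K x) - o (J y) (K y))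
    rw [Real.dist_eq, hg]
    rw [Complex.sub_re] at h2
    exact (h2.trans h1).trans_lt (by linarith)
  refine ⟨hD.extend g, (hD.uniformContinuous_extend hgu).continuous, fun j k => ?_⟩
  have h0 := hD.extend_of_ind hgu ⟨j * α + k, j, k, rfl⟩
  rw [h0, hg]
  refine eq_of_abs_sub_eq_zero ?_
  refine le_antisymm (le_of_forall_pos_le_add fun η hη => ?_) (abs_nonneg _)
  obtain ⟨d, hd, h⟩ := hm η hη
  have h1 := h (J ⟨j * α + k, j, k, rfl⟩) (K ⟨j * α + k, j, k, rfl⟩) j k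
    (by rw [← hJK, sub_self, abs_zero]; exact hd.le)
  have h2 := Complex.abs_re_le_norm (o (J ⟨j * α + k, j, k, rfl⟩) (K ⟨j * α + k, j, k, rfl⟩) - o j k)
  rw [Complex.sub_re] at h2
  linarith

theorem Adm.injOn_real {α S : ℝ} {f : ℂ → ℂ} (hf : Adm α S f) (hS : 1 ≤ S) {x y : ℝ}
    (h : f x = f y) : x = y := by
  have hn : ∀ v ∈ Strip S, ‖f v - v - α‖ ≤ 1 / 200 := fun z hz => by
    refine (hf.bound z hz).trans ?_
    have : Real.exp (-2 * Real.pi * (S - |z.im|)) ≤ 1 := Real.exp_le_one_iff.2 (by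
      have : |z.im| < S := hz
      nlinarith [Real.pi_pos])
    linarith
  have hd : DifferentiableOn ℂ (fun v => f v - v - α) (Strip S) :=
    (hf.diff.sub differentiableOn_id).sub_const _
  have hS0 : ∀ x : ℝ, (x : ℂ) ∈ Strip S := fun x => by
    show |(x : ℂ).im| < S
    simp; linarith
  have hsub : Metric.closedBall (x : ℂ) (1 / 2) ⊆ Strip S := fun z hz => by
    have h1 := Complex.abs_im_le_norm (z - x)
    rw [mem_closedBall_iff_norm] at hz
    rw [Complex.sub_im, Complex.ofReal_im, sub_zero] at h1
    show |z.im| < S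
    linarith
  have e : ‖(y : ℂ) - x‖ = ‖(f x - x - α) - (f y - y - α)‖ := by rw [h]; congr 1; ring
  have h1 : ‖(y : ℂ) - x‖ ≤ 1 / 100 := by
    rw [e]
    refine (norm_sub_le _ _).trans ?_
    linarith [hn x (hS0 x), hn y (hS0 y)]
  have h2 := norm_sub_le_of_closedBall (isOpen_Strip S) hd hn (by norm_num) hsub
    (Metric.mem_closedBall_self (by norm_num)) (v' := y)
    (by rw [mem_closedBall_iff_norm]; linarith)
  rw [← e, norm_sub_rev (x : ℂ)] at h2
  have h3 : ‖(y : ℂ) - x‖ = 0 := by nlinarith [norm_nonneg ((y : ℂ) - x)]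
  rw [norm_eq_zero, sub_eq_zero] at h3
  exact_mod_cast h3.symm

theorem Adm.continuous_re {α S : ℝ} {f : ℂ → ℂ} (hf : Adm α S f) (hS : 0 < S) :
    Continuous fun x : ℝ => (f x).re := by
  refine Complex.continuous_re.comp (continuous_iff_continuousAt.2 fun x => ?_)
  have hx : (x : ℂ) ∈ Strip S := by
    show |(x : ℂ).im| < S
    simpa using hS
  exact ContinuousAt.comp (f := fun x : ℝ => (x : ℂ))
    ((hf.diff.continuousOn _ hx).continuousAt ((isOpen_Strip S).mem_nhds hx))
    Complex.continuous_ofReal.continuousAt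

theorem Adm.ofReal_re {α S : ℝ} {f : ℂ → ℂ} (hf : Adm α S f) (hS : 0 < S) (x : ℝ) :
    ((f x).re : ℂ) = f x := by
  have hx : (x : ℂ) ∈ Strip S := by
    show |(x : ℂ).im| < S
    simpa using hS
  have := hf.conj x hx
  rw [Complex.conj_ofReal] at this
  exact Complex.conj_eq_iff_re.1 this.symm

theorem Adm.exists_conj {α S : ℝ} (hα : Irrational α) (hS : 1 ≤ S) {f : ℂ → ℂ} (hf : Adm α S f)
    {o : ℤ → ℤ → ℂ} (ho : LatOrbit 0 f o) (hE : OrbDev α 1 o)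
    (hm : ∀ η > 0, ∃ d > 0, OrbModulus α d η o) :
    ∃ H : ℝ → ℝ, Continuous H ∧ StrictMono H ∧ (∀ x, H (x + 1) = H x + 1) ∧
      ∀ x, f (H x) = H (x + α) := by
  obtain ⟨H, hH, hHo⟩ := exists_continuous_extension hα hm
  have hD := dense_lattice hα
  have hfc := hf.continuous_re (by linarith)
  have h1 : ∀ x, H (x + 1) = H x + 1 := by
    refine congrFun (Continuous.ext_on (f := fun x => H (x + 1)) (g := fun x => H x + 1) hD
      (by fun_prop) (by fun_prop) ?_)
    rintro x ⟨j, k, rfl⟩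
    have e : (j * α + k + 1 : ℝ) = j * α + ((k + 1 : ℤ) : ℝ) := by push_cast; ring
    simp only [e, hHo, ho.shift]
    simp
  have h2 : ∀ x, (f (H x)).re = H (x + α) := by
    refine congrFun (Continuous.ext_on (f := fun x => (f (H x)).re) (g := fun x => H (x + α)) hD
      (hfc.comp hH) (by fun_prop) ?_)
    rintro x ⟨j, k, rfl⟩
    have e : (j * α + k + α : ℝ) = ((j + 1 : ℤ) : ℝ) * α + k := by push_cast; ring
    simp only [e, hHo]
    rw [← ho.eq_re, ho.step]
  have h2' : ∀ x, f (H x) = H (x + α) := fun x => by rw [← h2, hf.ofReal_re (by linarith)]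
  have h3 : ∀ x, |H x - x| ≤ 1 := by
    refine hD.induction ?_ (isClosed_le (by fun_prop) continuous_const)
    rintro x ⟨j, k, rfl⟩
    rw [hHo]
    have := (Complex.abs_re_le_norm _).trans (hE j k)
    simpa using this
  have hinj : Function.Injective H := by
    intro a b hab
    by_contra hne
    have hj : ∀ j : ℤ, H (a + j * α) = H (b + j * α) := fun j => by
      induction j using Int.induction_on with
      | zero => simpa using hab
      | succ i ih =>
        have e : ∀ a : ℝ, a + ((i + 1 : ℤ) : ℝ) * α = a + (i : ℤ) * α + α := fun a => by
          push_cast; ring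
        rw [e, e, ← h2, ← h2, ih]
      | pred i ih =>
        have e : ∀ a : ℝ, a + ((-i : ℤ) : ℝ) * α = a + ((-i - 1 : ℤ) : ℝ) * α + α := fun a => by
          push_cast; ring
        refine hf.injOn_real hS ?_
        rw [h2', h2', ← e, ← e, ih]
    have hk : ∀ x : ℝ, ∀ k : ℤ, H (x + k) = H x + k := fun x k => by
      induction k using Int.induction_on with
      | zero => simp
      | succ i ih => push_cast; push_cast at ih; rw [← add_assoc, h1, ih]; ring
      | pred i ih =>
        have := h1 (x + ((-i - 1 : ℤ) : ℝ))
        rw [add_assoc] at this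
        push_cast at this ih ⊢
        rw [sub_add_cancel, ih] at this
        linarith
    have hT : ∀ x, H (x + (b - a)) = H x := by
      have : ∀ x, H (x + b) = H (x + a) := by
        refine congrFun (Continuous.ext_on (f := fun x => H (x + b)) (g := fun x => H (x + a)) hD
          (by fun_prop) (by fun_prop) ?_)
        rintro x ⟨j, k, rfl⟩
        have e : ∀ a : ℝ, j * α + k + a = a + j * α + k := fun a => by ring
        simp only [e, hk, hj]
      intro x
      have := this (x - a)
      rw [sub_add_cancel] at this
      rw [← this]; congr 1; ring
    have hTn : ∀ n : ℕ, H (n * (b - a)) = H 0 := fun n => by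
      induction n with
      | zero => simp
      | succ n ih => rw [← ih, ← hT (n * (b - a))]; congr 1; push_cast; ring
    obtain ⟨n, hn⟩ := exists_nat_gt (2 / |b - a|)
    have hba : 0 < |b - a| := abs_pos.2 (sub_ne_zero.2 (Ne.symm hne))
    rw [div_lt_iff₀ hba] at hn
    have h4 := h3 (n * (b - a))
    have h5 := h3 0
    rw [hTn] at h4
    have h6 : |n * (b - a)| = n * |b - a| := by rw [abs_mul, Nat.abs_cast]
    have h7 := abs_sub_abs_le_abs_sub (n * (b - a)) (H 0)
    rw [abs_sub_comm _ (H 0)] at h7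
    rw [sub_zero] at h5
    linarith
  refine ⟨H, hH, ?_, h1, h2'⟩
  rcases hH.strictMono_of_inj hinj with h | h
  · exact h
  · have := h (zero_lt_one (α := ℝ))
    have := h1 0
    rw [zero_add] at this
    linarith

theorem exists_circle_map {ω : Fin 2 → ℝ} (hω : NonResonant 2 ω) (hBR : ¬ BRCondition 2 ω) {S : ℝ}
    (hS : 1 ≤ S) : ∃ (f : ℂ → ℂ) (H : ℝ → ℝ), Adm (ω 1 / ω 0) S f ∧ Continuous H ∧ StrictMono H ∧
      (∀ x, H (x + 1) = H x + 1) ∧ (∀ x, f (H x) = H (x + ω 1 / ω 0)) ∧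
      ∀ η > 0, ∃ q p : ℤ, (q, p) ≠ (0, 0) ∧ ∃ o, LatOrbit η f o ∧
        ∀ j l, o (j + q) (l + p) = o j l := by
  obtain ⟨α, hα⟩ : ∃ α, α = ω 1 / ω 0 := ⟨_, rfl⟩
  rw [← hα]
  have hi : Irrational α := hα ▸ hω.irrational
  obtain ⟨m, hm⟩ : ∃ m, m = ⌊α⌋ := ⟨_, rfl⟩
  have hfr : α = Int.fract α + m := by rw [hm]; exact (Int.fract_add_floor α).symm
  have hi' : Irrational (Int.fract α) := by
    rw [← Int.self_sub_floor]; exact hi.sub_intCast _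
  have h0 : 0 < Int.fract α := lt_of_le_of_ne (Int.fract_nonneg _) fun h => hi'.ne_zero h.symm
  obtain ⟨A, G, hA⟩ := exists_gaussSeq hi' h0 (Int.fract_lt_one _)
  obtain ⟨f, o, hf, ho, hE, hmod, hper⟩ := G.exists_lattice
    (G.not_summable_log hω hBR (by rw [hA, hα])) (zero_lt_one.trans_le hS)
  rw [hA] at hf hE hmod
  obtain ⟨H, hH, hmono, hH1, hHf⟩ := hf.exists_conj hi' hS ho hE hmod
  have hHk : ∀ x, H (x + m) = H x + m := fun x => by
    have h : ∀ k : ℕ, ∀ x, H (x + k) = H x + k := fun k => by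
      induction k with
      | zero => simp
      | succ i ih => intro x; push_cast; rw [← add_assoc, hH1, ih]; ring
    rcases Int.eq_nat_or_neg m with ⟨k, rfl | rfl⟩
    · exact_mod_cast h k x
    · have := h k (x - k)
      rw [sub_add_cancel] at this
      push_cast
      rw [← sub_eq_add_neg, ← sub_eq_add_neg]
      linarith
  have hc : ((Int.fract α : ℝ) : ℂ) + m = α := by exact_mod_cast hfr.symm
  refine ⟨fun z => f z + m, H, ⟨hf.diff.add_const _, fun z => ?_, fun z hz => ?_, fun z hz => ?_⟩, hH,
    hmono, hH1, fun x => ?_, fun η hη => ?_⟩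
  · rw [hf.add_one]; ring
  · rw [hf.conj z hz]; simp
  · refine le_trans (le_of_eq ?_) (hf.bound z hz)
    rw [← hc]; congr 1; ring
  · simp only [hHf]
    rw [show x + α = x + Int.fract α + m by rw [add_assoc, ← hfr], hHk]
    push_cast; ring
  · obtain ⟨q, p, hqp, o', O, hP⟩ := hper η hη
    refine ⟨q, p - q * m, fun h => hqp ?_, fun j k => o' j k + ((j * m : ℤ) : ℂ),
      ⟨fun j k => ?_, fun j k => ?_, fun j k => ?_⟩, fun j l => ?_⟩
    · rw [Prod.mk.injEq] at h
      obtain ⟨rfl, h⟩ := h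
      rw [zero_mul, sub_zero] at h
      rw [h]
    · simp only [map_add_int hf.add_one, O.step]
      push_cast; ring
    · rw [O.shift]; ring
    · simpa using O.im_le j k
    · have h1 := hP j l
      have h2 := O.shift_int (j + q) (l + p) (-(q * m))
      rw [h1] at h2
      rw [show l + (p - q * m) = l + p + -(q * m) by ring]
      simp only [h2]
      push_cast; ring

theorem map_add_intCast_real {g : ℝ → ℝ} (h : ∀ y, g (y + 1) = g y + 1) (y : ℝ) (m : ℤ) :
    g (y + m) = g y + m := by
  induction m using Int.induction_on with
  | zero => simp
  | succ i ih => push_cast at ih ⊢; rw [← add_assoc, h, ih]; ring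
  | pred i ih =>
    have := h (y + ((-i - 1 : ℤ) : ℝ))
    rw [add_assoc] at this
    push_cast at this ih ⊢
    rw [sub_add_cancel, ih] at this
    linarith

theorem surjective_of_add_one {g : ℝ → ℝ} (hc : Continuous g) (h : ∀ y, g (y + 1) = g y + 1) :
    Function.Surjective g := by
  intro θ
  have h1 := map_add_intCast_real h 0 ⌊θ - g 0⌋
  have h2 := map_add_intCast_real h 0 ⌈θ - g 0⌉
  exact mem_range_of_exists_le_of_exists_ge hc
    ⟨0 + (⌊θ - g 0⌋ : ℝ), by rw [h1]; linarith [Int.floor_le (θ - g 0)]⟩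
    ⟨0 + (⌈θ - g 0⌉ : ℝ), by rw [h2]; linarith [Int.le_ceil (θ - g 0)]⟩

/-- A continuous family of degree one homeomorphisms of the line has a continuous family of
inverses. -/
theorem exists_fiber_inverse {κ : ℝ → ℝ → ℝ} (hc : Continuous fun p : ℝ × ℝ => κ p.1 p.2)
    (hm : ∀ x, StrictMono (κ x)) (h1 : ∀ x y, κ x (y + 1) = κ x y + 1) :
    ∃ Y : ℝ → ℝ → ℝ, (Continuous fun p : ℝ × ℝ => Y p.1 p.2) ∧ (∀ x θ, κ x (Y x θ) = θ) ∧
      ∀ x y, Y x (κ x y) = y := by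
  have hcx : ∀ x, Continuous (κ x) := fun x => hc.comp (Continuous.prodMk_right x)
  choose Y hY using fun x => surjective_of_add_one (hcx x) (h1 x)
  refine ⟨Y, continuous_iff_continuousAt.2 fun ⟨x₀, θ₀⟩ => ?_, hY, fun x y => (hm x).injective (hY _ _)⟩
  rw [Metric.continuousAt_iff']
  intro ε hε
  have hlt : ∀ y, Continuous fun p : ℝ × ℝ => κ p.1 y := fun y =>
    hc.comp (continuous_fst.prodMk continuous_const)
  have a1 : κ x₀ (Y x₀ θ₀ - ε) < θ₀ := by
    conv_rhs => rw [← hY x₀ θ₀]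
    exact hm x₀ (by linarith)
  have a2 : θ₀ < κ x₀ (Y x₀ θ₀ + ε) := by
    conv_lhs => rw [← hY x₀ θ₀]
    exact hm x₀ (by linarith)
  filter_upwards [((hlt (Y x₀ θ₀ - ε)).continuousAt (x := (x₀, θ₀))).eventually_lt
      continuous_snd.continuousAt a1, continuous_snd.continuousAt.eventually_lt
      ((hlt (Y x₀ θ₀ + ε)).continuousAt (x := (x₀, θ₀))) a2] with p hp1 hp2
  rw [Real.dist_eq, abs_lt]
  have b1 : Y x₀ θ₀ - ε < Y p.1 p.2 := (hm p.1).lt_iff_lt.1 (by rw [hY]; exact hp1)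
  have b2 : Y p.1 p.2 < Y x₀ θ₀ + ε := (hm p.1).lt_iff_lt.1 (by rw [hY]; exact hp2)
  constructor <;> linarith

/-- A continuous curve in a level set is differentiable where the vertical derivative does not
vanish. -/
theorem hasDerivAt_of_level {F : ℝ × ℝ → ℝ} {L : ℝ × ℝ →L[ℝ] ℝ} {a y : ℝ → ℝ} {t₀ a' b v : ℝ}
    (hF : HasFDerivAt F L (a t₀, y t₀)) (ha : HasDerivAt a a' t₀) (hy : ContinuousAt y t₀)
    (hv : ∀ᶠ t in 𝓝 t₀, F (a t, y t) = v) (hL : L (0, 1) ≠ 0) (hb : L (a', b) = 0) :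
    HasDerivAt y b t₀ := by
  have hq : Tendsto (fun t => (a t, y t)) (𝓝 t₀) (𝓝 (a t₀, y t₀)) :=
    (ha.continuousAt.prodMk hy).tendsto
  have h1 := hF.isLittleO.comp_tendsto hq
  have h2 : (fun t => L (a t - a t₀, y t - y t₀)) =o[𝓝 t₀]
      fun t => ((a t - a t₀, y t - y t₀) : ℝ × ℝ) := by
    refine (h1.neg_left).congr' ?_ (Eventually.of_forall fun t => rfl)
    filter_upwards [hv] with t ht
    simp only [Function.comp_apply, ht, hv.self_of_nhds, Prod.mk_sub_mk]
    ring
  have hsplit : ∀ p q : ℝ, L (p, q) = p * L (1, 0) + q * L (0, 1) := fun p q => by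
    have : ((p, q) : ℝ × ℝ) = p • (1, 0) + q • (0, 1) := by simp
    rw [this, map_add, map_smul, map_smul, smul_eq_mul, smul_eq_mul]
  rw [hsplit] at hb
  have ha2 := ha.isLittleO
  -- the defect of `y` from its linear approximation
  have h3 : (fun t => y t - y t₀ - (t - t₀) * b) =o[𝓝 t₀]
      fun t => ‖a t - a t₀‖ + ‖y t - y t₀‖ + ‖t - t₀‖ := by
    have e : (fun t => y t - y t₀ - (t - t₀) * b) = fun t => (L (0, 1))⁻¹ *
        (L (a t - a t₀, y t - y t₀) - L (1, 0) * (a t - a t₀ - (t - t₀) * a')) := by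
      ext t
      rw [hsplit (a t - a t₀)]
      field_simp
      linear_combination -(t - t₀) * hb
    rw [e]
    have hO : ∀ t, ‖‖a t - a t₀‖ + ‖y t - y t₀‖ + ‖t - t₀‖‖ = ‖a t - a t₀‖ + ‖y t - y t₀‖ + ‖t - t₀‖ :=
      fun t => Real.norm_of_nonneg (by positivity)
    have hO1 : (fun t => ((a t - a t₀, y t - y t₀) : ℝ × ℝ)) =O[𝓝 t₀]
        fun t => ‖a t - a t₀‖ + ‖y t - y t₀‖ + ‖t - t₀‖ := by
      refine Asymptotics.IsBigO.of_bound 1 (Eventually.of_forall fun t => ?_)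
      rw [one_mul, hO, Prod.norm_mk]
      have := norm_nonneg (t - t₀)
      have := norm_nonneg (a t - a t₀)
      have := norm_nonneg (y t - y t₀)
      refine max_le ?_ ?_ <;> linarith
    have hO2 : (fun t => t - t₀) =O[𝓝 t₀] fun t => ‖a t - a t₀‖ + ‖y t - y t₀‖ + ‖t - t₀‖ := by
      refine Asymptotics.IsBigO.of_bound 1 (Eventually.of_forall fun t => ?_)
      rw [one_mul, hO]
      have := norm_nonneg (a t - a t₀)
      have := norm_nonneg (y t - y t₀)
      linarith
    have ha3 : (fun t => a t - a t₀ - (t - t₀) * a') =o[𝓝 t₀] fun t => t - t₀ := ha2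
    exact ((h2.trans_isBigO hO1).sub ((ha3.trans_isBigO hO2).const_mul_left _)).const_mul_left _
  have haO : (fun t => a t - a t₀) =O[𝓝 t₀] fun t => t - t₀ := ha.isBigO_sub
  have hyO : (fun t => y t - y t₀) =O[𝓝 t₀] fun t => t - t₀ := by
    obtain ⟨C, hC⟩ := haO.bound
    refine Asymptotics.IsBigO.of_bound (2 * (|b| + 1) + |C|) ?_
    filter_upwards [h3.bound (show (0:ℝ) < 1 / 2 by norm_num), hC] with t ht hCt
    have hCt' : ‖a t - a t₀‖ ≤ |C| * ‖t - t₀‖ := hCt.trans (by gcongr; exact le_abs_self C)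
    rw [Real.norm_of_nonneg (by positivity : 0 ≤ ‖a t - a t₀‖ + ‖y t - y t₀‖ + ‖t - t₀‖)] at ht
    have h4 := norm_sub_norm_le (y t - y t₀) ((t - t₀) * b)
    rw [norm_mul, Real.norm_eq_abs b] at h4
    nlinarith [norm_nonneg (t - t₀)]
  rw [hasDerivAt_iff_isLittleO]
  simp only [smul_eq_mul]
  exact h3.trans_isBigO ((haO.norm_left.add hyO.norm_left).add (Asymptotics.isBigO_refl _ _).norm_left)

theorem eq_of_continuous_int {d : ℝ → ℝ} (hc : Continuous d) (h : ∀ x, ∃ m : ℤ, d x = m) (x y : ℝ) :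
    d x = d y := by
  choose m hm using h
  have hmc : Continuous m := by
    have := Int.isClosedEmbedding_coe_real.isInducing.continuous_iff (f := m)
    rw [this]
    refine hc.congr fun x => hm x
  rw [hm, hm, PreconnectedSpace.constant inferInstance hmc (x := x) (y := y)]

theorem const_of_irrational {d : ℝ → ℝ} {α : ℝ} (hα : Irrational α) (hc : Continuous d)
    (h1 : ∀ x, ∃ m : ℤ, d (x + 1) - d x = m) (h2 : ∀ x, ∃ m : ℤ, d (x + α) - d x = m) (x y : ℝ) :
    d x = d y := by
  have c1 := eq_of_continuous_int (by fun_prop : Continuous fun x => d (x + 1) - d x) h1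
  have c2 := eq_of_continuous_int (by fun_prop : Continuous fun x => d (x + α) - d x) h2
  obtain ⟨a, ha⟩ := h1 0
  obtain ⟨b, hb⟩ := h2 0
  have e1 : ∀ x, d (x + 1) = d x + a := fun x => by linarith [c1 x 0]
  have e2 : ∀ x, d (x + α) = d x + b := fun x => by linarith [c2 x 0]
  obtain ⟨p, hp⟩ : ∃ p : ℝ → ℝ, p = fun x => d x - a * x := ⟨_, rfl⟩
  have hpc : Continuous p := by rw [hp]; fun_prop
  have hpp : Function.Periodic p 1 := fun x => by rw [hp]; simp only [e1]; ring
  obtain ⟨C, hC⟩ := isCompact_Icc.exists_bound_of_continuousOn (s := Set.Icc (0:ℝ) 1) hpc.continuousOn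
  have hC' : ∀ x, |p x| ≤ C := fun x => by
    obtain ⟨y, hy, e⟩ := hpp.exists_mem_Ico₀ one_pos x
    rw [e]; exact hC y ⟨hy.1, hy.2.le⟩
  have hn : ∀ n : ℕ, p (n * α) = p 0 + n * (b - a * α) := fun n => by
    induction n with
    | zero => simp
    | succ n ih =>
      have : p (n * α + α) = p (n * α) + (b - a * α) := by rw [hp]; simp only [e2]; ring
      push_cast
      rw [add_mul, one_mul, this, ih]; ring
  have hz : (b : ℝ) - a * α = 0 := by
    by_contra hne
    have hpos := abs_pos.2 hne
    obtain ⟨n, hn'⟩ := exists_nat_gt (2 * C / |(b : ℝ) - a * α|)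
    rw [div_lt_iff₀ hpos] at hn'
    have h3 : |n * ((b : ℝ) - a * α)| = n * |(b : ℝ) - a * α| := by rw [abs_mul, Nat.abs_cast]
    have h4 := hC' (n * α)
    have h5 := hC' 0
    have h6 : n * ((b : ℝ) - a * α) = p (n * α) - p 0 := by rw [hn]; ring
    rw [h6] at h3
    have := abs_sub (p (n * α)) (p 0)
    linarith
  have ha0 : a = 0 := by
    by_contra hne
    refine hα ⟨b / a, ?_⟩
    have : (a : ℝ) ≠ 0 := by exact_mod_cast hne
    push_cast
    field_simp
    linarith
  have hb0 : (b : ℝ) = 0 := by rw [ha0] at hz; simpa using hz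
  rw [ha0] at e1
  rw [hb0] at e2
  have hlat : ∀ j k : ℤ, d (j * α + k) = d 0 := by
    have g1 : Function.Periodic d 1 := fun x => by simpa using e1 x
    have g2 : Function.Periodic d α := fun x => by simpa using e2 x
    intro j k
    have := (g1.int_mul k) (j * α)
    rw [mul_one] at this
    rw [this]
    have := (g2.int_mul j) 0
    rw [zero_add] at this
    exact this
  have : ∀ x, d x = d 0 := congrFun (Continuous.ext_on (g := fun _ => d 0) (dense_lattice hα) hc
    continuous_const (by rintro x ⟨j, k, rfl⟩; exact hlat j k))
  rw [this, this y]

/-- A flow box for a vector field `(ω 0, ω 0 * g)` on the torus, with vertical first integral `c`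
whose monodromy `fR` is conjugate by `H` to the rotation by `ω 1 / ω 0`. -/
structure SuspData (ω : Fin 2 → ℝ) (w : ℝ) (H fR : ℝ → ℝ) (c g : ℝ → ℝ → ℝ) : Prop where
  ne_zero : ω 0 ≠ 0
  irr : Irrational (ω 1 / ω 0)
  w_pos : 0 < w
  w_lt : w < 1
  H_cont : Continuous H
  H_mono : StrictMono H
  H_add : ∀ x, H (x + 1) = H x + 1
  H_conj : ∀ x, fR (H x) = H (x + ω 1 / ω 0)
  c_add : ∀ x y, c x (y + 1) = c x y + 1
  c_sub : ∀ x, |x| < w → ∀ y, c (x - 1) y = fR (c x y)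
  g_int : ∀ (x y : ℝ) (m : ℤ), g (x - m) y = g x y
  deriv : ∀ x, -1 - w < x → x < w → ∀ y, ∃ L : ℝ × ℝ →L[ℝ] ℝ,
    HasFDerivAt (fun p : ℝ × ℝ => c p.1 p.2) L (x, y) ∧ 0 < L (0, 1) ∧ L (1, g x y) = 0

namespace SuspData

variable {ω : Fin 2 → ℝ} {w : ℝ} {H fR : ℝ → ℝ} {c g : ℝ → ℝ → ℝ}

theorem c_mono (h : SuspData ω w H fR c g) {x : ℝ} (h1 : -1 - w < x) (h2 : x < w) :
    StrictMono (c x) := by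
  choose L hL using h.deriv x h1 h2
  have hd : ∀ y, HasDerivAt (c x) (L y (0, 1)) y := fun y => by
    have := (hL y).1.comp_hasDerivAt (f := fun y => (x, y)) y ((hasDerivAt_const y x).prodMk (hasDerivAt_id y))
    exact this
  refine strictMono_of_deriv_pos fun y => ?_
  rw [(hd y).deriv]
  exact (hL y).2.1

/-- The conjugating coordinate. -/
theorem exists_coord (h : SuspData ω w H fR c g) : ∃ κ Y : ℝ → ℝ → ℝ,
    (Continuous fun p : ℝ × ℝ => κ p.1 p.2) ∧ (Continuous fun p : ℝ × ℝ => Y p.1 p.2) ∧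
    (∀ x θ, κ x (Y x θ) = θ) ∧ (∀ x y, Y x (κ x y) = y) ∧
    (∀ (x y : ℝ) (m k : ℤ), κ (x + m) (y + k) = κ x y + k) ∧
    ∀ (x y : ℝ) (m : ℤ), -1 < x - m → x - m < w → H (κ x y - ω 1 / ω 0 * (x - m)) = c (x - m) y := by
  obtain ⟨Γ', hΓc', hΓ1', hΓ2'⟩ := exists_fiber_inverse (κ := fun _ => H) (h.H_cont.comp continuous_snd)
    (fun _ => h.H_mono) (fun _ => h.H_add)
  obtain ⟨Γ, hΓ⟩ : ∃ Γ, Γ = Γ' 0 := ⟨_, rfl⟩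
  have hΓc : Continuous Γ := by rw [hΓ]; exact hΓc'.comp (Continuous.prodMk_right 0)
  have hΓ1 : ∀ v, H (Γ v) = v := by rw [hΓ]; exact hΓ1' 0
  have hΓ2 : ∀ x, Γ (H x) = x := by rw [hΓ]; exact hΓ2' 0
  have hΓm : StrictMono Γ := fun a b hab => h.H_mono.lt_iff_lt.1 (by rwa [hΓ1, hΓ1])
  have hΓf : ∀ v, Γ (fR v) = Γ v + ω 1 / ω 0 := fun v => by
    conv_lhs => rw [← hΓ1 v, h.H_conj, hΓ2]
  have hΓa : ∀ v, Γ (v + 1) = Γ v + 1 := fun v => by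
    conv_lhs => rw [← hΓ1 v, ← h.H_add, hΓ2]
  obtain ⟨κ, hκ⟩ : ∃ κ : ℝ → ℝ → ℝ, κ = fun x y => Γ (c (x - ⌈x⌉) y) + ω 1 / ω 0 * (x - ⌈x⌉) := ⟨_, rfl⟩
  have hloc : ∀ (x y : ℝ) (m : ℤ), -1 < x - m → x - m < w →
      κ x y = Γ (c (x - m) y) + ω 1 / ω 0 * (x - m) := by
    intro x y m hm1 hm2
    rw [hκ]
    rcases le_or_gt (x - m) 0 with h0 | h0
    · have : ⌈x⌉ = m := Int.ceil_eq_iff.2 ⟨by linarith, by linarith⟩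
      simp only [this]
    · have h1 : ⌈x⌉ = m + 1 := Int.ceil_eq_iff.2
        ⟨by push_cast; linarith, by push_cast; linarith [h.w_lt]⟩
      have h2 := h.c_sub (x - m) (by rw [abs_of_pos h0]; exact hm2) y
      simp only [h1]
      push_cast
      rw [show x - (m + 1) = x - m - 1 by ring, h2, hΓf]
      ring
  have hceil : ∀ x : ℝ, -1 < x - ⌈x⌉ ∧ x - ⌈x⌉ < w := fun x =>
    ⟨by linarith [Int.ceil_lt_add_one x], by linarith [Int.le_ceil x, h.w_pos]⟩
  have hκc : Continuous fun p : ℝ × ℝ => κ p.1 p.2 := by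
    refine continuous_iff_continuousAt.2 fun ⟨x₀, y₀⟩ => ?_
    obtain ⟨L, hL, -⟩ := h.deriv (x₀ - ⌈x₀⌉) (by linarith [(hceil x₀).1, h.w_pos]) (hceil x₀).2 y₀
    have h1 : ContinuousAt (fun p : ℝ × ℝ => c (p.1 - ⌈x₀⌉) p.2) (x₀, y₀) :=
      ContinuousAt.comp (f := fun p : ℝ × ℝ => (p.1 - ⌈x₀⌉, p.2)) (x := (x₀, y₀))
        (g := fun p : ℝ × ℝ => c p.1 p.2) hL.continuousAt (by fun_prop)
    have h2 : ContinuousAt (fun p : ℝ × ℝ => Γ (c (p.1 - ⌈x₀⌉) p.2) + ω 1 / ω 0 * (p.1 - ⌈x₀⌉)) (x₀, y₀) :=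
      (hΓc.continuousAt.comp h1).add (by fun_prop)
    refine h2.congr ?_
    have h3 : ContinuousAt (fun p : ℝ × ℝ => p.1 - (⌈x₀⌉ : ℝ)) (x₀, y₀) := by fun_prop
    filter_upwards [h3.eventually (lt_mem_nhds (hceil x₀).1), h3.eventually (gt_mem_nhds (hceil x₀).2)] with p h4 h5
    exact (hloc p.1 p.2 _ h4 h5).symm
  have hκm : ∀ x, StrictMono (κ x) := fun x a b hab => by
    rw [hκ]
    have := hΓm (h.c_mono (by linarith [(hceil x).1, h.w_pos]) (hceil x).2 hab)
    exact add_lt_add_left this _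
  have hκ1 : ∀ x y, κ x (y + 1) = κ x y + 1 := fun x y => by
    rw [hκ]
    simp only [h.c_add, hΓa]
    ring
  obtain ⟨Y, hY, hY1, hY2⟩ := exists_fiber_inverse hκc hκm hκ1
  refine ⟨κ, Y, hκc, hY, hY1, hY2, fun x y m k => ?_, fun x y m h1 h2 => ?_⟩
  · rw [map_add_intCast_real (hκ1 _)]
    have : ⌈x + m⌉ = ⌈x⌉ + m := Int.ceil_add_intCast x m
    simp only [hκ, this]
    push_cast
    rw [show x + m - (⌈x⌉ + m) = x - ⌈x⌉ by ring]
  · rw [hloc x y m h1 h2, add_sub_cancel_right, hΓ1]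

theorem flow_eq (h : SuspData ω w H fR c g) {κ Y : ℝ → ℝ → ℝ} (hY : ∀ x y, Y x (κ x y) = y)
    (hc : ∀ (x y : ℝ) (m : ℤ), -1 < x - m → x - m < w → H (κ x y - ω 1 / ω 0 * (x - m)) = c (x - m) y)
    {φ : ℝ → (Fin 2 → ℝ) → (Fin 2 → ℝ)}
    (hφ : IsFlowOf (fun p => ![ω 0, ω 0 * g (p 0) (p 1)]) φ) (t : ℝ) (p : Fin 2 → ℝ) :
    φ t p = ![p 0 + t * ω 0, Y (p 0 + t * ω 0) (κ (p 0) (p 1) + t * ω 1)] := by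
  have hd := hφ.2 p
  have hd0 : ∀ t, HasDerivAt (fun τ => φ τ p 0) (ω 0) t := fun t => by
    simpa using (hasDerivAt_pi.1 (hd t)) 0
  have hd1 : ∀ t, HasDerivAt (fun τ => φ τ p 1) (ω 0 * g (φ t p 0) (φ t p 1)) t := fun t => by
    simpa using (hasDerivAt_pi.1 (hd t)) 1
  have hx : ∀ t, φ t p 0 = p 0 + t * ω 0 := fun t => by
    have h1 : ∀ t, HasDerivAt (fun τ => φ τ p 0 - τ * ω 0) 0 t := fun t => by
      simpa using (hd0 t).fun_sub ((hasDerivAt_id t).mul_const (ω 0))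
    have := is_const_of_deriv_eq_zero (fun t => (h1 t).differentiableAt) (fun t => (h1 t).deriv) t 0
    simp only [hφ.1] at this
    linarith
  have hk : ∀ t₀, HasDerivAt (fun t => κ (φ t p 0) (φ t p 1) - ω 1 / ω 0 * φ t p 0) 0 t₀ := fun t₀ => by
    obtain ⟨m, hm⟩ : ∃ m : ℤ, m = ⌈φ t₀ p 0⌉ := ⟨_, rfl⟩
    have hm1 : -1 < φ t₀ p 0 - m := by rw [hm]; linarith [Int.ceil_lt_add_one (φ t₀ p 0)]
    have hm2 : φ t₀ p 0 - m < w := by rw [hm]; linarith [Int.le_ceil (φ t₀ p 0), h.w_pos]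
    have hcont : ContinuousAt (fun t => φ t p 0 - (m:ℝ)) t₀ := (hd0 t₀).continuousAt.sub continuousAt_const
    obtain ⟨r, hr, hball⟩ := Metric.eventually_nhds_iff_ball.1
      ((hcont.eventually (lt_mem_nhds hm1)).and (hcont.eventually (gt_mem_nhds hm2)))
    have hq : ∀ t ∈ Metric.ball t₀ r, HasDerivAt (fun t => c (φ t p 0 - m) (φ t p 1)) 0 t := by
      intro t ht
      obtain ⟨L, hL, -, hL0⟩ := h.deriv (φ t p 0 - m) (by linarith [(hball t ht).1, h.w_pos])
        (hball t ht).2 (φ t p 1)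
      have := hL.comp_hasDerivAt (f := fun t => (φ t p 0 - (m:ℝ), φ t p 1)) t
        (((hd0 t).sub_const (m:ℝ)).prodMk (hd1 t))
      rw [h.g_int] at hL0
      have e : ((ω 0, ω 0 * g (φ t p 0) (φ t p 1)) : ℝ × ℝ) = ω 0 • (1, g (φ t p 0) (φ t p 1)) := by simp
      rw [e, map_smul, hL0, smul_zero] at this
      exact this
    have hconst : ∀ t ∈ Metric.ball t₀ r, c (φ t p 0 - m) (φ t p 1) = c (φ t₀ p 0 - m) (φ t₀ p 1) :=
      fun t ht => Metric.isOpen_ball.is_const_of_deriv_eq_zero (convex_ball t₀ r).isPreconnected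
        (fun t ht => (hq t ht).differentiableAt.differentiableWithinAt)
        (fun t ht => (hq t ht).deriv) ht (Metric.mem_ball_self hr)
    refine (hasDerivAt_const t₀ (κ (φ t₀ p 0) (φ t₀ p 1) - ω 1 / ω 0 * φ t₀ p 0)).congr_of_eventuallyEq ?_
    filter_upwards [Metric.ball_mem_nhds t₀ hr] with t ht
    have e1 := hc _ (φ t p 1) m (hball t ht).1 (hball t ht).2
    rw [hconst t ht, ← hc _ (φ t₀ p 1) m hm1 hm2] at e1
    have := h.H_mono.injective e1
    linarith
  have hκ : κ (φ t p 0) (φ t p 1) = κ (p 0) (p 1) + t * ω 1 := by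
    have := is_const_of_deriv_eq_zero (fun t => (hk t).differentiableAt) (fun t => (hk t).deriv) t 0
    simp only [hφ.1] at this
    rw [hx] at this ⊢
    have h0 := h.ne_zero
    have e : ω 1 / ω 0 * (p 0 + t * ω 0) = ω 1 / ω 0 * p 0 + t * ω 1 := by field_simp
    linarith
  ext i
  fin_cases i
  · exact hx t
  · show φ t p 1 = Y (p 0 + t * ω 0) (κ (p 0) (p 1) + t * ω 1)
    rw [← hκ, ← hx, hY]

theorem isFlowOf (h : SuspData ω w H fR c g) {κ Y : ℝ → ℝ → ℝ} (hYc : Continuous fun p : ℝ × ℝ => Y p.1 p.2)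
    (hκY : ∀ x θ, κ x (Y x θ) = θ) (hY : ∀ x y, Y x (κ x y) = y)
    (hc : ∀ (x y : ℝ) (m : ℤ), -1 < x - m → x - m < w → H (κ x y - ω 1 / ω 0 * (x - m)) = c (x - m) y) :
    IsFlowOf (fun p : Fin 2 → ℝ => ![ω 0, ω 0 * g (p 0) (p 1)])
      (fun t p => ![p 0 + t * ω 0, Y (p 0 + t * ω 0) (κ (p 0) (p 1) + t * ω 1)]) := by
  refine ⟨fun p => ?_, fun p t₀ => ?_⟩
  · ext i
    fin_cases i <;> simp [hY]
  obtain ⟨x, hxe⟩ : ∃ x : ℝ → ℝ, x = fun t => p 0 + t * ω 0 := ⟨_, rfl⟩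
  have hx : ∀ t, HasDerivAt x (ω 0) t := fun t => by
    rw [hxe]
    simpa using ((hasDerivAt_id t).mul_const (ω 0)).const_add (p 0)
  obtain ⟨y, hye⟩ : ∃ y : ℝ → ℝ, y = fun t => Y (x t) (κ (p 0) (p 1) + t * ω 1) := ⟨_, rfl⟩
  have hyc : Continuous y := by
    rw [hye]
    exact hYc.comp ((continuous_iff_continuousAt.2 fun t => (hx t).continuousAt).prodMk (by fun_prop))
  have hκy : ∀ t, κ (x t) (y t) = κ (p 0) (p 1) + t * ω 1 := fun t => by rw [hye]; exact hκY _ _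
  have hy : HasDerivAt y (ω 0 * g (x t₀) (y t₀)) t₀ := by
    obtain ⟨m, hm⟩ : ∃ m : ℤ, m = ⌈x t₀⌉ := ⟨_, rfl⟩
    have hm1 : -1 < x t₀ - m := by rw [hm]; linarith [Int.ceil_lt_add_one (x t₀)]
    have hm2 : x t₀ - m < w := by rw [hm]; linarith [Int.le_ceil (x t₀), h.w_pos]
    have hcont : ContinuousAt (fun t => x t - (m:ℝ)) t₀ := (hx t₀).continuousAt.sub continuousAt_const
    obtain ⟨L, hL, hL1, hL0⟩ := h.deriv (x t₀ - m) (by linarith [h.w_pos]) hm2 (y t₀)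
    rw [h.g_int] at hL0
    refine hasDerivAt_of_level (F := fun p => c p.1 p.2) (a := fun t => x t - m) (a' := ω 0)
      (v := c (x t₀ - m) (y t₀)) hL ((hx t₀).sub_const _) hyc.continuousAt ?_ hL1.ne' ?_
    · filter_upwards [hcont.eventually (lt_mem_nhds hm1), hcont.eventually (gt_mem_nhds hm2)] with t h1 h2
      show c (x t - m) (y t) = c (x t₀ - m) (y t₀)
      rw [← hc _ _ _ h1 h2, ← hc _ _ _ hm1 hm2, hκy, hκy, hxe]
      have h0 := h.ne_zero
      congr 1
      field_simp
      ring
    · have e : ((ω 0, ω 0 * g (x t₀) (y t₀)) : ℝ × ℝ) = ω 0 • (1, g (x t₀) (y t₀)) := by simp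
      rw [e, map_smul, hL0, smul_zero]
  rw [hasDerivAt_pi]
  intro i
  fin_cases i
  · simpa [hxe] using hx t₀
  · simpa [hye, hxe] using hy

theorem topConj (h : SuspData ω w H fR c g) {φ : ℝ → (Fin 2 → ℝ) → (Fin 2 → ℝ)}
    (hφ : IsFlowOf (fun p => ![ω 0, ω 0 * g (p 0) (p 1)]) φ) : FlowTopConjLinear ω φ := by
  obtain ⟨κ, Y, hκc, hYc, h1, h2, h3, h4⟩ := h.exists_coord
  have hY3 : ∀ (x y : ℝ) (m k : ℤ), Y (x + m) (y + k) = Y x y + k := fun x y m k => by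
    conv_lhs => rw [← h1 x y, ← h3, h2]
  refine ⟨fun p => ![p 0, Y (p 0) (p 1)], fun p => ![p 0, κ (p 0) (p 1)], ?_, fun t x => ?_⟩
  · have hi : ∀ v : Fin 2 → ℝ, IsIntVec v ↔ (∃ m : ℤ, v 0 = m) ∧ ∃ m : ℤ, v 1 = m := fun v => Fin.forall_fin_two
    refine ⟨?_, ?_, fun x v hv => ?_, fun x v hv => ?_, fun x => ?_, fun x => ?_⟩
    · have : Continuous fun p : Fin 2 → ℝ => Y (p 0) (p 1) :=
        hYc.comp (f := fun p : Fin 2 → ℝ => (p 0, p 1)) (by fun_prop)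
      exact continuous_pi fun i => by fin_cases i <;> [exact continuous_apply (0 : Fin 2); exact this]
    · have : Continuous fun p : Fin 2 → ℝ => κ (p 0) (p 1) :=
        hκc.comp (f := fun p : Fin 2 → ℝ => (p 0, p 1)) (by fun_prop)
      exact continuous_pi fun i => by fin_cases i <;> [exact continuous_apply (0 : Fin 2); exact this]
    · obtain ⟨⟨m, hm⟩, k, hk⟩ := (hi v).1 hv
      exact (hi _).2 ⟨⟨m, by simp [hm]⟩, k, by simp [hm, hk, hY3]⟩
    · obtain ⟨⟨m, hm⟩, k, hk⟩ := (hi v).1 hv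
      exact (hi _).2 ⟨⟨m, by simp [hm]⟩, k, by simp [hm, hk, h3]⟩
    · exact (hi _).2 ⟨⟨0, by simp⟩, 0, by simp [h1]⟩
    · exact (hi _).2 ⟨⟨0, by simp⟩, 0, by simp [h2]⟩
  · rw [h.flow_eq h2 h4 hφ]
    ext i
    fin_cases i <;> simp [h1]

end SuspData

theorem eqOn_of_eqOn_real {f g : ℂ → ℂ} {U : Set ℂ} (hU : IsOpen U) (hc : IsPreconnected U)
    (hf : DifferentiableOn ℂ f U) (hg : DifferentiableOn ℂ g U) {x₀ : ℝ} (hx₀ : (x₀ : ℂ) ∈ U)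
    (h : ∀ x : ℝ, (x : ℂ) ∈ U → f x = g x) : Set.EqOn f g U := by
  refine AnalyticOnNhd.eqOn_of_preconnected_of_frequently_eq (hf.analyticOnNhd hU)
    (hg.analyticOnNhd hU) hc hx₀ ?_
  have ht : Tendsto (fun x : ℝ => (x : ℂ)) (𝓝[≠] x₀) (𝓝[≠] (x₀ : ℂ)) := by
    refine tendsto_nhdsWithin_iff.2 ⟨(Complex.continuous_ofReal.tendsto x₀).mono_left nhdsWithin_le_nhds, ?_⟩
    filter_upwards [self_mem_nhdsWithin] with x hx
    exact fun h => hx (Complex.ofReal_injective h)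
  refine ht.frequently (Eventually.frequently ?_)
  filter_upwards [nhdsWithin_le_nhds ((Complex.continuous_ofReal.continuousAt (x := x₀)).eventually
    (hU.mem_nhds hx₀))] with x hx using h x hx

theorem exists_local_extension {Γ : ℝ → ℝ} {x₀ : ℝ} (h : AnalyticAt ℝ Γ x₀) :
    ∃ r > 0, ∃ F : ℂ → ℂ, DifferentiableOn ℂ F (Metric.ball (x₀ : ℂ) r) ∧
      ∀ x : ℝ, (x : ℂ) ∈ Metric.ball (x₀ : ℂ) r → F x = Γ x := by
  obtain ⟨p, hp⟩ := h
  rw [hasFPowerSeriesAt_iff, Metric.eventually_nhds_iff_ball] at hp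
  obtain ⟨ρ, hρ, hp⟩ := hp
  have hs := (hp (ρ / 2) (by rw [mem_ball_zero_iff, Real.norm_of_nonneg (by linarith)]; linarith)).summable
  obtain ⟨C, hC⟩ := hs.tendsto_atTop_zero.norm.bddAbove_range
  have hC' : ∀ n, (ρ / 2) ^ n * ‖p.coeff n‖ ≤ C := fun n => by
    have := hC ⟨n, rfl⟩
    simpa [abs_of_pos hρ] using this
  refine ⟨ρ / 4, by linarith, fun z => ∑' n, (z - x₀) ^ n * (p.coeff n : ℂ),
    Complex.differentiableOn_tsum_of_summable_norm (u := fun n => C * (1 / 2) ^ n)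
    (summable_geometric_two.mul_left C) (fun n => by fun_prop) Metric.isOpen_ball fun n z hz => ?_, fun x hx => ?_⟩
  · rw [mem_ball_iff_norm] at hz
    rw [norm_mul, norm_pow, Complex.norm_real]
    calc ‖z - x₀‖ ^ n * ‖p.coeff n‖ ≤ (ρ / 4) ^ n * ‖p.coeff n‖ := by gcongr
      _ = (ρ / 2) ^ n * ‖p.coeff n‖ * (1 / 2) ^ n := by
        rw [show ρ / 4 = ρ / 2 * (1 / 2) by ring, mul_pow]; ring
      _ ≤ C * (1 / 2) ^ n := by gcongr; exact hC' n
  · rw [mem_ball_iff_norm, ← Complex.ofReal_sub, Complex.norm_real] at hx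
    have h1 := hp (x - x₀) (by rw [mem_ball_zero_iff]; linarith)
    rw [add_sub_cancel] at h1
    have h2 := (Complex.hasSum_ofReal.2 h1).tsum_eq
    push_cast at h2
    simpa using h2

/-- A real-analytic function with `Γ (x + 1) = Γ x + 1` extends to a strip. -/
theorem exists_strip_extension {Γ : ℝ → ℝ} (h : ∀ x, AnalyticAt ℝ Γ x) (h1 : ∀ x, Γ (x + 1) = Γ x + 1) :
    ∃ δ > 0, ∃ F : ℂ → ℂ, DifferentiableOn ℂ F (Strip δ) ∧ ∀ x : ℝ, F x = Γ x := by
  choose r hr F hF hFΓ using fun x => exists_local_extension (h x)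
  obtain ⟨δ, hδ, hL⟩ := lebesgue_number_lemma_of_metric
    (isCompact_Icc.image Complex.continuous_ofReal : IsCompact ((fun x : ℝ => (x : ℂ)) '' Set.Icc 0 1))
    (c := fun x : ℝ => Metric.ball (x : ℂ) (r x)) (fun _ => Metric.isOpen_ball) (by
      rintro _ ⟨x, -, rfl⟩
      exact Set.mem_iUnion.2 ⟨x, Metric.mem_ball_self (hr x)⟩)
  have hloc : ∀ x : ℝ, ∃ F : ℂ → ℂ, DifferentiableOn ℂ F (Metric.ball (x : ℂ) δ) ∧
      ∀ t : ℝ, (t : ℂ) ∈ Metric.ball (x : ℂ) δ → F t = Γ t := fun x => by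
    obtain ⟨i, hi⟩ := hL ((Int.fract x : ℝ) : ℂ) ⟨_, ⟨Int.fract_nonneg x, (Int.fract_lt_one x).le⟩, rfl⟩
    have hsub : ∀ z ∈ Metric.ball (x : ℂ) δ, z - ⌊x⌋ ∈ Metric.ball (i : ℂ) (r i) := fun z hz => hi (by
      rw [mem_ball_iff_norm] at hz ⊢
      refine lt_of_le_of_lt (le_of_eq ?_) hz
      congr 1
      rw [← Int.self_sub_floor]
      push_cast
      ring)
    refine ⟨fun z => F i (z - ⌊x⌋) + ⌊x⌋, ((hF i).comp (by fun_prop) hsub).add_const _, fun t ht => ?_⟩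
    have h2 := hsub _ ht
    have h3 : (t : ℂ) - ⌊x⌋ = ((t - ⌊x⌋ : ℝ) : ℂ) := by push_cast; rfl
    simp only [h3] at h2 ⊢
    rw [hFΓ i _ h2]
    have := map_add_intCast_real h1 (t - ⌊x⌋) ⌊x⌋
    rw [sub_add_cancel] at this
    rw [this]
    push_cast
    rfl
  choose E hE hEΓ using hloc
  have hmem : ∀ z : ℂ, z ∈ Strip δ → z ∈ Metric.ball (z.re : ℂ) δ := fun z hz => by
    have : z - z.re = z.im * Complex.I := by linear_combination -(Complex.re_add_im z)
    rw [mem_ball_iff_norm, this]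
    simpa [Strip] using hz
  have hag : ∀ x : ℝ, ∀ z ∈ Strip δ, z ∈ Metric.ball (x : ℂ) δ → E z.re z = E x z := fun x z hz hzx => by
    have hre : (z.re : ℂ) ∈ Metric.ball (x : ℂ) δ := by
      rw [mem_ball_iff_norm] at hzx ⊢
      refine lt_of_le_of_lt ?_ hzx
      have := Complex.abs_re_le_norm (z - x)
      rw [← Complex.ofReal_sub, Complex.norm_real]
      simpa using this
    exact eqOn_of_eqOn_real (Metric.isOpen_ball.inter Metric.isOpen_ball)
      ((convex_ball (z.re : ℂ) δ).inter (convex_ball (x : ℂ) δ)).isPreconnected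
      ((hE _).mono Set.inter_subset_left) ((hE _).mono Set.inter_subset_right) (x₀ := z.re)
      ⟨Metric.mem_ball_self hδ, hre⟩ (fun t ht => by rw [hEΓ _ _ ht.1, hEΓ _ _ ht.2]) ⟨hmem z hz, hzx⟩
  refine ⟨δ, hδ, fun z => E z.re z, fun z hz => ?_, fun x => ?_⟩
  · have hb : Metric.ball (z.re : ℂ) δ ∩ Strip δ ∈ 𝓝 z :=
      (Metric.isOpen_ball.inter (isOpen_Strip δ)).mem_nhds ⟨hmem z hz, hz⟩
    have h2 : DifferentiableAt ℂ (E z.re) z := (hE _).differentiableAt (Metric.isOpen_ball.mem_nhds (hmem z hz))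
    refine (h2.congr_of_eventuallyEq ?_).differentiableWithinAt
    filter_upwards [hb] with t ht using hag _ t ht.2 ht.1
  · simp only [Complex.ofReal_re]
    exact hEΓ _ _ (Metric.mem_ball_self hδ)

theorem convex_Strip (δ : ℝ) : Convex ℝ (Strip δ) := by
  have : Strip δ = Complex.imLm ⁻¹' (Metric.ball 0 δ) := by
    ext z
    simp [Strip]
  rw [this]
  exact (convex_ball 0 δ).linear_preimage _

/-- A linearization of an admissible map having periodic orbits close to the real axis is not
real-analytic. -/
theorem Adm.not_analytic {α S : ℝ} {f : ℂ → ℂ} (hf : Adm α S f) (hS : 1 ≤ S) (hα : Irrational α) {Γ : ℝ → ℝ}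
    (hΓ : ∀ x, AnalyticAt ℝ Γ x) (hΓ1 : ∀ x, Γ (x + 1) = Γ x + 1) (hΓf : ∀ x : ℝ, Γ (f x).re = Γ x + α)
    (hp : ∀ η > 0, ∃ q p : ℤ, (q, p) ≠ (0, 0) ∧ ∃ o, LatOrbit η f o ∧ ∀ j l, o (j + q) (l + p) = o j l) :
    False := by
  obtain ⟨δ, hδ, F, hFd, hF⟩ := exists_strip_extension hΓ hΓ1
  have hn : ∀ v ∈ Strip S, ‖f v - v - α‖ ≤ 1 / 200 := fun z hz => by
    refine (hf.bound z hz).trans ?_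
    have : Real.exp (-2 * Real.pi * (S - |z.im|)) ≤ 1 := Real.exp_le_one_iff.2 (by
      have : |z.im| < S := hz
      nlinarith [Real.pi_pos])
    linarith
  have hd : DifferentiableOn ℂ (fun v => f v - v - α) (Strip S) :=
    (hf.diff.sub differentiableOn_id).sub_const _
  have him : ∀ z ∈ Strip (1 / 4), |(f z).im| ≤ 2 * |z.im| := fun z hz => by
    have hz' : |z.im| < 1 / 4 := hz
    have hsub : Metric.closedBall (z.re : ℂ) (1 / 2) ⊆ Strip S := fun v hv => by
      have h1 := Complex.abs_im_le_norm (v - z.re)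
      rw [mem_closedBall_iff_norm] at hv
      rw [Complex.sub_im, Complex.ofReal_im, sub_zero] at h1
      show |v.im| < S
      linarith
    have e : z - z.re = z.im * Complex.I := by linear_combination -(Complex.re_add_im z)
    have e' : ‖z - z.re‖ = |z.im| := by rw [e]; simp
    have h2 := norm_sub_le_of_closedBall (isOpen_Strip S) hd hn (by norm_num) hsub (v := z) (v' := z.re)
      (by rw [mem_closedBall_iff_norm, e']; linarith) (Metric.mem_closedBall_self (by norm_num))
    rw [e'] at h2
    have h3 := Complex.abs_im_le_norm (f z - z - α - (f z.re - z.re - α))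
    have h4 : (f z.re).im = 0 := by rw [← hf.ofReal_re (by linarith)]; exact Complex.ofReal_im _
    simp only [Complex.sub_im, Complex.ofReal_im, h4, sub_zero] at h3
    have h5 := abs_sub_abs_le_abs_sub (f z).im z.im
    nlinarith [abs_nonneg z.im]
  obtain ⟨η, hη⟩ : ∃ η, η = min (δ / 2) (1 / 4) := ⟨_, rfl⟩
  have hη0 : 0 < η := by rw [hη]; positivity
  have hηδ : η ≤ δ / 2 := by rw [hη]; exact min_le_left _ _
  have hη4 : η ≤ 1 / 4 := by rw [hη]; exact min_le_right _ _
  have hreal : ∀ x : ℝ, (x : ℂ) ∈ Strip η := fun x => by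
    show |(x : ℂ).im| < η
    simpa using hη0
  have hs4 : Strip η ⊆ Strip (1 / 4) := fun z hz => lt_of_lt_of_le hz hη4
  have hsS : Strip η ⊆ Strip S := fun z hz => lt_of_lt_of_le hz (by linarith : η ≤ S)
  have hsδ : Strip η ⊆ Strip δ := fun z hz => lt_of_lt_of_le hz (by linarith : η ≤ δ)
  have hmaps : Set.MapsTo f (Strip η) (Strip δ) := fun z hz => by
    have h1 := him z (hs4 hz)
    have h2 : |z.im| < η := hz
    show |(f z).im| < δ
    linarith
  have hFf : Set.EqOn (fun z => F (f z)) (fun z => F z + α) (Strip η) := by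
    refine eqOn_of_eqOn_real (isOpen_Strip η) (convex_Strip η).isPreconnected (hFd.comp (hf.diff.mono hsS) hmaps)
      ((hFd.mono hsδ).add_const _) (hreal 0) fun x _ => ?_
    show F (f x) = F x + α
    rw [← hf.ofReal_re (by linarith), hF, hF, hΓf]
    push_cast
    rfl
  have hF1 : Set.EqOn (fun z => F (z + 1)) (fun z => F z + 1) (Strip η) := by
    refine eqOn_of_eqOn_real (isOpen_Strip η) (convex_Strip η).isPreconnected
      (hFd.comp (by fun_prop) fun z hz => hsδ (by simpa [Strip] using hz))
      ((hFd.mono hsδ).add_const _) (hreal 0) fun x _ => ?_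
    have e : (x : ℂ) + 1 = ((x + 1 : ℝ) : ℂ) := by push_cast; rfl
    simp only [e]
    rw [hF, hF, hΓ1]
    push_cast
    rfl
  obtain ⟨q, p, hqp, o, ho, hper⟩ := hp (η / 2) (by linarith)
  have hoS : ∀ j k, o j k ∈ Strip η := fun j k => lt_of_le_of_lt (ho.im_le j k) (by linarith)
  have s1 : ∀ j k, F (o (j + 1) k) = F (o j k) + α := fun j k => by
    rw [← ho.step]; exact hFf (hoS j k)
  have s2 : ∀ j k, F (o j (k + 1)) = F (o j k) + 1 := fun j k => by
    rw [ho.shift]; exact hF1 (hoS j k)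
  have t1 : ∀ j k : ℤ, F (o j k) = F (o 0 k) + j * α := fun j k => by
    induction j using Int.induction_on with
    | zero => simp
    | succ i ih => rw [s1, ih]; push_cast; ring
    | pred i ih =>
      have := s1 (-i - 1) k
      rw [sub_add_cancel, ih] at this
      push_cast at this ⊢
      linear_combination -this
  have t2 : ∀ k : ℤ, F (o 0 k) = F (o 0 0) + k := fun k => by
    induction k using Int.induction_on with
    | zero => simp
    | succ i ih => rw [s2, ih]; push_cast; ring
    | pred i ih =>
      have := s2 0 (-i - 1)
      rw [sub_add_cancel, ih] at this
      push_cast at this ⊢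
      linear_combination -this
  have h0 := t1 q p
  have h1 := hper 0 0
  rw [zero_add, zero_add] at h1
  rw [h1, t2 p] at h0
  have h2 : ((q * α + p : ℝ) : ℂ) = 0 := by push_cast; linear_combination -h0
  have h3 : (q : ℝ) * α + p = 0 := by exact_mod_cast h2
  by_cases hq : q = 0
  · rw [hq] at h3
    refine hqp (by rw [hq]; simpa using h3)
  · refine hα ⟨-p / q, ?_⟩
    have : (q : ℝ) ≠ 0 := by exact_mod_cast hq
    push_cast
    field_simp
    linarith

theorem analyticAt_of_inverse {c P : ℝ → ℝ} (hc : ∀ y, AnalyticAt ℝ c y) (hd : ∀ y, deriv c y ≠ 0)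
    (hPc : Continuous P) (h1 : ∀ v, c (P v) = v) (h2 : ∀ y, P (c y) = y) (v : ℝ) : AnalyticAt ℝ P v := by
  obtain ⟨e, he⟩ : ∃ e : ℝ ≃ₜ ℝ, e = ⟨⟨c, P, h2, h1⟩,
    continuous_iff_continuousAt.2 fun y => (hc y).continuousAt, hPc⟩ := ⟨_, rfl⟩
  have := e.toOpenPartialHomeomorph.analyticAt_symm (𝕜 := ℝ) (a := v)
    (i := ContinuousLinearEquiv.unitsEquivAut ℝ (Units.mk0 _ (hd (P v)))) (by simp)
    (by simpa [he] using hc (P v)) (by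
      ext
      simp [he])
  simpa [he] using this

namespace SuspData

variable {ω : Fin 2 → ℝ} {w : ℝ} {H fR : ℝ → ℝ} {c g : ℝ → ℝ → ℝ}

theorem exists_analytic_linearization (h : SuspData ω w H fR c g) (hc0 : ∀ y, AnalyticAt ℝ (c 0) y)
    {φ : ℝ → (Fin 2 → ℝ) → (Fin 2 → ℝ)}
    (hφ : IsFlowOf (fun p => ![ω 0, ω 0 * g (p 0) (p 1)]) φ) (ha : FlowAnalyticConjLinear ω φ) :
    ∃ Γ : ℝ → ℝ, (∀ x, AnalyticAt ℝ Γ x) ∧ (∀ x, Γ (x + 1) = Γ x + 1) ∧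
      ∀ x, Γ (fR x) = Γ x + ω 1 / ω 0 := by
  obtain ⟨κ, Y, hκc, hYc, k1, k2, k3, k4⟩ := h.exists_coord
  have hY3 : ∀ (x y : ℝ) (m k : ℤ), Y (x + m) (y + k) = Y x y + k := fun x y m k => by
    conv_lhs => rw [← k1 x y, ← k3, k2]
  have hflow := h.flow_eq k2 k4 hφ
  have hi : ∀ v : Fin 2 → ℝ, IsIntVec v ↔ (∃ m : ℤ, v 0 = m) ∧ ∃ m : ℤ, v 1 = m := fun v => Fin.forall_fin_two
  obtain ⟨Ht, G, ⟨hHc, hGc, hHv, hGv, hGH, hHG⟩, hHa, hGa, hconj⟩ := ha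
  have hφv : ∀ t p v, IsIntVec v → φ t (p + v) = φ t p + v := fun t p v hv => by
    obtain ⟨⟨m, hm⟩, k, hk⟩ := (hi v).1 hv
    rw [hflow, hflow]
    ext i
    fin_cases i
    · simp; ring
    · have := hY3 (p 0 + t * ω 0) (κ (p 0) (p 1) + t * ω 1) m k
      simp only [Pi.add_apply, hm, hk, k3, Fin.mk_one, Matrix.cons_val_one, Matrix.cons_val_fin_one]
      rw [← this]
      congr 1 <;> ring
  -- the inverse conjugacy linearizes the flow
  have hGφ : ∀ t p, G (φ t p) 1 = G p 1 + t * ω 1 := fun t p => by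
    have hcont : Continuous fun t => G (φ t p) 1 - (G p 1 + t * ω 1) := by
      have hφc : Continuous fun t => φ t p := continuous_iff_continuousAt.2 fun t => (hφ.2 p t).continuousAt
      have : Continuous fun t => G (φ t p) 1 := (continuous_apply 1).comp (hGc.comp hφc)
      fun_prop
    have hintg : ∀ t, ∃ m : ℤ, G (φ t p) 1 - (G p 1 + t * ω 1) = m := fun t => by
      have hv := hHG p
      obtain ⟨v, hve⟩ : ∃ v, v = Ht (G p) - p := ⟨_, rfl⟩
      rw [← hve] at hv
      have e1 : φ t p + v = Ht (G p + t • ω) := by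
        rw [hconj, ← hφv t p v hv, hve, add_sub_cancel]
      obtain ⟨m, hm⟩ := hGv (φ t p) v hv 1
      obtain ⟨k, hk⟩ := hGH (G p + t • ω) 1
      rw [← e1] at hk
      simp only [Pi.sub_apply, Pi.add_apply, Pi.smul_apply, smul_eq_mul] at hm hk
      refine ⟨k - m, ?_⟩
      push_cast
      linarith
    have := eq_of_continuous_int hcont hintg t 0
    rw [hφ.1] at this
    linarith
  have hd := const_of_irrational (d := fun u => G ![0, Y 0 u] 1 - u) h.irr (by
      have h1 : Continuous fun u => Y 0 u := hYc.comp (Continuous.prodMk_right 0)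
      have h2 : Continuous fun u => (![0, Y 0 u] : Fin 2 → ℝ) :=
        continuous_pi fun i => by fin_cases i <;> [exact continuous_const; exact h1]
      have h3 : Continuous fun u => G ![0, Y 0 u] 1 := (continuous_apply 1).comp (hGc.comp h2)
      fun_prop) (fun u => by
      obtain ⟨m, hm⟩ := hGv ![0, Y 0 u] ![0, 1] ((hi _).2 ⟨⟨0, by simp⟩, 1, by simp⟩) 1
      have e := hY3 0 u 0 1
      simp only [Int.cast_zero, Int.cast_one, add_zero] at e
      refine ⟨m - 1, ?_⟩
      have e2 : (![0, Y 0 u] + ![0, 1] : Fin 2 → ℝ) = ![0, Y 0 (u + 1)] := by rw [e]; simp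
      rw [e2, Pi.sub_apply] at hm
      push_cast
      linarith) (fun u => by
      obtain ⟨m, hm⟩ := hGv ![0, Y 0 u] ![-1, 0] ((hi _).2 ⟨⟨-1, by simp⟩, 0, by simp⟩) 1
      have e := hY3 0 u (-1) 0
      simp only [Int.cast_zero, Int.cast_neg, Int.cast_one, add_zero, zero_add] at e
      have e2 : (![0, Y 0 u] + ![-1, 0] : Fin 2 → ℝ) = ![-1, Y (-1) u] := by rw [e]; simp
      have e3 := hflow (1 / ω 0) ![-1, Y (-1) u]
      have h0 := h.ne_zero
      simp only [Matrix.cons_val_zero, Matrix.cons_val_one, k1, one_div_mul_cancel h0,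
        neg_add_cancel, Matrix.cons_val_fin_one] at e3
      have e4 := hGφ (1 / ω 0) ![-1, Y (-1) u]
      rw [e3] at e4
      rw [e2, Pi.sub_apply] at hm
      refine ⟨m, ?_⟩
      rw [show u + ω 1 / ω 0 = u + 1 / ω 0 * ω 1 by ring, e4]
      linarith)
  have hκ0 : ∀ y, κ 0 y = G ![0, y] 1 - (G ![0, Y 0 0] 1 - 0) := fun y => by
    have := hd (κ 0 y) 0
    simp only [k2] at this
    linarith
  have hκa : ∀ y, AnalyticAt ℝ (κ 0) y := fun y => by
    have e : κ 0 = fun y => G ![0, y] 1 - (G ![0, Y 0 0] 1 - 0) := funext hκ0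
    have h1 : AnalyticAt ℝ (fun y : ℝ => (![0, y] : Fin 2 → ℝ)) y := by
      rw [analyticAt_pi_iff]
      intro i
      fin_cases i
      · exact analyticAt_const
      · exact analyticAt_id
    have h2 : AnalyticAt ℝ (fun y : ℝ => G ![0, y]) y := (hGa _).comp h1
    rw [e]
    exact ((analyticAt_pi_iff.1 h2) 1).sub analyticAt_const
  have hk4 : ∀ y, H (κ 0 y) = c 0 y := fun y => by
    have := k4 0 y 0 (by simp) (by simpa using h.w_pos)
    simpa using this
  obtain ⟨Γ', hΓc', hΓ1', hΓ2'⟩ := exists_fiber_inverse (κ := fun _ => H) (h.H_cont.comp continuous_snd)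
    (fun _ => h.H_mono) (fun _ => h.H_add)
  obtain ⟨P', hPc', hP1', hP2'⟩ := exists_fiber_inverse (κ := fun _ => c 0)
    ((continuous_iff_continuousAt.2 fun y => (hc0 y).continuousAt).comp continuous_snd)
    (fun _ => h.c_mono (by linarith [h.w_pos]) h.w_pos) (fun _ => h.c_add 0)
  have hPa := analyticAt_of_inverse hc0 (fun y => ?_) (hPc'.comp (Continuous.prodMk_right 0)) (hP1' 0) (hP2' 0)
  · have hΓ : ∀ v, Γ' 0 v = κ 0 (P' 0 v) := fun v => by
      conv_lhs => rw [← hP1' 0 v, ← hk4, hΓ2']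
    refine ⟨Γ' 0, fun x => ?_, fun x => ?_, fun x => ?_⟩
    · rw [funext hΓ]
      exact (hκa _).comp (hPa x)
    · conv_lhs => rw [← hΓ1' 0 x, ← h.H_add, hΓ2']
    · conv_lhs => rw [← hΓ1' 0 x, h.H_conj, hΓ2']
  · obtain ⟨L, hL, hL1, -⟩ := h.deriv 0 (by linarith [h.w_pos]) h.w_pos y
    have : HasDerivAt (c 0) (L (0, 1)) y :=
      hL.comp_hasDerivAt (f := fun y => (0, y)) y ((hasDerivAt_const y 0).prodMk (hasDerivAt_id y))
    rw [this.deriv]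
    exact hL1.ne'

end SuspData

/-- Bounded separately holomorphic functions of two variables. -/
structure SepHol (C : ℝ) (U V : Set ℂ) (F : ℂ → ℂ → ℂ) : Prop where
  left : ∀ y ∈ V, DifferentiableOn ℂ (fun x => F x y) U
  right : ∀ x ∈ U, DifferentiableOn ℂ (F x) V
  bound : ∀ x ∈ U, ∀ y ∈ V, ‖F x y‖ ≤ C

namespace SepHol

variable {C : ℝ} {U V : Set ℂ} {F : ℂ → ℂ → ℂ}

theorem swap (h : SepHol C U V F) : SepHol C V U (fun y x => F x y) :=
  ⟨h.right, h.left, fun y hy x hx => h.bound x hx y hy⟩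

theorem continuousAt (h : SepHol C U V F) (hU : IsOpen U) (hV : IsOpen V) {x₀ y₀ : ℂ} (hx : x₀ ∈ U) (hy : y₀ ∈ V) :
    ContinuousAt (fun p : ℂ × ℂ => F p.1 p.2) (x₀, y₀) := by
  obtain ⟨r, hr, hrU⟩ := Metric.nhds_basis_closedBall.mem_iff.1 (hU.mem_nhds hx)
  have hcy : ContinuousAt (fun p : ℂ × ℂ => F x₀ p.2) (x₀, y₀) :=
    ContinuousAt.comp (f := Prod.snd) (g := F x₀) (x := (x₀, y₀))
      ((h.right x₀ hx).continuousOn.continuousAt (hV.mem_nhds hy)) continuous_snd.continuousAt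
  have hdx : Tendsto (fun p : ℂ × ℂ => F p.1 p.2 - F x₀ p.2) (𝓝 (x₀, y₀)) (𝓝 0) := by
    have ht : Tendsto (fun p : ℂ × ℂ => 2 * C / r * ‖p.1 - x₀‖) (𝓝 (x₀, y₀)) (𝓝 0) := by
      have : Continuous fun p : ℂ × ℂ => 2 * C / r * ‖p.1 - x₀‖ := by fun_prop
      have := this.tendsto (x₀, y₀)
      simpa using this
    refine squeeze_zero_norm' ?_ ht
    filter_upwards [prod_mem_nhds (Metric.closedBall_mem_nhds x₀ (half_pos hr)) (hV.mem_nhds hy)] with p hp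
    exact norm_sub_le_of_closedBall hU (h.left _ hp.2) (fun x hx => h.bound x hx _ hp.2) hr hrU hp.1
      (Metric.mem_closedBall_self (by linarith))
  have := hdx.add hcy.tendsto
  simpa [ContinuousAt] using this

theorem deriv_left (h : SepHol C U V F) (hU : IsOpen U) (hV : IsOpen V) {r : ℝ} (hr : 0 < r) {W : Set ℂ}
    (hW : ∀ x ∈ W, Metric.closedBall x r ⊆ U) (hWU : IsOpen W) :
    SepHol (2 * C / r) W V (fun x y => deriv (fun x => F x y) x) := by
  have hWs : W ⊆ U := fun x hx => hW x hx (Metric.mem_closedBall_self hr.le)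
  have hquot : ∀ x ∈ W, ∀ y ∈ V, ∀ v ∈ Metric.closedBall x (r / 2),
      ‖F v y - F x y‖ ≤ 2 * C / r * ‖v - x‖ := fun x hx y hy v hv =>
    norm_sub_le_of_closedBall hU (h.left y hy) (fun x hx => h.bound x hx y hy) hr (hW x hx) hv
      (Metric.mem_closedBall_self (by linarith))
  have hlim : ∀ x ∈ W, ∀ y ∈ V, Tendsto (fun n : ℕ => ((r / 2 / (n + 1) : ℝ) : ℂ)⁻¹ *
      (F (x + (r / 2 / (n + 1) : ℝ)) y - F x y)) atTop (𝓝 (deriv (fun x => F x y) x)) := fun x hx y hy => by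
    have hd := ((h.left y hy).differentiableAt (hU.mem_nhds (hWs hx))).hasDerivAt
    have h0 : Tendsto (fun n : ℕ => ((r / 2 / (n + 1) : ℝ) : ℂ)) atTop (𝓝[≠] 0) := by
      refine tendsto_nhdsWithin_iff.2 ⟨?_, Eventually.of_forall fun n => ?_⟩
      · have h1 : Tendsto (fun n : ℕ => (r / 2 / (n + 1) : ℝ)) atTop (𝓝 0) := by
          have := (tendsto_one_div_add_atTop_nhds_zero_nat (𝕜 := ℝ)).const_mul (r / 2)
          simpa [div_eq_mul_inv] using this
        have := (Complex.continuous_ofReal.tendsto 0).comp h1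
        simpa [Function.comp_def] using this
      · have : (r / 2 / (n + 1) : ℝ) ≠ 0 := by positivity
        simpa using (Complex.ofReal_ne_zero.2 this)
    have := hd.tendsto_slope_zero.comp h0
    simpa [Function.comp_def] using this
  have hn : ∀ x ∈ W, ∀ n : ℕ, ∀ y ∈ V, ‖((r / 2 / (n + 1) : ℝ) : ℂ)⁻¹ *
      (F (x + (r / 2 / (n + 1) : ℝ)) y - F x y)‖ ≤ 2 * C / r := fun x hx n y hy => by
    have hpos : 0 < r / 2 / (n + 1) := by positivity
    have hnorm : ‖((r / 2 / (n + 1) : ℝ) : ℂ)‖ = r / 2 / (n + 1) := by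
      rw [Complex.norm_real, Real.norm_of_nonneg hpos.le]
    have hle : r / 2 / (n + 1) ≤ r / 2 := div_le_self (by linarith) (by linarith [n.cast_nonneg (α := ℝ)])
    have := hquot x hx y hy (x + (r / 2 / (n + 1) : ℝ)) (by
      rw [mem_closedBall_iff_norm, add_sub_cancel_left, hnorm]; exact hle)
    rw [add_sub_cancel_left, hnorm] at this
    rw [norm_mul, norm_inv, hnorm, inv_mul_le_iff₀ hpos]
    linarith
  refine ⟨fun y hy => ((h.left y hy).deriv hU).mono hWs, fun x hx => ?_, fun x hx y hy => ?_⟩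
  · refine (tendstoLocallyUniformlyOn_of_norm_le hV (C := 2 * C / r) (fun n => ?_) (hn x hx) (hlim x hx)).differentiableOn
      (Eventually.of_forall fun n => ?_) hV
    all_goals
      have hpos : 0 < r / 2 / ((n : ℝ) + 1) := by positivity
      have hle : r / 2 / ((n : ℝ) + 1) ≤ r / 2 := div_le_self (by linarith) (by linarith [n.cast_nonneg (α := ℝ)])
      refine (((h.right _ (hW x hx ?_)).sub (h.right _ (hWs hx))).const_mul _)
      rw [mem_closedBall_iff_norm, add_sub_cancel_left, Complex.norm_real, Real.norm_of_nonneg hpos.le]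
      linarith
  · exact le_of_tendsto (hlim x hx y hy).norm (Eventually.of_forall fun n => hn x hx n y hy)

theorem exists_nhd (hU : IsOpen U) {x₀ : ℂ} (hx : x₀ ∈ U) :
    ∃ r > 0, x₀ ∈ Metric.ball x₀ r ∧ ∀ x ∈ Metric.ball x₀ r, Metric.closedBall x r ⊆ U := by
  obtain ⟨r, hr, hrU⟩ := Metric.nhds_basis_closedBall.mem_iff.1 (hU.mem_nhds hx)
  exact ⟨r / 2, half_pos hr, Metric.mem_ball_self (half_pos hr), fun x hx =>
    (Metric.closedBall_subset_closedBall' (by have := Metric.mem_ball.1 hx; linarith)).trans hrU⟩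

theorem mono (h : SepHol C U V F) {U' V' : Set ℂ} (hU : U' ⊆ U) (hV : V' ⊆ V) : SepHol C U' V' F :=
  ⟨fun y hy => (h.left y (hV hy)).mono hU, fun x hx => (h.right x (hU hx)).mono hV,
    fun x hx y hy => h.bound x (hU hx) y (hV hy)⟩

theorem hasFDerivAt (h : SepHol C U V F) (hU : IsOpen U) (hV : IsOpen V) {x₀ y₀ : ℂ} (hx : x₀ ∈ U) (hy : y₀ ∈ V) :
    HasFDerivAt (fun p : ℂ × ℂ => F p.1 p.2)
      ((ContinuousLinearMap.toSpanSingleton ℂ (deriv (fun x => F x y₀) x₀)).coprod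
        (ContinuousLinearMap.toSpanSingleton ℂ (deriv (F x₀) y₀))) (x₀, y₀) := by
  obtain ⟨r, hr, hr0, hrU⟩ := exists_nhd hU hx
  obtain ⟨q, hq, hq0, hqV⟩ := exists_nhd hV hy
  have c1 := (h.deriv_left hU hV hr hrU Metric.isOpen_ball).continuousAt Metric.isOpen_ball hV hr0 hy
  have c2 := (h.swap.deriv_left hV hU hq hqV Metric.isOpen_ball).swap.continuousAt hU Metric.isOpen_ball hx hq0
  have hnhd : U ×ˢ V ∈ 𝓝 (x₀, y₀) := prod_mem_nhds (hU.mem_nhds hx) (hV.mem_nhds hy)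
  have hcont : ∀ D : ℂ → ℂ → ℂ, ContinuousAt (fun p : ℂ × ℂ => D p.1 p.2) (x₀, y₀) →
      ContinuousAt (fun p : ℂ × ℂ => ContinuousLinearMap.toSpanSingleton ℂ (D p.1 p.2)) (x₀, y₀) := fun D hD =>
    ContinuousAt.comp (f := fun p : ℂ × ℂ => D p.1 p.2) (g := ContinuousLinearMap.toSpanSingleton ℂ)
      (ContinuousLinearMap.toSpanSingletonCLE (𝕜 := ℂ) (E := ℂ)).continuous.continuousAt hD
  have d1 : ∀ᶠ p : ℂ × ℂ in 𝓝 (x₀, y₀), HasFDerivAt (fun x => F x p.2)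
      (ContinuousLinearMap.toSpanSingleton ℂ (deriv (fun x => F x p.2) p.1)) p.1 := by
    filter_upwards [hnhd] with p hp
    exact ((h.left p.2 hp.2).differentiableAt (hU.mem_nhds hp.1)).hasDerivAt.hasFDerivAt
  have d2 : ∀ᶠ p : ℂ × ℂ in 𝓝 (x₀, y₀), HasFDerivAt (F p.1)
      (ContinuousLinearMap.toSpanSingleton ℂ (deriv (F p.1) p.2)) p.2 := by
    filter_upwards [hnhd] with p hp
    exact ((h.right p.1 hp.1).differentiableAt (hV.mem_nhds hp.2)).hasDerivAt.hasFDerivAt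
  have e1 := hcont (fun x y => deriv (fun x => F x y) x) c1
  have e2 := hcont (fun x y => deriv (F x) y) c2
  exact (hasStrictFDerivAt_uncurry_coprod (𝕜 := ℂ) (f := F) (u := (x₀, y₀))
    (f₁ := fun x y => ContinuousLinearMap.toSpanSingleton ℂ (deriv (fun x => F x y) x))
    (f₂ := fun x y => ContinuousLinearMap.toSpanSingleton ℂ (deriv (F x) y)) d1 d2 e1 e2).hasFDerivAt

theorem differentiableAt_deriv_left (h : SepHol C U V F) (hU : IsOpen U) (hV : IsOpen V) {x₀ y₀ : ℂ} (hx : x₀ ∈ U)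
    (hy : y₀ ∈ V) : DifferentiableAt ℂ (fun p : ℂ × ℂ => deriv (fun x => F x p.2) p.1) (x₀, y₀) := by
  obtain ⟨r, hr, hr0, hrU⟩ := exists_nhd hU hx
  exact ((h.deriv_left hU hV hr hrU Metric.isOpen_ball).hasFDerivAt Metric.isOpen_ball hV hr0 hy).differentiableAt

theorem differentiableAt_deriv_right (h : SepHol C U V F) (hU : IsOpen U) (hV : IsOpen V) {x₀ y₀ : ℂ} (hx : x₀ ∈ U)
    (hy : y₀ ∈ V) : DifferentiableAt ℂ (fun p : ℂ × ℂ => deriv (F p.1) p.2) (x₀, y₀) := by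
  obtain ⟨r, hr, hr0, hrV⟩ := exists_nhd hV hy
  exact ((h.swap.deriv_left hV hU hr hrV Metric.isOpen_ball).swap.hasFDerivAt hU Metric.isOpen_ball hx hr0).differentiableAt

end SepHol

/-- The gluing iterates depend holomorphically on parameters. -/
theorem glueIter_param_diff {w h δ L η : ℝ} {Ω : Set ℂ} (hΩ : IsOpen Ω) {E : ℂ → ℂ → ℂ → ℂ}
    (hE : ∀ y ∈ Ω, GlueAdm w h δ L η (E y))
    (hd : ∀ t ∈ Rect w h, ∀ v : ℂ → ℂ, DifferentiableOn ℂ v Ω → (∀ y ∈ Ω, ‖v y‖ ≤ η) →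
      DifferentiableOn ℂ (fun y => E y t (v y)) Ω) (k : ℕ) :
    ∀ x ∈ WideRect w h, DifferentiableOn ℂ (fun y => glueIter w h (E y) k x) Ω := by
  rcases Ω.eq_empty_or_nonempty with rfl | ⟨y₁, hy₁⟩
  · exact fun x _ => differentiableOn_empty
  have hw := (hE y₁ hy₁).w_pos
  have hw' := (hE y₁ hy₁).w_lt
  have hδ := (hE y₁ hy₁).δ_nonneg
  have hh := (hE y₁ hy₁).h_pos
  induction k with
  | zero => exact fun x _ => differentiableOn_const 0
  | succ k ih =>
    intro x hx
    have hμ : ∀ t ∈ Rect w h, DifferentiableOn ℂ (fun y => E y t (glueIter w h (E y) k t)) Ω := fun t ht =>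
      hd t ht _ (ih t (Rect_subset_WideRect ht)) fun y hy => (hE y hy).iter_small k ht
    have hb : ∀ y ∈ Ω, ∀ t ∈ Rect w h, ‖E y t (glueIter w h (E y) k t)‖ ≤ δ * expWeight h t.im :=
      fun y hy t ht => (hE y hy).bound t ht _ ((hE y hy).iter_small k ht)
    refine DifferentiableOn.neg (DifferentiableOn.sub (DifferentiableOn.add (DifferentiableOn.const_mul ?_ _) ?_) ?_)
    · refine differentiableOn_integral_of_dominated hΩ (fun y hy =>
        aestronglyMeasurable_glue ((hE y hy).rhs_diff k).continuousOn x) fun y₀ hy₀ => ?_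
      obtain ⟨r, hr, hrΩ⟩ := Metric.isOpen_iff.1 hΩ y₀ hy₀
      refine ⟨r, hr, fun p => δ * glueDom h x p, (integrableOn_glueDom hw hh x).1.const_mul δ, ?_⟩
      filter_upwards [glue_ae_ne x (coordRect w h), ae_restrict_mem (measurableSet_coordRect w h)]
        with p ⟨h0, h1, h2⟩ hp
      refine ⟨((hμ _ (pt_mem_Rect.2 hp)).mono hrΩ).mul_const _, fun y hy => ?_⟩
      have k1 := norm_cotPi_le_glueDom hw' hx hp h0 h1 h2
      have m := hb y (hrΩ hy) _ (pt_mem_Rect.2 hp)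
      rw [pt_im] at m
      rw [norm_mul]
      calc _ ≤ δ * expWeight h p.2 * ‖cotPi (pt p - x)‖ := mul_le_mul_of_nonneg_right m (norm_nonneg _)
        _ = δ * (expWeight h p.2 * ‖cotPi (pt p - x)‖) := by ring
        _ ≤ _ := mul_le_mul_of_nonneg_left k1 hδ
    · by_cases hx2 : x ∈ Rect w h
      · exact (hμ x hx2).const_mul _
      · have : glueCut w x.re = 0 := glueCut_eq_zero hw (by
          by_contra hc
          exact hx2 ⟨abs_lt.2 ⟨not_le.1 hc, hx.2.1⟩, hx.2.2⟩)
        simp only [this, Complex.ofReal_zero, zero_mul]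
        exact differentiableOn_const 0
    · by_cases hx2 : x + 1 ∈ Rect w h
      · exact (hμ _ hx2).const_mul _
      · have : glueCut w (-(x.re + 1)) = 0 := glueCut_eq_zero hw (by
          by_contra hc
          refine hx2 ⟨abs_lt.2 ⟨by simp; linarith [hx.1], by simp; linarith⟩, by simpa using hx.2.2⟩)
        simp only [this, Complex.ofReal_zero, zero_mul]
        exact differentiableOn_const 0

theorem glueSol_param_diff {w h δ L η : ℝ} {Ω : Set ℂ} (hΩ : IsOpen Ω) {E : ℂ → ℂ → ℂ → ℂ}
    (hE : ∀ y ∈ Ω, GlueAdm w h δ L η (E y))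
    (hd : ∀ t ∈ Rect w h, ∀ v : ℂ → ℂ, DifferentiableOn ℂ v Ω → (∀ y ∈ Ω, ‖v y‖ ≤ η) →
      DifferentiableOn ℂ (fun y => E y t (v y)) Ω) :
    SepHol (glueConst w * δ) (WideRect w h) Ω (fun x y => glueSol w h (E y) x) := by
  refine ⟨fun y hy => (hE y hy).sol_diff, fun x hx => ?_, fun x hx y hy => (hE y hy).norm_sol hx⟩
  have hk := fun k => glueIter_param_diff hΩ hE hd k x hx
  exact (tendstoLocallyUniformlyOn_of_norm_le hΩ hk (fun k y hy => ((hE y hy).iter k).2 x hx)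
    fun y hy => (hE y hy).tendsto hx).differentiableOn (Eventually.of_forall hk) hΩ

/-- Holomorphic correction of the linear first integral `y - α x` whose monodromy is `f`. -/
structure SuspHol (α T N : ℝ) (f : ℂ → ℂ) (n : ℂ → ℂ → ℂ) : Prop where
  sep : SepHol N (WideRect (3 / 16) T) (Strip T) n
  add_one : ∀ x y, n x (y + 1) = n x y
  real : ∀ x y : ℝ, (x : ℂ) ∈ WideRect (3 / 16) T → (n x y).im = 0
  mem : ∀ x ∈ WideRect (3 / 16) T, ∀ y ∈ Strip T, DifferentiableAt ℂ f (y + n x y - α * x)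
  eq : ∀ x ∈ Rect (3 / 16) T, ∀ y ∈ Strip T,
    f (y + n x y - α * x) = y + n (x - 1) y - α * (x - 1)

open ComplexConjugate in
theorem Adm.exists_suspHol {α S : ℝ} {f : ℂ → ℂ} (hf : Adm α S f) (hα : α ≠ 0) {T δ : ℝ} (hT : 1 ≤ T) (hδ : 0 ≤ δ)
    (hG : glueConst (3 / 16) * δ ≤ 1 / 10 ^ 4) (hS : T + |α| * (T + 1) < S)
    (hb : 1 / |α| * (1 / 200 * Real.exp (-2 * Real.pi * (S - (T + |α| * (T + 1))))) ≤ δ * Real.exp (-2 * Real.pi * T)) :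
    ∃ n, SuspHol α T (|α| * (glueConst (3 / 16) * (2 * δ))) f n := by
  classical
  have hα' : 0 < |α| := abs_pos.2 hα
  have hαc : (α : ℂ) ≠ 0 := Complex.ofReal_ne_zero.2 hα
  have hpi := Real.pi_pos
  obtain ⟨φ, hφ⟩ : ∃ φ : ℂ → ℂ, φ = fun z => if z ∈ Strip S then f z - z - α else 0 := ⟨_, rfl⟩
  have hφS : ∀ z ∈ Strip S, φ z = f z - z - α := fun z hz => by rw [hφ]; exact if_pos hz
  have hφ1 : ∀ z, φ (z + 1) = φ z := fun z => by
    have : z + 1 ∈ Strip S ↔ z ∈ Strip S := by simp [Strip]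
    simp only [hφ, this, hf.add_one]
    split_ifs <;> ring
  have hφc : ∀ z, φ (conj z) = conj (φ z) := fun z => by
    have : conj z ∈ Strip S ↔ z ∈ Strip S := by simp [Strip]
    simp only [hφ, this]
    split_ifs with hz
    · rw [hf.conj z hz]; simp
    · simp
  have hφd : DifferentiableOn ℂ φ (Strip S) :=
    ((hf.diff.sub differentiableOn_id).sub_const _).congr hφS
  have him : ∀ {y t : ℂ} {r : ℝ}, |y.im| < T → |t.im| ≤ r → |(y - α * t).im| ≤ T + |α| * r := fun {y t r} hy ht => by
    have : (y - α * t).im = y.im - α * t.im := by simp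
    rw [this]
    refine (abs_sub _ _).trans ?_
    rw [abs_mul]
    gcongr
  obtain ⟨E, hE⟩ : ∃ E : ℂ → ℂ → ℂ → ℂ, E = fun y t v => -(1 / α) * φ (y - α * (t + v)) := ⟨_, rfl⟩
  have hadm : ∀ y ∈ Strip T, GlueAdm (3 / 16) T (2 * δ) (200 * δ) (1 / 1000) (E y) := fun y hy => by
    have hmem : ∀ t ∈ Rect (1 / 4) (T + 1 / 40), |(y - α * t).im| ≤ T + |α| * (T + 1) := fun t ht =>
      him hy (by have := ht.2; linarith)
    have := glueAdm_translate hT hδ hG (e := fun t => -(1 / α) * φ (y - α * t)) ?_ fun t ht => ?_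
    · rw [hE]; exact this
    · refine DifferentiableOn.const_mul (hφd.comp (by fun_prop) fun t ht => ?_) _
      exact (hmem t ht).trans_lt hS
    · have hz := hmem t ht
      have h1 := hf.bound _ (show y - α * t ∈ Strip S from hz.trans_lt hS)
      rw [norm_mul, hφS _ (hz.trans_lt hS)]
      have h2 : ‖(-(1 / α) : ℂ)‖ = 1 / |α| := by simp
      rw [h2]
      calc _ ≤ 1 / |α| * (1 / 200 * Real.exp (-2 * Real.pi * (S - (T + |α| * (T + 1))))) := by
            refine mul_le_mul_of_nonneg_left (h1.trans ?_) (by positivity)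
            gcongr 1 / 200 * Real.exp ?_
            nlinarith
        _ ≤ _ := hb
        _ ≤ _ := by
            unfold expWeight
            gcongr δ * Real.exp ?_
            nlinarith [abs_nonneg t.im]
  have hsep := glueSol_param_diff (isOpen_Strip T) hadm fun t ht v hv hvb => by
    rw [hE]
    refine DifferentiableOn.const_mul (hφd.comp (by fun_prop) fun y hy => ?_) _
    refine (him (r := T + 1) hy ?_).trans_lt hS
    have h1 := (Complex.abs_im_le_norm (v y)).trans (hvb y hy)
    have h2 := ht.2
    rw [Complex.add_im]
    exact (abs_add_le _ _).trans (by linarith)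
  obtain ⟨n, hn⟩ : ∃ n : ℂ → ℂ → ℂ, n = fun x y => -α * glueSol (3 / 16) T (E y) x := ⟨_, rfl⟩
  have hc : ∀ x ∈ WideRect (3 / 16) T, ∀ y ∈ Strip T, y + n x y - α * x ∈ Strip S := fun x hx y hy => by
    have : y + n x y - α * x = y - α * (x + glueSol (3 / 16) T (E y) x) := by rw [hn]; ring
    rw [this]
    refine (him (r := T + 1) hy ?_).trans_lt hS
    have h1 := (Complex.abs_im_le_norm _).trans (((hadm y hy).norm_sol hx).trans (hadm y hy).small)
    have h2 := hx.2.2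
    rw [Complex.add_im]
    exact (abs_add_le _ _).trans (by linarith)
  refine ⟨n, ⟨fun y hy => ?_, fun x hx => ?_, fun x hx y hy => ?_⟩, fun x y => ?_, fun x y hx => ?_, fun x hx y hy => ?_,
    fun x hx y hy => ?_⟩
  · rw [hn]; exact (hsep.left y hy).const_mul _
  · rw [hn]; exact (hsep.right x hx).const_mul _
  · rw [hn, norm_mul]
    have : ‖(-α : ℂ)‖ = |α| := by simp
    rw [this]
    exact mul_le_mul_of_nonneg_left (hsep.bound x hx y hy) hα'.le
  · have : E (y + 1) = E y := by
      rw [hE]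
      funext t v
      have e : y + 1 - α * (t + v) = y - α * (t + v) + 1 := by ring
      simp only [e, hφ1]
    simp only [hn, this]
  · have hy : (y : ℂ) ∈ Strip T := by simp [Strip]; linarith
    have := (hadm y hy).sol_conj (fun t v => by
      simp only [hE, map_mul, map_neg, map_div₀, map_one, Complex.conj_ofReal, ← hφc, map_sub, map_add]) hx
    rw [Complex.conj_ofReal] at this
    have := Complex.conj_eq_iff_im.1 this.symm
    simp [hn, this]
  · exact hf.diff.differentiableAt ((isOpen_Strip S).mem_nhds (hc x hx y hy))
  · have h1 := (hadm y hy).sol_eq hx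
    have h2 := hφS _ (hc x (Rect_subset_WideRect hx) y hy)
    have h3 : y + n x y - α * x = y - α * (x + glueSol (3 / 16) T (E y) x) := by rw [hn]; ring
    have h4 : E y x (glueSol (3 / 16) T (E y) x) = -(1 / α) * φ (y + n x y - α * x) := by
      rw [h3, hE]
    rw [h4, h2] at h1
    have h5 : (α : ℂ) * (glueSol (3 / 16) T (E y) (x - 1) - glueSol (3 / 16) T (E y) x) =
        -(f (y + n x y - α * x) - (y + n x y - α * x) - α) := by
      rw [h1]; field_simp
    rw [hn] at h5 ⊢
    linear_combination h5

theorem im_deriv_eq_zero {F : ℂ → ℂ} {x : ℝ} (hF : DifferentiableAt ℂ F x)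
    (h : ∀ᶠ t : ℝ in 𝓝 x, (F t).im = 0) : (deriv F x).im = 0 := by
  have h1 : HasDerivAt (fun t : ℝ => (F t).im) (deriv F x).im x :=
    Complex.imCLM.hasFDerivAt.comp_hasDerivAt x hF.hasDerivAt.comp_ofReal
  exact h1.unique ((hasDerivAt_const x (0 : ℝ)).congr_of_eventuallyEq h)

/-- Slope of the level curves of `y + n x y - α * x`. -/
noncomputable def levelSlope (α : ℝ) (n : ℂ → ℂ → ℂ) (x y : ℂ) : ℂ :=
  (α - deriv (fun x => n x y) x) / (1 + deriv (n x) y)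

/-- Periodization of the slope in the first variable. -/
noncomputable def periodicSlope (α : ℝ) (n : ℂ → ℂ → ℂ) (x y : ℂ) : ℂ :=
  levelSlope α n (x - ⌈x.re⌉) y

theorem periodicSlope_sub_int (α : ℝ) (n : ℂ → ℂ → ℂ) (x y : ℂ) (m : ℤ) :
    periodicSlope α n (x - m) y = periodicSlope α n x y := by
  have h1 : (x - m).re = x.re - m := by simp
  unfold periodicSlope
  rw [h1, Int.ceil_sub_intCast]
  congr 1
  push_cast
  ring

namespace SuspHol

variable {α T N : ℝ} {f : ℂ → ℂ} {n : ℂ → ℂ → ℂ}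

theorem norm_deriv_right_le (h : SuspHol α T N f n) {x y : ℂ} (hx : x ∈ WideRect (3 / 16) T) (hy : y ∈ Strip (T - 1)) :
    ‖deriv (n x) y‖ ≤ N := by
  have := norm_deriv_le_of_closedBall (h.sep.right x hx) (h.sep.bound x hx) one_pos (y := y) fun z hz => by
    have h1 := (Complex.abs_im_le_norm (z - y)).trans (mem_closedBall_iff_norm.1 hz)
    have h2 := abs_sub_abs_le_abs_sub z.im y.im
    rw [Complex.sub_im] at h1
    have : |y.im| < T - 1 := hy
    show |z.im| < T
    linarith
  simpa using this

theorem norm_deriv_left_le (h : SuspHol α T N f n) {x y : ℂ} (hx : x.re ∈ Set.Icc (-1) 0) (hxi : |x.im| < T - 1)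
    (hy : y ∈ Strip T) : ‖deriv (fun x => n x y) x‖ ≤ 8 * N := by
  have := norm_deriv_le_of_closedBall (h.sep.left y hy) (fun x hx => h.sep.bound x hx y hy) (ρ := 1 / 8)
    (by norm_num) (y := x) fun z hz => by
      have h0 := mem_closedBall_iff_norm.1 hz
      have h1 := (Complex.abs_im_le_norm (z - x)).trans h0
      have h2 := abs_sub_abs_le_abs_sub z.im x.im
      have h3 := abs_le.1 ((Complex.abs_re_le_norm (z - x)).trans h0)
      rw [Complex.sub_im] at h1
      rw [Complex.sub_re] at h3
      exact ⟨by linarith [hx.1, h3.1], by linarith [hx.2, h3.2], by linarith⟩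
  linarith

theorem one_add_ne_zero (h : SuspHol α T N f n) (hN : N ≤ 1 / 2) {x y : ℂ} (hx : x ∈ WideRect (3 / 16) T)
    (hy : y ∈ Strip (T - 1)) : 1 / 2 ≤ ‖1 + deriv (n x) y‖ := by
  have h1 := h.norm_deriv_right_le hx hy
  have h2 := norm_sub_norm_le (1 : ℂ) (-deriv (n x) y)
  rw [norm_neg, norm_one, sub_neg_eq_add] at h2
  linarith

theorem Strip_sub_one_subset : Strip (T - 1) ⊆ Strip T := fun y hy => by
  have : |y.im| < T - 1 := hy
  show |y.im| < T
  linarith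

theorem levelSlope_sub_one (h : SuspHol α T N f n) (hN : N ≤ 1 / 2) {x y : ℂ} (hx : x ∈ Rect (3 / 16) T)
    (hy : y ∈ Strip (T - 1)) : levelSlope α n (x - 1) y = levelSlope α n x y := by
  have hyT := Strip_sub_one_subset hy
  have hxW := Rect_subset_WideRect hx
  have hxW1 : x - 1 ∈ WideRect (3 / 16) T := sub_one_mem_WideRect (by norm_num) hx
  have hU := isOpen_WideRect (3 / 16) T
  have dl := fun x hx => ((h.sep.left y hyT).differentiableAt (hU.mem_nhds (x := x) hx)).hasDerivAt
  have dr := fun x hx => ((h.sep.right x hx).differentiableAt ((isOpen_Strip T).mem_nhds hyT)).hasDerivAt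
  have hf := (h.mem x hxW y hyT).hasDerivAt
  have e1 : deriv f (y + n x y - α * x) * (deriv (fun x => n x y) x - α) = deriv (fun x => n x y) (x - 1) - α := by
    have d0 : HasDerivAt (fun x => y + n x y - α * x) (deriv (fun x => n x y) x - α) x := by
      simpa using ((dl x hxW).const_add y).fun_sub ((hasDerivAt_id x).const_mul (α : ℂ))
    have d1 := HasDerivAt.comp (h₂ := f) x hf d0
    have d2 : HasDerivAt (fun x => y + n (x - 1) y - α * (x - 1)) (deriv (fun x => n x y) (x - 1) - α) x := by
      have := (((dl (x - 1) hxW1).comp_sub_const x 1).const_add y).fun_sub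
        (((hasDerivAt_id x).sub_const 1).const_mul (α : ℂ))
      simpa using this
    refine d1.unique (d2.congr_of_eventuallyEq ?_)
    filter_upwards [(isOpen_Rect (3 / 16) T).mem_nhds hx] with x' hx'
    exact h.eq x' hx' y hyT
  have e2 : deriv f (y + n x y - α * x) * (1 + deriv (n x) y) = 1 + deriv (n (x - 1)) y := by
    have d0 : HasDerivAt (fun y => y + n x y - α * x) (1 + deriv (n x) y) y :=
      ((hasDerivAt_id y).add (dr x hxW)).sub_const _
    have d1 := HasDerivAt.comp (h₂ := f) y hf d0
    have d2 : HasDerivAt (fun y => y + n (x - 1) y - α * (x - 1)) (1 + deriv (n (x - 1)) y) y :=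
      ((hasDerivAt_id y).add (dr _ hxW1)).sub_const _
    refine d1.unique (d2.congr_of_eventuallyEq ?_)
    filter_upwards [(isOpen_Strip T).mem_nhds hyT] with y' hy'
    exact h.eq x hx y' hy'
  have n1 := h.one_add_ne_zero hN hxW1 hy
  have n0 := h.one_add_ne_zero hN hxW hy
  have n1' : 1 + deriv (n (x - 1)) y ≠ 0 := norm_pos_iff.1 (by linarith)
  have n0' : 1 + deriv (n x) y ≠ 0 := norm_pos_iff.1 (by linarith)
  unfold levelSlope
  rw [div_eq_div_iff n1' n0', ← e2]
  linear_combination (-(1 + deriv (n x) y)) * (-e1)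

theorem periodicSlope_eq (h : SuspHol α T N f n) (hN : N ≤ 1 / 2) {x y : ℂ} (hx : x ∈ WideRect (3 / 16) T)
    (hy : y ∈ Strip (T - 1)) : periodicSlope α n x y = levelSlope α n x y := by
  obtain ⟨h1, h2, h3⟩ := hx
  unfold periodicSlope
  rcases le_or_gt x.re 0 with h0 | h0
  · rcases le_or_gt x.re (-1) with h4 | h4
    · have : ⌈x.re⌉ = -1 := Int.ceil_eq_iff.2 ⟨by push_cast; linarith, by push_cast; linarith⟩
      have := h.levelSlope_sub_one hN (x := x + 1) (y := y)
        ⟨abs_lt.2 ⟨by simp; linarith, by simp; linarith⟩, by simpa using h3⟩ hy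
      rw [add_sub_cancel_right] at this
      rw [this, ‹⌈x.re⌉ = -1›]
      congr 1
      push_cast
      ring
    · have : ⌈x.re⌉ = 0 := Int.ceil_eq_iff.2 ⟨by push_cast; linarith, by push_cast; linarith⟩
      rw [this]
      simp
  · have : ⌈x.re⌉ = 1 := Int.ceil_eq_iff.2 ⟨by push_cast; linarith, by push_cast; linarith⟩
    rw [this]
    simpa using h.levelSlope_sub_one hN (x := x) ⟨abs_lt.2 ⟨by linarith, by linarith⟩, h3⟩ hy

theorem sub_ceil_re (x : ℂ) : (x - ⌈x.re⌉).re ∈ Set.Ioc (-1) 0 := by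
  have h1 := Int.le_ceil x.re
  have h2 := Int.ceil_lt_add_one x.re
  constructor <;> simp <;> linarith

theorem sub_ceil_mem {x : ℂ} (hx : |x.im| < T) : x - ⌈x.re⌉ ∈ WideRect (3 / 16) T :=
  ⟨by linarith [(sub_ceil_re x).1], by linarith [(sub_ceil_re x).2], by simpa using hx⟩

theorem periodicSlope_differentiableAt (h : SuspHol α T N f n) (hN : N ≤ 1 / 2) {x y : ℂ} (hx : |x.im| < T)
    (hy : y ∈ Strip (T - 1)) : DifferentiableAt ℂ (fun p : ℂ × ℂ => periodicSlope α n p.1 p.2) (x, y) := by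
  have hU := isOpen_WideRect (3 / 16) T
  have hV := isOpen_Strip (T - 1)
  obtain ⟨m, hm⟩ : ∃ m, m = ⌈x.re⌉ := ⟨_, rfl⟩
  have hxm : x - m ∈ WideRect (3 / 16) T := by rw [hm]; exact sub_ceil_mem hx
  have hsep := h.sep.mono subset_rfl Strip_sub_one_subset
  have d1 := hsep.differentiableAt_deriv_left hU hV hxm hy
  have d2 := hsep.differentiableAt_deriv_right hU hV hxm hy
  have n0 := h.one_add_ne_zero hN hxm hy
  have hne : 1 + deriv (n (x - m)) y ≠ 0 := norm_pos_iff.1 (by linarith)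
  have d3 : DifferentiableAt ℂ (fun p : ℂ × ℂ => levelSlope α n p.1 p.2) (x - m, y) := by
    simp only [levelSlope, div_eq_mul_inv]
    exact (d1.const_sub (α : ℂ)).fun_mul ((d2.const_add 1).fun_inv hne)
  have d4 : DifferentiableAt ℂ (fun p : ℂ × ℂ => levelSlope α n (p.1 - m) p.2) (x, y) :=
    DifferentiableAt.comp (f := fun p : ℂ × ℂ => (p.1 - m, p.2)) (x, y) d3 (by fun_prop)
  refine d4.congr_of_eventuallyEq ?_
  have hc : Continuous fun p : ℂ × ℂ => p.1 - m := by fun_prop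
  filter_upwards [hc.continuousAt.preimage_mem_nhds (x := (x, y)) (hU.mem_nhds hxm),
    continuous_snd.continuousAt.preimage_mem_nhds (x := (x, y)) (hV.mem_nhds hy)] with p hp1 hp2
  rw [← h.periodicSlope_eq hN hp1 hp2, periodicSlope_sub_int]

theorem norm_periodicSlope_sub_le (h : SuspHol α T N f n) (hN : N ≤ 1 / 2) {x y : ℂ} (hx : |x.im| < T - 1)
    (hy : y ∈ Strip (T - 1)) : ‖periodicSlope α n x y - α‖ ≤ 2 * (8 + |α|) * N := by
  obtain ⟨z, hz⟩ : ∃ z, z = x - ⌈x.re⌉ := ⟨_, rfl⟩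
  have hzW : z ∈ WideRect (3 / 16) T := by rw [hz]; exact sub_ceil_mem (by linarith)
  have n0 := h.one_add_ne_zero hN hzW hy
  have hne : 1 + deriv (n z) y ≠ 0 := norm_pos_iff.1 (by linarith)
  have b1 := h.norm_deriv_right_le hzW hy
  have b2 := h.norm_deriv_left_le (x := z) (by rw [hz]; exact Set.Ioc_subset_Icc_self (sub_ceil_re x))
    (by rw [hz]; simpa using hx) (Strip_sub_one_subset hy)
  have e : periodicSlope α n x y - α = -(deriv (fun x => n x y) z + α * deriv (n z) y) / (1 + deriv (n z) y) := by
    rw [periodicSlope, ← hz, levelSlope, div_sub' hne]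
    congr 1
    ring
  have b3 : ‖deriv (fun x => n x y) z + α * deriv (n z) y‖ ≤ (8 + |α|) * N := by
    refine (norm_add_le _ _).trans ?_
    rw [norm_mul, Complex.norm_real, Real.norm_eq_abs]
    nlinarith [abs_nonneg α]
  rw [e, norm_div, norm_neg, div_le_iff₀ (by linarith)]
  have : 0 ≤ (8 + |α|) * N := (norm_nonneg _).trans b3
  nlinarith

theorem im_deriv_right (h : SuspHol α T N f n) {x y : ℝ} (hx : (x : ℂ) ∈ WideRect (3 / 16) T) :
    (deriv (n x) y).im = 0 := by
  have hT : (y : ℂ) ∈ Strip T := by have := hx.2.2; simpa [Strip] using this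
  exact im_deriv_eq_zero ((h.sep.right x hx).differentiableAt ((isOpen_Strip T).mem_nhds hT))
    (Eventually.of_forall fun t => h.real x t hx)

theorem im_deriv_left (h : SuspHol α T N f n) {x y : ℝ} (hx : (x : ℂ) ∈ WideRect (3 / 16) T) :
    (deriv (fun x => n x y) x).im = 0 := by
  have hT : (y : ℂ) ∈ Strip T := by have := hx.2.2; simpa [Strip] using this
  have hU := isOpen_WideRect (3 / 16) T
  refine im_deriv_eq_zero ((h.sep.left y hT).differentiableAt (hU.mem_nhds hx)) ?_
  filter_upwards [Complex.continuous_ofReal.continuousAt.preimage_mem_nhds (hU.mem_nhds hx)] with t ht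
  exact h.real t y ht

theorem im_levelSlope (h : SuspHol α T N f n) {x y : ℝ} (hx : (x : ℂ) ∈ WideRect (3 / 16) T) :
    (levelSlope α n x y).im = 0 := by
  unfold levelSlope
  rw [Complex.div_im]
  simp [h.im_deriv_left hx, h.im_deriv_right hx]

theorem im_periodicSlope (h : SuspHol α T N f n) (hT : 0 < T) (x y : ℝ) : (periodicSlope α n x y).im = 0 := by
  have h1 : (x : ℂ) - ⌈(x : ℂ).re⌉ = ((x - ⌈x⌉ : ℝ) : ℂ) := by simp
  have h2 := sub_ceil_mem (T := T) (x := (x : ℂ)) (by simpa using hT)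
  unfold periodicSlope
  rw [h1] at h2 ⊢
  exact h.im_levelSlope h2

theorem periodicSlope_add_one (h : SuspHol α T N f n) (x y : ℂ) :
    periodicSlope α n x (y + 1) = periodicSlope α n x y := by
  have h1 : ∀ x, deriv (n x) (y + 1) = deriv (n x) y := fun x => by
    rw [← deriv_comp_add_const]
    congr 1
    funext t
    exact h.add_one x t
  simp only [periodicSlope, levelSlope, h1, h.add_one]

theorem hasFDerivAt_re (h : SuspHol α T N f n) {x y : ℝ} (hx : (x : ℂ) ∈ WideRect (3 / 16) T) :
    ∃ L : ℝ × ℝ →L[ℝ] ℝ, HasFDerivAt (fun p : ℝ × ℝ => ((p.2 : ℂ) + n p.1 p.2 - α * p.1).re) L (x, y) ∧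
      L (0, 1) = 1 + (deriv (n x) y).re ∧ ∀ a, L (1, a) = (deriv (fun x => n x y) x).re - α + a * (1 + (deriv (n x) y).re) := by
  have hT : (y : ℂ) ∈ Strip T := by have := hx.2.2; simpa [Strip] using this
  have hU := isOpen_WideRect (3 / 16) T
  have h1 := (h.sep.hasFDerivAt hU (isOpen_Strip T) hx hT).restrictScalars ℝ
  have h2 : HasFDerivAt (fun p : ℝ × ℝ => ((p.1 : ℂ), (p.2 : ℂ)))
      (Complex.ofRealCLM.prodMap Complex.ofRealCLM) (x, y) :=
    (Complex.ofRealCLM.prodMap Complex.ofRealCLM).hasFDerivAt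
  have h3 := HasFDerivAt.comp (g := fun p : ℂ × ℂ => n p.1 p.2) (f := fun p : ℝ × ℝ => ((p.1 : ℂ), (p.2 : ℂ))) (x, y) h1 h2
  have h4 : HasFDerivAt (fun p : ℝ × ℝ => (n p.1 p.2).re) _ (x, y) := Complex.reCLM.hasFDerivAt.comp (x, y) h3
  have h5 := (hasFDerivAt_snd (𝕜 := ℝ) (p := (x, y))).add h4
  have h6 := h5.sub ((hasFDerivAt_fst (𝕜 := ℝ) (p := (x, y))).const_mul α)
  refine ⟨_, h6.congr_of_eventuallyEq (Eventually.of_forall fun p => ?_), ?_, fun a => ?_⟩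
  · simp
  · simp
  · simp; ring

end SuspHol

namespace SuspHol

variable {α T N : ℝ} {f : ℂ → ℂ} {n : ℂ → ℂ → ℂ}

theorem suspData {ω : Fin 2 → ℝ} (h : SuspHol (ω 1 / ω 0) T N f n) (hT : 1 < T) (hN : N ≤ 1 / 2) (h0 : ω 0 ≠ 0)
    (hirr : Irrational (ω 1 / ω 0)) {H : ℝ → ℝ} (hf : ∀ x : ℝ, ((f x).re : ℂ) = f x) (hHc : Continuous H) (hHm : StrictMono H)
    (hH1 : ∀ x, H (x + 1) = H x + 1) (hHf : ∀ x, f (H x) = H (x + ω 1 / ω 0)) :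
    SuspData ω (3 / 16) H (fun v => (f v).re) (fun x y => ((y : ℂ) + n x y - (ω 1 / ω 0 : ℝ) * x).re)
      (fun x y => (periodicSlope (ω 1 / ω 0) n x y).re) := by
  have hmem : ∀ x : ℝ, -1 - 3 / 16 < x → x < 3 / 16 → (x : ℂ) ∈ WideRect (3 / 16) T := fun x h1 h2 =>
    ⟨by simpa using h1, by simpa using h2, by simp; linarith⟩
  have hs : ∀ y : ℝ, (y : ℂ) ∈ Strip (T - 1) := fun y => by simp [Strip]; linarith
  refine ⟨h0, hirr, by norm_num, by norm_num, hHc, hHm, hH1, fun x => ?_, fun x y => ?_, fun x hx y => ?_,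
    fun x y m => ?_, fun x h1 h2 y => ?_⟩
  · simp [hHf]
  · have := h.add_one x y
    push_cast
    simp [this]
    ring
  · have hx' : (x : ℂ) ∈ Rect (3 / 16) T := ⟨by simpa using hx, by simp; linarith⟩
    have e := h.eq x hx' y (Strip_sub_one_subset (hs y))
    have hre : (y : ℂ) + n x y - (ω 1 / ω 0 : ℝ) * x = (((y : ℂ) + n x y - (ω 1 / ω 0 : ℝ) * x).re : ℂ) := by
      have := h.real x y (Rect_subset_WideRect hx')
      apply Complex.ext
      · simp only [Complex.ofReal_re]
      · simp only [Complex.ofReal_im, Complex.add_im, Complex.sub_im, Complex.mul_im, Complex.ofReal_re, this]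
        ring
    show _ = (f ((((y : ℂ) + n x y - (ω 1 / ω 0 : ℝ) * x).re : ℝ) : ℂ)).re
    rw [← hre, e]
    push_cast
    rfl
  · have := periodicSlope_sub_int (ω 1 / ω 0) n x y m
    show (periodicSlope (ω 1 / ω 0) n ((x - m : ℝ) : ℂ) y).re = _
    rw [← this]
    push_cast
    rfl
  · have hx := hmem x h1 h2
    obtain ⟨L, hL, hL1, hL2⟩ := h.hasFDerivAt_re (y := y) hx
    have hb := (Complex.abs_re_le_norm _).trans (h.norm_deriv_right_le hx (hs y))
    have hpos : 0 < 1 + (deriv (n x) y).re := by linarith [(abs_le.1 hb).1]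
    refine ⟨L, hL, hL1 ▸ hpos, ?_⟩
    have hv : levelSlope (ω 1 / ω 0) n x y =
        ((((ω 1 / ω 0 : ℝ) - (deriv (fun x => n x y) x).re) / (1 + (deriv (n x) y).re) : ℝ) : ℂ) := by
      have e1 : ((deriv (fun x => n x y) x).re : ℂ) = deriv (fun x => n x y) x :=
        Complex.ext (by simp) (by simp [h.im_deriv_left hx])
      have e2 : ((deriv (n x) y).re : ℂ) = deriv (n x) y := Complex.ext (by simp) (by simp [h.im_deriv_right hx])
      rw [levelSlope]
      conv_lhs => rw [← e1, ← e2]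
      push_cast
      rfl
    rw [hL2, h.periodicSlope_eq hN hx (hs y), hv, Complex.ofReal_re, div_mul_cancel₀ _ hpos.ne']
    ring

theorem analyticAt_zero (h : SuspHol α T N f n) (hT : 0 < T) (y : ℝ) :
    AnalyticAt ℝ (fun y : ℝ => ((y : ℂ) + n ((0 : ℝ) : ℂ) y - α * ((0 : ℝ) : ℂ)).re) y := by
  have hs : (y : ℂ) ∈ Strip T := by simpa [Strip] using hT
  have h0 : ((0 : ℝ) : ℂ) ∈ WideRect (3 / 16) T := ⟨by norm_num, by norm_num, by simpa using hT⟩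
  have h1 : AnalyticAt ℝ (fun y : ℂ => y + n ((0 : ℝ) : ℂ) y - α * ((0 : ℝ) : ℂ)) y :=
    (((differentiableOn_id.add (h.sep.right _ h0)).sub_const _).analyticAt
      ((isOpen_Strip T).mem_nhds hs)).restrictScalars
  exact (Complex.reCLM.analyticAt _).comp (h1.comp (Complex.ofRealCLM.analyticAt y))

theorem periodicSlope_add_int (h : SuspHol α T N f n) (x y : ℂ) (k m : ℤ) :
    periodicSlope α n (x + k) (y + m) = periodicSlope α n x y := by
  have h1 := (show Function.Periodic (periodicSlope α n (x + k)) 1 from h.periodicSlope_add_one _).int_mul m y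
  rw [mul_one] at h1
  have h2 := periodicSlope_sub_int α n (x + k) y k
  rw [h1, ← h2, add_sub_cancel_right]

theorem hasHolExt {ω : Fin 2 → ℝ} {s ε : ℝ} (h : SuspHol α (s + 2) N f n) (hs : 0 < s) (hN : N ≤ 1 / 2)
    (hε : |ω 0| * (2 * (8 + |α|) * N) ≤ ε) :
    HasHolExtTorusVF 2 (fun p => ![0, ω 0 * ((periodicSlope α n (p 0) (p 1)).re - α)]) s ε := by
  have hm : ∀ z : ℂ, |z.im| < s → |z.im| < s + 2 - 1 := fun z hz => by linarith
  refine ⟨fun z => ![0, ω 0 * (periodicSlope α n (z 0) (z 1) - α)], fun z hz => ?_, fun z hz k => ?_, fun x => ?_,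
    fun z hz => ?_⟩
  · refine DifferentiableAt.differentiableWithinAt (differentiableAt_pi.2 (Fin.forall_fin_two.2 ⟨?_, ?_⟩))
    · exact differentiableAt_const _
    · have := h.periodicSlope_differentiableAt hN (x := z 0) (y := z 1) (by linarith [hz 0]) (hm _ (hz 1))
      have : DifferentiableAt ℂ (fun z : Fin 2 → ℂ => periodicSlope α n (z 0) (z 1)) z :=
        DifferentiableAt.comp (f := fun z : Fin 2 → ℂ => (z 0, z 1)) z this (by fun_prop)
      exact (this.sub_const _).const_mul _
  · simp only [Pi.add_apply, h.periodicSlope_add_int]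
  · have := h.im_periodicSlope (by linarith) (x 0) (x 1)
    have e : ((periodicSlope α n (x 0) (x 1)).re : ℂ) = periodicSlope α n (x 0) (x 1) :=
      Complex.ext (by simp) (by simp [this])
    refine funext (Fin.forall_fin_two.2 ⟨by simp, ?_⟩)
    simp [e]
  · have h1 := h.norm_periodicSlope_sub_le hN (x := z 0) (y := z 1) (hm _ (hz 0)) (hm _ (hz 1))
    have h2 : |ω 0| * ‖periodicSlope α n (z 0) (z 1) - α‖ ≤ ε :=
      (mul_le_mul_of_nonneg_left h1 (abs_nonneg _)).trans hε
    have h3 : 0 ≤ ε := le_trans (by positivity) h2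
    refine (pi_norm_le_iff_of_nonneg h3).2 (Fin.forall_fin_two.2 ⟨by simpa using h3, ?_⟩)
    simpa using h2

end SuspHol

/-- Yoccoz, continuous version, n = 2. -/
theorem yoccoz_torus_flow (ω : Fin 2 → ℝ) (hnr : NonResonant 2 ω)
    (hBR : ¬ BRCondition 2 ω) :
    ∀ ε > (0:ℝ), ∀ s > (0:ℝ), ∃ V : (Fin 2 → ℝ) → (Fin 2 → ℝ),
      (∀ x v, IsIntVec v → V (x + v) = V x) ∧
      HasHolExtTorusVF 2 V s ε ∧
      (∃ φ, IsFlowOf (fun x => ω + V x) φ) ∧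
      ∀ φ, IsFlowOf (fun x => ω + V x) φ →
        FlowTopConjLinear ω φ ∧ ¬ FlowAnalyticConjLinear ω φ := by
  intro ε hε s hs
  have h0 := hnr.ne_zero
  have hirr := hnr.irrational
  obtain ⟨α, hα⟩ : ∃ α, α = ω 1 / ω 0 := ⟨_, rfl⟩
  have hα0 : α ≠ 0 := by rw [hα]; exact hirr.ne_zero
  have hα' : 0 < |α| := abs_pos.2 hα0
  have hsmall : ∀ C b : ℝ, 0 < b → ∀ᶠ δ : ℝ in 𝓝[>] 0, C * δ ≤ b := fun C b hb => by
    have h1 : Continuous fun δ : ℝ => C * δ := by fun_prop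
    have h2 : Tendsto (fun δ : ℝ => C * δ) (𝓝[>] 0) (𝓝 0) := by
      simpa using (h1.tendsto 0).mono_left nhdsWithin_le_nhds
    exact (h2.eventually_lt_const hb).mono fun δ hδ => hδ.le
  obtain ⟨δ, hδ, b1, b2, b3⟩ := ((eventually_mem_nhdsWithin (a := (0 : ℝ)) (s := Set.Ioi 0)).and ((hsmall (glueConst (3 / 16)) (1 / 10 ^ 4) (by norm_num)).and
    ((hsmall (|α| * (glueConst (3 / 16) * 2)) (1 / 2) (by norm_num)).and
      (hsmall (|ω 0| * (2 * (8 + |α|) * (|α| * (glueConst (3 / 16) * 2)))) ε hε)))).exists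
  have hδ : 0 < δ := hδ
  have hexp : Tendsto (fun S : ℝ => 1 / |α| * (1 / 200 * Real.exp (-2 * Real.pi * (S - (s + 2 + |α| * (s + 2 + 1))))))
      atTop (𝓝 0) := by
    have h1 : Tendsto (fun S : ℝ => -2 * Real.pi * (S - (s + 2 + |α| * (s + 2 + 1)))) atTop atBot :=
      (tendsto_atTop_add_const_right _ _ tendsto_id).const_mul_atTop_of_neg (by linarith [Real.pi_pos])
    have h2 := ((Real.tendsto_exp_atBot.comp h1).const_mul (1 / 200)).const_mul (1 / |α|)
    rw [mul_zero, mul_zero] at h2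
    exact h2
  obtain ⟨S, hS1, hS2, hS3⟩ := ((eventually_ge_atTop 1).and ((eventually_gt_atTop (s + 2 + |α| * (s + 2 + 1))).and
    (hexp.eventually_lt_const (by positivity : 0 < δ * Real.exp (-2 * Real.pi * (s + 2)))))).exists
  obtain ⟨f, H, hf, hHc, hHm, hH1, hHf, hper⟩ := exists_circle_map hnr hBR hS1
  rw [← hα] at hf
  obtain ⟨n, hn⟩ := hf.exists_suspHol hα0 (by linarith : 1 ≤ s + 2) hδ.le b1 hS2 hS3.le
  obtain ⟨N, hN⟩ : ∃ N, N = |α| * (glueConst (3 / 16) * (2 * δ)) := ⟨_, rfl⟩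
  rw [← hN] at hn
  have hN2 : N ≤ 1 / 2 := by rw [hN]; linarith
  have hN3 : |ω 0| * (2 * (8 + |α|) * N) ≤ ε := by rw [hN]; linarith
  have hext := hn.hasHolExt hs hN2 hN3
  have hu : (fun x : Fin 2 → ℝ => ω + ![0, ω 0 * ((periodicSlope α n (x 0) (x 1)).re - α)]) =
      fun p => ![ω 0, ω 0 * (periodicSlope α n (p 0) (p 1)).re] := by
    funext p
    refine funext (Fin.forall_fin_two.2 ⟨by simp, ?_⟩)
    have : ω 0 * α = ω 1 := by rw [hα]; field_simp
    simp
    linarith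
  have hsusp : SuspData ω (3 / 16) H (fun v => (f v).re) (fun x y => ((y : ℂ) + n x y - (α : ℝ) * x).re)
      (fun x y => (periodicSlope α n x y).re) := by
    subst hα
    exact hn.suspData (by linarith) hN2 h0 hirr (hf.ofReal_re (by linarith)) hHc hHm hH1 hHf
  refine ⟨_, fun x v hv => ?_, hext, ?_, fun φ hφ => ?_⟩
  · obtain ⟨k, hk⟩ := hv 0
    obtain ⟨m, hm⟩ := hv 1
    have := hn.periodicSlope_add_int (x 0) (x 1) k m
    simp [hk, hm, this]
  · rw [hu]
    obtain ⟨κ, Y, -, hYc, h1, h2, -, h4⟩ := hsusp.exists_coord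
    exact ⟨_, hsusp.isFlowOf hYc h1 h2 h4⟩
  · rw [hu] at hφ
    refine ⟨hsusp.topConj hφ, fun ha => ?_⟩
    obtain ⟨Γ, hΓ, hΓ1, hΓf⟩ :=
      hsusp.exists_analytic_linearization (hn.analyticAt_zero (by linarith)) hφ ha
    rw [← hα] at hΓf hirr
    exact hf.not_analytic hS1 hirr hΓ hΓ1 hΓf hper
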